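/- Let k be a field of characteristic not 2 or 3 and let (A,−) be a bi-octonion algebra over k. Then the following are equivalent: (1) (A,−) is not a structurable division algebra; (2) the Albert form of (A,−) is isotropic; (3) (A,−) has a nonzero skew element that is not conjugate-invertible; (4) (A,−) contains a biquaternion subalgebra, stabilised by the involution, that is not a division algebra; (5) (A,−) contains an associative subalgebra, stabilised by the involution, that is not a division algebra; (6) the Albert form of (A,−) is similar to φ₁′ ⊥ ⟨−1⟩φ₂′ where φ₁, φ₂ are 3-Pfister forms with a common slot; (7) (A,−) is isotopic to a decomposable bi-octonion algebra C₁ ⊗ C₂ where the norms of the octonion algebras C₁ and C₂ have a common slot. -/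

import Mathlib

open scoped TensorProduct

noncomputable section

universe u

/-- A unital, not necessarily associative, algebra with involution over a commutative ring. -/
structure AlgebraWithInvolution (R : Type u) [CommRing R] : Type (u + 1) where
  carrier : Type u
  [isNonAssocRing : NonAssocRing carrier]
  [isModule : Module R carrier]
  [isSMulCommClass : SMulCommClass R carrier carrier]
  [isScalarTower : IsScalarTower R carrier carrier]
  invol : carrier →ₗ[R] carrier
  invol_one : invol 1 = 1
  invol_mul : ∀ x y : carrier, invol (x * y) = invol y * invol x
  invol_invol : ∀ x : carrier, invol (invol x) = x

namespace AlgebraWithInvolution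

attribute [instance] isNonAssocRing isModule isSMulCommClass isScalarTower

instance {R : Type u} [CommRing R] : CoeSort (AlgebraWithInvolution R) (Type u) :=
  ⟨carrier⟩

variable {R : Type u} [CommRing R]

/-- The operator `V_{x,y} z = (x ȳ) z + (z ȳ) x − (z x̄) y` of a (candidate) structurable
algebra. -/
def Vop (A : AlgebraWithInvolution R) (x y z : A) : A :=
  (x * A.invol y) * z + (z * A.invol y) * x - (z * A.invol x) * y

/-- `(A,−)` is a structurable algebra:
`[V_{x,y}, V_{z,w}] = V_{V_{x,y} z, w} − V_{z, V_{y,x} w}`. -/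
def IsStructurable (A : AlgebraWithInvolution R) : Prop :=
  ∀ x y z w v : A,
    A.Vop x y (A.Vop z w v) - A.Vop z w (A.Vop x y v) =
      A.Vop (A.Vop x y z) w v - A.Vop z (A.Vop y x w) v

/-- An element `x` is conjugate-invertible if `V_{x,y} = id` for some `y`. -/
def ConjInvertible (A : AlgebraWithInvolution R) (x : A) : Prop :=
  ∃ y : A, ∀ z : A, A.Vop x y z = z

/-- A structurable division algebra: every nonzero element is conjugate-invertible. -/
def IsStructurableDivisionAlgebra (A : AlgebraWithInvolution R) : Prop :=
  ∀ x : A, x ≠ 0 → A.ConjInvertible x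

/-- The submodule of skew elements of an algebra with involution. -/
def skew (A : AlgebraWithInvolution R) : Submodule R A.carrier where
  carrier := {a | A.invol a = -a}
  add_mem' := by
    intro a b ha hb
    simp only [Set.mem_setOf_eq, map_add] at *
    rw [ha, hb, neg_add]
  zero_mem' := by simp
  smul_mem' := by
    intro c a ha
    simp only [Set.mem_setOf_eq, map_smul] at *
    rw [ha, smul_neg]

/-- `ψ(x,y) = x ȳ − y x̄`. -/
def psi (A : AlgebraWithInvolution R) (x y : A) : A :=
  x * A.invol y - y * A.invol x

/-- Isomorphisms of algebras with involution. -/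
structure Iso (A B : AlgebraWithInvolution R) where
  toLinearEquiv : A.carrier ≃ₗ[R] B.carrier
  map_mul : ∀ x y : A, toLinearEquiv (x * y) = toLinearEquiv x * toLinearEquiv y
  map_one : toLinearEquiv 1 = 1
  map_invol : ∀ x : A, toLinearEquiv (A.invol x) = B.invol (toLinearEquiv x)

/-- Isotopies of (structurable) algebras with involution: pairs `(α, α̂)` of linear
bijections with `α ∘ V_{x,y} ∘ α⁻¹ = V_{α x, α̂ y}`. -/
structure Isotopy (A B : AlgebraWithInvolution R) where
  toLinearEquiv : A.carrier ≃ₗ[R] B.carrier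
  hat : A.carrier ≃ₗ[R] B.carrier
  map_Vop : ∀ x y z : A,
    toLinearEquiv (A.Vop x y z) = B.Vop (toLinearEquiv x) (hat y) (toLinearEquiv z)

/-- Two algebras with involution are isotopic if there is an isotopy between them. -/
def IsIsotopic (A B : AlgebraWithInvolution R) : Prop :=
  Nonempty (A.Isotopy B)

/-- The tensor product of two algebras with involution. -/
def tensor (A B : AlgebraWithInvolution R) : AlgebraWithInvolution R where
  carrier := A.carrier ⊗[R] B.carrier
  invol := TensorProduct.map A.invol B.invol
  invol_one := by
    simp [Algebra.TensorProduct.one_def, A.invol_one, B.invol_one]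
  invol_mul := by
    intro x y
    induction x with
    | zero => simp
    | tmul a b =>
      induction y with
      | zero => simp
      | tmul c d =>
        simp [Algebra.TensorProduct.tmul_mul_tmul, A.invol_mul, B.invol_mul]
      | add u v hu hv =>
        simp only [mul_add, map_add, hu, hv, add_mul]
    | add u v hu hv =>
      simp only [add_mul, map_add, hu, hv, mul_add]
  invol_invol := by
    intro x
    induction x with
    | zero => simp
    | tmul a b => simp [A.invol_invol, B.invol_invol]
    | add u v hu hv => simp [hu, hv]

/-- Base change of an algebra with involution along `R → S`. -/
def baseChange (A : AlgebraWithInvolution R) (S : Type u) [CommRing S] [Algebra R S] :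
    AlgebraWithInvolution S where
  carrier := S ⊗[R] A.carrier
  invol := LinearMap.baseChange S A.invol
  invol_one := by
    simp [Algebra.TensorProduct.one_def, A.invol_one]
  invol_mul := by
    intro x y
    induction x with
    | zero => simp
    | tmul s a =>
      induction y with
      | zero => simp
      | tmul t b =>
        simp only [Algebra.TensorProduct.tmul_mul_tmul, LinearMap.baseChange_tmul,
          A.invol_mul, mul_comm s t]
      | add u v hu hv =>
        simp only [mul_add, map_add, hu, hv, add_mul]
    | add u v hu hv =>
      simp only [add_mul, map_add, hu, hv, mul_add]
  invol_invol := by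
    intro x
    induction x with
    | zero => simp
    | tmul s a => simp [A.invol_invol]
    | add u v hu hv => simp [hu, hv]

end AlgebraWithInvolution

/-- A composition algebra over a field `F`: a unital (possibly non-associative) algebra with a
nondegenerate multiplicative quadratic form, together with its standard involution
`x̄ = b(x,1)·1 − x` (where `b` is the polar form of the norm). -/
structure CompositionAlgebra (F : Type u) [Field F] : Type (u + 1) where
  carrier : Type u
  [isNonAssocRing : NonAssocRing carrier]
  [isModule : Module F carrier]
  [isSMulCommClass : SMulCommClass F carrier carrier]
  [isScalarTower : IsScalarTower F carrier carrier]
  [isFinite : FiniteDimensional F carrier]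
  norm : QuadraticForm F carrier
  norm_one : norm 1 = 1
  norm_mul : ∀ x y : carrier, norm (x * y) = norm x * norm y
  nondegenerate : ∀ x : carrier, (∀ y : carrier, norm (x + y) - norm x - norm y = 0) → x = 0
  conj : carrier →ₗ[F] carrier
  conj_def : ∀ x : carrier, conj x = (norm (x + 1) - norm x - norm 1) • (1 : carrier) - x
  conj_one : conj 1 = 1
  conj_mul : ∀ x y : carrier, conj (x * y) = conj y * conj x
  conj_conj : ∀ x : carrier, conj (conj x) = x

namespace CompositionAlgebra

attribute [instance] isNonAssocRing isModule isSMulCommClass isScalarTower isFinite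

variable {F : Type u} [Field F]

/-- A composition algebra, viewed as an algebra with its standard involution. -/
def toAWI (C : CompositionAlgebra F) : AlgebraWithInvolution F where
  carrier := C.carrier
  invol := C.conj
  invol_one := C.conj_one
  invol_mul := C.conj_mul
  invol_invol := C.conj_conj

end CompositionAlgebra

/-- A splitting datum witnessing that `(A,−)` is an `(m₁, m₂)`-product algebra: a field
extension `K/k` over which `(A,−)` becomes isomorphic, as an algebra with involution, to the
tensor product of two composition algebras (with their standard involutions) of dimensions
`m₁` and `m₂`. -/
structure ProductAlgebraSplitting {k : Type u} [Field k]
    (A : AlgebraWithInvolution k) (m₁ m₂ : ℕ) : Type (u + 1) where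
  K : Type u
  [fieldK : Field K]
  [algK : Algebra k K]
  C₁ : CompositionAlgebra K
  C₂ : CompositionAlgebra K
  finrank₁ : Module.finrank K C₁.carrier = m₁
  finrank₂ : Module.finrank K C₂.carrier = m₂
  iso : (A.baseChange K).Iso (C₁.toAWI.tensor C₂.toAWI)

attribute [instance] ProductAlgebraSplitting.fieldK ProductAlgebraSplitting.algK

/-- `(A,−)` is an `(m₁, m₂)`-product algebra. -/
def IsProductAlgebra {k : Type u} [Field k] (A : AlgebraWithInvolution k) (m₁ m₂ : ℕ) : Prop :=
  Nonempty (ProductAlgebraSplitting A m₁ m₂)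

/-- An Albert form of an `(m₁,m₂)`-product algebra `(A,−)`: a quadratic form `Q` on the space
of skew elements, together with the `♮`-map, satisfying `L_s ∘ L_{s♮} = −Q(s)·id` and such that
`Q(s) ≠ 0` iff left multiplication by `s` is invertible. -/
structure AlbertForm {k : Type u} [Field k] (A : AlgebraWithInvolution k) where
  Q : QuadraticForm k A.skew
  natMap : A.skew →ₗ[k] A.skew
  mul_natMap : ∀ (s : A.skew) (a : A.carrier),
    (s : A.carrier) * ((natMap s : A.carrier) * a) = -(Q s) • a
  nonzero_iff : ∀ s : A.skew,
    Q s ≠ 0 ↔ Function.Bijective fun a : A.carrier => (s : A.carrier) * a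

end

universe u

namespace CompositionAlgebra

variable {F : Type u} [Field F] (C : CompositionAlgebra F)

/-- The polar form of the norm of a composition algebra. -/
noncomputable def bil : LinearMap.BilinForm F C.carrier := QuadraticMap.polarBilin C.norm

lemma bil_def (x y : C.carrier) : C.bil x y = C.norm (x + y) - C.norm x - C.norm y := rfl

lemma norm_add (x y : C.carrier) : C.norm (x + y) = C.norm x + C.norm y + C.bil x y := by
  rw [bil_def]; ring

lemma bil_comm (x y : C.carrier) : C.bil x y = C.bil y x :=
  QuadraticMap.polar_comm _ _ _

lemma bil_self (x : C.carrier) : C.bil x x = 2 * C.norm x := by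
  simp [bil]

lemma eq_of_bil {x y : C.carrier} (h : ∀ z, C.bil x z = C.bil y z) : x = y := by
  rw [← sub_eq_zero]
  apply C.nondegenerate
  intro z
  have : C.bil (x - y) z = 0 := by simp [h]
  rwa [bil_def] at this

lemma conj_eq (x : C.carrier) : C.conj x = C.bil x 1 • (1 : C.carrier) - x := C.conj_def x

lemma bil_mul_left (x y z : C.carrier) : C.bil (x * y) (x * z) = C.norm x * C.bil y z := by
  simp only [bil_def, ← mul_add, C.norm_mul]; ring

lemma bil_mul_right (x y z : C.carrier) : C.bil (y * x) (z * x) = C.norm x * C.bil y z := by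
  simp only [bil_def, ← add_mul, C.norm_mul]; ring

lemma bil_exchange (x y z w : C.carrier) :
    C.bil (x * y) (z * w) + C.bil (x * w) (z * y) = C.bil x z * C.bil y w := by
  have h := C.bil_mul_right (y + w) x z
  simp only [mul_add, map_add, LinearMap.add_apply, C.bil_mul_right, C.norm_add y w] at h
  linear_combination h + C.bil_comm (x*w) (z*y) - C.bil_comm (x*w) (z*y)

lemma bil_conj_left (x y z : C.carrier) : C.bil (x * y) z = C.bil y (C.conj x * z) := by
  have h := C.bil_exchange x y 1 z
  simp only [one_mul] at h
  rw [conj_eq, sub_mul, smul_mul_assoc, one_mul, map_sub, map_smul, smul_eq_mul]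
  linear_combination h - C.bil_comm (x * z) y

lemma bil_conj_right (x y z : C.carrier) : C.bil (x * y) z = C.bil x (z * C.conj y) := by
  have h := C.bil_exchange x y z 1
  simp only [mul_one] at h
  rw [conj_eq, mul_sub, mul_smul_comm, mul_one, map_sub, map_smul, smul_eq_mul]
  linear_combination h

lemma bil_conj_conj (x y : C.carrier) : C.bil (C.conj x) (C.conj y) = C.bil x y := by
  have e := C.bil_self 1
  rw [C.norm_one] at e
  simp only [conj_eq, map_sub, LinearMap.sub_apply, map_smul, LinearMap.smul_apply, smul_eq_mul]
  rw [C.bil_comm 1 y]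
  linear_combination C.bil x 1 * C.bil y 1 * e

lemma norm_conj (x : C.carrier) : C.norm (C.conj x) = C.norm x := by
  have e := C.bil_self 1
  rw [C.norm_one] at e
  rw [conj_eq, sub_eq_add_neg, norm_add, QuadraticMap.map_smul, QuadraticMap.map_neg, C.norm_one]
  simp [C.bil_comm 1 x]

lemma conj_mul_mul (x y : C.carrier) : C.conj x * (x * y) = C.norm x • y := by
  apply C.eq_of_bil
  intro z
  rw [bil_conj_left, C.conj_conj, bil_mul_left, C.bil_comm y z, C.bil_comm z y]
  simp

lemma mul_mul_conj (x y : C.carrier) : (y * x) * C.conj x = C.norm x • y := by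
  apply C.eq_of_bil
  intro z
  rw [bil_conj_right, C.conj_conj, bil_mul_right]
  simp

lemma mul_conj_mul' (x y : C.carrier) : (y * C.conj x) * x = C.norm x • y := by
  have := C.mul_mul_conj (C.conj x) y
  rwa [C.conj_conj, norm_conj] at this

lemma mul_conj (x : C.carrier) : x * C.conj x = C.norm x • (1 : C.carrier) := by
  have := C.mul_mul_conj x 1
  rwa [one_mul] at this

lemma conj_mul_add (x y z : C.carrier) :
    C.conj x * (z * y) + C.conj z * (x * y) = C.bil x z • y := by
  have h := C.conj_mul_mul (x + z) y
  simp only [map_add, add_mul, mul_add, norm_add, conj_mul_mul, add_smul] at h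
  rw [← sub_eq_zero] at h ⊢
  rw [← h]; abel

lemma mul_conj_add (x y z : C.carrier) :
    (y * x) * C.conj z + (y * z) * C.conj x = C.bil x z • y := by
  have h := C.mul_mul_conj (x + z) y
  simp only [map_add, add_mul, mul_add, norm_add, mul_mul_conj, add_smul] at h
  rw [← sub_eq_zero] at h ⊢
  rw [← h]; abel

lemma mul_conj_add' (x y z : C.carrier) :
    x * (C.conj z * y) + z * (C.conj x * y) = C.bil x z • y := by
  have h := C.conj_mul_add (C.conj x) y (C.conj z)
  rwa [C.conj_conj, C.conj_conj, bil_conj_conj] at h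

lemma conj_mul_add' (x y z : C.carrier) :
    (y * C.conj x) * z + (y * C.conj z) * x = C.bil x z • y := by
  have h := C.mul_conj_add (C.conj x) y (C.conj z)
  rwa [C.conj_conj, C.conj_conj, bil_conj_conj] at h

/-- The trace zero elements of a composition algebra. -/
noncomputable def pure : Submodule F C.carrier := LinearMap.ker (C.bil.flip 1)

lemma mem_pure {x : C.carrier} : x ∈ C.pure ↔ C.bil x 1 = 0 := by
  simp [pure]

lemma conj_pure {x : C.carrier} (hx : x ∈ C.pure) : C.conj x = -x := by
  rw [conj_eq, C.mem_pure.1 hx]; simp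

lemma pure_of_conj {x : C.carrier} (hx : C.conj x = -x) : x ∈ C.pure := by
  rw [mem_pure]
  rw [conj_eq, sub_eq_neg_self] at hx
  have h1 : (1 : C.carrier) ≠ 0 := by
    intro h
    have := C.norm_one
    rw [h, QuadraticMap.map_zero] at this
    exact zero_ne_one this
  exact (smul_eq_zero.1 hx).resolve_right h1

end CompositionAlgebra

/-- The underlying space of the octonion algebra obtained by three Cayley-Dickson doublings
with parameters `a`, `b`, `c`. -/
@[ext]
structure Cayley {k : Type u} (a b c : k) : Type u where
  coord : Fin 8 → k

namespace Cayley

lemma ext_coord {k : Type u} {a b c : k} {x y : Cayley a b c}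
    (h0 : x.coord 0 = y.coord 0) (h1 : x.coord 1 = y.coord 1)
    (h2 : x.coord 2 = y.coord 2) (h3 : x.coord 3 = y.coord 3) (h4 : x.coord 4 = y.coord 4)
    (h5 : x.coord 5 = y.coord 5) (h6 : x.coord 6 = y.coord 6) (h7 : x.coord 7 = y.coord 7) :
    x = y := by
  refine Cayley.ext (funext fun i => ?_)
  fin_cases i <;> assumption

variable {k : Type u} [Field k] {a b c : k}

/-- The coordinates as a bijection. -/
def coordEquiv : Cayley a b c ≃ (Fin 8 → k) := ⟨coord, mk, fun _ => rfl, fun _ => rfl⟩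

instance : AddCommGroup (Cayley a b c) := coordEquiv.addCommGroup

instance : Module k (Cayley a b c) := coordEquiv.module k

/-- The coordinates as a linear equivalence. -/
def coordLin : Cayley a b c ≃ₗ[k] (Fin 8 → k) := coordEquiv.linearEquiv k

lemma coord_add (x y : Cayley a b c) : (x + y).coord = x.coord + y.coord := rfl

lemma coord_smul (r : k) (x : Cayley a b c) : (r • x).coord = r • x.coord := rfl

lemma coord_zero : (0 : Cayley a b c).coord = 0 := rfl

lemma coord_sub (x y : Cayley a b c) : (x - y).coord = x.coord - y.coord := rfl

variable (a b c) in
/-- The coordinates of a product. -/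
def mulCoord (x y : Fin 8 → k) : Fin 8 → k :=
  ![x 0 * y 0 + a * x 1 * y 1 + b * x 2 * y 2 - a * b * x 3 * y 3 + c * x 4 * y 4 - a * c * x 5 * y 5 - b * c * x 6 * y 6 + a * b * c * x 7 * y 7,
    x 0 * y 1 + x 1 * y 0 - b * x 2 * y 3 + b * x 3 * y 2 - c * x 4 * y 5 + c * x 5 * y 4 - b * c * x 6 * y 7 + b * c * x 7 * y 6,
    x 0 * y 2 + a * x 1 * y 3 + x 2 * y 0 - a * x 3 * y 1 - c * x 4 * y 6 + a * c * x 5 * y 7 + c * x 6 * y 4 - a * c * x 7 * y 5,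
    x 0 * y 3 + x 1 * y 2 - x 2 * y 1 + x 3 * y 0 - c * x 4 * y 7 + c * x 5 * y 6 - c * x 6 * y 5 + c * x 7 * y 4,
    x 0 * y 4 + a * x 1 * y 5 + b * x 2 * y 6 - a * b * x 3 * y 7 + x 4 * y 0 - a * x 5 * y 1 - b * x 6 * y 2 + a * b * x 7 * y 3,
    x 0 * y 5 + x 1 * y 4 + b * x 2 * y 7 - b * x 3 * y 6 - x 4 * y 1 + x 5 * y 0 + b * x 6 * y 3 - b * x 7 * y 2,
    x 0 * y 6 - a * x 1 * y 7 + x 2 * y 4 + a * x 3 * y 5 - x 4 * y 2 - a * x 5 * y 3 + x 6 * y 0 + a * x 7 * y 1,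
    x 0 * y 7 - x 1 * y 6 + x 2 * y 5 + x 3 * y 4 - x 4 * y 3 - x 5 * y 2 + x 6 * y 1 + x 7 * y 0]

instance : Mul (Cayley a b c) := ⟨fun x y => ⟨mulCoord a b c x.coord y.coord⟩⟩

instance : One (Cayley a b c) := ⟨⟨![1, 0, 0, 0, 0, 0, 0, 0]⟩⟩

lemma coord_mul (x y : Cayley a b c) : (x * y).coord = mulCoord a b c x.coord y.coord := rfl

lemma coord_one : (1 : Cayley a b c).coord = ![1, 0, 0, 0, 0, 0, 0, 0] := rfl

lemma mul_add_aux (x y z : Cayley a b c) : x * (y + z) = x * y + x * z := by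
  apply ext_coord <;> simp only [coord_mul, coord_add, mulCoord, Pi.add_apply, Matrix.cons_val] <;>
    ring

lemma add_mul_aux (x y z : Cayley a b c) : (x + y) * z = x * z + y * z := by
  apply ext_coord <;> simp only [coord_mul, coord_add, mulCoord, Pi.add_apply, Matrix.cons_val] <;>
    ring

instance : NonAssocRing (Cayley a b c) where
  left_distrib := mul_add_aux
  right_distrib := add_mul_aux
  zero_mul x := by
    apply ext_coord <;> simp [coord_mul, coord_zero, mulCoord]
  mul_zero x := by
    apply ext_coord <;> simp [coord_mul, coord_zero, mulCoord]
  one_mul x := by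
    apply ext_coord <;> simp [coord_mul, coord_one, mulCoord]
  mul_one x := by
    apply ext_coord <;> simp [coord_mul, coord_one, mulCoord]

instance : IsScalarTower k (Cayley a b c) (Cayley a b c) where
  smul_assoc r x y := by
    apply ext_coord <;> simp only [coord_mul, coord_smul, mulCoord, Pi.smul_apply, smul_eq_mul, Matrix.cons_val] <;> ring

instance : SMulCommClass k (Cayley a b c) (Cayley a b c) where
  smul_comm r x y := by
    apply ext_coord <;> simp only [coord_mul, coord_smul, mulCoord, Pi.smul_apply, smul_eq_mul, Matrix.cons_val] <;> ring

instance : FiniteDimensional k (Cayley a b c) := Module.Finite.equiv coordLin.symm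

variable (a b c) in
/-- The norm of the octonion algebra. -/
noncomputable def normForm : QuadraticForm k (Cayley a b c) :=
  (QuadraticMap.weightedSumSquares k
    ![1, -a, -b, a * b, -c, a * c, b * c, -(a * b * c)]).comp (coordLin (a := a)).toLinearMap

lemma normForm_apply (x : Cayley a b c) : normForm a b c x =
    x.coord 0 ^ 2 - a * x.coord 1 ^ 2 - b * x.coord 2 ^ 2 + a * b * x.coord 3 ^ 2 -
    c * x.coord 4 ^ 2 + a * c * x.coord 5 ^ 2 + b * c * x.coord 6 ^ 2 -
    a * b * c * x.coord 7 ^ 2 := by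
  have : normForm a b c x = QuadraticMap.weightedSumSquares k
    ![1, -a, -b, a * b, -c, a * c, b * c, -(a * b * c)] x.coord := rfl
  rw [this, QuadraticMap.weightedSumSquares_apply, Fin.sum_univ_eight]
  simp
  ring

variable (a b c) in
/-- The conjugation of the octonion algebra. -/
def conjLin : Cayley a b c →ₗ[k] Cayley a b c where
  toFun x := ⟨fun i => if i = 0 then x.coord i else -x.coord i⟩
  map_add' x y := by
    refine Cayley.ext (funext fun i => ?_)
    by_cases hi : i = 0 <;> simp [coord_add, hi]
    ring
  map_smul' r x := by
    refine Cayley.ext (funext fun i => ?_)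
    by_cases hi : i = 0 <;> simp [coord_smul, hi]

lemma conjLin_coord (x : Cayley a b c) (i : Fin 8) :
    (conjLin a b c x).coord i = if i = 0 then x.coord i else -x.coord i := rfl

/-- The octonion algebra as a composition algebra. -/
noncomputable def alg (h2 : (2 : k) ≠ 0) (ha : a ≠ 0) (hb : b ≠ 0) (hc : c ≠ 0) :
    CompositionAlgebra k where
  carrier := Cayley a b c
  norm := normForm a b c
  norm_one := by simp [normForm_apply, coord_one]
  norm_mul x y := by
    simp only [normForm_apply, coord_mul, mulCoord, Matrix.cons_val]
    ring
  nondegenerate x h := by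
    have e : ∀ y, normForm a b c (x + y) - normForm a b c x - normForm a b c y =
        2 * (x.coord 0 * y.coord 0 - a * (x.coord 1 * y.coord 1) - b * (x.coord 2 * y.coord 2) +
        a * b * (x.coord 3 * y.coord 3) - c * (x.coord 4 * y.coord 4) +
        a * c * (x.coord 5 * y.coord 5) + b * c * (x.coord 6 * y.coord 6) -
        a * b * c * (x.coord 7 * y.coord 7)) := by
      intro y
      simp only [normForm_apply, coord_add, Pi.add_apply]
      ring
    simp only [e] at h
    refine Cayley.ext (funext fun i => ?_)
    have := h ⟨Pi.single i 1⟩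
    fin_cases i <;> simpa [h2, ha, hb, hc, Pi.single_apply, coord_zero] using this
  conj := conjLin a b c
  conj_def x := by
    apply ext_coord <;> simp [conjLin_coord, normForm_apply, coord_add, coord_smul, coord_sub, coord_one]
    ring
  conj_one := by
    apply ext_coord <;> simp [conjLin_coord, coord_one]
  conj_mul x y := by
    apply ext_coord <;> simp [conjLin_coord, coord_mul, mulCoord] <;> ring
  conj_conj x := by
    refine Cayley.ext (funext fun i => ?_)
    by_cases hi : i = 0 <;> simp [conjLin_coord, hi]

lemma finrank_alg (h2 : (2 : k) ≠ 0) (ha : a ≠ 0) (hb : b ≠ 0) (hc : c ≠ 0) :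
    Module.finrank k (alg h2 ha hb hc).carrier = 8 :=
  (LinearEquiv.finrank_eq (coordLin (a := a) (b := b) (c := c))).trans (by simp)

/-- The norm of the octonion algebra is isometric to a Pfister form. -/
noncomputable def isometry (h2 : (2 : k) ≠ 0) (ha : a ≠ 0) (hb : b ≠ 0) (hc : c ≠ 0) :
    QuadraticMap.IsometryEquiv (alg h2 ha hb hc).norm (QuadraticMap.weightedSumSquares k
      ![1, -a, -b, a * b, -c, a * c, b * c, -(a * b * c)]) where
  toLinearEquiv := coordLin (a := a) (b := b) (c := c)
  map_app' _ := rfl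

end Cayley

/-- Two families of vectors which are dual to each other with respect to a bilinear form. -/
structure DualFamilies {F S ι : Type*} [Field F] [AddCommGroup S] [Module F S] [Fintype ι]
    (B : LinearMap.BilinForm F S) (b b' : ι → S) : Prop where
  sum_left : ∀ s, ∑ i, B s (b' i) • b i = s
  sum_right : ∀ s, ∑ i, B s (b i) • b' i = s

namespace DualFamilies

variable {F S ι : Type*} [Field F] [AddCommGroup S] [Module F S] [Fintype ι]
  {B : LinearMap.BilinForm F S} {b b' : ι → S} {M : Type*} [AddCommGroup M] [Module F M]

/-- The Casimir element of a bilinear form does not depend on the choice of dual families. -/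
lemma sum_eq (hB : ∀ s t, B s t = B t s) (h : DualFamilies B b b') {κ : Type*} [Fintype κ]
    {c c' : κ → S} (h' : DualFamilies B c c') (f : S →ₗ[F] S →ₗ[F] M) :
    ∑ i, f (b i) (b' i) = ∑ j, f (c j) (c' j) := by
  calc ∑ i, f (b i) (b' i) = ∑ i, ∑ j, B (b i) (c' j) • f (c j) (b' i) := by
        refine Finset.sum_congr rfl fun i _ => ?_
        conv_lhs => rw [← h'.sum_left (b i)]
        simp
    _ = ∑ j, ∑ i, B (b i) (c' j) • f (c j) (b' i) := Finset.sum_comm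
    _ = _ := by
        refine Finset.sum_congr rfl fun j _ => ?_
        conv_rhs => rw [← h.sum_right (c' j)]
        simp [hB]

/-- Moving a skew operator across the Casimir element. -/
lemma sum_skew (hB : ∀ s t, B s t = B t s) (h : DualFamilies B b b') (f : S →ₗ[F] S →ₗ[F] M)
    (d : S →ₗ[F] S) (hd : ∀ s t, B (d s) t = - B s (d t)) :
    ∑ i, f (d (b i)) (b' i) = - ∑ i, f (b i) (d (b' i)) := by
  have e1 : ∀ i, f (d (b i)) (b' i) = ∑ j, B (d (b i)) (b' j) • f (b j) (b' i) := by
    intro i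
    conv_lhs => rw [← h.sum_left (d (b i))]
    simp
  have e2 : ∀ j, f (b j) (d (b' j)) = ∑ i, B (d (b' j)) (b i) • f (b j) (b' i) := by
    intro j
    conv_lhs => rw [← h.sum_right (d (b' j))]
    simp
  simp only [e1, e2]
  rw [Finset.sum_comm, ← Finset.sum_neg_distrib]
  refine Finset.sum_congr rfl fun j _ => ?_
  rw [← Finset.sum_neg_distrib]
  refine Finset.sum_congr rfl fun i _ => ?_
  rw [hd, hB (b i), neg_smul]

lemma symm (h : DualFamilies B b b') : DualFamilies B b' b := ⟨h.sum_right, h.sum_left⟩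

lemma of_orthogonal (b : ι → S) (hspan : Submodule.span F (Set.range b) = ⊤)
    (ho : ∀ i j, i ≠ j → B (b i) (b j) = 0) (hn : ∀ i, B (b i) (b i) ≠ 0) :
    DualFamilies B b (fun i => (B (b i) (b i))⁻¹ • b i) := by
  classical
  constructor
  · intro s
    have hs : s ∈ Submodule.span F (Set.range b) := by rw [hspan]; trivial
    induction hs using Submodule.span_induction with
    | mem x hx =>
      obtain ⟨i, rfl⟩ := hx
      rw [Finset.sum_eq_single i]
      · simp [hn]
      · intro j _ hj; simp [ho _ _ hj.symm]
      · simp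
    | zero => simp
    | add x y _ _ hx hy =>
      conv_rhs => rw [← hx, ← hy]
      simp [add_smul, mul_add, Finset.sum_add_distrib]
    | smul a x _ hx =>
      conv_rhs => rw [← hx]
      simp [Finset.smul_sum, smul_smul, mul_left_comm]
  · intro s
    have hs : s ∈ Submodule.span F (Set.range b) := by rw [hspan]; trivial
    induction hs using Submodule.span_induction with
    | mem x hx =>
      obtain ⟨i, rfl⟩ := hx
      rw [Finset.sum_eq_single i]
      · simp [hn, smul_smul]
      · intro j _ hj; simp [ho _ _ hj.symm]
      · simp
    | zero => simp
    | add x y _ _ hx hy =>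
      conv_rhs => rw [← hx, ← hy]
      simp [add_smul, Finset.sum_add_distrib]
    | smul a x _ hx =>
      conv_rhs => rw [← hx]
      simp [Finset.smul_sum, smul_smul, mul_assoc]

end DualFamilies

/-- The abstract data behind the operators `V` of a tensor product of two octonion algebras:
a pair of half-spin maps `m, m'` for a quadratic space of dimension 14, acting on a space
with an invariant pairing. -/
structure SpinModel (F S M : Type*) [Field F] [AddCommGroup S] [Module F S]
    [AddCommGroup M] [Module F M] where
  B : LinearMap.BilinForm F S
  symm : ∀ s t, B s t = B t s
  m : S →ₗ[F] Module.End F M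
  m' : S →ₗ[F] Module.End F M
  rel : ∀ u v x, m u (m' v x) + m v (m' u x) = - B u v • x
  rel' : ∀ u v x, m' u (m v x) + m' v (m u x) = - B u v • x
  pair : LinearMap.BilinForm F M
  pair_symm : ∀ x y, pair x y = pair y x
  pair_nondeg : ∀ x, (∀ y, pair x y = 0) → x = 0
  pair_m : ∀ u x y, pair (m u x) y = - pair x (m u y)
  pair_m' : ∀ u x y, pair (m' u x) y = - pair x (m' u y)
  V : M → M → M → M
  b : Fin 14 → S
  b' : Fin 14 → S
  dual : DualFamilies B b b'
  dual_one : ∀ i, B (b i) (b' i) = 1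
  m_inj : Function.Injective m
  fierz : ∀ x y z, (2 : F) • V x y z = ∑ i, ∑ j, pair (m (b i) (m' (b j) x)) y •
    m (b' j) (m' (b' i) z) - (3 * pair x y) • z
  psi : M → M → S
  psi_spec : ∀ x y u, B (psi x y) u = - pair (m' u x) y
  V_swap : ∀ x y z, V x y z = V z y x + m (psi x z) y
  V_transp : ∀ x y z w, pair (V x y z) w = pair z (V y x w)

namespace SpinModel

variable {F S M : Type*} [Field F] [AddCommGroup S] [Module F S]
    [AddCommGroup M] [Module F M] (D : SpinModel F S M)

/-- The operators `m(u) m'(v)`. -/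
def E (u v : S) (x : M) : M := D.m u (D.m' v x)

lemma E_add_swap (u v : S) (x : M) : D.E u v x + D.E v u x = - D.B u v • x := D.rel u v x

lemma m_mul (u v : S) (x : M) : D.m u (D.m' v x) = - D.B u v • x - D.m v (D.m' u x) := by
  rw [← D.rel]; abel

lemma m'_mul (u v : S) (x : M) : D.m' u (D.m v x) = - D.B u v • x - D.m' v (D.m u x) := by
  rw [← D.rel']; abel

/-- The infinitesimal rotation attached to `E(s,t)`. -/
def rot (s t : S) : S →ₗ[F] S := (D.B s).smulRight t - (D.B t).smulRight s

lemma rot_apply (s t w : S) : D.rot s t w = D.B s w • t - D.B t w • s := rfl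

lemma rot_skew (s t u v : S) : D.B (D.rot s t u) v = - D.B u (D.rot s t v) := by
  simp only [rot_apply, map_sub, map_smul, LinearMap.sub_apply, LinearMap.smul_apply, smul_eq_mul,
    D.symm u]
  ring

lemma E_comm (s t u v : S) (x : M) : D.E s t (D.E u v x) - D.E u v (D.E s t x) =
    D.E (D.rot s t u) v x + D.E u (D.rot s t v) x := by
  have h1 : D.E s t (D.E u v x) = - D.B t u • D.E s v x - D.E s u (D.E t v x) := by
    simp only [E]; rw [D.m'_mul t u]; simp
  have h2 : D.E s u (D.E t v x) = - D.B s u • D.E t v x - D.E u s (D.E t v x) := D.m_mul _ _ _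
  have h3 : D.E u s (D.E t v x) = - D.B s t • D.E u v x - D.E u t (D.E s v x) := by
    simp only [E]; rw [D.m'_mul s t]; simp
  have h4 : D.E u t (D.E s v x) = - D.B s v • D.E u t x - D.E u t (D.E v s x) := by
    simp only [E]; rw [D.m_mul s v]; simp
  have h5 : D.E u t (D.E v s x) = - D.B t v • D.E u s x - D.E u v (D.E t s x) := by
    simp only [E]; rw [D.m'_mul t v]; simp
  have h6 : D.E u v (D.E t s x) = - D.B t s • D.E u v x - D.E u v (D.E s t x) := by
    simp only [E]; rw [D.m_mul t s]; simp
  have e1 : D.E (D.rot s t u) v x = D.B s u • D.E t v x - D.B t u • D.E s v x := by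
    simp [E, rot_apply]
  have e2 : D.E u (D.rot s t v) x = D.B s v • D.E u t x - D.B t v • D.E u s x := by
    simp [E, rot_apply]
  rw [h1, h2, h3, h4, h5, h6, e1, e2, D.symm t s]
  module

lemma pair_E (u v : S) (x y : M) : D.pair (D.E u v x) y = D.pair x (D.m' v (D.m u y)) := by
  simp [E, D.pair_m, D.pair_m']

/-- `E` as a trilinear map. -/
def Elin : S →ₗ[F] S →ₗ[F] Module.End F M :=
  LinearMap.mk₂ F (fun u v => D.m u ∘ₗ D.m' v) (by intros; ext; simp) (by intros; ext; simp)
    (by intros; ext; simp) (by intros; ext; simp)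

lemma Elin_apply (u v : S) (x : M) : D.Elin u v x = D.E u v x := rfl

lemma eq_of_pair {x y : M} (h : ∀ z, D.pair x z = D.pair y z) : x = y := by
  rw [← sub_eq_zero]
  exact D.pair_nondeg _ fun z => by simp [h]

end SpinModel

namespace Springer

open Polynomial

lemma exists_irreducible_odd {k : Type*} [Field k] : ∀ (n : ℕ) (g : k[X]), g.natDegree = n →
    Odd n → ∃ h, Irreducible h ∧ h ∣ g ∧ Odd h.natDegree := by
  intro n
  induction n using Nat.strong_induction_on with
  | _ n ih =>
  intro g hg hn
  have hg0 : g ≠ 0 := by rintro rfl; simp at hg; subst hg; simp at hn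
  have hu : ¬ IsUnit g := by
    intro hu
    rw [natDegree_eq_zero_of_isUnit hu] at hg
    subst hg; simp at hn
  obtain ⟨h, hi, g', rfl⟩ := WfDvdMonoid.exists_irreducible_factor hu hg0
  by_cases ho : Odd h.natDegree
  · exact ⟨h, hi, Dvd.intro _ rfl, ho⟩
  · have h1 : h ≠ 0 := hi.ne_zero
    have h2 : g' ≠ 0 := right_ne_zero_of_mul hg0
    rw [natDegree_mul h1 h2] at hg
    have h3 : 0 < h.natDegree := hi.natDegree_pos
    have : Odd g'.natDegree := by
      rw [← hg] at hn
      rw [Nat.not_odd_iff_even] at ho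
      exact (Nat.odd_add.1 (by rwa [add_comm])).2 ho
    obtain ⟨q, hq, hd, hqo⟩ := ih _ (by omega) g' rfl this
    exact ⟨q, hq, hd.mul_left h, hqo⟩

lemma polynomial {k : Type*} [Field k] {ι : Type*} [Fintype ι] (q : ι → k)
    (hq : ∀ c : ι → k, ∑ i, q i * c i ^ 2 = 0 → c = 0) :
    ∀ (d : ℕ), Odd d → ∀ p : k[X], Irreducible p → p.natDegree = d → ∀ n, n < d →
      ∀ f : ι → k[X], (∀ i, (f i).natDegree ≤ n) → p ∣ ∑ i, C (q i) * f i ^ 2 → f = 0 := by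
  intro d
  induction d using Nat.strong_induction_on with
  | _ d ihd =>
  intro hd p hp hpd n
  induction n with
  | zero =>
    intro _ f hf hdvd
    have hsum : ∑ i, C (q i) * f i ^ 2 = C (∑ i, q i * (f i).coeff 0 ^ 2) := by
      rw [map_sum]
      refine Finset.sum_congr rfl fun i _ => ?_
      conv_lhs => rw [eq_C_of_natDegree_le_zero (hf i)]
      simp
    rw [hsum] at hdvd
    by_cases h0 : ∑ i, q i * (f i).coeff 0 ^ 2 = 0
    · have := hq _ h0
      funext i
      rw [eq_C_of_natDegree_le_zero (hf i), congrFun this i]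
      simp
    · have := natDegree_le_of_dvd hdvd (C_ne_zero.2 h0)
      rw [natDegree_C] at this
      obtain ⟨r, hr⟩ := hd
      omega
  | succ n ihn =>
    intro hn f hf hdvd
    by_cases h0 : ∑ i, q i * (f i).coeff (n + 1) ^ 2 = 0
    · have h1 := hq _ h0
      refine ihn (by omega) f (fun i => ?_) hdvd
      refine natDegree_le_iff_coeff_eq_zero.2 fun N hN => ?_
      rcases Nat.lt_or_ge (n + 1) N with h | h
      · exact coeff_eq_zero_of_natDegree_lt ((hf i).trans_lt h)
      · obtain rfl : N = n + 1 := by omega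
        exact congrFun h1 i
    · have hdeg : (∑ i, C (q i) * f i ^ 2).natDegree = 2 * (n + 1) := by
        refine natDegree_eq_of_le_of_coeff_ne_zero ?_ ?_
        · refine natDegree_sum_le_of_forall_le _ _ fun i _ => ?_
          refine (natDegree_C_mul_le _ _).trans ?_
          exact natDegree_pow_le_of_le 2 (hf i)
        · rw [finsetSum_coeff]
          convert h0 using 3 with i
          rw [coeff_C_mul, coeff_pow_of_natDegree_le (hf i)]
      have hs0 : ∑ i, C (q i) * f i ^ 2 ≠ 0 := by
        intro h
        rw [h] at hdeg
        simp at hdeg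
      obtain ⟨g, hg⟩ := hdvd
      have hg0 : g ≠ 0 := by rintro rfl; simp [hg] at hs0
      rw [hg, natDegree_mul hp.ne_zero hg0, hpd] at hdeg
      obtain ⟨h, hi, hdv, ho⟩ := exists_irreducible_odd g.natDegree g rfl (by
        obtain ⟨r, hr⟩ := hd
        exact ⟨n - r, by omega⟩)
      have hle := natDegree_le_of_dvd hdv hg0
      have hall : ∀ i, h ∣ f i := by
        have h1 := ihd h.natDegree (by omega) ho h hi rfl (h.natDegree - 1)
          (by have := hi.natDegree_pos; omega) (fun i => f i % h)
          (fun i => by have := natDegree_mod_lt (f i) hi.natDegree_pos.ne'; omega) (by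
            have h2 : h ∣ ∑ i, C (q i) * f i ^ 2 := by rw [hg]; exact hdv.mul_left p
            rw [← dvd_iff_dvd_of_dvd_sub (a := h) (b := ∑ i, C (q i) * f i ^ 2)]
            · exact h2
            · rw [← Finset.sum_sub_distrib]
              refine Finset.dvd_sum fun i _ => ?_
              have : h ∣ f i - f i % h := ⟨f i / h, by rw [EuclideanDomain.mod_eq_sub_mul_div]; ring⟩
              have e : C (q i) * f i ^ 2 - C (q i) * (f i % h) ^ 2 =
                (f i - f i % h) * (C (q i) * (f i + f i % h)) := by ring
              rw [e]
              exact this.mul_right _)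
        intro i
        exact EuclideanDomain.mod_eq_zero.1 (congrFun h1 i)
      choose f' hf' using hall
      have h2 : ∑ i, C (q i) * f i ^ 2 = h ^ 2 * ∑ i, C (q i) * f' i ^ 2 := by
        rw [Finset.mul_sum]
        refine Finset.sum_congr rfl fun i _ => ?_
        rw [hf' i]; ring
      have h3 : ¬ p ∣ h := by
        intro hh
        have := natDegree_le_of_dvd hh hi.ne_zero
        omega
      have h4 : p ∣ ∑ i, C (q i) * f' i ^ 2 := by
        have : p ∣ h ^ 2 * ∑ i, C (q i) * f' i ^ 2 := by rw [← h2, hg]; exact Dvd.intro _ rfl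
        rcases hp.prime.dvd_or_dvd this with h5 | h5
        · exact absurd (hp.prime.dvd_of_dvd_pow h5) h3
        · exact h5
      have h5 := ihn (by omega) f' (fun i => by
        by_cases hz : f' i = 0
        · simp [hz]
        · have := hf i
          rw [hf' i, natDegree_mul hi.ne_zero hz] at this
          have := hi.natDegree_pos
          omega) h4
      funext i
      rw [hf' i, congrFun h5 i]
      simp

/-- Springer's theorem for diagonal forms: an anisotropic form stays anisotropic over an
extension of odd degree. -/
theorem odd_degree {ι : Type*} [Fintype ι] (n : ℕ) : ∀ (k : Type u) (L : Type u) [Field k] [Field L]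
    [Algebra k L] [FiniteDimensional k L] (q : ι → k)
    (_ : ∀ c : ι → k, ∑ i, q i * c i ^ 2 = 0 → c = 0), Module.finrank k L = n → Odd n →
    ∀ c : ι → L, ∑ i, algebraMap k L (q i) * c i ^ 2 = 0 → c = 0 := by
  induction n using Nat.strong_induction_on with
  | _ n ih =>
  intro k L _ _ _ _ q hq hn ho c hc
  by_cases hbot : ∀ α : L, α ∈ Set.range (algebraMap k L)
  · choose c' hc' using fun i => hbot (c i)
    have : ∑ i, q i * c' i ^ 2 = 0 := by
      apply (algebraMap k L).injective
      rw [map_sum, map_zero, ← hc]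
      refine Finset.sum_congr rfl fun i _ => ?_
      rw [map_mul, map_pow, hc']
    have := hq _ this
    funext i
    rw [← hc', congrFun this i]
    simp
  · push Not at hbot
    obtain ⟨α, hα⟩ := hbot
    have hαi : IsIntegral k α := Algebra.IsIntegral.isIntegral α
    let E := IntermediateField.adjoin k {α}
    have hmul : Module.finrank k E * Module.finrank E L = n := by
      rw [Module.finrank_mul_finrank, hn]
    rw [← hmul, Nat.odd_mul] at ho
    have hE : Module.finrank k E = (minpoly k α).natDegree :=
      IntermediateField.adjoin.finrank hαi
    have hE1 : Module.finrank k E ≠ 1 := by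
      intro h
      apply hα
      rw [IntermediateField.finrank_eq_one_iff] at h
      have : α ∈ E := IntermediateField.mem_adjoin_simple_self k α
      rw [h] at this
      exact IntermediateField.mem_bot.1 this
    have hpos : 0 < Module.finrank E L := Module.finrank_pos
    have hpos' : 0 < Module.finrank k E := Module.finrank_pos
    refine ih (Module.finrank E L) (by rw [← hmul]; nlinarith [Nat.lt_of_le_of_ne hpos' hE1.symm])
      E L (fun i => algebraMap k E (q i)) ?_ rfl ho.2 c (by
        rw [← hc]
        refine Finset.sum_congr rfl fun i _ => ?_
        rw [← IsScalarTower.algebraMap_apply])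
    intro b hb
    have hrep : ∀ i, ∃ f : k[X], f.natDegree ≤ (minpoly k α).natDegree - 1 ∧ aeval α f = (b i : L) := by
      intro i
      have hbi : (b i : L) ∈ Algebra.adjoin k {α} := by
        rw [← IntermediateField.adjoin_simple_toSubalgebra_of_isAlgebraic hαi.isAlgebraic]
        exact (b i).2
      rw [Algebra.adjoin_singleton_eq_range_aeval] at hbi
      obtain ⟨f, hf⟩ := hbi
      refine ⟨f %ₘ minpoly k α, ?_, ?_⟩
      · have := natDegree_modByMonic_lt f (minpoly.monic hαi) (minpoly.ne_one k α)
        omega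
      · rw [← hf]
        exact aeval_modByMonic_eq_self_of_root (minpoly.aeval k α)
    choose f hfd hf using hrep
    have := polynomial q hq (minpoly k α).natDegree (by rw [← hE]; exact ho.1) (minpoly k α)
      (minpoly.irreducible hαi) rfl ((minpoly k α).natDegree - 1) (by omega) f hfd (by
        apply minpoly.dvd
        have h1 := congrArg (algebraMap E L) hb
        rw [map_sum, map_zero] at h1
        rw [map_sum, ← h1]
        refine Finset.sum_congr rfl fun i _ => ?_
        rw [map_mul, map_pow, map_mul, map_pow, aeval_C, hf, ← IsScalarTower.algebraMap_apply]
        rfl)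
    funext i
    apply Subtype.ext
    rw [← hf, congrFun this i]
    simp

end Springer

section CliffordEigenvalue

variable {N S M ι : Type*} [Field N] [AddCommGroup S] [Module N S] [AddCommGroup M] [Module N M]
  [Fintype ι]

lemma DualFamilies.commutator {B : S →ₗ[N] S →ₗ[N] N} {b b' : ι → S} (hd : DualFamilies B b b')
    (κ : S →ₗ[N] Module.End N M)
    (hκ : ∀ u v, κ u * κ v + κ v * κ u = B u v • 1) (hB : ∀ u v, B u v = B v u)
    (D : S →ₗ[N] S) (hD : ∀ u v, B (D u) v = -B u (D v)) (u : S) (hu : D u = 0) :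
    Commute (∑ i, κ (D (b i)) * κ (b' i)) (κ u) := by
  have h1 : ∀ i, κ (D (b i)) * κ (b' i) * κ u - κ u * (κ (D (b i)) * κ (b' i)) =
      B (b' i) u • κ (D (b i)) := by
    intro i
    have e1 : κ (b' i) * κ u = B (b' i) u • 1 - κ u * κ (b' i) := by rw [← hκ]; abel
    have e2 : κ u * κ (D (b i)) = - (κ (D (b i)) * κ u) := by
      rw [eq_neg_iff_add_eq_zero, add_comm, hκ, hD, hu]; simp
    rw [mul_assoc, e1, ← mul_assoc (κ u), e2, mul_sub, mul_smul_comm, mul_one, ← mul_assoc]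
    simp
  have h2 : ∑ i, B (b' i) u • κ (D (b i)) = 0 := by
    have : ∑ i, B (b' i) u • κ (D (b i)) = κ (D (∑ i, B u (b' i) • b i)) := by
      simp only [map_sum, map_smul, hB u]
    rw [this, hd.sum_left, hu, map_zero]
  rw [commute_iff_eq, ← sub_eq_zero, Finset.sum_mul, Finset.mul_sum, ← Finset.sum_sub_distrib,
    Finset.sum_congr rfl fun i _ => h1 i, h2]

/-- In a Clifford module, the eigenvalues of the quadratic element attached to a skew
transformation `D` lie in every additive subgroup containing the eigenvalues of `D`, if the latter
is diagonalisable. -/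
lemma DualFamilies.eigenvalue_mem [FiniteDimensional N S] (h2 : (2 : N) ≠ 0)
    {B : S →ₗ[N] S →ₗ[N] N} {b b' : ι → S} (hd : DualFamilies B b b')
    (κ : S →ₗ[N] Module.End N M)
    (hκ : ∀ u v, κ u * κ v + κ v * κ u = B u v • 1) (hB : ∀ u v, B u v = B v u)
    (Z : AddSubgroup N) : ∀ (n : ℕ)
    (D : S →ₗ[N] S) (_ : ∀ u v, B (D u) v = -B u (D v))
    (_ : Module.finrank N S ≤ Module.finrank N (LinearMap.ker D) + n)
    (_ : Submodule.span N {u | ∃ μ ∈ Z, D u = μ • u} = ⊤) (x : M) (_ : x ≠ 0) (c : N)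
    (_ : (∑ i, κ (D (b i)) * κ (b' i)) x = c • x), c ∈ Z := by
  have zero_case : ∀ (x : M) (_ : x ≠ 0) (c : N)
    (_ : (∑ i, κ ((0 : S →ₗ[N] S) (b i)) * κ (b' i)) x = c • x), c ∈ Z := by
    intro x hx c h
    have : c • x = 0 := by rw [← h]; simp
    rw [(smul_eq_zero.1 this).resolve_right hx]
    exact Z.zero_mem
  intro n
  induction n with
  | zero =>
    intro D hD hn hs x hx c h
    have : LinearMap.ker D = ⊤ := Submodule.eq_top_of_finrank_eq
      (le_antisymm (Submodule.finrank_le _) (by simpa using hn))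
    rw [LinearMap.ker_eq_top] at this
    subst this
    exact zero_case x hx c h
  | succ n ih =>
    intro D hD hn hs x hx c h
    by_cases h0 : D = 0
    · subst h0; exact zero_case x hx c h
    obtain ⟨v, ⟨l, hl, hv⟩, hDv⟩ : ∃ v, v ∈ {u | ∃ μ ∈ Z, D u = μ • u} ∧ D v ≠ 0 := by
      by_contra! hc
      apply h0
      rw [← LinearMap.ker_eq_top, eq_top_iff, ← hs, Submodule.span_le]
      exact fun v hv => hc v hv
    have hl0 : l ≠ 0 := by rintro rfl; simp [hv] at hDv
    have hv0 : v ≠ 0 := by rintro rfl; simp at hDv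
    obtain ⟨w₀, ⟨m, hm, hw₀⟩, hvw₀⟩ : ∃ w, w ∈ {u | ∃ μ ∈ Z, D u = μ • u} ∧ B v w ≠ 0 := by
      by_contra! hc
      have : LinearMap.ker (B v) = ⊤ := by
        rw [eq_top_iff, ← hs, Submodule.span_le]
        exact fun w hw => hc w hw
      rw [LinearMap.ker_eq_top] at this
      apply hv0
      rw [← hd.sum_left v, this]
      simp
    have hml : m = -l := by
      have := hD v w₀
      rw [hv, hw₀] at this
      simp only [map_smul, LinearMap.smul_apply, smul_eq_mul] at this
      apply mul_right_cancel₀ hvw₀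
      linear_combination this
    set w := (B v w₀)⁻¹ • w₀ with hwdef
    have hvw : B v w = 1 := by simp [hwdef, hvw₀]
    have hw : D w = -(l • w) := by
      rw [hwdef, map_smul, hw₀, hml, smul_comm]; simp
    have hvv : B v v = 0 := by
      have := hD v v
      rw [hv] at this
      simp only [map_smul, LinearMap.smul_apply, smul_eq_mul] at this
      have : (2 * l) * B v v = 0 := by linear_combination this
      exact (mul_eq_zero.1 this).resolve_left (mul_ne_zero h2 hl0)
    have hww : B w w = 0 := by
      have := hD w w
      rw [hw] at this
      simp only [map_smul, map_neg, LinearMap.neg_apply, LinearMap.smul_apply, smul_eq_mul] at this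
      have : (2 * l) * B w w = 0 := by linear_combination -this
      exact (mul_eq_zero.1 this).resolve_left (mul_ne_zero h2 hl0)
    have hwv : B w v = 1 := by rw [hB, hvw]
    let P : S →ₗ[N] S := (B.flip w).smulRight v - (B.flip v).smulRight w
    have hP : ∀ u, P u = B u w • v - B u v • w := fun u => rfl
    set D₁ := D - l • P with hD₁
    have hD₁a : ∀ u, D₁ u = D u - l • (B u w • v - B u v • w) := fun u => rfl
    have hD₁v : D₁ v = 0 := by rw [hD₁a, hv, hvw, hvv]; simp
    have hD₁w : D₁ w = 0 := by rw [hD₁a, hw, hwv, hww]; simp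
    have hskew : ∀ u z, B (D₁ u) z = -B u (D₁ z) := by
      intro u z
      rw [hD₁a, hD₁a]
      simp only [map_sub, map_smul, LinearMap.sub_apply, LinearMap.smul_apply, smul_eq_mul, hD u z,
        hB v z, hB w z]
      ring
    have hsum : ∑ i, κ (D (b i)) * κ (b' i) =
        ∑ i, κ (D₁ (b i)) * κ (b' i) + l • (κ v * κ w - κ w * κ v) := by
      have e : ∀ i, κ (D (b i)) * κ (b' i) = κ (D₁ (b i)) * κ (b' i) +
          l • (κ v * (B w (b i) • κ (b' i)) - κ w * (B v (b i) • κ (b' i))) := by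
        intro i
        rw [hD₁a, hB w, hB v]
        simp only [map_sub, map_smul, sub_mul, smul_mul_assoc, mul_smul_comm, smul_sub]
        abel
      rw [Finset.sum_congr rfl fun i _ => e i, Finset.sum_add_distrib, ← Finset.smul_sum,
        Finset.sum_sub_distrib, ← Finset.mul_sum, ← Finset.mul_sum]
      have e2 : ∀ u, ∑ i, B u (b i) • κ (b' i) = κ u := by
        intro u
        conv_rhs => rw [← hd.sum_right u]
        simp
      rw [e2, e2]
    have hker : Module.finrank N (LinearMap.ker D) < Module.finrank N (LinearMap.ker D₁) := by
      apply Submodule.finrank_lt_finrank_of_lt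
      refine lt_of_le_of_ne ?_ ?_
      · intro u hu
        rw [LinearMap.mem_ker] at hu ⊢
        have h1 := hD u v
        have h2 := hD u w
        rw [hu, hv] at h1
        rw [hu, hw] at h2
        simp [hl0] at h1 h2
        rw [hD₁a, hu, h1, h2]
        simp
      · intro he
        have : v ∈ LinearMap.ker D₁ := hD₁v
        rw [← he] at this
        exact hDv this
    have hspan : Submodule.span N {u | ∃ μ ∈ Z, D₁ u = μ • u} = ⊤ := by
      rw [eq_top_iff, ← hs, Submodule.span_le]
      rintro u ⟨μ, hμ, hu⟩
      have hu' : u = (u - B u w • v - B u v • w) + (B u w • v + B u v • w) := by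
        rw [sub_sub, sub_add_cancel]
      rw [SetLike.mem_coe, hu']
      refine Submodule.add_mem _ (Submodule.subset_span ⟨μ, hμ, ?_⟩) (Submodule.add_mem _
        (Submodule.smul_mem _ _ (Submodule.subset_span ⟨0, Z.zero_mem, by simp [hD₁v]⟩))
        (Submodule.smul_mem _ _ (Submodule.subset_span ⟨0, Z.zero_mem, by simp [hD₁w]⟩)))
      have h1 := hD u v
      have h2 := hD u w
      rw [hu, hv] at h1
      rw [hu, hw] at h2
      simp only [map_smul, map_neg, LinearMap.smul_apply, smul_eq_mul, neg_neg] at h1 h2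
      simp only [map_sub, map_smul, hD₁v, hD₁w, smul_zero, sub_zero]
      rw [hD₁a, hu]
      simp only [smul_sub, smul_smul, h1, h2]
      rw [show l * B u v = -(μ * B u v) by rw [h1]; ring]
      simp only [neg_smul, neg_neg, sub_neg_eq_add, sub_add_eq_sub_sub]
    have hcomm : ∀ u, D₁ u = 0 → Commute (∑ i, κ (D₁ (b i)) * κ (b' i)) (κ u) := fun u hu =>
      hd.commutator κ hκ hB D₁ hskew u hu
    have hc1 : ∀ y, (∑ i, κ (D₁ (b i)) * κ (b' i)) (κ v (κ w y)) =
        κ v (κ w ((∑ i, κ (D₁ (b i)) * κ (b' i)) y)) := by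
      intro y
      have := congrArg (fun f : Module.End N M => f y) ((hcomm v hD₁v).mul_right (hcomm w hD₁w)).eq
      exact this
    have hc2 : ∀ y, (∑ i, κ (D₁ (b i)) * κ (b' i)) (κ w (κ v y)) =
        κ w (κ v ((∑ i, κ (D₁ (b i)) * κ (b' i)) y)) := by
      intro y
      have := congrArg (fun f : Module.End N M => f y) ((hcomm w hD₁w).mul_right (hcomm v hD₁v)).eq
      exact this
    have sq : ∀ u, B u u = 0 → ∀ y, κ u (κ u y) = 0 := by
      intro u hu y
      have := congrArg (fun f : Module.End N M => f y) (hκ u u)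
      simp only [hu, zero_smul, LinearMap.zero_apply, ← two_smul N] at this
      exact (smul_eq_zero.1 this).resolve_left h2
    have ac : ∀ y, κ v (κ w y) + κ w (κ v y) = y := by
      intro y
      have := congrArg (fun f : Module.End N M => f y) (hκ v w)
      simpa [hvw] using this
    have hx1 : (∑ i, κ (D₁ (b i)) * κ (b' i)) x = c • x - l • (κ v (κ w x) - κ w (κ v x)) := by
      rw [← h, hsum]
      simp
    by_cases hx' : κ v (κ w x) = 0
    · have hx'' : κ w (κ v x) ≠ 0 := by
        intro h'
        apply hx
        rw [← ac x, hx', h', add_zero]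
      have := ih D₁ hskew (by omega) hspan _ hx'' (c + l) (by
        rw [hc2, hx1, hx', zero_sub, smul_neg, sub_neg_eq_add]
        have e : κ w (κ v (κ w (κ v x))) = κ w (κ v x) := by
          have := ac (κ w (κ v x))
          rwa [sq w hww, map_zero, zero_add] at this
        simp only [map_add, map_smul, e, add_smul])
      simpa using Z.sub_mem this hl
    · have := ih D₁ hskew (by omega) hspan _ hx' (c - l) (by
        have e : κ v (κ w (κ v (κ w x))) = κ v (κ w x) := by
          have := ac (κ v (κ w x))
          rwa [sq v hvv, map_zero, add_zero] at this
        have e' : κ w (κ w (κ v x)) = 0 := sq w hww _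
        rw [hc1, hx1]
        simp only [map_sub, map_smul, e, e', sub_zero, sub_smul])
      simpa using Z.add_mem this hl

end CliffordEigenvalue

section SkewEigenvalues

open Polynomial

lemma Polynomial.Squarefree.separable_of_splits {L N : Type*} [Field L] [Field N] [Algebra L N]
    [FiniteDimensional L N] [IsGalois L N] {f : L[X]} (hf : Squarefree f)
    (hs : (f.map (algebraMap L N)).Splits) : f.Separable := by
  refine isCoprime_of_irreducible_dvd (hf.ne_zero ·.1) ?_
  rintro p (h : Irreducible p) ⟨q, rfl⟩ (dvd : p ∣ derivative (p * q))
  have hsep : p.Separable := by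
    have h0 : (p * q).map (algebraMap L N) ≠ 0 := by
      rw [Ne, Polynomial.map_eq_zero]; exact hf.ne_zero
    have hps : (p.map (algebraMap L N)).Splits :=
      hs.of_dvd h0 (Polynomial.map_dvd _ (dvd_mul_right p q))
    obtain ⟨x, hx⟩ := hps.exists_eval_eq_zero (by
      rw [degree_map]; exact (degree_pos_of_irreducible h).ne')
    have hx' : aeval x p = 0 := by rwa [aeval_def, eval₂_eq_eval_map]
    have hd : minpoly L x ∣ p := minpoly.dvd L x hx'
    have hd' : p ∣ minpoly L x := by
      have := (minpoly.irreducible (Algebra.IsIntegral.isIntegral (R := L) x)).associated_of_dvd h hd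
      exact this.symm.dvd
    exact (Algebra.IsSeparable.isSeparable L x : (minpoly L x).Separable).of_dvd hd'
  replace dvd : p ∣ q := by
    rw [derivative_mul, dvd_add_left (dvd_mul_right p _)] at dvd
    exact hsep.dvd_of_dvd_mul_left dvd
  exact (h.1 : ¬ IsUnit p) (hf _ <| mul_dvd_mul_left _ dvd)

lemma Module.End.ker_aeval_prod_le_span {N V : Type*} [Field N] [AddCommGroup V] [Module N V]
    (T : Module.End N V) (s : Finset N) :
    LinearMap.ker (aeval T (∏ a ∈ s, (X - C a))) ≤ Submodule.span N {u | ∃ μ ∈ s, T u = μ • u} := by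
  classical
  induction s using Finset.induction_on with
  | empty => simp [Module.End.one_eq_id]
  | insert a s ha ih =>
    rw [Finset.prod_insert ha, ← sup_ker_aeval_eq_ker_aeval_mul_of_coprime]
    · refine sup_le ?_ (ih.trans (Submodule.span_mono ?_))
      · intro u hu
        refine Submodule.subset_span ⟨a, Finset.mem_insert_self _ _, ?_⟩
        simpa [sub_eq_zero, Module.algebraMap_end_apply] using hu
      · rintro u ⟨μ, hμ, hu⟩
        exact ⟨μ, Finset.mem_insert_of_mem hμ, hu⟩
    · refine IsCoprime.prod_right fun b hb => ?_
      exact isCoprime_X_sub_C_of_isUnit_sub (sub_ne_zero.2 (by rintro rfl; exact ha hb)).isUnit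

variable {L V : Type*} [Field L] [AddCommGroup V] [Module L V]
  {B : LinearMap.BilinForm L V} {T : Module.End L V}

lemma LinearMap.BilinForm.isSemisimple_of_skew [FiniteDimensional L V] (hB : ∀ u v, B u v = B v u)
    (ha : ∀ u, B u u = 0 → u = 0) (hT : ∀ u v, B (T u) v = -B u (T v)) : T.IsSemisimple := by
  rw [Module.End.isSemisimple_iff]
  intro p hp
  refine ⟨B.orthogonal p, ?_, ?_⟩
  · rw [Module.End.mem_invtSubmodule] at hp ⊢
    intro v hv u hu
    have : B (T u) v = 0 := hv (T u) (hp hu)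
    rw [hT, neg_eq_zero] at this
    exact this
  · refine LinearMap.BilinForm.isCompl_orthogonal_of_restrict_nondegenerate
      (fun u v h => by rw [hB, h]) ⟨?_, ?_⟩
    · intro u hu
      exact Subtype.ext (ha u (hu u))
    · intro u hu
      exact Subtype.ext (ha u (hu u))

lemma LinearMap.BilinForm.aeval_skew (hT : ∀ u v, B (T u) v = -B u (T v)) (p : L[X]) (u v : V) :
    B (aeval T p u) v = B u (aeval T (p.comp (-X)) v) := by
  induction p using Polynomial.induction_on generalizing u v with
  | C a => simp [Module.algebraMap_end_apply]
  | add p q hp hq => simp [hp, hq]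
  | monomial n a h =>
    have e : (C a * X ^ (n + 1) : L[X]) = C a * X ^ n * X := by ring
    have e2 : (C a * X ^ (n + 1) : L[X]).comp (-X) = -X * (C a * X ^ n).comp (-X) := by
      rw [e, mul_comp, X_comp, mul_comm]
    have l : aeval T (C a * X ^ n * X) u = aeval T (C a * X ^ n) (T u) := by
      rw [map_mul (aeval T) (C a * X ^ n) X, aeval_X]; rfl
    have r : ∀ q : L[X], aeval T (-X * q) v = -T (aeval T q v) := fun q => by simp
    rw [e2, e, l, h, hT, r, map_neg]

lemma LinearMap.BilinForm.dvd_comp_neg_of_skew [FiniteDimensional L V]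
    (ha : ∀ u, B u u = 0 → u = 0) (hT : ∀ u v, B (T u) v = -B u (T v)) {p : L[X]}
    (hp : Irreducible p) (hdvd : p ∣ minpoly L T) : p ∣ p.comp (-X) := by
  by_contra hnd
  obtain ⟨a, b, hab⟩ := (hp.coprime_iff_not_dvd).2 hnd
  obtain ⟨g, hg⟩ := hdvd
  have hinj : ∀ v, aeval T p v = 0 → v = 0 := by
    intro v hv
    have hv' : aeval T (p.comp (-X)) (aeval T b v) = v := by
      rw [← Module.End.mul_apply, ← aeval_mul, mul_comm]
      have := congrArg (fun r => aeval T r v) hab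
      simp only [map_add, aeval_mul, LinearMap.add_apply, Module.End.mul_apply, hv, map_zero,
        zero_add, aeval_one, Module.End.one_apply] at this
      rw [aeval_mul, Module.End.mul_apply, this]
    apply ha
    conv_lhs => rw [← hv', ← aeval_skew hT, hv']
    rw [hv]
    simp
  have hg0 : aeval T g = 0 := by
    ext v
    apply hinj
    rw [← Module.End.mul_apply, ← aeval_mul, ← hg, minpoly.aeval]
    simp
  have hmp : minpoly L T ≠ 0 := minpoly.ne_zero (Algebra.IsIntegral.isIntegral T)
  have hg1 : g ≠ 0 := by rintro rfl; simp at hg; exact hmp hg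
  have h1 := natDegree_le_of_dvd (minpoly.dvd L T hg0) hg1
  rw [hg, natDegree_mul hp.ne_zero hg1] at h1
  have := hp.natDegree_pos
  omega

lemma trace_eq_zero_of_dvd_comp_neg {L N : Type*} [Field L] [Field N] [Algebra L N]
    [FiniteDimensional L N] [IsGalois L N] (h2 : (2 : L) ≠ 0) (l : N)
    (h : minpoly L l ∣ (minpoly L l).comp (-X)) : Algebra.trace L N l = 0 := by
  have h0 : aeval (-l) (minpoly L l) = 0 := by
    obtain ⟨g, hg⟩ := h
    have := congrArg (aeval l) hg
    rw [aeval_mul, minpoly.aeval, zero_mul, aeval_comp] at this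
    simpa using this
  have hli : IsIntegral L l := Algebra.IsIntegral.isIntegral l
  have h1 : minpoly L l = minpoly L (-l) :=
    minpoly.eq_of_irreducible_of_monic (minpoly.irreducible hli) h0 (minpoly.monic hli)
  obtain ⟨σ, hσ⟩ := (Normal.minpoly_eq_iff_mem_orbit N).1 h1
  have h3 : σ (-l) = l := hσ
  have h4 := Algebra.trace_eq_of_algEquiv σ (-l)
  rw [h3, map_neg] at h4
  have : (2 : L) * Algebra.trace L N l = 0 := by linear_combination h4
  exact (mul_eq_zero.1 this).resolve_left h2

end SkewEigenvalues

/-- The diagonal bilinear form. -/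
def diagForm {L ι : Type*} [Field L] [Fintype ι] (q : ι → L) : LinearMap.BilinForm L (ι → L) :=
  LinearMap.mk₂ L (fun u v => ∑ i, q i * u i * v i)
    (fun u v w => by simp [← Finset.sum_add_distrib, mul_add, add_mul])
    (fun c u v => by simp [Finset.mul_sum]; congr; ext; ring)
    (fun u v w => by simp [← Finset.sum_add_distrib, mul_add])
    (fun c u v => by simp [Finset.mul_sum]; congr; ext; ring)

lemma diagForm_apply {L ι : Type*} [Field L] [Fintype ι] (q : ι → L) (u v : ι → L) :
    diagForm q u v = ∑ i, q i * u i * v i := rfl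

lemma diagForm_comm {L ι : Type*} [Field L] [Fintype ι] (q : ι → L) (u v : ι → L) :
    diagForm q u v = diagForm q v u := by
  simp only [diagForm_apply, mul_right_comm]

lemma diagForm_skew {L ι : Type*} [Field L] [Fintype ι] [DecidableEq ι] (q : ι → L)
    (D : Matrix ι ι L) (hD : ∀ i j, q i * D i j = -(q j * D j i)) (u v : ι → L) :
    diagForm q (D.toLin' u) v = -diagForm q u (D.toLin' v) := by
  simp only [diagForm_apply, Matrix.toLin'_apply, Matrix.mulVec, dotProduct, Finset.mul_sum,
    Finset.sum_mul, ← Finset.sum_neg_distrib]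
  rw [Finset.sum_comm]
  refine Finset.sum_congr rfl fun i _ => Finset.sum_congr rfl fun j _ => ?_
  linear_combination u i * v j * hD j i

open Polynomial in
lemma Matrix.span_eigenvectors_trace_zero {L N ι : Type*} [Field L] [Field N] [Algebra L N]
    [FiniteDimensional L N] [IsGalois L N] (h2 : (2 : L) ≠ 0) [Fintype ι] [DecidableEq ι]
    (q : ι → L) (hq : ∀ c : ι → L, ∑ i, q i * c i ^ 2 = 0 → c = 0)
    (D : Matrix ι ι L) (hD : ∀ i j, q i * D i j = -(q j * D j i))
    (hs : ((minpoly L D).map (algebraMap L N)).Splits) :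
    Submodule.span N {u : ι → N | ∃ μ ∈ (Algebra.trace L N).toAddMonoidHom.ker,
      (D.map (algebraMap L N)).toLin' u = μ • u} = ⊤ := by
  classical
  have ha : ∀ u, diagForm q u u = 0 → u = 0 := by
    intro u hu
    apply hq
    rw [← hu, diagForm_apply]
    exact Finset.sum_congr rfl fun i _ => by ring
  have hT := diagForm_skew q D hD
  rw [← Matrix.minpoly_toLin'] at hs
  have hsep := Polynomial.Squarefree.separable_of_splits
    (LinearMap.BilinForm.isSemisimple_of_skew (diagForm_comm q) ha hT).minpoly_squarefree hs
  set f := minpoly L D.toLin' with hf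
  have hfm : (f.map (algebraMap L N)).Monic :=
    (minpoly.monic (Algebra.IsIntegral.isIntegral _)).map _
  have hprod := hs.eq_prod_roots_of_monic hfm
  have hnd : (f.map (algebraMap L N)).roots.Nodup := nodup_roots hsep.map
  rw [eq_top_iff]
  intro u _
  have h0 : aeval (D.map (algebraMap L N)).toLin' (f.map (algebraMap L N)) = 0 := by
    have h1 : aeval D f = 0 := by
      rw [hf, Matrix.minpoly_toLin']; exact minpoly.aeval L D
    have h2 : aeval (D.map (algebraMap L N)) (f.map (algebraMap L N)) = 0 := by
      have := congrArg (fun E : Matrix ι ι L => (Algebra.ofId L N).mapMatrix E) h1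
      simp only [map_zero, ← aeval_algHom_apply] at this
      rw [aeval_map_algebraMap]
      exact this
    have h3 := congrArg Matrix.toLinAlgEquiv' h2
    rw [map_zero, ← AlgEquiv.coe_toAlgHom, ← aeval_algHom_apply] at h3
    exact h3
  have h1 := Module.End.ker_aeval_prod_le_span (D.map (algebraMap L N)).toLin'
    (f.map (algebraMap L N)).roots.toFinset
  have h3 : ∏ a ∈ (f.map (algebraMap L N)).roots.toFinset, (X - C a) = f.map (algebraMap L N) := by
    conv_rhs => rw [hprod]
    rw [Finset.prod_multiset_map_count]
    refine Finset.prod_congr rfl fun a ha => ?_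
    rw [Multiset.count_eq_one_of_mem hnd (Multiset.mem_toFinset.1 ha), pow_one]
  rw [h3, h0, LinearMap.ker_zero] at h1
  refine Submodule.span_mono ?_ (h1 (Submodule.mem_top : u ∈ ⊤))
  rintro v ⟨l, hl, hv⟩
  refine ⟨l, ?_, hv⟩
  rw [Multiset.mem_toFinset] at hl
  have hroot : aeval l f = 0 := by
    have := (mem_roots'.1 hl).2
    rwa [IsRoot.def, ← eval₂_eq_eval_map, ← aeval_def] at this
  have hli : IsIntegral L l := Algebra.IsIntegral.isIntegral l
  exact trace_eq_zero_of_dvd_comp_neg h2 l (LinearMap.BilinForm.dvd_comp_neg_of_skew ha hT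
    (minpoly.irreducible hli) (minpoly.dvd L l hroot))

/-- A normal extension in characteristic not two contains an intermediate field of odd degree over
which it is Galois of 2-power degree. -/
lemma exists_odd_intermediateField (k N : Type u) [Field k] [Field N] [Algebra k N]
    [FiniteDimensional k N] [Normal k N] (h2 : (2 : k) ≠ 0) :
    ∃ L : IntermediateField k N, Odd (Module.finrank k L) ∧ IsGalois L N ∧
      ∃ n, Module.finrank L N = 2 ^ n := by
  classical
  let P : Sylow 2 Gal(N/k) := default
  have : Fact (Nat.Prime 2) := ⟨Nat.prime_two⟩
  refine ⟨IntermediateField.fixedField (P : Subgroup Gal(N/k)), ?_, ?_, ?_⟩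
  · have h1 := Module.finrank_mul_finrank k
      (IntermediateField.fixedField (P : Subgroup Gal(N/k))) N
    rw [IntermediateField.finrank_fixedField_eq_card,
      ← Field.finSepDegree_mul_finInsepDegree k N] at h1
    have h3 : Field.finSepDegree k N = Nat.card Gal(N/k) := by
      exact Nat.card_congr (Normal.algHomEquivAut k (AlgebraicClosure N) N)
    rw [h3, ← Subgroup.card_mul_index (P : Subgroup Gal(N/k)), mul_comm, mul_assoc] at h1
    have h4 := Nat.eq_of_mul_eq_mul_left Nat.card_pos h1
    rw [h4, Nat.odd_mul]
    refine ⟨?_, ?_⟩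
    · have := P.not_dvd_index
      rwa [← even_iff_two_dvd, Nat.not_even_iff_odd] at this
    · obtain ⟨p, hp⟩ := ExpChar.exists k
      obtain ⟨n, hn⟩ := finInsepDegree_eq_pow k N p
      rw [hn]
      apply Odd.pow
      cases hp with
      | zero => simp
      | prime hp =>
        refine hp.odd_of_ne_two ?_
        rintro rfl
        exact h2 (CharP.cast_eq_zero k 2)
  · exact IsGalois.of_fixed_field N P
  · rw [IntermediateField.finrank_fixedField_eq_card]
    exact (IsPGroup.iff_card.1 P.isPGroup')

set_option maxHeartbeats 1000000 in
/-- A Clifford module over an anisotropic quadratic space has no nonzero vector fixed by an element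
of the spin Lie algebra. -/
theorem eq_zero_of_mem_span_commutators {k S M : Type u} [Field k] (h2 : (2 : k) ≠ 0)
    [AddCommGroup S] [Module k S] [FiniteDimensional k S] [AddCommGroup M] [Module k M]
    (B : LinearMap.BilinForm k S) (hB : ∀ u v, B u v = B v u) (ha : ∀ u, B u u = 0 → u = 0)
    (κ : S →ₗ[k] Module.End k M) (hκ : ∀ u v, κ u * κ v + κ v * κ u = B u v • 1) (x : M)
    (hx : x ∈ Submodule.span k {z | ∃ s t, z = κ s (κ t x) - κ t (κ s x)}) : x = 0 := by
  classical
  have : Invertible (2 : k) := invertibleOfNonzero h2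
  obtain ⟨v, hv⟩ := LinearMap.BilinForm.exists_orthogonal_basis (B := B) ⟨fun u v => hB u v⟩
  set q : Fin (Module.finrank k S) → k := fun i => B (v i) (v i) with hq
  have hq0 : ∀ i, q i ≠ 0 := fun i h => v.ne_zero i (ha _ h)
  have hBv : ∀ i j, B (v i) (v j) = if i = j then q i else 0 := by
    intro i j
    split_ifs with h
    · rw [h]
    · exact hv h
  have hrepr : ∀ u i, B u (v i) = q i * v.repr u i := by
    intro u i
    conv_lhs => rw [← v.sum_repr u]
    simp [hBv, mul_comm, -Module.Basis.sum_repr]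
  have hdual : ∀ u, u = ∑ i, B u (v i) • (q i)⁻¹ • v i := by
    intro u
    conv_lhs => rw [← v.sum_repr u]
    refine Finset.sum_congr rfl fun i _ => ?_
    rw [hrepr, smul_smul, mul_right_comm, mul_inv_cancel₀ (hq0 i), one_mul]
  obtain ⟨D, hD, hDx⟩ : ∃ D : S →ₗ[k] S, (∀ u w, B (D u) w = -B u (D w)) ∧
      x = ∑ i, κ (D (v i)) (κ ((q i)⁻¹ • v i) x) := by
    have : ∀ y ∈ Submodule.span k {z | ∃ s t, z = κ s (κ t x) - κ t (κ s x)},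
        ∃ D : S →ₗ[k] S, (∀ u w, B (D u) w = -B u (D w)) ∧
      y = ∑ i, κ (D (v i)) (κ ((q i)⁻¹ • v i) x) := by
      intro y hy
      induction hy using Submodule.span_induction with
      | mem y hy =>
        obtain ⟨s, t, rfl⟩ := hy
        refine ⟨(B.flip t).smulRight s - (B.flip s).smulRight t, ?_, ?_⟩
        · intro u w
          simp [hB s w, hB t w]
          ring
        · have e : ∀ i, κ (((B.flip t).smulRight s - (B.flip s).smulRight t) (v i))
              (κ ((q i)⁻¹ • v i) x) = κ s (κ (B t (v i) • (q i)⁻¹ • v i) x) -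
                κ t (κ (B s (v i) • (q i)⁻¹ • v i) x) := by
            intro i
            simp [hB s, hB t, smul_sub, smul_comm (q i)⁻¹]
          rw [Finset.sum_congr rfl fun i _ => e i, Finset.sum_sub_distrib, ← map_sum, ← map_sum,
            ← LinearMap.sum_apply, ← LinearMap.sum_apply, ← map_sum, ← map_sum, ← hdual, ← hdual]
      | zero => exact ⟨0, by simp, by simp⟩
      | add y z _ _ hy hz =>
        obtain ⟨D, hD, rfl⟩ := hy
        obtain ⟨D', hD', rfl⟩ := hz
        refine ⟨D + D', fun u w => by simp [hD, hD']; ring, ?_⟩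
        simp [Finset.sum_add_distrib]
      | smul c y _ hy =>
        obtain ⟨D, hD, rfl⟩ := hy
        exact ⟨c • D, fun u w => by simp [hD], by
          simp [Finset.smul_sum, smul_comm c]⟩
    exact this x hx
  set Dm := LinearMap.toMatrix v v D with hDm
  have hDv : ∀ j, D (v j) = ∑ i, Dm i j • v i := by
    intro j
    rw [← v.sum_repr (D (v j))]
    simp [hDm, LinearMap.toMatrix_apply]
  have hDq : ∀ i j, q i * Dm i j = -(q j * Dm j i) := by
    intro i j
    have h1 := hrepr (D (v j)) i
    have h2 := hrepr (D (v i)) j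
    rw [hDm, LinearMap.toMatrix_apply, LinearMap.toMatrix_apply, ← h1, ← h2, hD, hB]
  by_contra hx0
  let N := (minpoly k Dm).SplittingField
  have hNn : Normal k N := Normal.of_isSplittingField (minpoly k Dm)
  obtain ⟨L, hodd, hgal, m, hm⟩ := exists_odd_intermediateField k N h2
  have hmap : ∀ a : k, algebraMap L N (algebraMap k L a) = algebraMap k N a := fun a =>
    (IsScalarTower.algebraMap_apply k L N a).symm
  have h2L : (2 : L) ≠ 0 := by
    have := (map_ne_zero (algebraMap k L)).2 h2
    rwa [map_ofNat] at this
  have h2N : (2 : N) ≠ 0 := by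
    have := (map_ne_zero (algebraMap k N)).2 h2
    rwa [map_ofNat] at this
  have hspan := Matrix.span_eigenvectors_trace_zero (N := N) h2L (fun i => algebraMap k L (q i))
    (Springer.odd_degree _ k L q (fun c hc => by
      have h := ha (∑ i, c i • v i) (by
        rw [← hc]
        simp [hBv]
        exact Finset.sum_congr rfl fun i _ => by ring)
      funext i
      exact Fintype.linearIndependent_iff.1 v.linearIndependent c h i) rfl hodd)
    (Dm.map (algebraMap k L)) (fun i j => by
      simp only [Matrix.map_apply, ← map_mul, ← map_neg, hDq i j]) (by
      have h1 := Polynomial.SplittingField.splits (minpoly k Dm)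
      refine h1.of_dvd (Polynomial.map_ne_zero (minpoly.ne_zero (Algebra.IsIntegral.isIntegral _))) ?_
      have h3 : (minpoly k Dm).map (algebraMap k N) =
          ((minpoly k Dm).map (algebraMap k L)).map (algebraMap L N) := by
        rw [Polynomial.map_map, ← IsScalarTower.algebraMap_eq]
      rw [h3]
      refine Polynomial.map_dvd _ (minpoly.dvd _ _ ?_)
      rw [Polynomial.aeval_map_algebraMap]
      have h4 := congrArg (fun E : Matrix _ _ k => (Algebra.ofId k L).mapMatrix E)
        (minpoly.aeval k Dm)
      simp only [map_zero, ← Polynomial.aeval_algHom_apply] at h4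
      exact h4)
  have hmm : (Dm.map (algebraMap k L)).map (algebraMap L N) = Dm.map (algebraMap k N) := by
    ext i j
    simp [hmap]
  rw [hmm] at hspan
  let qN : Fin (Module.finrank k S) → N := fun i => algebraMap k N (q i)
  have hqN : ∀ i, qN i ≠ 0 := fun i => by
    simpa [qN] using hq0 i
  let e : Fin (Module.finrank k S) → (Fin (Module.finrank k S) → N) := fun i => Pi.single i 1
  have hd : DualFamilies (diagForm qN) e (fun i => (qN i)⁻¹ • e i) := by
    constructor
    · intro s
      funext j
      simp [e, diagForm_apply, Finset.sum_apply, Pi.single_apply, mul_comm]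
      rw [mul_assoc, mul_inv_cancel₀ (hqN j), mul_one]
    · intro s
      funext j
      simp [e, diagForm_apply, Finset.sum_apply, Pi.single_apply, mul_comm]
      rw [mul_assoc, mul_inv_cancel₀ (hqN j), mul_one]
  let κN : (Fin (Module.finrank k S) → N) →ₗ[N] Module.End N (N ⊗[k] M) :=
    ∑ i, (LinearMap.proj i : _ →ₗ[N] N).smulRight ((κ (v i)).baseChange N)
  have hκN : ∀ u, κN u = ∑ i, u i • (κ (v i)).baseChange N := by
    intro u
    simp [κN, LinearMap.sum_apply]
  have hκe : ∀ (c : N) i, κN (c • e i) = c • (κ (v i)).baseChange N := by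
    intro c i
    rw [hκN, Finset.sum_eq_single i]
    · simp [e]
    · intro j _ hj
      simp [e, hj]
    · simp
  have hmem := hd.eigenvalue_mem h2N κN (fun u w => by
      rw [hκN, hκN, Finset.sum_mul_sum, Finset.sum_mul_sum]
      nth_rewrite 2 [Finset.sum_comm]
      rw [← Finset.sum_add_distrib]
      have e1 : ∀ i, (∑ j, u i • (κ (v i)).baseChange N * w j • (κ (v j)).baseChange N +
        ∑ j, w j • (κ (v j)).baseChange N * u i • (κ (v i)).baseChange N) =
          (qN i * u i * w i) • (1 : Module.End N (N ⊗[k] M)) := by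
        intro i
        rw [← Finset.sum_add_distrib]
        have e2 : ∀ j, u i • (κ (v i)).baseChange N * w j • (κ (v j)).baseChange N +
          w j • (κ (v j)).baseChange N * u i • (κ (v i)).baseChange N =
            if i = j then (qN i * u i * w i) • (1 : Module.End N (N ⊗[k] M)) else 0 := by
          intro j
          rw [smul_mul_smul_comm, smul_mul_smul_comm, mul_comm (w j), ← smul_add,
            ← LinearMap.baseChange_mul, ← LinearMap.baseChange_mul, ← LinearMap.baseChange_add,
            hκ, hBv]
          split_ifs with hij
          · subst hij
            rw [LinearMap.baseChange_smul, LinearMap.baseChange_one]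
            rw [← algebraMap_smul N (q i), smul_smul, mul_comm _ (algebraMap k N (q i)), mul_assoc]
          · simp
        rw [Finset.sum_congr rfl fun j _ => e2 j]
        simp
      rw [Finset.sum_congr rfl fun i _ => e1 i, ← Finset.sum_smul, diagForm_apply])
    (diagForm_comm qN) (Algebra.trace L N).toAddMonoidHom.ker _ (Dm.map (algebraMap k N)).toLin'
    (diagForm_skew _ _ (fun i j => by
      simp only [Matrix.map_apply, qN, ← map_mul, ← map_neg, hDq i j])) (Nat.le_add_left _ _) hspan
    (1 ⊗ₜ x) (by
      intro h
      exact hx0 (Module.FaithfullyFlat.tensorProduct_mk_injective (A := k) (B := N) M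
        (by simpa using h))) 1 (by
      have h5 : ∀ j, κN ((Dm.map (algebraMap k N)).toLin' (e j)) = (κ (D (v j))).baseChange N := by
        intro j
        have h7 : (Dm.map (algebraMap k N)).toLin' (e j) = ∑ i, algebraMap k N (Dm i j) • e i := by
          funext l
          simp [e, Matrix.toLin'_apply, Finset.sum_apply, Pi.single_apply]
          exact Algebra.algebraMap_eq_smul_one _
        rw [h7, hDv, map_sum, map_sum, Finset.sum_congr rfl fun i _ => hκe _ i]
        simp only [map_smul, algebraMap_smul]
        ext z
        simp [TensorProduct.tmul_sum]
      have h6 : ∀ j, κN ((qN j)⁻¹ • e j) = (κ ((q j)⁻¹ • v j)).baseChange N := by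
        intro j
        rw [hκe, map_smul, LinearMap.baseChange_smul, ← algebraMap_smul N (q j)⁻¹, map_inv₀]
      simp only [h5, h6, LinearMap.sum_apply, Module.End.mul_apply, LinearMap.baseChange_tmul,
        one_smul]
      rw [← TensorProduct.tmul_sum, ← hDx])
  have htr : Algebra.trace L N 1 = 0 := hmem
  rw [← map_one (algebraMap L N), Algebra.trace_algebraMap, hm] at htr
  rw [nsmul_eq_mul, mul_one, Nat.cast_pow] at htr
  exact pow_ne_zero m h2L htr

namespace SpinModel

variable {F S M : Type*} [Field F] [AddCommGroup S] [Module F S]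
    [AddCommGroup M] [Module F M] (D : SpinModel F S M)

lemma eq_of_B {s t : S} (h : ∀ u, D.B s u = D.B t u) : s = t := by
  rw [← D.dual.sum_left s, ← D.dual.sum_left t]
  simp [h]

lemma fierz' (h2 : (2 : F) ≠ 0) (x y z : M) : D.V x y z =
    (1 / 2 : F) • ∑ i, ∑ j, D.pair (D.E (D.b i) (D.b j) x) y • D.E (D.b' j) (D.b' i) z
      - (3 / 2 * D.pair x y) • z := by
  have := D.fierz x y z
  have h : D.V x y z = (1 / 2 : F) • ((2 : F) • D.V x y z) := by
    rw [smul_smul]; simp [h2]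
  rw [h, this, smul_sub, smul_smul]
  simp only [E]
  congr 2
  ring

lemma E_V (h2 : (2 : F) ≠ 0) (u v : S) (x y z : M) :
    D.E u v (D.V x y z) - D.V x y (D.E u v z) =
      D.V (D.E u v x) y z - D.V x (D.m' v (D.m u y)) z := by
  have key : ∀ p q : S, D.E u v (D.E p q z) - D.E p q (D.E u v z) =
      D.E (D.rot u v p) q z + D.E p (D.rot u v q) z := fun p q => D.E_comm _ _ _ _ _
  have key' : ∀ p q : S, D.E p q (D.E u v x) = D.E u v (D.E p q x) -
      (D.E (D.rot u v p) q x + D.E p (D.rot u v q) x) := fun p q => by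
    rw [← D.E_comm]; abel
  have Elin_eq : ∀ p : M, D.E u v p = D.Elin u v p := fun _ => rfl
  have l1 : D.E u v (D.V x y z) - D.V x y (D.E u v z) = (1 / 2 : F) • ∑ i, ∑ j,
      D.pair (D.E (D.b i) (D.b j) x) y • (D.E (D.rot u v (D.b' j)) (D.b' i) z +
        D.E (D.b' j) (D.rot u v (D.b' i)) z) := by
    rw [D.fierz' h2, D.fierz' h2, Elin_eq (_ - _)]
    simp only [map_sub, map_smul, map_sum, ← key, smul_sub, Finset.sum_sub_distrib, Elin_apply]
    abel
  have l2 : D.V (D.E u v x) y z - D.V x (D.m' v (D.m u y)) z = (1 / 2 : F) • ∑ i, ∑ j,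
      (- D.pair (D.E (D.rot u v (D.b i)) (D.b j) x + D.E (D.b i) (D.rot u v (D.b j)) x) y) •
        D.E (D.b' j) (D.b' i) z := by
    rw [D.fierz' h2, D.fierz' h2]
    simp only [key', ← D.pair_E u v, map_sub, LinearMap.sub_apply, sub_smul, neg_smul,
      Finset.sum_sub_distrib, smul_sub, Finset.sum_neg_distrib, smul_neg]
    abel
  rw [l1, l2]
  congr 1
  have hs := D.rot_skew u v
  -- the two Casimir sums
  have c1 : ∀ j, ∑ i, D.pair (D.E (D.rot u v (D.b i)) (D.b j) x) y • D.E (D.b' j) (D.b' i) z =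
      - ∑ i, D.pair (D.E (D.b i) (D.b j) x) y • D.E (D.b' j) (D.rot u v (D.b' i)) z := by
    intro j
    exact D.dual.sum_skew D.symm (LinearMap.mk₂ F (fun p q => D.pair (D.E p (D.b j) x) y •
      D.E (D.b' j) q z) (by intros; simp [E, add_smul]) (by intros; simp [E, smul_smul])
      (by intros; simp [E]) (by intros; simp [E, smul_smul, mul_comm])) (D.rot u v) hs
  have c2 : ∀ i, ∑ j, D.pair (D.E (D.b i) (D.rot u v (D.b j)) x) y • D.E (D.b' j) (D.b' i) z =
      - ∑ j, D.pair (D.E (D.b i) (D.b j) x) y • D.E (D.rot u v (D.b' j)) (D.b' i) z := by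
    intro i
    exact D.dual.sum_skew D.symm (LinearMap.mk₂ F (fun p q => D.pair (D.E (D.b i) p x) y •
      D.E q (D.b' i) z) (by intros; simp [E, add_smul]) (by intros; simp [E, smul_smul])
      (by intros; simp [E]) (by intros; simp [E, smul_smul, mul_comm])) (D.rot u v) hs
  simp only [map_add, LinearMap.add_apply, neg_smul, add_smul, smul_add, Finset.sum_add_distrib,
    Finset.sum_neg_distrib, c2]
  rw [Finset.sum_comm (f := fun i j => D.pair (D.E (D.rot u v (D.b i)) (D.b j) x) y •
    D.E (D.b' j) (D.b' i) z)]
  simp only [c1, Finset.sum_neg_distrib]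
  rw [Finset.sum_comm (f := fun i j => D.pair (D.E (D.b i) (D.b j) x) y •
    D.E (D.b' j) ((D.rot u v) (D.b' i)) z)]
  abel

lemma E_m (u v s : S) (z : M) : D.E u v (D.m s z) + D.m s (D.m' v (D.m u z)) =
    - D.m (D.B v s • u - D.B u s • v + D.B u v • s) z := by
  have h1 : D.E u v (D.m s z) = - D.B v s • D.m u z - D.m u (D.m' s (D.m v z)) := by
    simp only [E]; rw [D.m'_mul v s]; simp
  have h2 : D.m u (D.m' s (D.m v z)) = - D.B u s • D.m v z - D.m s (D.m' u (D.m v z)) :=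
    D.m_mul _ _ _
  have h3 : D.m s (D.m' u (D.m v z)) = - D.B u v • D.m s z - D.m s (D.m' v (D.m u z)) := by
    rw [D.m'_mul u v]; simp
  rw [h1, h2, h3]
  simp only [map_add, map_sub, map_smul, LinearMap.add_apply, LinearMap.sub_apply,
    LinearMap.smul_apply]
  module

/-- The triple product as a trilinear map. -/
lemma exists_trilinear (h2 : (2 : F) ≠ 0) :
    ∃ f : M →ₗ[F] M →ₗ[F] M →ₗ[F] M, ∀ x y z, f x y z = D.V x y z := by
  refine ⟨(1 / 2 : F) • ∑ i, ∑ j, LinearMap.mk₂ F (fun x y =>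
      D.pair (D.E (D.b i) (D.b j) x) y • D.Elin (D.b' j) (D.b' i))
      (by intros; simp [E, add_smul]) (by intros; simp [E, smul_smul])
      (by intros; simp [add_smul]) (by intros; simp [smul_smul])
      - LinearMap.mk₂ F (fun x y => (3 / 2 * D.pair x y) • LinearMap.id)
      (by intros; simp [mul_add, add_smul]) (by intros; simp [smul_smul, mul_left_comm])
      (by intros; simp [mul_add, add_smul]) (by intros; simp [smul_smul, mul_left_comm]),
      fun x y z => ?_⟩
  rw [D.fierz' h2]
  simp [LinearMap.sum_apply]
  rfl

lemma V_transp_eq (h2 : (2 : F) ≠ 0) (x y w : M) : D.V y x w =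
    (1 / 2 : F) • ∑ i, ∑ j, D.pair (D.E (D.b i) (D.b j) x) y • D.m' (D.b' i) (D.m (D.b' j) w)
      - (3 / 2 * D.pair x y) • w := by
  apply D.eq_of_pair
  intro z
  rw [D.pair_symm, ← D.V_transp, D.fierz' h2]
  simp only [map_sub, map_smul, map_sum, LinearMap.sub_apply, LinearMap.smul_apply,
    LinearMap.sum_apply, D.pair_E, D.pair_symm z]

/-- The structurable identity. -/
lemma V_V (h2 : (2 : F) ≠ 0) (x y z w v : M) :
    D.V x y (D.V z w v) - D.V z w (D.V x y v) =
      D.V (D.V x y z) w v - D.V z (D.V y x w) v := by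
  obtain ⟨f, hf⟩ := D.exists_trilinear h2
  rw [D.V_transp_eq h2 x y w, D.fierz' h2 x y z, D.fierz' h2 x y (D.V z w v),
    D.fierz' h2 x y v]
  have key : ∀ p q, D.V (D.E p q z) w v =
      D.E p q (D.V z w v) - D.V z w (D.E p q v) + D.V z (D.m' q (D.m p w)) v := by
    intro p q; rw [D.E_V h2]; abel
  simp only [← hf] at key ⊢
  simp only [map_sub, map_smul, map_sum, LinearMap.sub_apply, LinearMap.smul_apply,
    LinearMap.sum_apply, key, smul_sub, smul_add, Finset.sum_sub_distrib, Finset.sum_add_distrib]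
  abel

lemma sum_pair_E (h2 : (2 : F) ≠ 0) (x y : M) :
    ∑ i, D.pair (D.E (D.b i) (D.b' i) x) y = - 7 * D.pair x y := by
  have h : ∑ i, D.pair (D.E (D.b i) (D.b' i) x) y = ∑ i, D.pair (D.E (D.b' i) (D.b i) x) y :=
    D.dual.sum_eq D.symm D.dual.symm (LinearMap.mk₂ F (fun u v => D.pair (D.E u v x) y)
    (by intros; simp [E]) (by intros; simp [E]) (by intros; simp [E]) (by intros; simp [E]))
  have h' : ∑ i, D.pair (D.E (D.b i) (D.b' i) x) y + ∑ i, D.pair (D.E (D.b' i) (D.b i) x) y =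
      - 14 * D.pair x y := by
    rw [← Finset.sum_add_distrib]
    simp_rw [← LinearMap.add_apply, ← map_add, E_add_swap, D.dual_one]
    simp
  rw [← h] at h'
  apply mul_left_cancel₀ h2
  linear_combination h'

lemma V_m (h2 : (2 : F) ≠ 0) (x y : M) (s : S) (z : M) :
    (2 : F) • (D.V x y (D.m s z) + D.m s (D.V y x z)) =
      D.m (∑ j, (D.pair (D.E (D.b j) s x) y - D.pair (D.E s (D.b j) x) y) • D.b' j
        + D.pair x y • s) z := by
  have e1 : ∀ j, ∑ i, (D.pair (D.E (D.b i) (D.b j) x) y * D.B (D.b' i) s) • D.m (D.b' j) z =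
      D.pair (D.E s (D.b j) x) y • D.m (D.b' j) z := by
    intro j
    conv_rhs => rw [← D.dual.sum_left s]
    rw [← Finset.sum_smul]
    simp [E, D.symm s, mul_comm]
  have e2 : ∀ i, ∑ j, (D.pair (D.E (D.b i) (D.b j) x) y * D.B (D.b' j) s) • D.m (D.b' i) z =
      D.pair (D.E (D.b i) s x) y • D.m (D.b' i) z := by
    intro j
    conv_rhs => rw [← D.dual.sum_left s]
    rw [← Finset.sum_smul]
    simp [E, D.symm s, mul_comm]
  have e3 : ∑ i, ∑ j, D.pair (D.E (D.b i) (D.b j) x) y * D.B (D.b' j) (D.b' i) =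
      - 7 * D.pair x y := by
    rw [← D.sum_pair_E h2]
    refine Finset.sum_congr rfl fun i _ => ?_
    conv_rhs => rw [← D.dual.sum_left (D.b' i)]
    simp [E, D.symm (D.b' i), mul_comm]
  have e0 : ∀ i j, D.E (D.b' j) (D.b' i) (D.m s z) = - D.m s (D.m' (D.b' i) (D.m (D.b' j) z))
      - (D.B (D.b' i) s • D.m (D.b' j) z - D.B (D.b' j) s • D.m (D.b' i) z
        + D.B (D.b' j) (D.b' i) • D.m s z) := by
    intro i j
    have := D.E_m (D.b' j) (D.b' i) s z
    rw [eq_sub_iff_add_eq.2 this]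
    simp
    abel
  have e4 : (2 : F) • (D.V x y (D.m s z) + D.m s (D.V y x z)) =
      - (∑ j, ∑ i, (D.pair (D.E (D.b i) (D.b j) x) y * D.B (D.b' i) s) • D.m (D.b' j) z)
      + (∑ i, ∑ j, (D.pair (D.E (D.b i) (D.b j) x) y * D.B (D.b' j) s) • D.m (D.b' i) z)
      - (∑ i, ∑ j, D.pair (D.E (D.b i) (D.b j) x) y * D.B (D.b' j) (D.b' i)) • D.m s z
      - (6 * D.pair x y) • D.m s z := by
    rw [D.V_transp_eq h2 x y z, D.fierz' h2 x y, Finset.sum_comm (f := fun j i =>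
      (D.pair (D.E (D.b i) (D.b j) x) y * D.B (D.b' i) s) • D.m (D.b' j) z)]
    simp only [e0, map_sub, map_smul, map_sum, smul_sub, smul_add, smul_smul,
      Finset.sum_sub_distrib, Finset.sum_add_distrib, Finset.sum_smul, smul_neg,
      Finset.sum_neg_distrib]
    have e : (2 : F) * (1 / 2) = 1 := by field_simp
    have e' : (2 : F) * (3 / 2 * D.pair x y) = 3 * D.pair x y := by field_simp
    rw [e, e']
    module
  rw [e4, e3]
  simp only [e1, e2, map_add, map_sum, map_smul, LinearMap.add_apply, LinearMap.sum_apply,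
    LinearMap.smul_apply, sub_smul, Finset.sum_sub_distrib, map_sub, LinearMap.sub_apply]
  module

lemma V_symm_of_inv {x y : M} (h : ∀ z, D.V x y z = z) (z : M) : D.V y x z = z := by
  apply D.eq_of_pair
  intro w
  rw [D.pair_symm, ← D.V_transp, h, D.pair_symm]

lemma pair_of_inv (h2 : (2 : F) ≠ 0) {x y : M} (h : ∀ z, D.V x y z = z) (s t : S) :
    D.pair (D.E s t x) y = - 2 * D.B s t ∧ (4 - D.pair x y) * D.B s t = 0 := by
  have h4 : ∀ s t : S, 4 * D.B s t =
      D.pair (D.E t s x) y - D.pair (D.E s t x) y + D.pair x y * D.B s t := by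
    intro s t
    have : (4 : F) • s = ∑ j, (D.pair (D.E (D.b j) s x) y - D.pair (D.E s (D.b j) x) y) • D.b' j
        + D.pair x y • s := by
      apply D.m_inj
      ext z
      rw [← D.V_m h2, h, D.V_symm_of_inv h]
      simp only [map_smul, LinearMap.smul_apply]
      module
    have h' := congrArg (fun r => D.B r t) this
    have e : D.B (∑ j, (D.pair (D.E (D.b j) s x) y - D.pair (D.E s (D.b j) x) y) • D.b' j) t =
        D.pair (D.E t s x) y - D.pair (D.E s t x) y := by
      conv_rhs => rw [← D.dual.sum_left t]
      simp [E, D.symm t, Finset.sum_sub_distrib, mul_sub, mul_comm]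
    simp only [map_add, map_smul, LinearMap.add_apply, LinearMap.smul_apply, smul_eq_mul, e] at h'
    exact h'
  have h5 : D.pair (D.E s t x) y + D.pair (D.E t s x) y = - D.B s t * D.pair x y := by
    rw [← LinearMap.add_apply, ← map_add, E_add_swap]; simp
  have h6 := h4 s t
  have h7 := h4 t s
  rw [D.symm t s] at h7
  have h8 : (4 - D.pair x y) * D.B s t = 0 := by
    apply mul_left_cancel₀ h2
    linear_combination h6 + h7
  refine ⟨?_, h8⟩
  apply mul_left_cancel₀ h2
  linear_combination h5 + h6

/-- Isotropic vectors give elements which are not conjugate-invertible. -/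
lemma not_inv_of_isotropic (h2 : (2 : F) ≠ 0) {s : S} (hs : s ≠ 0) (hs0 : D.B s s = 0) (e : M) :
    ¬ ∃ y, ∀ z, D.V (D.m s e) y z = z := by
  rintro ⟨y, hy⟩
  obtain ⟨t, ht⟩ : ∃ t, D.B s t ≠ 0 := by
    by_contra! h
    exact hs (D.eq_of_B fun u => by simp [h u])
  have h1 : D.E s t (D.m s e) = - D.B s t • D.m s e := by
    have h0 : ∀ z, D.m s (D.m' s z) = 0 := by
      intro z
      have := D.rel s s z
      rw [hs0, neg_zero, zero_smul, ← two_smul F] at this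
      exact (smul_eq_zero.1 this).resolve_left h2
    rw [E, D.m'_mul, map_sub, h0, D.symm t s]
    simp
  obtain ⟨h3, h4⟩ := D.pair_of_inv h2 hy s t
  have h5 : D.pair (D.m s e) y = 4 := by
    have := (mul_eq_zero.1 h4).resolve_right ht
    linear_combination - this
  rw [h1] at h3
  simp only [map_smul, LinearMap.smul_apply, smul_eq_mul, h5] at h3
  apply ht
  apply mul_left_cancel₀ h2
  linear_combination - h3

/-- An element which is not fixed by any bivector is conjugate-invertible. -/
lemma exists_inv (h2 : (2 : F) ≠ 0) {x : M}
    (hx : x ∉ Submodule.span F {z | ∃ u v, z = D.E u v x - D.E v u x})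
    [FiniteDimensional F M] : ∃ y, ∀ z, D.V x y z = z := by
  obtain ⟨f, hf1, hf2⟩ := Submodule.exists_dual_map_eq_bot_of_notMem hx inferInstance
  obtain ⟨y, hy⟩ : ∃ y, ∀ z, D.pair z y = 4 * (f x)⁻¹ * f z := by
    have hn : D.pair.Nondegenerate := by
      refine ⟨fun a h => D.pair_nondeg a h, fun a h => D.pair_nondeg a fun z => ?_⟩
      rw [D.pair_symm, h]
    refine ⟨(LinearMap.BilinForm.toDual D.pair hn).symm ((4 * (f x)⁻¹) • f), fun z => ?_⟩
    rw [D.pair_symm, ← LinearMap.BilinForm.toDual_def hn]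
    simp
  have hxy : D.pair x y = 4 := by rw [hy]; field_simp
  have hE : ∀ u v, D.pair (D.E u v x) y = - 2 * D.B u v := by
    intro u v
    have h1 : f (D.E u v x - D.E v u x) = 0 := by
      rw [← Submodule.mem_bot F, ← hf2]
      exact Submodule.mem_map_of_mem (Submodule.subset_span ⟨u, v, rfl⟩)
    have h3 : D.pair (D.E u v x - D.E v u x) y = 0 := by rw [hy, h1, mul_zero]
    have h4 : D.pair (D.E u v x + D.E v u x) y = - 4 * D.B u v := by
      rw [E_add_swap]; simp [hxy, mul_comm]
    simp only [map_sub, map_add, LinearMap.sub_apply, LinearMap.add_apply] at h3 h4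
    apply mul_left_cancel₀ h2
    linear_combination h3 + h4
  refine ⟨y, fun z => ?_⟩
  rw [D.fierz' h2]
  simp only [hE, hxy]
  have e : ∀ i, ∑ j, (- 2 * D.B (D.b i) (D.b j)) • D.E (D.b' j) (D.b' i) z =
      (- 2 : F) • D.E (D.b i) (D.b' i) z := by
    intro i
    conv_rhs => rw [← D.dual.sum_right (D.b i)]
    simp [E, mul_smul, Finset.smul_sum]
  have e' : ∑ i, D.E (D.b i) (D.b' i) z = (- 7 : F) • z := by
    apply D.eq_of_pair
    intro w
    simp only [map_sum, LinearMap.sum_apply, D.sum_pair_E h2]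
    simp
  simp only [e, ← Finset.smul_sum, e', smul_smul, ← sub_smul]
  have : (1 / 2 * (- 2 * - 7) - 3 / 2 * 4 : F) = 1 := by field_simp; norm_num
  rw [this, one_smul]

/-- The `U`-operator of a conjugate-invertible element is injective. -/
lemma U_injective (h2 : (2 : F) ≠ 0) (h3 : (3 : F) ≠ 0) {x y w : M} (h : ∀ z, D.V x y z = z)
    (hw : D.V x w x = 0) : w = 0 := by
  have h' := D.V_symm_of_inv h
  obtain ⟨f, hf⟩ := D.exists_trilinear h2
  have a1 : ∀ v, D.V x (D.V w x y) v = 0 := by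
    intro v
    have := D.V_V h2 x w x y v
    rw [h, h, hw] at this
    simp only [← hf, map_zero, LinearMap.zero_apply] at this ⊢
    simpa using this.symm
  have a2 : ∀ v, D.V (D.V w x y) x v = 0 := by
    intro v
    apply D.pair_nondeg
    intro u
    rw [D.V_transp, a1, map_zero]
  set s := D.psi w y with hs
  have a3 : D.V w x y = w + D.m s x := by rw [D.V_swap, h', hs]
  have a4 : D.psi (w + D.m s x) y = (3 : F) • s := by
    apply D.eq_of_B
    intro c
    rw [D.psi_spec]
    have := (D.pair_of_inv h2 h' s c).1
    have e : D.pair (D.m' c (D.m s x)) y = - 2 * D.B s c := by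
      rw [← this, D.pair_symm (D.E s c y), E, D.pair_m', D.pair_m, neg_neg]
    have e' : D.B s c = - D.pair (D.m' c w) y := by rw [hs, D.psi_spec]
    simp only [map_add, map_smul, LinearMap.add_apply, LinearMap.smul_apply, smul_eq_mul, e]
    linear_combination - e'
  have a5 := a2 y
  rw [D.V_swap, h', a3, a4] at a5
  have a6 : w = - (4 : F) • D.m s x := by
    rw [← sub_eq_zero, ← a5]; simp; module
  have a7 : D.psi (w + (4 : F) • D.m s x) y = (9 : F) • s := by
    apply D.eq_of_B
    intro c
    have e := congrArg (fun r => D.B r c) a4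
    have e' : D.B s c = - D.pair (D.m' c w) y := by rw [hs, D.psi_spec]
    simp only [D.psi_spec, map_add, map_smul, LinearMap.add_apply, LinearMap.smul_apply,
      smul_eq_mul] at e ⊢
    linear_combination 4 * e + 3 * e'
  have a8 : D.psi 0 y = 0 := by
    apply D.eq_of_B
    intro c
    rw [D.psi_spec]; simp
  have a9 : w + (4 : F) • D.m s x = 0 := by rw [a6]; module
  rw [a9, a8] at a7
  have h9 : (9 : F) ≠ 0 := by
    have : (9 : F) = 3 * 3 := by norm_num
    rw [this]; exact mul_ne_zero h3 h3
  have hs0 : s = 0 := (smul_eq_zero.1 a7.symm).resolve_left h9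
  rw [a6, hs0]; simp

end SpinModel

namespace CompositionAlgebra

variable {F : Type u} [Field F] (C : CompositionAlgebra F)

lemma norm_ne_zero_iff {x : C.carrier} (h2 : (2 : F) ≠ 0) : C.norm x ≠ 0 ↔ C.bil x x ≠ 0 := by
  rw [bil_self]; simp [h2]

lemma bil_one_one : C.bil 1 1 = 2 := by rw [bil_self, norm_one, mul_one]

lemma finrank_pure (h2 : (2 : F) ≠ 0) :
    Module.finrank F C.pure + 1 = Module.finrank F C.carrier := by
  have h1 : C.bil.flip 1 ≠ 0 := by
    intro h
    have := LinearMap.congr_fun h 1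
    simp [bil_one_one, h2] at this
  have := Module.Dual.finrank_ker_add_one_of_ne_zero h1
  exact this

lemma decomp (h2 : (2 : F) ≠ 0) (x : C.carrier) :
    x - (C.bil x 1 / 2) • (1 : C.carrier) ∈ C.pure := by
  rw [mem_pure]
  simp [bil_one_one, h2]

/-- An orthogonal basis of the trace zero elements of an octonion algebra. -/
structure PureBasis where
  e : Fin 7 → C.carrier
  bil_one : ∀ i, C.bil (e i) 1 = 0
  ortho : ∀ i j, i ≠ j → C.bil (e i) (e j) = 0
  norm_ne : ∀ i, C.norm (e i) ≠ 0
  span : ∀ x ∈ C.pure, x ∈ Submodule.span F (Set.range e)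

lemma exists_pureBasis (h2 : (2 : F) ≠ 0) (h8 : Module.finrank F C.carrier = 8) :
    Nonempty C.PureBasis := by
  have := C.finrank_pure h2
  have h7 : Module.finrank F C.pure = 7 := by omega
  let B := C.bil.restrict C.pure
  have hs : LinearMap.IsSymm B := ⟨fun x y => by simp [B, C.bil_comm x.1]⟩
  have : Invertible (2 : F) := invertibleOfNonzero h2
  obtain ⟨v, hv⟩ := LinearMap.BilinForm.exists_orthogonal_basis (B := B) hs
  have hn : B.Nondegenerate := by
    have key : ∀ x : C.pure, (∀ y : C.pure, B x y = 0) → x = 0 := by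
      intro x hx
      apply Subtype.ext
      apply C.eq_of_bil
      intro z
      have h := hx ⟨_, C.decomp h2 z⟩
      have hx1 := C.mem_pure.1 x.2
      simp only [B, LinearMap.BilinForm.restrict_apply, LinearMap.domRestrict_apply, map_sub,
        map_smul, hx1] at h
      simpa using h
    refine ⟨key, fun x hx => key x fun y => ?_⟩
    rw [← hx y]; exact C.bil_comm _ _
  have hne := LinearMap.BilinForm.iIsOrtho.not_isOrtho_basis_self_of_nondegenerate hv hn
  let f : Fin 7 ≃ Fin (Module.finrank F C.pure) := finCongr h7.symm
  refine ⟨⟨fun i => v (f i), fun i => C.mem_pure.1 (v (f i)).2, fun i j hij => ?_, fun i => ?_, ?_⟩⟩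
  · exact hv (fun h => hij (f.injective h))
  · rw [C.norm_ne_zero_iff h2]; exact hne (f i)
  · intro x hx
    have h := v.mem_span ⟨x, hx⟩
    have h' := Submodule.mem_map_of_mem (f := C.pure.subtype) h
    rw [Submodule.map_span, ← Set.range_comp] at h'
    refine (Submodule.span_mono ?_) h'
    rintro _ ⟨i, rfl⟩
    exact ⟨f.symm i, by simp⟩

namespace PureBasis

variable {C} (e : C.PureBasis)

/-- The orthogonal basis of an octonion algebra extending a basis of the trace zero elements. -/
def full : Fin 8 → C.carrier := Fin.cons 1 e.e

lemma full_ortho (i j : Fin 8) (h : i ≠ j) : C.bil (e.full i) (e.full j) = 0 := by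
  cases i using Fin.cases with
  | zero => cases j using Fin.cases with
    | zero => exact absurd rfl h
    | succ j => simp [full, C.bil_comm 1, e.bil_one]
  | succ i => cases j using Fin.cases with
    | zero => simp [full, e.bil_one]
    | succ j => simp [full, e.ortho i j (fun h' => h (by rw [h']))]

lemma full_norm (i : Fin 8) : C.norm (e.full i) ≠ 0 := by
  cases i using Fin.cases with
  | zero => simp [full, C.norm_one]
  | succ i => simp [full, e.norm_ne]

lemma full_span (h2 : (2 : F) ≠ 0) : Submodule.span F (Set.range e.full) = ⊤ := by
  rw [eq_top_iff]
  intro x _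
  have h := e.span _ (C.decomp h2 x)
  have h1 : (1 : C.carrier) ∈ Submodule.span F (Set.range e.full) :=
    Submodule.subset_span ⟨0, rfl⟩
  have h' : Submodule.span F (Set.range e.e) ≤ Submodule.span F (Set.range e.full) := by
    apply Submodule.span_mono
    rintro _ ⟨i, rfl⟩
    exact ⟨i.succ, rfl⟩
  have := add_mem (h' h) (Submodule.smul_mem _ (C.bil x 1 / 2) h1)
  simpa using this

lemma full_dual (h2 : (2 : F) ≠ 0) : DualFamilies C.bil e.full
    (fun i => (C.bil (e.full i) (e.full i))⁻¹ • e.full i) :=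
  DualFamilies.of_orthogonal _ (e.full_span h2) e.full_ortho
    (fun i => (C.norm_ne_zero_iff h2).1 (e.full_norm i))

lemma expand (h2 : (2 : F) ≠ 0) (x : C.carrier) :
    x = (C.bil x 1 / 2) • (1 : C.carrier) +
      ∑ i, (C.bil x (e.e i) / (2 * C.norm (e.e i))) • e.e i := by
  conv_lhs => rw [← (e.full_dual h2).sum_left x, Fin.sum_univ_succ]
  simp [full, C.bil_self, C.norm_one, div_eq_inv_mul]

lemma trace_eq (h2 : (2 : F) ≠ 0) (f : C.carrier →ₗ[F] C.carrier) :
    LinearMap.trace F C.carrier f = C.bil (f 1) 1 / 2 +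
      ∑ i, C.bil (f (e.e i)) (e.e i) / (2 * C.norm (e.e i)) := by
  have hf : f = (C.bil.flip 1).smulRight ((1 / 2 : F) • f 1) +
      ∑ i, (C.bil.flip (e.e i)).smulRight ((2 * C.norm (e.e i))⁻¹ • f (e.e i)) := by
    ext x
    conv_lhs => rw [e.expand h2 x]
    simp [LinearMap.sum_apply, smul_smul, div_eq_mul_inv]
  conv_lhs => rw [hf]
  simp [LinearMap.trace_smulRight, div_eq_inv_mul]

end PureBasis

end CompositionAlgebra

namespace CompositionAlgebra

variable {F : Type u} [Field F] (C : CompositionAlgebra F)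

/-- Right multiplication by `x`, as an endomorphism depending linearly on `x`. -/
noncomputable def R : C.carrier →ₗ[F] Module.End F C.carrier := (LinearMap.mul F C.carrier).flip

lemma R_apply (x y : C.carrier) : C.R x y = y * x := rfl

lemma R_conj (x y : C.carrier) : C.R (C.conj x) * C.R y =
    C.bil x y • (1 : Module.End F C.carrier) - C.R (C.conj y) * C.R x := by
  ext v
  simp [R_apply, ← C.mul_conj_add x v y]

lemma R_conj' (x y : C.carrier) : C.R x * C.R (C.conj y) =
    C.bil x y • (1 : Module.End F C.carrier) - C.R y * C.R (C.conj x) := by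
  have := C.R_conj (C.conj x) (C.conj y)
  rwa [C.conj_conj, C.conj_conj, bil_conj_conj] at this

/-- Invariance of the trace under passing to the adjoint. -/
lemma trace_adj (h2 : (2 : F) ≠ 0) (h8 : Module.finrank F C.carrier = 8)
    (f g : Module.End F C.carrier) (h : ∀ x y, C.bil (f x) y = C.bil x (g y)) :
    LinearMap.trace F _ f = LinearMap.trace F _ g := by
  obtain ⟨e⟩ := C.exists_pureBasis h2 h8
  rw [e.trace_eq h2, e.trace_eq h2]
  simp only [h, C.bil_comm 1, C.bil_comm (e.e _) (g _)]

lemma trace_R_R (h2 : (2 : F) ≠ 0) (h8 : Module.finrank F C.carrier = 8) (x y : C.carrier) :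
    LinearMap.trace F _ (C.R (C.conj x) * C.R y) = 4 * C.bil x y := by
  have h1 := C.trace_adj h2 h8 (C.R (C.conj x) * C.R y) (C.R (C.conj y) * C.R x) (by
    intro v w
    simp [R_apply, bil_conj_right, C.conj_conj])
  have h3 := congrArg (LinearMap.trace F _) (C.R_conj x y)
  rw [map_sub, map_smul, ← h1, LinearMap.trace_one, h8, smul_eq_mul] at h3
  apply mul_left_cancel₀ h2
  push_cast at h3
  linear_combination h3

/-- The two half-spin traces of four vectors agree. -/
lemma trace_swap (h2 : (2 : F) ≠ 0) (h8 : Module.finrank F C.carrier = 8) (x y z w : C.carrier) :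
    LinearMap.trace F _ (C.R (C.conj w) * C.R z * C.R (C.conj y) * C.R x) =
    LinearMap.trace F _ (C.R w * C.R (C.conj z) * C.R y * C.R (C.conj x)) := by
  obtain ⟨e⟩ := C.exists_pureBasis h2 h8
  have ind : ∀ f g : C.carrier →ₗ[F] F, (∀ i, f (e.full i) = g (e.full i)) → ∀ x, f x = g x := by
    intro f g h x
    have := e.full_dual h2
    rw [← this.sum_left x]
    simp [h]
  have base : ∀ i j k l, LinearMap.trace F _ (C.R (C.conj (e.full l)) * C.R (e.full k) *
      C.R (C.conj (e.full j)) * C.R (e.full i)) = LinearMap.trace F _ (C.R (e.full l) *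
      C.R (C.conj (e.full k)) * C.R (e.full j) * C.R (C.conj (e.full i))) := by
    intro i j k l
    obtain ⟨m, hm⟩ : ∃ m : Fin 8, m ∉ ({i, j, k, l} : Finset (Fin 8)) := by
      by_contra! h
      have h1 : Finset.univ ⊆ ({i, j, k, l} : Finset (Fin 8)) := fun a _ => h a
      have h3 := Finset.card_le_card h1
      have h4 : ({i, j, k, l} : Finset (Fin 8)).card ≤ 4 := Finset.card_le_four
      simp at h3
      omega
    simp only [Finset.mem_insert, Finset.mem_singleton, not_or] at hm
    obtain ⟨mi, mj, mk, ml⟩ := hm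
    set u := e.full m
    have s1 : ∀ p, m ≠ p → C.R (C.conj u) * C.R (e.full p) = - (C.R (C.conj (e.full p)) * C.R u) := by
      intro p hp
      rw [C.R_conj, e.full_ortho m p hp]; simp
    have s2 : ∀ p, m ≠ p → C.R u * C.R (C.conj (e.full p)) = - (C.R (e.full p) * C.R (C.conj u)) := by
      intro p hp
      rw [C.R_conj', e.full_ortho m p hp]; simp
    have hu : C.R (C.conj u) * C.R u = C.norm u • 1 := by
      ext v; simp [R_apply, C.mul_mul_conj]
    have hu' : C.R u * C.R (C.conj u) = C.norm u • 1 := by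
      ext v; simp [R_apply, C.mul_conj_mul']
    apply mul_left_cancel₀ (e.full_norm m)
    have l1 : C.R u * (C.R (C.conj (e.full l)) * C.R (e.full k) *
      C.R (C.conj (e.full j)) * C.R (e.full i)) = C.R (e.full l) *
      C.R (C.conj (e.full k)) * C.R (e.full j) * C.R (C.conj (e.full i)) * C.R u := by
      simp only [← mul_assoc]
      rw [s2 l ml, neg_mul, mul_assoc (C.R (e.full l)), s1 k mk]
      simp only [mul_neg, neg_neg, ← mul_assoc]
      rw [mul_assoc _ (C.R u), s2 j mj]
      simp only [neg_mul, mul_neg, ← mul_assoc]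
      rw [mul_assoc _ (C.R (C.conj u)), s1 i mi]
      simp only [mul_neg, neg_neg, ← mul_assoc]
    calc _ = LinearMap.trace F _ (C.R (C.conj u) * (C.R u * (C.R (C.conj (e.full l)) *
            C.R (e.full k) * C.R (C.conj (e.full j)) * C.R (e.full i)))) := by
          rw [← mul_assoc, hu, smul_mul_assoc, one_mul, map_smul, smul_eq_mul]
      _ = _ := by
          rw [l1, LinearMap.trace_mul_comm, mul_assoc _ (C.R u), hu', mul_smul_comm, mul_one,
            map_smul, smul_eq_mul]
  let T : Module.End F C.carrier →ₗ[F] F := LinearMap.trace F _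
  let mL (a : Module.End F C.carrier) := LinearMap.mulLeft F a
  let mR (a : Module.End F C.carrier) := LinearMap.mulRight F a
  have h1 : ∀ i j k w, T (C.R (C.conj w) * C.R (e.full k) *
      C.R (C.conj (e.full j)) * C.R (e.full i)) = T (C.R w *
      C.R (C.conj (e.full k)) * C.R (e.full j) * C.R (C.conj (e.full i))) := by
    intro i j k w
    exact ind (T ∘ₗ mR (C.R (e.full i)) ∘ₗ mR (C.R (C.conj (e.full j))) ∘ₗ mR (C.R (e.full k)) ∘ₗ
      C.R ∘ₗ C.conj) (T ∘ₗ mR (C.R (C.conj (e.full i))) ∘ₗ mR (C.R (e.full j)) ∘ₗ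
      mR (C.R (C.conj (e.full k))) ∘ₗ C.R) (fun l => base i j k l) w
  have h3 : ∀ i j z w, T (C.R (C.conj w) * C.R z *
      C.R (C.conj (e.full j)) * C.R (e.full i)) = T (C.R w *
      C.R (C.conj z) * C.R (e.full j) * C.R (C.conj (e.full i))) := by
    intro i j z w
    exact ind (T ∘ₗ mR (C.R (e.full i)) ∘ₗ mR (C.R (C.conj (e.full j))) ∘ₗ mL (C.R (C.conj w)) ∘ₗ
      C.R) (T ∘ₗ mR (C.R (C.conj (e.full i))) ∘ₗ mR (C.R (e.full j)) ∘ₗ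
      mL (C.R w) ∘ₗ C.R ∘ₗ C.conj) (fun k => h1 i j k w) z
  have h4 : ∀ i y z w, T (C.R (C.conj w) * C.R z *
      C.R (C.conj y) * C.R (e.full i)) = T (C.R w *
      C.R (C.conj z) * C.R y * C.R (C.conj (e.full i))) := by
    intro i y z w
    exact ind (T ∘ₗ mR (C.R (e.full i)) ∘ₗ mL (C.R (C.conj w) * C.R z) ∘ₗ C.R ∘ₗ C.conj)
      (T ∘ₗ mR (C.R (C.conj (e.full i))) ∘ₗ mL (C.R w * C.R (C.conj z)) ∘ₗ C.R)
      (fun k => h3 i k z w) y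
  exact ind (T ∘ₗ mL (C.R (C.conj w) * C.R z * C.R (C.conj y)) ∘ₗ C.R)
      (T ∘ₗ mL (C.R w * C.R (C.conj z) * C.R y) ∘ₗ C.R ∘ₗ C.conj)
      (fun k => h4 k y z w) x

lemma trace_four (h2 : (2 : F) ≠ 0) (h8 : Module.finrank F C.carrier = 8) (x y z w : C.carrier) :
    LinearMap.trace F _ (C.R (C.conj w) * C.R z * C.R (C.conj y) * C.R x) =
    2 * C.bil x y * C.bil z w - 2 * C.bil x z * C.bil y w + 2 * C.bil x w * C.bil y z := by
  have h1 : C.R (C.conj w) * C.R z * C.R (C.conj y) * C.R x =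
      C.bil x y • (C.R (C.conj w) * C.R z) - C.bil x z • (C.R (C.conj w) * C.R y)
      + C.bil x w • (C.R (C.conj z) * C.R y) - C.R (C.conj x) * C.R w * C.R (C.conj z) * C.R y := by
    rw [mul_assoc _ (C.R (C.conj y)), C.R_conj y x, mul_sub, ← mul_assoc,
      mul_assoc _ (C.R z) (C.R (C.conj x)), C.R_conj' z x, mul_sub, sub_mul, ← mul_assoc,
      C.R_conj w x]
    simp only [mul_smul_comm, smul_mul_assoc, mul_one, one_mul, sub_mul, C.bil_comm x]
    simp only [mul_assoc]
    abel
  have h3 := congrArg (LinearMap.trace F _) h1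
  have h4 : LinearMap.trace F _ (C.R (C.conj x) * C.R w * C.R (C.conj z) * C.R y) =
      LinearMap.trace F _ (C.R (C.conj w) * C.R z * C.R (C.conj y) * C.R x) := by
    rw [C.trace_swap h2 h8, mul_assoc, mul_assoc, LinearMap.trace_mul_comm]
    simp only [mul_assoc]
  simp only [map_sub, map_add, map_smul, smul_eq_mul, C.trace_R_R h2 h8, h4] at h3
  apply mul_left_cancel₀ h2
  rw [C.bil_comm z w, C.bil_comm y w, C.bil_comm y z]
  linear_combination h3

namespace PureBasis

variable {C} (e : C.PureBasis)

lemma sum_G (h2 : (2 : F) ≠ 0) (x y z : C.carrier) :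
    ∑ i, (C.bil (e.e i * x) y / C.norm (e.e i)) • (e.e i * z) =
      (2 : F) • ((y * C.conj x) * z) - C.bil x y • z := by
  have h := e.expand h2 (y * C.conj x)
  have c : ∀ v, C.bil (y * C.conj x) v = C.bil (v * x) y := fun v => by
    rw [C.bil_conj_right v, C.bil_comm]
  simp only [c, one_mul] at h
  rw [h, add_mul, Finset.sum_mul, smul_mul_assoc, one_mul]
  simp only [smul_add, Finset.smul_sum, smul_mul_assoc, smul_smul]
  have e1 : ∀ r : F, 2 * (r / 2) = r := fun r => by field_simp
  have e2 : ∀ r n : F, 2 * (r / (2 * n)) = r / n := fun r n => by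
    rw [← mul_div_assoc, mul_div_mul_left _ _ h2]
  simp only [e1, e2]
  abel

lemma sum_Y (h2 : (2 : F) ≠ 0) (h8 : Module.finrank F C.carrier = 8) (x y z : C.carrier) :
    ∑ j, (C.norm (e.e j))⁻¹ • (e.e j * (((e.e j * x) * C.conj y) * z)) =
      (x * C.conj y) * z - (4 : F) • (C.bil x y • z + C.bil y z • x - C.bil x z • y) := by
  apply C.eq_of_bil
  intro w
  have h := C.trace_four h2 h8 x y z w
  rw [e.trace_eq h2] at h
  simp only [Module.End.mul_apply, R_apply, one_mul] at h
  have hp : ∀ j, C.conj (e.e j) = - e.e j := fun j => C.conj_pure (C.mem_pure.2 (e.bil_one j))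
  have c : ∀ j v, C.bil (e.e j * v) w = - C.bil (v * C.conj w) (e.e j) := by
    intro j v
    rw [C.bil_conj_left, hp, neg_mul, map_neg, C.bil_comm, C.bil_conj_right, C.bil_comm]
  simp only [map_sum, map_smul, map_sub, map_add, LinearMap.sum_apply, LinearMap.sub_apply,
    LinearMap.add_apply, LinearMap.smul_apply, c, smul_eq_mul]
  have c1 : C.bil (x * C.conj y * z * C.conj w) 1 = C.bil (x * C.conj y * z) w := by
    rw [C.bil_conj_right, C.conj_conj, one_mul]
  rw [c1] at h
  have e2 : ∀ r n : F, r / (2 * n) = 2⁻¹ * (n⁻¹ * r) := fun r n => by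
    rw [div_eq_mul_inv, mul_inv]; ring
  simp only [e2, ← Finset.mul_sum] at h
  simp only [mul_neg, Finset.sum_neg_distrib]
  set N := ∑ i, (C.norm (e.e i))⁻¹ * C.bil (e.e i * x * C.conj y * z * C.conj w) (e.e i)
  have h' := congrArg (fun r => 2 * r) h
  simp only [mul_add, mul_div_cancel₀ _ h2, mul_inv_cancel_left₀ h2] at h'
  linear_combination - h'

lemma sum_W (h2 : (2 : F) ≠ 0) (h8 : Module.finrank F C.carrier = 8) (x y z : C.carrier) :
    ∑ i, ∑ j, (C.bil (e.e i * (e.e j * x)) y / (4 * C.norm (e.e i) * C.norm (e.e j))) •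
      (e.e j * (e.e i * z)) =
      (2 : F) • (C.bil y z • x - C.bil x z • y) + (y * C.conj x) * z + (5 / 4 * C.bil x y) • z := by
  rw [Finset.sum_comm]
  have a1 : ∀ j, ∑ i, (C.bil (e.e i * (e.e j * x)) y / (4 * C.norm (e.e i) * C.norm (e.e j))) •
      (e.e j * (e.e i * z)) = (1 / 4 : F) • ((C.bil (e.e j * x) y / C.norm (e.e j)) • (e.e j * z))
        - (1 / 2 : F) • ((C.norm (e.e j))⁻¹ • (e.e j * (((e.e j * x) * C.conj y) * z))) := by
    intro j
    have h := e.sum_G h2 (e.e j * x) y z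
    have h' := congrArg (fun r => (1 / (4 * C.norm (e.e j))) • (e.e j * r)) h
    simp only [Finset.mul_sum, Finset.smul_sum, mul_smul_comm, smul_smul] at h'
    have c : ∀ i, 1 / (4 * C.norm (e.e j)) * (C.bil (e.e i * (e.e j * x)) y / C.norm (e.e i)) =
        C.bil (e.e i * (e.e j * x)) y / (4 * C.norm (e.e i) * C.norm (e.e j)) := by
      intro i
      have := e.norm_ne i
      have := e.norm_ne j
      rw [div_mul_div_comm, one_mul]; congr 1; ring
    simp only [c] at h'
    rw [h']
    have h5 : y * C.conj (e.e j * x) = C.bil (e.e j * x) y • 1 - (e.e j * x) * C.conj y := by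
      rw [← C.mul_conj_add _ 1 y, one_mul, one_mul]; abel
    have h4 : (4 : F) = 2 * 2 := by norm_num
    have hn := e.norm_ne j
    rw [h5, sub_mul, smul_mul_assoc, one_mul, mul_sub, mul_smul_comm, mul_sub, mul_smul_comm]
    have h4 : (4 : F) ≠ 0 := by rw [h4]; exact mul_ne_zero h2 h2
    match_scalars <;> field_simp <;> ring
  simp only [a1, Finset.sum_sub_distrib, ← Finset.smul_sum, e.sum_G h2, e.sum_Y h2 h8]
  have h5 : x * C.conj y = C.bil x y • 1 - y * C.conj x := by
    rw [← C.mul_conj_add _ 1 y, one_mul, one_mul]; abel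
  rw [h5, sub_mul, smul_mul_assoc, one_mul]
  have h4 : (4 : F) ≠ 0 := by
    have : (4 : F) = 2 * 2 := by norm_num
    rw [this]; exact mul_ne_zero h2 h2
  match_scalars <;> field_simp <;> ring

end PureBasis

end CompositionAlgebra

namespace AlgebraWithInvolution

variable {R : Type u} [CommRing R] (A : AlgebraWithInvolution R)

/-- The triple product `V_{x,y} z` as a trilinear map. -/
def VLin : A →ₗ[R] A →ₗ[R] A →ₗ[R] A :=
  LinearMap.mk₂ R (fun x y => LinearMap.mulLeft R (x * A.invol y) +
    LinearMap.mulRight R x ∘ₗ LinearMap.mulRight R (A.invol y) -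
    LinearMap.mulRight R y ∘ₗ LinearMap.mulRight R (A.invol x))
    (by intros; ext; simp [add_mul, mul_add]; abel)
    (by intros; ext; simp [smul_mul_assoc, mul_smul_comm, smul_sub, smul_add])
    (by intros; ext; simp [add_mul, mul_add]; abel)
    (by intros; ext; simp [smul_mul_assoc, mul_smul_comm, smul_sub, smul_add])

lemma VLin_apply (x y z : A) : A.VLin x y z = A.Vop x y z := rfl

end AlgebraWithInvolution

namespace CompositionAlgebra

variable {F : Type u} [Field F] (C₁ C₂ : CompositionAlgebra F)

/-- The tensor product of two composition algebras as an algebra with involution. -/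
noncomputable abbrev T : AlgebraWithInvolution F := C₁.toAWI.tensor C₂.toAWI

variable {C₁ C₂}

/-- Pure tensors in the tensor product of two composition algebras. -/
noncomputable def tm : C₁.carrier →ₗ[F] C₂.carrier →ₗ[F] T C₁ C₂ :=
  TensorProduct.mk F C₁.carrier C₂.carrier

lemma tm_mul (a c : C₁.carrier) (b d : C₂.carrier) : tm a b * tm c d = tm (a * c) (b * d) :=
  Algebra.TensorProduct.tmul_mul_tmul a c b d

lemma invol_tm (a : C₁.carrier) (b : C₂.carrier) :
    (T C₁ C₂).invol (tm a b) = tm (C₁.conj a) (C₂.conj b) :=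
  TensorProduct.map_tmul _ _ _ _

lemma tm_one : (1 : T C₁ C₂) = tm 1 1 := rfl

lemma T_ind {P : T C₁ C₂ → Prop} (h0 : P 0) (ht : ∀ a b, P (tm a b))
    (ha : ∀ x y, P x → P y → P (x + y)) (x : T C₁ C₂) : P x :=
  TensorProduct.induction_on x h0 ht ha

/-- The tensor product of the polar forms. -/
noncomputable def pairing : LinearMap.BilinForm F (T C₁ C₂) :=
  LinearMap.BilinForm.tmul C₁.bil C₂.bil

lemma pairing_tm (a c : C₁.carrier) (b d : C₂.carrier) :
    pairing (tm a b) (tm c d) = C₁.bil a c * C₂.bil b d :=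
  (LinearMap.BilinForm.tensorDistrib_tmul (R := F) (A := F) C₁.bil C₂.bil a b c d).trans
    (by simp [mul_comm])

lemma pairing_comm (x y : T C₁ C₂) : pairing x y = pairing y x := by
  induction x using T_ind with
  | h0 => simp
  | ha x x' hx hx' => simp [hx, hx']
  | ht a b =>
    induction y using T_ind with
    | h0 => simp
    | ha x x' hx hx' => simp [hx, hx']
    | ht c d => rw [pairing_tm, pairing_tm, C₁.bil_comm, C₂.bil_comm]

lemma pairing_mul_left (x y z : T C₁ C₂) :
    pairing (x * y) z = pairing y ((T C₁ C₂).invol x * z) := by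
  induction x using T_ind with
  | h0 => simp
  | ha x x' hx hx' => simp [hx, hx', add_mul]
  | ht a b =>
    induction y using T_ind with
    | h0 => simp
    | ha x x' hx hx' => simp only [hx, hx', mul_add, map_add, LinearMap.add_apply]
    | ht c d =>
      induction z using T_ind with
      | h0 => simp
      | ha x x' hx hx' => simp only [hx, hx', mul_add, map_add]
      | ht e f => simp only [tm_mul, invol_tm, pairing_tm, C₁.bil_conj_left, C₂.bil_conj_left]

lemma pairing_mul_right (x y z : T C₁ C₂) :
    pairing (x * y) z = pairing x (z * (T C₁ C₂).invol y) := by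
  induction x using T_ind with
  | h0 => simp
  | ha x x' hx hx' => simp [hx, hx', add_mul]
  | ht a b =>
    induction y using T_ind with
    | h0 => simp
    | ha x x' hx hx' => simp only [hx, hx', mul_add, map_add, LinearMap.add_apply]
    | ht c d =>
      induction z using T_ind with
      | h0 => simp
      | ha x x' hx hx' => simp only [hx, hx', add_mul, map_add]
      | ht e f => simp only [tm_mul, invol_tm, pairing_tm, C₁.bil_conj_right, C₂.bil_conj_right]

lemma pairing_nondeg {ι κ : Type*} [Fintype ι] [Fintype κ] {b b' : ι → C₁.carrier}
    {c c' : κ → C₂.carrier} (hb : DualFamilies C₁.bil b b') (hc : DualFamilies C₂.bil c c')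
    (x : T C₁ C₂) (hx : ∀ y, pairing x y = 0) : x = 0 := by
  have key : ∀ x : T C₁ C₂, ∑ i, ∑ j, pairing x (tm (b' i) (c' j)) • tm (b i) (c j) = x := by
    intro x
    induction x using T_ind with
    | h0 => simp
    | ha x x' hx hx' =>
      conv_rhs => rw [← hx, ← hx']
      simp [add_smul, Finset.sum_add_distrib]
    | ht a d =>
      conv_rhs => rw [← hb.sum_left a, ← hc.sum_left d]
      simp only [pairing_tm, map_sum, LinearMap.sum_apply, map_smul, LinearMap.smul_apply,
        Finset.smul_sum, smul_smul]
      rw [Finset.sum_comm]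
      simp only [mul_comm]
  rw [← key x]
  simp [hx]

variable (C₁ C₂) in
/-- The embedding of the space of pairs of pure elements as skew elements. -/
noncomputable def sk : (C₁.pure × C₂.pure) →ₗ[F] T C₁ C₂ :=
  LinearMap.coprod (tm.flip 1 ∘ₗ C₁.pure.subtype) (tm 1 ∘ₗ C₂.pure.subtype)

lemma sk_apply (u : C₁.pure × C₂.pure) : sk C₁ C₂ u = tm (u.1 : C₁.carrier) 1 + tm 1 (u.2 : C₂.carrier) :=
  rfl

lemma sk_inj (h2 : (2 : F) ≠ 0) (u : C₁.pure × C₂.pure) (h : sk C₁ C₂ u = 0) : u = 0 := by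
  rw [sk_apply] at h
  have h1 : (u.1 : C₁.carrier) = 0 := by
    apply C₁.eq_of_bil
    intro z
    have := congrArg (fun x => pairing x (tm z 1)) h
    simp only [map_add, LinearMap.add_apply, pairing_tm, bil_one_one, C₂.mem_pure.1 u.2.2,
      map_zero, LinearMap.zero_apply, mul_zero, add_zero, mul_eq_zero, h2, or_false] at this
    simp [this]
  have h1' : (u.2 : C₂.carrier) = 0 := by
    apply C₂.eq_of_bil
    intro z
    have := congrArg (fun x => pairing x (tm 1 z)) h
    simp only [map_add, LinearMap.add_apply, pairing_tm, bil_one_one, C₁.mem_pure.1 u.1.2,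
      map_zero, LinearMap.zero_apply, zero_mul, zero_add, mul_eq_zero, h2, false_or] at this
    simp [this]
  ext
  · simpa using h1
  · simpa using h1'

variable (C₁ C₂) in
/-- Replacing the second component of a pair by its negative. -/
noncomputable def flip2 : (C₁.pure × C₂.pure) →ₗ[F] (C₁.pure × C₂.pure) :=
  LinearMap.prodMap LinearMap.id (-LinearMap.id)

lemma flip2_apply (u : C₁.pure × C₂.pure) : flip2 C₁ C₂ u = (u.1, -u.2) := rfl

variable (C₁ C₂) in
/-- Left multiplication by skew elements. -/
noncomputable def mL : (C₁.pure × C₂.pure) →ₗ[F] Module.End F (T C₁ C₂) :=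
  LinearMap.mul F (T C₁ C₂) ∘ₗ sk C₁ C₂

lemma mL_apply (u : C₁.pure × C₂.pure) (x : T C₁ C₂) : mL C₁ C₂ u x = sk C₁ C₂ u * x := rfl

lemma mL_tm (u : C₁.pure × C₂.pure) (x : C₁.carrier) (y : C₂.carrier) :
    mL C₁ C₂ u (tm x y) = tm ((u.1 : C₁.carrier) * x) y + tm x ((u.2 : C₂.carrier) * y) := by
  rw [mL_apply, sk_apply, add_mul, tm_mul, tm_mul, one_mul, one_mul]

lemma invol_sk (u : C₁.pure × C₂.pure) : (T C₁ C₂).invol (sk C₁ C₂ u) = - sk C₁ C₂ u := by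
  rw [sk_apply, map_add, invol_tm, invol_tm, C₁.conj_one, C₂.conj_one, C₁.conj_pure u.1.2,
    C₂.conj_pure u.2.2]
  simp [add_comm]

variable (C₁ C₂) in
/-- The bilinear form of the Albert form of a tensor product. -/
noncomputable def albertBil : LinearMap.BilinForm F (C₁.pure × C₂.pure) :=
  (C₁.bil.domRestrict₁₂ C₁.pure C₁.pure).compl₁₂ (LinearMap.fst F _ _) (LinearMap.fst F _ _) -
  (C₂.bil.domRestrict₁₂ C₂.pure C₂.pure).compl₁₂ (LinearMap.snd F _ _) (LinearMap.snd F _ _)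

lemma albertBil_apply (u v : C₁.pure × C₂.pure) : albertBil C₁ C₂ u v =
    C₁.bil (u.1 : C₁.carrier) v.1 - C₂.bil (u.2 : C₂.carrier) v.2 := rfl

lemma pure_mul_mul (C : CompositionAlgebra F) {u v : C.carrier} (hu : u ∈ C.pure) (hv : v ∈ C.pure)
    (x : C.carrier) : u * (v * x) = - C.bil u v • x - v * (u * x) := by
  have := C.conj_mul_add u x v
  rw [C.conj_pure hu, C.conj_pure hv] at this
  rw [neg_smul, ← this]
  simp

lemma mL_rel (u v : C₁.pure × C₂.pure) (x : T C₁ C₂) :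
    mL C₁ C₂ u (mL C₁ C₂ (flip2 C₁ C₂ v) x) + mL C₁ C₂ v (mL C₁ C₂ (flip2 C₁ C₂ u) x) =
      - albertBil C₁ C₂ u v • x := by
  induction x using T_ind with
  | h0 => simp
  | ha x y hx hy =>
    rw [smul_add, ← hx, ← hy]; simp only [map_add]; abel
  | ht a b =>
    simp only [mL_tm, map_add, flip2_apply, albertBil_apply]
    rw [pure_mul_mul C₁ u.1.2 v.1.2 a]
    simp only [Submodule.coe_neg, neg_mul, mul_neg, map_neg, map_sub, LinearMap.sub_apply, map_smul,
      LinearMap.smul_apply, pure_mul_mul C₂ u.2.2 v.2.2 b]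
    module

end CompositionAlgebra

namespace CompositionAlgebra

variable {F : Type u} [Field F] {C₁ C₂ : CompositionAlgebra F}

lemma pairing_mL (u : C₁.pure × C₂.pure) (x y : T C₁ C₂) :
    pairing (mL C₁ C₂ u x) y = - pairing x (mL C₁ C₂ u y) := by
  rw [mL_apply, pairing_mul_left, invol_sk, neg_mul, map_neg, mL_apply]

lemma Vop_pairing (x y z w : T C₁ C₂) :
    pairing ((T C₁ C₂).Vop x y z) w = pairing z ((T C₁ C₂).Vop y x w) := by
  simp only [AlgebraWithInvolution.Vop, map_add, map_sub, LinearMap.add_apply, LinearMap.sub_apply]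
  congr 1
  · congr 1
    · rw [pairing_mul_left, AlgebraWithInvolution.invol_mul, AlgebraWithInvolution.invol_invol]
    · rw [pairing_mul_right, pairing_mul_right, AlgebraWithInvolution.invol_invol]
  · rw [pairing_mul_right, pairing_mul_right, AlgebraWithInvolution.invol_invol]

lemma Vop_tm (x₁ y₁ z₁ : C₁.carrier) (x₂ y₂ z₂ : C₂.carrier) :
    (T C₁ C₂).Vop (tm x₁ x₂) (tm y₁ y₂) (tm z₁ z₂) =
      tm ((y₁ * C₁.conj x₁) * z₁) ((y₂ * C₂.conj x₂) * z₂) +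
      C₂.bil x₂ y₂ • tm (C₁.bil y₁ z₁ • x₁ - C₁.bil x₁ z₁ • y₁) z₂ +
      C₁.bil x₁ y₁ • tm z₁ (C₂.bil y₂ z₂ • x₂ - C₂.bil x₂ z₂ • y₂) := by
  have e1 : ∀ (C : CompositionAlgebra F) (x y z : C.carrier),
      (x * C.conj y) * z = C.bil x y • z - (y * C.conj x) * z := by
    intro C x y z
    have h := C.mul_conj_add x 1 y
    rw [one_mul, one_mul] at h
    rw [eq_sub_iff_add_eq, ← add_mul, h, smul_mul_assoc, one_mul]
  have e2 : ∀ (C : CompositionAlgebra F) (x y z : C.carrier),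
      (z * C.conj y) * x = (C.bil y z • x - C.bil x z • y) + (y * C.conj x) * z := by
    intro C x y z
    have h1 := C.conj_mul_add' x y z
    have h2 := e1 C z y x
    rw [h2, C.bil_comm z y, ← h1]
    abel
  have e3 : ∀ (C : CompositionAlgebra F) (x y z : C.carrier),
      (z * C.conj x) * y = C.bil x y • z - (C.bil y z • x - C.bil x z • y) - (y * C.conj x) * z := by
    intro C x y z
    have h1 := C.conj_mul_add' x z y
    rw [eq_sub_of_add_eq h1, e2]
    abel
  simp only [AlgebraWithInvolution.Vop, invol_tm, tm_mul, e3 _ x₁ y₁ z₁, e3 _ x₂ y₂ z₂, e2 _ x₁ y₁ z₁,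
    e2 _ x₂ y₂ z₂, e1 _ x₁ y₁ z₁, e1 _ x₂ y₂ z₂]
  generalize (y₁ * C₁.conj x₁) * z₁ = a₁
  generalize (y₂ * C₂.conj x₂) * z₂ = a₂
  generalize C₁.bil y₁ z₁ • x₁ - C₁.bil x₁ z₁ • y₁ = d₁
  generalize C₂.bil y₂ z₂ • x₂ - C₂.bil x₂ z₂ • y₂ = d₂
  simp only [map_add, map_sub, LinearMap.add_apply, LinearMap.sub_apply, map_smul,
    LinearMap.smul_apply]
  module

variable (e : C₁.PureBasis) (f : C₂.PureBasis)

/-- The concatenation of two families indexed by `Fin 7`. -/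
def join {X : Type*} (g h : Fin 7 → X) (i : Fin 14) : X :=
  Sum.elim g h ((finSumFinEquiv (m := 7) (n := 7)).symm i)

lemma sum_join₂ {X Y M : Type*} [AddCommMonoid M] (g h : Fin 7 → X) (g' h' : Fin 7 → Y)
    (φ : X → Y → M) :
    ∑ i, φ (join g h i) (join g' h' i) = ∑ i, φ (g i) (g' i) + ∑ i, φ (h i) (h' i) := by
  rw [← Equiv.sum_comp (finSumFinEquiv (m := 7) (n := 7)), Fintype.sum_sum_type]
  simp [join]

lemma forall_join {X Y : Type*} (g h : Fin 7 → X) (g' h' : Fin 7 → Y) (P : X → Y → Prop)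
    (h1 : ∀ i, P (g i) (g' i)) (h2 : ∀ i, P (h i) (h' i)) (i : Fin 14) :
    P (join g h i) (join g' h' i) := by
  unfold join
  rcases (finSumFinEquiv (m := 7) (n := 7)).symm i with j | j
  · exact h1 j
  · exact h2 j

/-- A basis vector of pure elements, as an element of the subspace of pure elements. -/
def PureBasis.p {C : CompositionAlgebra F} (e : C.PureBasis) (i : Fin 7) : C.pure :=
  ⟨e.e i, C.mem_pure.2 (e.bil_one i)⟩

/-- The orthogonal basis of the skew elements. -/
noncomputable def bvec : Fin 14 → C₁.pure × C₂.pure :=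
  join (fun i => (e.p i, 0)) (fun i => (0, f.p i))

/-- The dual basis of the skew elements. -/
noncomputable def bvec' : Fin 14 → C₁.pure × C₂.pure :=
  join (fun i => ((2 * C₁.norm (e.e i))⁻¹ • e.p i, 0))
    (fun i => (0, -(2 * C₂.norm (f.e i))⁻¹ • f.p i))

lemma PureBasis.pure_expand {C : CompositionAlgebra F} (e : C.PureBasis) (h2 : (2 : F) ≠ 0)
    (x : C.pure) : ∑ i, (C.bil (x : C.carrier) (e.e i) * (2 * C.norm (e.e i))⁻¹) • e.p i = x := by
  apply Subtype.ext
  conv_rhs => rw [e.expand h2 (x : C.carrier), C.mem_pure.1 x.2]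
  simp [p, div_eq_mul_inv]

lemma bvec_dual (h2 : (2 : F) ≠ 0) : DualFamilies (albertBil C₁ C₂) (bvec e f) (bvec' e f) := by
  constructor
  · intro s
    rw [bvec, bvec', sum_join₂ _ _ _ _ (fun x y => albertBil C₁ C₂ s y • x)]
    conv_rhs => rw [← Prod.mk.eta (p := s), ← e.pure_expand h2 s.1, ← f.pure_expand h2 s.2]
    refine Prod.ext ?_ ?_
    · simp [albertBil_apply, Prod.fst_sum, PureBasis.p, mul_comm]
    · simp [albertBil_apply, Prod.snd_sum, PureBasis.p, mul_comm]
  · intro s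
    rw [bvec, bvec', sum_join₂ _ _ _ _ (fun x y => albertBil C₁ C₂ s x • y)]
    conv_rhs => rw [← Prod.mk.eta (p := s), ← e.pure_expand h2 s.1, ← f.pure_expand h2 s.2]
    refine Prod.ext ?_ ?_
    · simp [albertBil_apply, Prod.fst_sum, PureBasis.p, smul_smul]
    · simp [albertBil_apply, Prod.snd_sum, PureBasis.p, smul_smul]

lemma bvec_dual_one (h2 : (2 : F) ≠ 0) (i : Fin 14) :
    albertBil C₁ C₂ (bvec e f i) (bvec' e f i) = 1 := by
  refine forall_join _ _ _ _ (fun x y => albertBil C₁ C₂ x y = 1) ?_ ?_ i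
  · intro j
    have := e.norm_ne j
    simp [albertBil_apply, PureBasis.p, bil_self]
    field_simp
  · intro j
    have := f.norm_ne j
    simp [albertBil_apply, PureBasis.p, bil_self]
    field_simp

/-- The skew element attached to two elements. -/
noncomputable def skPsi (x y : T C₁ C₂) : C₁.pure × C₂.pure :=
  ∑ i, (-pairing (mL C₁ C₂ (flip2 C₁ C₂ (bvec e f i)) x) y) • bvec' e f i

lemma skPsi_spec (h2 : (2 : F) ≠ 0) (x y : T C₁ C₂) (u : C₁.pure × C₂.pure) :
    albertBil C₁ C₂ (skPsi e f x y) u = - pairing (mL C₁ C₂ (flip2 C₁ C₂ u) x) y := by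
  have hc : ∀ s t, albertBil C₁ C₂ s t = albertBil C₁ C₂ t s := by
    intro s t
    rw [albertBil_apply, albertBil_apply, C₁.bil_comm, C₂.bil_comm]
  conv_rhs => rw [← (bvec_dual e f h2).sum_left u]
  simp only [skPsi, map_sum, LinearMap.sum_apply, map_smul, LinearMap.smul_apply, smul_eq_mul,
    hc u, ← Finset.sum_neg_distrib]
  exact Finset.sum_congr rfl fun i _ => by ring

lemma sk_skPsi (h2 : (2 : F) ≠ 0) (x y : T C₁ C₂) :
    sk C₁ C₂ (skPsi e f x y) = x * (T C₁ C₂).invol y - y * (T C₁ C₂).invol x := by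
  induction x using T_ind with
  | h0 => simp [skPsi]
  | ha x x' hx hx' =>
    rw [map_add, add_mul, mul_add, add_sub_add_comm, ← hx, ← hx', ← map_add]
    congr 1
    simp [skPsi, add_smul, Finset.sum_add_distrib]
    abel
  | ht a b =>
    induction y using T_ind with
    | h0 => simp [skPsi]
    | ha x x' hx hx' =>
      rw [map_add, add_mul, mul_add, add_sub_add_comm, ← hx, ← hx', ← map_add]
      congr 1
      simp [skPsi, add_smul, Finset.sum_add_distrib]
      abel
    | ht c d =>
      have key : ∀ (C : CompositionAlgebra F) (g : C.PureBasis) (x y : C.carrier),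
          x * C.conj y = (C.bil x y / 2) • (1 : C.carrier) -
            ∑ i, (C.bil (g.e i * x) y * (2 * C.norm (g.e i))⁻¹) • g.e i ∧
          y * C.conj x = (C.bil x y / 2) • (1 : C.carrier) +
            ∑ i, (C.bil (g.e i * x) y * (2 * C.norm (g.e i))⁻¹) • g.e i := by
        intro C g x y
        have h5 := g.expand h2 (y * C.conj x)
        have h1 : ∀ z, C.bil (y * C.conj x) z = C.bil (z * x) y := by
          intro z
          rw [C.bil_conj_right, C.conj_conj, C.bil_comm]
        simp only [h1, one_mul, div_eq_mul_inv (C.bil (_ * x) y) (2 * _)] at h5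
        refine ⟨?_, h5⟩
        have h3 := C.mul_conj_add x 1 y
        rw [one_mul, one_mul, h5] at h3
        rw [eq_sub_of_add_eq h3]
        match_scalars <;> field_simp
        ring
      rw [invol_tm, invol_tm, tm_mul, tm_mul, (key C₁ e a c).1, (key C₁ e a c).2,
        (key C₂ f b d).1, (key C₂ f b d).2]
      have hs : sk C₁ C₂ (skPsi e f (tm a b) (tm c d)) =
        tm (-∑ i, (C₁.bil (e.e i * a) c * (2 * C₁.norm (e.e i))⁻¹) • e.e i) (C₂.bil b d • 1) +
        tm (C₁.bil a c • 1) (-∑ i, (C₂.bil (f.e i * b) d * (2 * C₂.norm (f.e i))⁻¹) • f.e i) := by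
        rw [skPsi, map_sum, bvec, bvec', sum_join₂ _ _ _ _ (fun u v => sk C₁ C₂
          (-(pairing ((mL C₁ C₂ (flip2 C₁ C₂ u)) (tm a b))) (tm c d) • v))]
        congr 1
        · simp only [mL_tm, flip2_apply, map_smul, sk_apply]
          simp [pairing_tm, PureBasis.p, Finset.smul_sum, smul_smul]
          exact Finset.sum_congr rfl fun i _ => by congr 1; ring
        · simp only [mL_tm, flip2_apply, map_smul, sk_apply]
          simp [pairing_tm, PureBasis.p, Finset.smul_sum, smul_smul]
          exact Finset.sum_congr rfl fun i _ => by congr 1; ring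
      rw [hs]
      generalize ∑ i, (C₁.bil (e.e i * a) c * (2 * C₁.norm (e.e i))⁻¹) • e.e i = p
      generalize ∑ i, (C₂.bil (f.e i * b) d * (2 * C₂.norm (f.e i))⁻¹) • f.e i = q
      simp only [map_add, map_sub, map_neg, map_smul, LinearMap.add_apply, LinearMap.sub_apply,
        LinearMap.neg_apply, LinearMap.smul_apply]
      match_scalars <;> field_simp <;> ring

lemma fierz_tm (h2 : (2 : F) ≠ 0) (h8₁ : Module.finrank F C₁.carrier = 8)
    (h8₂ : Module.finrank F C₂.carrier = 8) (x₁ y₁ z₁ : C₁.carrier) (x₂ y₂ z₂ : C₂.carrier) :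
    (2 : F) • (T C₁ C₂).Vop (tm x₁ x₂) (tm y₁ y₂) (tm z₁ z₂) =
    ∑ i, ∑ j, pairing (mL C₁ C₂ (bvec e f i) (mL C₁ C₂ (flip2 C₁ C₂ (bvec e f j)) (tm x₁ x₂)))
      (tm y₁ y₂) • mL C₁ C₂ (bvec' e f j) (mL C₁ C₂ (flip2 C₁ C₂ (bvec' e f i)) (tm z₁ z₂))
      - (3 * pairing (tm x₁ x₂) (tm y₁ y₂)) • tm z₁ z₂ := by
  have hj : ∀ φ : (C₁.pure × C₂.pure) → (C₁.pure × C₂.pure) → (C₁.pure × C₂.pure) →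
      (C₁.pure × C₂.pure) → T C₁ C₂, ∑ i, ∑ j, φ (bvec e f i) (bvec e f j) (bvec' e f j)
      (bvec' e f i) = (∑ i, ∑ j, φ (e.p i, 0) (e.p j, 0)
        ((2 * C₁.norm (e.e j))⁻¹ • e.p j, 0) ((2 * C₁.norm (e.e i))⁻¹ • e.p i, 0) +
      ∑ i, ∑ j, φ (e.p i, 0) (0, f.p j)
        (0, -(2 * C₂.norm (f.e j))⁻¹ • f.p j) ((2 * C₁.norm (e.e i))⁻¹ • e.p i, 0)) +
      (∑ i, ∑ j, φ (0, f.p i) (e.p j, 0)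
        ((2 * C₁.norm (e.e j))⁻¹ • e.p j, 0) (0, -(2 * C₂.norm (f.e i))⁻¹ • f.p i) +
      ∑ i, ∑ j, φ (0, f.p i) (0, f.p j)
        (0, -(2 * C₂.norm (f.e j))⁻¹ • f.p j) (0, -(2 * C₂.norm (f.e i))⁻¹ • f.p i)) := by
    intro φ
    rw [bvec, bvec', sum_join₂ _ _ _ _ (fun u v => ∑ j, φ u (join (fun i => (e.p i, 0))
      (fun i => (0, f.p i)) j) (join (fun i => ((2 * C₁.norm (e.e i))⁻¹ • e.p i, 0))
    (fun i => (0, -(2 * C₂.norm (f.e i))⁻¹ • f.p i)) j) v)]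
    congr 1
    · rw [← Finset.sum_add_distrib]
      exact Finset.sum_congr rfl fun i _ => sum_join₂ _ _ _ _ (fun u v => φ _ u v _)
    · rw [← Finset.sum_add_distrib]
      exact Finset.sum_congr rfl fun i _ => sum_join₂ _ _ _ _ (fun u v => φ _ u v _)
  rw [hj (fun a b c d => pairing (mL C₁ C₂ a (mL C₁ C₂ (flip2 C₁ C₂ b) (tm x₁ x₂)))
      (tm y₁ y₂) • mL C₁ C₂ c (mL C₁ C₂ (flip2 C₁ C₂ d) (tm z₁ z₂)))]
  have h4 : (4 : F) ≠ 0 := by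
    have : (4 : F) = 2 * 2 := by norm_num
    rw [this]; exact mul_ne_zero h2 h2
  have W₁ := e.sum_W h2 h8₁ x₁ y₁ z₁
  have W₂ := f.sum_W h2 h8₂ x₂ y₂ z₂
  have G₁ := e.sum_G h2 x₁ y₁ z₁
  have G₂ := f.sum_G h2 x₂ y₂ z₂
  have hee : ∑ i, ∑ j, pairing (mL C₁ C₂ (e.p i, 0) (mL C₁ C₂ (flip2 C₁ C₂ (e.p j, 0)) (tm x₁ x₂)))
      (tm y₁ y₂) • mL C₁ C₂ ((2 * C₁.norm (e.e j))⁻¹ • e.p j, 0) (mL C₁ C₂ (flip2 C₁ C₂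
        ((2 * C₁.norm (e.e i))⁻¹ • e.p i, 0)) (tm z₁ z₂)) =
      tm (∑ i, ∑ j, (C₁.bil (e.e i*(e.e j*x₁)) y₁/(4*C₁.norm (e.e i)*C₁.norm (e.e j))) •
        (e.e j*(e.e i*z₁))) (C₂.bil x₂ y₂ • z₂) := by
    simp only [mL_tm, flip2_apply]
    simp [pairing_tm, PureBasis.p, Finset.smul_sum, smul_smul, mL_tm, smul_mul_assoc]
    refine Finset.sum_congr rfl fun i _ => Finset.sum_congr rfl fun j _ => ?_
    congr 1
    have := e.norm_ne i
    have := e.norm_ne j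
    field_simp
    ring
  have hff : ∑ i, ∑ j, pairing (mL C₁ C₂ (0, f.p i) (mL C₁ C₂ (flip2 C₁ C₂ (0, f.p j)) (tm x₁ x₂)))
      (tm y₁ y₂) • mL C₁ C₂ (0, -(2 * C₂.norm (f.e j))⁻¹ • f.p j) (mL C₁ C₂ (flip2 C₁ C₂
        (0, -(2 * C₂.norm (f.e i))⁻¹ • f.p i)) (tm z₁ z₂)) =
      tm (C₁.bil x₁ y₁ • z₁) (∑ i, ∑ j, (C₂.bil (f.e i*(f.e j*x₂)) y₂/
        (4*C₂.norm (f.e i)*C₂.norm (f.e j))) • (f.e j*(f.e i*z₂))) := by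
    simp only [mL_tm, flip2_apply]
    simp [pairing_tm, PureBasis.p, smul_smul, mL_tm, smul_mul_assoc]
    refine Finset.sum_congr rfl fun i _ => Finset.sum_congr rfl fun j _ => ?_
    congr 1
    have := f.norm_ne i
    have := f.norm_ne j
    field_simp
    ring
  have hef : ∑ i, ∑ j, pairing (mL C₁ C₂ (e.p i, 0) (mL C₁ C₂ (flip2 C₁ C₂ (0, f.p j)) (tm x₁ x₂)))
      (tm y₁ y₂) • mL C₁ C₂ (0, -(2 * C₂.norm (f.e j))⁻¹ • f.p j) (mL C₁ C₂ (flip2 C₁ C₂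
        ((2 * C₁.norm (e.e i))⁻¹ • e.p i, 0)) (tm z₁ z₂)) =
      (1 / 4 : F) • tm (∑ i, (C₁.bil (e.e i*x₁) y₁/C₁.norm (e.e i)) • (e.e i*z₁))
        (∑ i, (C₂.bil (f.e i*x₂) y₂/C₂.norm (f.e i)) • (f.e i*z₂)) := by
    simp only [mL_tm, flip2_apply]
    simp [pairing_tm, PureBasis.p, Finset.smul_sum, smul_smul, mL_tm, smul_mul_assoc]
    rw [Finset.sum_comm]
    refine Finset.sum_congr rfl fun i _ => Finset.sum_congr rfl fun j _ => ?_
    congr 1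
    have := f.norm_ne i
    have := e.norm_ne j
    have : (4 : F) = 2 * 2 := by norm_num
    rw [this]
    field_simp
  have hfe : ∑ i, ∑ j, pairing (mL C₁ C₂ (0, f.p i) (mL C₁ C₂ (flip2 C₁ C₂ (e.p j, 0)) (tm x₁ x₂)))
      (tm y₁ y₂) • mL C₁ C₂ ((2 * C₁.norm (e.e j))⁻¹ • e.p j, 0) (mL C₁ C₂ (flip2 C₁ C₂
        (0, -(2 * C₂.norm (f.e i))⁻¹ • f.p i)) (tm z₁ z₂)) =
      (1 / 4 : F) • tm (∑ i, (C₁.bil (e.e i*x₁) y₁/C₁.norm (e.e i)) • (e.e i*z₁))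
        (∑ i, (C₂.bil (f.e i*x₂) y₂/C₂.norm (f.e i)) • (f.e i*z₂)) := by
    simp only [mL_tm, flip2_apply]
    simp [pairing_tm, PureBasis.p, Finset.smul_sum, smul_smul, mL_tm, smul_mul_assoc]
    refine Finset.sum_congr rfl fun i _ => Finset.sum_congr rfl fun j _ => ?_
    congr 1
    have := f.norm_ne i
    have := e.norm_ne j
    have : (4 : F) = 2 * 2 := by norm_num
    rw [this]
    field_simp
  rw [hee, hff, hef, hfe, W₁, W₂, G₁, G₂, Vop_tm, pairing_tm]
  generalize (y₁ * C₁.conj x₁) * z₁ = a₁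
  generalize (y₂ * C₂.conj x₂) * z₂ = a₂
  generalize C₁.bil y₁ z₁ • x₁ - C₁.bil x₁ z₁ • y₁ = d₁
  generalize C₂.bil y₂ z₂ • x₂ - C₂.bil x₂ z₂ • y₂ = d₂
  simp only [map_add, map_sub, LinearMap.add_apply, LinearMap.sub_apply, map_smul,
    LinearMap.smul_apply]
  match_scalars <;> field_simp <;> ring

lemma fierz_T (h2 : (2 : F) ≠ 0) (h8₁ : Module.finrank F C₁.carrier = 8)
    (h8₂ : Module.finrank F C₂.carrier = 8) (x y z : T C₁ C₂) :
    (2 : F) • (T C₁ C₂).Vop x y z =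
    ∑ i, ∑ j, pairing (mL C₁ C₂ (bvec e f i) (mL C₁ C₂ (flip2 C₁ C₂ (bvec e f j)) x))
      y • mL C₁ C₂ (bvec' e f j) (mL C₁ C₂ (flip2 C₁ C₂ (bvec' e f i)) z)
      - (3 * pairing x y) • z := by
  simp only [← AlgebraWithInvolution.VLin_apply]
  induction x using T_ind with
  | h0 => simp
  | ha x x' hx hx' =>
    simp only [map_add, LinearMap.add_apply, smul_add, hx, hx', add_smul, Finset.sum_add_distrib,
      mul_add]
    abel
  | ht a b =>
  induction y using T_ind with
  | h0 => simp
  | ha x x' hx hx' =>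
    simp only [map_add, LinearMap.add_apply, smul_add, hx, hx', add_smul, Finset.sum_add_distrib,
      mul_add]
    abel
  | ht c d =>
  induction z using T_ind with
  | h0 => simp
  | ha x x' hx hx' =>
    simp only [map_add, smul_add, hx, hx', Finset.sum_add_distrib]
    abel
  | ht c d => exact fierz_tm e f h2 h8₁ h8₂ _ _ _ _ _ _

/-- The spin model of a tensor product of two octonion algebras. -/
noncomputable def model (h2 : (2 : F) ≠ 0) (h8₁ : Module.finrank F C₁.carrier = 8)
    (h8₂ : Module.finrank F C₂.carrier = 8) : SpinModel F (C₁.pure × C₂.pure) (T C₁ C₂) where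
  B := albertBil C₁ C₂
  symm s t := by rw [albertBil_apply, albertBil_apply, C₁.bil_comm, C₂.bil_comm]
  m := mL C₁ C₂
  m' := mL C₁ C₂ ∘ₗ flip2 C₁ C₂
  rel u v x := mL_rel u v x
  rel' u v x := by
    have := mL_rel (flip2 C₁ C₂ u) (flip2 C₁ C₂ v) x
    have hf : ∀ u, flip2 C₁ C₂ (flip2 C₁ C₂ u) = u := fun u => by simp [flip2_apply]
    rw [hf, hf] at this
    refine this.trans ?_
    simp [albertBil_apply, flip2_apply]
  pair := pairing
  pair_symm := pairing_comm
  pair_nondeg := pairing_nondeg ((C₁.exists_pureBasis h2 h8₁).some.full_dual h2)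
    ((C₂.exists_pureBasis h2 h8₂).some.full_dual h2)
  pair_m := pairing_mL
  pair_m' u x y := pairing_mL (flip2 C₁ C₂ u) x y
  V := (T C₁ C₂).Vop
  b := bvec (C₁.exists_pureBasis h2 h8₁).some (C₂.exists_pureBasis h2 h8₂).some
  b' := bvec' (C₁.exists_pureBasis h2 h8₁).some (C₂.exists_pureBasis h2 h8₂).some
  dual := bvec_dual _ _ h2
  dual_one := bvec_dual_one _ _ h2
  m_inj := by
    rw [injective_iff_map_eq_zero]
    intro u hu
    apply sk_inj h2
    have := LinearMap.congr_fun hu 1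
    rwa [mL_apply, mul_one] at this
  fierz := fierz_T _ _ h2 h8₁ h8₂
  psi := skPsi (C₁.exists_pureBasis h2 h8₁).some (C₂.exists_pureBasis h2 h8₂).some
  psi_spec x y u := skPsi_spec _ _ h2 x y u
  V_swap x y z := by
    rw [mL_apply, sk_skPsi _ _ h2, sub_mul, AlgebraWithInvolution.Vop, AlgebraWithInvolution.Vop]
    abel
  V_transp := Vop_pairing

end CompositionAlgebra

/-- A pairwise commuting family of involutions admitting sign-reversing automorphisms cuts out a
common fixed space of the expected dimension. -/
theorem Module.End.finrank_fixed_mul {F H ι : Type*} [Field F] [AddCommGroup H] [Module F H]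
    [FiniteDimensional F H] (h2 : (2 : F) ≠ 0) (Φ T : ι → Module.End F H)
    (hsq : ∀ i f, Φ i (Φ i f) = f) (hcomm : ∀ i j f, Φ i (Φ j f) = Φ j (Φ i f))
    (hT : ∀ i, Function.Injective (T i)) (hanti : ∀ i f, Φ i (T i f) = -T i (Φ i f))
    (hTc : ∀ i j f, i ≠ j → Φ j (T i f) = T i (Φ j f)) (s : Finset ι) :
    Module.finrank F (⨅ i ∈ s, LinearMap.ker (Φ i - 1) : Submodule F H) * 2 ^ s.card =
      Module.finrank F H := by
  classical
  induction s using Finset.induction_on with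
  | empty =>
    have h : (⨅ i ∈ (∅ : Finset ι), LinearMap.ker (Φ i - 1) : Submodule F H) = ⊤ := by simp
    rw [h]
    simp
  | insert i s hi ih =>
    rw [Finset.card_insert_of_notMem hi, pow_succ, mul_comm (2 ^ s.card), ← mul_assoc, ← ih]
    congr 1
    set V : Submodule F H := ⨅ i ∈ s, LinearMap.ker (Φ i - 1) with hV
    have hmem : ∀ f, f ∈ V ↔ ∀ j ∈ s, Φ j f = f := by
      intro f
      simp [hV, Submodule.mem_iInf, sub_eq_zero]
    rw [Finset.iInf_insert]
    set P : Submodule F H := LinearMap.ker (Φ i - 1) ⊓ V with hP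
    set N : Submodule F H := LinearMap.ker (Φ i + 1) ⊓ V with hN
    have hPm : ∀ f, f ∈ P ↔ Φ i f = f ∧ f ∈ V := by
      intro f
      simp [hP, sub_eq_zero]
    have hNm : ∀ f, f ∈ N ↔ Φ i f = -f ∧ f ∈ V := by
      intro f
      simp [hN, add_eq_zero_iff_eq_neg]
    have hTV : ∀ f ∈ V, T i f ∈ V := by
      intro f hf
      rw [hmem] at hf ⊢
      intro j hj
      rw [hTc i j _ (by rintro rfl; exact hi hj), hf j hj]
    have hΦV : ∀ f ∈ V, Φ i f ∈ V := by
      intro f hf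
      rw [hmem] at hf ⊢
      intro j hj
      rw [hcomm, hf j hj]
    have hPN : Module.finrank F P = Module.finrank F N := by
      apply le_antisymm
      · refine LinearMap.finrank_le_finrank_of_injective
          (f := (T i).restrict (p := P) (q := N) fun f hf => ?_) fun a b hab => ?_
        · rw [hPm] at hf
          rw [hNm]
          exact ⟨by rw [hanti, hf.1], hTV f hf.2⟩
        · exact Subtype.ext (hT i (congrArg Subtype.val hab))
      · refine LinearMap.finrank_le_finrank_of_injective
          (f := (T i).restrict (p := N) (q := P) fun f hf => ?_) fun a b hab => ?_
        · rw [hNm] at hf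
          rw [hPm]
          exact ⟨by rw [hanti, hf.1, map_neg, neg_neg], hTV f hf.2⟩
        · exact Subtype.ext (hT i (congrArg Subtype.val hab))
    have hsup : P ⊔ N = V := by
      apply le_antisymm (sup_le inf_le_right inf_le_right)
      intro f hf
      have e : f = (2 : F)⁻¹ • (f + Φ i f) + (2 : F)⁻¹ • (f - Φ i f) := by
        rw [← smul_add, add_add_sub_cancel, ← two_smul F f, smul_smul, inv_mul_cancel₀ h2, one_smul]
      rw [e]
      refine Submodule.add_mem_sup (P.smul_mem _ ?_) (N.smul_mem _ ?_)
      · rw [hPm]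
        exact ⟨by rw [map_add, hsq, add_comm], V.add_mem hf (hΦV f hf)⟩
      · rw [hNm]
        exact ⟨by rw [map_sub, hsq, neg_sub], V.sub_mem hf (hΦV f hf)⟩
    have hinf : P ⊓ N = ⊥ := by
      rw [eq_bot_iff]
      intro f hf
      have h1 := ((hPm f).1 hf.1).1
      have h3 := ((hNm f).1 hf.2).1
      rw [h1, eq_neg_iff_add_eq_zero, ← two_smul F f] at h3
      exact (smul_eq_zero.1 h3).resolve_left h2
    have := Submodule.finrank_sup_add_finrank_inf_eq P N
    rw [hsup, hinf, finrank_bot] at this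
    omega

/-- Operators satisfying the relations of the generators of the Clifford algebra of a diagonal
form. -/
structure CliffordFamily {F M ι : Type*} [Field F] [AddCommGroup M] [Module F M]
    (q : ι → F) (x : ι → Module.End F M) : Prop where
  sq : ∀ i m, x i (x i m) = q i • m
  anti : ∀ i j m, i ≠ j → x i (x j m) = -x j (x i m)

namespace CliffordFamily

variable {F M M' ι : Type*} [Field F] [AddCommGroup M] [Module F M] [AddCommGroup M'] [Module F M']
  {q : ι → F} {x : ι → Module.End F M} {y : ι → Module.End F M'}

lemma injective (hx : CliffordFamily q x) (hq : ∀ i, q i ≠ 0) (i : ι) :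
    Function.Injective (x i) := by
  rw [← LinearMap.ker_eq_bot, eq_bot_iff]
  intro m hm
  have h := hx.sq i m
  rw [LinearMap.mem_ker.1 hm, map_zero] at h
  exact (smul_eq_zero.1 h.symm).resolve_left (hq i)

lemma comp {κ : Type*} (hx : CliffordFamily q x) {f : κ → ι} (hf : Function.Injective f) :
    CliffordFamily (fun i => q (f i)) fun i => x (f i) :=
  ⟨fun i => hx.sq (f i), fun i j m h => hx.anti (f i) (f j) m (hf.ne h)⟩

lemma exists_volume [Fintype ι] (hx : CliffordFamily q x) (hq : ∀ i, q i ≠ 0)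
    (he : Even (Fintype.card ι)) :
    ∃ ω : Module.End F M, Function.Injective ω ∧ ∀ i m, x i (ω m) = -ω (x i m) := by
  classical
  have key : ∀ l : List ι, l.Nodup → ∃ ω : Module.End F M, Function.Injective ω ∧
      (∀ i ∉ l, ∀ m, x i (ω m) = (-1 : F) ^ l.length • ω (x i m)) ∧
      ∀ i ∈ l, ∀ m, x i (ω m) = -((-1 : F) ^ l.length • ω (x i m)) := by
    intro l
    induction l with
    | nil => exact fun _ => ⟨1, fun _ _ h => h, by simp, by simp⟩
    | cons j l ih =>
      intro hl
      obtain ⟨hj, hl⟩ := List.nodup_cons.1 hl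
      obtain ⟨ω, hω, h1, h2⟩ := ih hl
      refine ⟨x j * ω, (hx.injective hq j).comp hω, ?_, ?_⟩
      · intro i hi m
        rw [List.mem_cons, not_or] at hi
        simp only [Module.End.mul_apply, List.length_cons, pow_succ]
        rw [hx.anti i j _ hi.1, h1 i hi.2, map_smul, mul_neg_one, neg_smul]
      · intro i hi m
        simp only [Module.End.mul_apply, List.length_cons, pow_succ, mul_neg_one, neg_smul, neg_neg]
        rcases eq_or_ne i j with rfl | hij
        · rw [h1 i hj, map_smul]
        · have hi := (List.mem_cons.1 hi).resolve_left hij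
          rw [hx.anti i j _ hij, h2 i hi, map_neg, map_smul, neg_neg]
  obtain ⟨ω, h1, -, h3⟩ := key Finset.univ.toList (Finset.nodup_toList _)
  refine ⟨ω, h1, fun i m => ?_⟩
  rw [h3 i (by simp) m, Finset.length_toList, Finset.card_univ, he.neg_one_pow, one_smul]

/-- The intertwiners between two modules over an even-dimensional Clifford algebra. -/
def intertwiners (x : ι → Module.End F M) (y : ι → Module.End F M') : Submodule F (M' →ₗ[F] M) where
  carrier := {f | ∀ i m, x i (f m) = f (y i m)}
  add_mem' := by
    intro f g hf hg i m
    simp [hf i m, hg i m]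
  zero_mem' := by simp
  smul_mem' := by
    intro c f hf i m
    simp [hf i m]

lemma finrank_intertwiners [Fintype ι] [FiniteDimensional F M] [FiniteDimensional F M']
    (h2 : (2 : F) ≠ 0) (hx : CliffordFamily q x) (hy : CliffordFamily q y) (hq : ∀ i, q i ≠ 0)
    (he : Even (Fintype.card ι)) :
    Module.finrank F (intertwiners x y) * 2 ^ Fintype.card ι =
      Module.finrank F M' * Module.finrank F M := by
  obtain ⟨ω, hω, hωx⟩ := hx.exists_volume hq he
  let Φ : ι → Module.End F (M' →ₗ[F] M) := fun i =>
    (q i)⁻¹ • (LinearMap.compRight F (x i)).comp (LinearMap.lcomp F M (y i))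
  have hΦ : ∀ i f m, Φ i f m = (q i)⁻¹ • x i (f (y i m)) := fun i f m => rfl
  let T : ι → Module.End F (M' →ₗ[F] M) := fun i => LinearMap.compRight F (ω * x i)
  have hT : ∀ i f m, T i f m = ω (x i (f m)) := fun i f m => rfl
  have h := Module.End.finrank_fixed_mul h2 Φ T
    (fun i f => by
      ext m
      simp only [hΦ, hy.sq, map_smul, hx.sq, smul_smul]
      rw [← mul_assoc, mul_assoc, mul_assoc]
      simp [hq i])
    (fun i j f => by
      rcases eq_or_ne i j with rfl | hij
      · rfl
      ext m
      simp only [hΦ, map_smul]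
      rw [hx.anti i j _ hij, hy.anti j i _ hij.symm, map_neg, map_neg, map_neg, neg_neg, smul_comm])
    (fun i f g hfg => by
      ext m
      exact hx.injective hq i (hω (LinearMap.congr_fun hfg m)))
    (fun i f => by
      ext m
      simp only [hΦ, hT, LinearMap.neg_apply, map_smul, hωx, smul_neg])
    (fun i j f hij => by
      ext m
      simp only [hΦ, hT, map_smul, hωx]
      rw [hx.anti j i _ hij.symm, map_neg, neg_neg]) Finset.univ
  rw [Finset.card_univ, Module.finrank_linearMap] at h
  rw [← h]
  congr 1
  refine congrArg (fun V : Submodule F (M' →ₗ[F] M) => Module.finrank F V) ?_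
  ext f
  simp only [Finset.mem_univ, iInf_pos, Submodule.mem_iInf, LinearMap.mem_ker, LinearMap.sub_apply,
    sub_eq_zero, Module.End.one_apply]
  refine forall_congr' fun i => ⟨fun hf => ?_, fun hf m => ?_⟩
  · ext m
    rw [hΦ, hf, hy.sq, map_smul, smul_smul, inv_mul_cancel₀ (hq i), one_smul]
  · have := congrArg (x i) (LinearMap.congr_fun hf m)
    rw [hΦ, map_smul, hx.sq, smul_smul, inv_mul_cancel₀ (hq i), one_smul] at this
    exact this.symm

lemma two_pow_le [Fintype ι] [FiniteDimensional F M] [Nontrivial M]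
    (h2 : (2 : F) ≠ 0) (hx : CliffordFamily q x) (hq : ∀ i, q i ≠ 0)
    (he : Even (Fintype.card ι)) :
    2 ^ Fintype.card ι ≤ Module.finrank F M * Module.finrank F M := by
  rw [← finrank_intertwiners h2 hx hx hq he]
  refine Nat.le_mul_of_pos_left _ (Module.finrank_pos_iff_exists_ne_zero.2 ⟨⟨1, fun _ _ => rfl⟩, ?_⟩)
  intro h
  obtain ⟨m, hm⟩ := exists_ne (0 : M)
  exact hm (LinearMap.congr_fun (congrArg Subtype.val h) m)

/-- Two 64-dimensional modules over a Clifford algebra in 13 variables agree up to the sign of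
the last generator. -/
theorem exists_intertwiner {n d : ℕ} (hn : Even n) (hd : d * d = 2 ^ n)
    {q : Fin (n + 1) → F} {x : Fin (n + 1) → Module.End F M} {y : Fin (n + 1) → Module.End F M'}
    [FiniteDimensional F M] [FiniteDimensional F M']
    (h2 : (2 : F) ≠ 0) (hx : CliffordFamily q x) (hy : CliffordFamily q y) (hq : ∀ i, q i ≠ 0)
    (hM : Module.finrank F M = d) (hM' : Module.finrank F M' = d) :
    ∃ α : M' ≃ₗ[F] M, (∀ i m, α (y (Fin.castSucc i) m) = x (Fin.castSucc i) (α m)) ∧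
      ∃ ε : F, (ε = 1 ∨ ε = -1) ∧ ∀ m, α (y (Fin.last n) m) = ε • x (Fin.last n) (α m) := by
  have hinj := Fin.castSucc_injective n
  have hx' := hx.comp hinj
  have hy' := hy.comp hinj
  have hq' : ∀ i : Fin n, q i.castSucc ≠ 0 := fun i => hq _
  have he : Even (Fintype.card (Fin n)) := by rwa [Fintype.card_fin]
  have h1 := finrank_intertwiners h2 hx' hy' hq' he
  rw [hM, hM', hd, Fintype.card_fin] at h1
  have h1' := Nat.eq_of_mul_eq_mul_right (by positivity) (h1.trans (one_mul _).symm)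
  obtain ⟨⟨f, hf⟩, hf0, -⟩ := finrank_eq_one_iff'.1 h1'
  have hd0 : 0 < d := Nat.pos_of_ne_zero fun h => by
    rw [h, zero_mul] at hd
    exact absurd hd.symm (by positivity)
  let W := LinearMap.range f
  have hW : ∀ i : Fin n, ∀ m ∈ W, x i.castSucc m ∈ W := by
    rintro i _ ⟨m, rfl⟩
    exact ⟨y i.castSucc m, (hf i m).symm⟩
  have hWx : CliffordFamily (fun i : Fin n => q i.castSucc)
      (fun i => (x i.castSucc).restrict (hW i)) :=
    ⟨fun i m => Subtype.ext (hx'.sq i m), fun i j m h => Subtype.ext (hx'.anti i j m h)⟩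
  have hWn : Nontrivial W := by
    rw [Submodule.nontrivial_iff_ne_bot]
    intro h
    exact hf0 (Subtype.ext (LinearMap.range_eq_bot.1 h))
  have h3 := two_pow_le h2 hWx hq' he
  rw [Fintype.card_fin, ← hd] at h3
  have hsurj : Function.Surjective f := by
    rw [← LinearMap.range_eq_top]
    refine Submodule.eq_top_of_finrank_eq (le_antisymm (Submodule.finrank_le _) ?_)
    rw [hM]
    exact Nat.mul_self_le_mul_self_iff.1 h3
  have hbij : Function.Bijective f :=
    ⟨(LinearMap.injective_iff_surjective_of_finrank_eq_finrank (hM'.trans hM.symm)).2 hsurj, hsurj⟩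
  let α := LinearEquiv.ofBijective f hbij
  have hα : ∀ i m, α (y (Fin.castSucc i) m) = x (Fin.castSucc i) (α m) := fun i m => (hf i m).symm
  refine ⟨α, hα, ?_⟩
  have h4 := finrank_intertwiners h2 hx' hx' hq' he
  rw [hM, hd, Fintype.card_fin] at h4
  have h4' := Nat.eq_of_mul_eq_mul_right (by positivity) (h4.trans (one_mul _).symm)
  have hMn : Nontrivial M := Module.nontrivial_of_finrank_pos (R := F) (by omega)
  obtain ⟨m₀, hm₀⟩ := exists_ne (0 : M)
  have hcl : ∀ i : Fin n, i.castSucc ≠ Fin.last n := fun i => (Fin.castSucc_lt_last i).ne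
  have hα' : ∀ i m, y (Fin.castSucc i) (α.symm m) = α.symm (x (Fin.castSucc i) m) := fun i m => by
    apply α.injective
    rw [hα]
    simp
  obtain ⟨c, hc⟩ := (finrank_eq_one_iff_of_nonzero' (⟨1, fun _ _ => rfl⟩ :
      intertwiners (fun i : Fin n => x i.castSucc) (fun i : Fin n => x i.castSucc)) (fun h =>
        hm₀ (LinearMap.congr_fun (congrArg Subtype.val h) m₀))).1 h4'
    ⟨x (Fin.last n) ∘ₗ α.toLinearMap ∘ₗ y (Fin.last n) ∘ₗ α.symm.toLinearMap, fun i m => by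
      simp only [LinearMap.comp_apply, LinearEquiv.coe_coe]
      rw [hx.anti _ _ _ (hcl i), ← hα, hy.anti _ _ _ (hcl i), hα', map_neg, map_neg, neg_neg]⟩
  have hc' : ∀ m, x (Fin.last n) (α (y (Fin.last n) (α.symm m))) = c • m := fun m =>
    (LinearMap.congr_fun (congrArg Subtype.val hc) m).symm
  have h5 : ∀ m, α (y (Fin.last n) m) = (c * (q (Fin.last n))⁻¹) • x (Fin.last n) (α m) := by
    intro m
    have := congrArg (x (Fin.last n)) (hc' (α m))
    rw [hx.sq, map_smul, α.symm_apply_apply] at this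
    rw [mul_comm, mul_smul, ← this, smul_smul, inv_mul_cancel₀ (hq _), one_smul]
  refine ⟨_, ?_, h5⟩
  have h6 : (c * (q (Fin.last n))⁻¹) ^ 2 = 1 := by
    have h7 := h5 (y (Fin.last n) (α.symm m₀))
    rw [hy.sq, map_smul, α.apply_symm_apply, h5, α.apply_symm_apply, map_smul, hx.sq, smul_smul,
      smul_smul] at h7
    have h8 := smul_left_injective F hm₀ h7
    have hql := hq (Fin.last n)
    have h9 : q (Fin.last n) * ((c * (q (Fin.last n))⁻¹) ^ 2 - 1) = 0 := by
      linear_combination -h8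
    exact sub_eq_zero.1 ((mul_eq_zero.1 h9).resolve_left hql)
  exact eq_or_eq_neg_of_sq_eq_sq _ _ (h6.trans (one_pow 2).symm)

end CliffordFamily

namespace CompositionAlgebra

variable {F : Type u} [Field F] (C : CompositionAlgebra F)

lemma pure_mul_add {x y : C.carrier} (hx : x ∈ C.pure) (hy : y ∈ C.pure) :
    x * y + y * x = -(C.bil x y) • (1 : C.carrier) := by
  have h := C.conj_mul_add x 1 y
  rw [C.conj_pure hx, C.conj_pure hy, mul_one, mul_one, neg_mul, neg_mul, ← neg_add] at h
  rw [neg_smul, ← h, neg_neg]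

lemma mul_anticomm {x y : C.carrier} (hx : x ∈ C.pure) (hy : y ∈ C.pure) (h : C.bil x y = 0) :
    y * x = -(x * y) := by
  have := C.pure_mul_add hx hy
  rw [h, neg_zero, zero_smul] at this
  rw [eq_neg_iff_add_eq_zero, add_comm, this]

lemma mul_mem_pure {x y : C.carrier} (hx : x ∈ C.pure) (h : C.bil x y = 0) : x * y ∈ C.pure := by
  rw [mem_pure, C.bil_conj_left, mul_one, C.conj_pure hx, map_neg, C.bil_comm, h, neg_zero]

lemma pure_mul_self_mul {x : C.carrier} (hx : x ∈ C.pure) (y : C.carrier) :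
    x * (x * y) = -(C.norm x) • y := by
  have := C.conj_mul_mul x y
  rw [C.conj_pure hx, neg_mul] at this
  rw [neg_smul, ← this, neg_neg]

/-- The halved commutator, as a map to the trace zero elements. -/
noncomputable def cross : C.pure →ₗ[F] C.pure →ₗ[F] C.pure :=
  LinearMap.mk₂ F (fun x y => ⟨(2 : F)⁻¹ • ((x : C.carrier) * y - y * x), Submodule.smul_mem _ _ (by
      apply C.pure_of_conj
      rw [map_sub, C.conj_mul, C.conj_mul, C.conj_pure x.2, C.conj_pure y.2, neg_mul_neg,
        neg_mul_neg, neg_sub])⟩)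
    (fun x x' y => Subtype.ext (by
      simp only [Submodule.coe_add, add_mul, mul_add]; module))
    (fun c x y => Subtype.ext (by
      simp only [Submodule.coe_smul, smul_mul_assoc, mul_smul_comm]; module))
    (fun x y y' => Subtype.ext (by
      simp only [Submodule.coe_add, add_mul, mul_add]; module))
    (fun c x y => Subtype.ext (by
      simp only [Submodule.coe_smul, smul_mul_assoc, mul_smul_comm]; module))

lemma coe_cross (x y : C.pure) :
    (C.cross x y : C.carrier) = (2 : F)⁻¹ • ((x : C.carrier) * y - y * x) := rfl

lemma cross_eq (h2 : (2 : F) ≠ 0) {x y : C.pure} (h : C.bil x y = 0) :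
    (C.cross x y : C.carrier) = (x : C.carrier) * y := by
  rw [coe_cross, C.mul_anticomm x.2 y.2 h, sub_neg_eq_add, ← two_smul F ((x : C.carrier) * y),
    smul_smul, inv_mul_cancel₀ h2, one_smul]

lemma bil_cross (x y : C.pure) : C.bil x (C.cross x y) = 0 := by
  rw [coe_cross, map_smul, map_sub, C.bil_comm, C.bil_comm _ ((y : C.carrier) * x),
    C.bil_conj_left, C.bil_conj_right (y : C.carrier), C.conj_pure x.2, C.bil_comm y, neg_mul,
    mul_neg, C.bil_comm (y : C.carrier), sub_self, smul_zero]

/-- The associator with two trace zero elements. -/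
noncomputable def assoc (s t : C.pure) : C.pure →ₗ[F] C.pure where
  toFun x := ⟨((s : C.carrier) * t) * x - s * (t * x), by
    rw [mem_pure, map_sub, LinearMap.sub_apply, C.bil_conj_left, C.bil_conj_left, mul_one,
      C.bil_conj_left, C.conj_mul, mul_one, sub_self]⟩
  map_add' x y := Subtype.ext (by simp only [Submodule.coe_add, mul_add]; abel)
  map_smul' c x := Subtype.ext (by
    simp only [Submodule.coe_smul, mul_smul_comm, RingHom.id_apply]; module)

lemma coe_assoc (s t x : C.pure) :
    (C.assoc s t x : C.carrier) = ((s : C.carrier) * t) * x - s * (t * x) := rfl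

/-- A triple of elements generating an octonion algebra by repeated doubling. -/
structure OrthoTriple (s t u : C.pure) : Prop where
  st : C.bil s t = 0
  su : C.bil s u = 0
  tu : C.bil t u = 0
  stu : C.bil ((s : C.carrier) * t) u = 0

lemma orthoTriple_assoc {s t : C.pure} (h : C.bil s t = 0) (x : C.pure) :
    C.OrthoTriple s t (C.assoc s t x) where
  st := h
  su := by
    have e1 : C.bil ((s : C.carrier) * t * x) s = C.norm s * C.bil t (C.conj x) := by
      rw [C.bil_conj_right, C.bil_mul_left]
    have e2 : C.bil ((s : C.carrier) * (t * x)) s = C.norm s * C.bil t (C.conj x) := by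
      have := C.bil_mul_left (s : C.carrier) ((t : C.carrier) * x) 1
      rw [mul_one] at this
      rw [this, C.bil_conj_right, one_mul]
    rw [C.bil_comm, coe_assoc, map_sub, LinearMap.sub_apply, e1, e2, sub_self]
  tu := by
    have e0 : (t : C.carrier) * (s * t) = C.norm t • (s : C.carrier) := by
      rw [← neg_neg ((s : C.carrier) * t), ← C.mul_anticomm s.2 t.2 h, mul_neg,
        C.pure_mul_self_mul t.2, neg_smul, neg_neg]
    have e1 : C.bil ((s : C.carrier) * t * x) t = C.norm t * C.bil x s := by
      rw [C.bil_conj_right, C.bil_comm, C.bil_conj_left, C.conj_pure t.2, neg_mul, e0,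
        C.conj_pure x.2, map_neg, map_neg, map_smul, smul_eq_mul, LinearMap.neg_apply, mul_neg,
        neg_neg]
    have e2 : C.bil ((s : C.carrier) * (t * x)) t = C.norm t * C.bil x s := by
      rw [C.bil_conj_left, C.bil_conj_left, C.conj_pure t.2, C.conj_pure s.2, neg_mul, neg_mul,
        mul_neg, neg_neg, e0, map_smul, smul_eq_mul]
    rw [C.bil_comm, coe_assoc, map_sub, LinearMap.sub_apply, e1, e2, sub_self]
  stu := by
    have e1 := C.bil_mul_left ((s : C.carrier) * t) x 1
    have e2 := C.bil_mul_left (t : C.carrier) x 1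
    rw [mul_one] at e1 e2
    rw [C.bil_comm, coe_assoc, map_sub, LinearMap.sub_apply, e1, C.bil_mul_left, e2, C.norm_mul,
      mul_assoc, sub_self]

variable {C}

namespace OrthoTriple

variable {s t u : C.pure}

lemma bil_mul_left_eq (h : C.OrthoTriple s t u) : C.bil ((s : C.carrier) * u) t = 0 := by
  rw [C.bil_conj_left, C.conj_pure s.2, neg_mul, map_neg, C.bil_comm, h.stu, neg_zero]

lemma bil_mul_right_eq (h : C.OrthoTriple s t u) : C.bil s ((t : C.carrier) * u) = 0 := by
  rw [C.bil_comm, C.bil_conj_left, C.conj_pure t.2, neg_mul, map_neg,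
    C.mul_anticomm s.2 t.2 h.st, map_neg, C.bil_comm, h.stu, neg_zero, neg_zero]

lemma mul_mul (h : C.OrthoTriple s t u) :
    ((s : C.carrier) * t) * u = -((s : C.carrier) * (t * u)) := by
  have h1 := C.conj_mul_add' (t : C.carrier) s u
  have h2 := C.mul_conj_add' (s : C.carrier) u t
  rw [C.conj_pure u.2, C.conj_pure t.2, h.tu, zero_smul, mul_neg, mul_neg, neg_mul, neg_mul,
    ← neg_add, neg_eq_zero] at h1
  rw [C.conj_pure s.2, C.conj_pure t.2, h.st, zero_smul, neg_mul, neg_mul, mul_neg, mul_neg,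
    ← neg_add, neg_eq_zero] at h2
  have h3 := C.mul_anticomm (C.mul_mem_pure s.2 h.su) t.2 h.bil_mul_left_eq
  rw [eq_neg_of_add_eq_zero_left h1, ← h3, eq_neg_of_add_eq_zero_right h2]

lemma norm_assoc (h : C.OrthoTriple s t u) :
    C.norm (C.assoc s t u) = 4 * (C.norm s * C.norm t * C.norm u) := by
  have e : (C.assoc s t u : C.carrier) = (2 : F) • (((s : C.carrier) * t) * u) := by
    rw [coe_assoc, two_smul, sub_eq_add_neg, h.mul_mul]
  rw [e, QuadraticMap.map_smul, C.norm_mul, C.norm_mul, smul_eq_mul]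
  ring

end OrthoTriple

variable (C) in
/-- The orthogonal family obtained from a triple by repeated doubling. -/
noncomputable def oct (s t u : C.pure) : Fin 7 → C.pure :=
  ![s, t, C.cross s t, u, C.cross s u, C.cross t u, C.cross s (C.cross t u)]

lemma OrthoTriple.oct_ortho (h2 : (2 : F) ≠ 0) {s t u : C.pure} (h : C.OrthoTriple s t u) :
    ∀ i j, i ≠ j → C.bil (C.oct s t u i) (C.oct s t u j) = 0 := by
  have hst := C.cross_eq h2 h.st
  have hsu := C.cross_eq h2 h.su
  have htu := C.cross_eq h2 h.tu
  have hsw' : C.bil s (C.cross t u) = 0 := by rw [htu, h.bil_mul_right_eq]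
  have hsw := C.cross_eq h2 hsw'
  have htw : C.bil t (C.cross t u) = 0 := C.bil_cross t u
  have huw : C.bil u (C.cross t u) = 0 := by
    rw [htu, C.bil_comm, C.bil_conj_right, C.conj_pure u.2, mul_neg, map_neg,
      C.bil_comm, ← neg_eq_zero]
    have := C.mem_pure.1 t.2
    have e : (u : C.carrier) * u = -(C.norm u) • (1 : C.carrier) := by
      have := C.pure_mul_self_mul u.2 1
      rwa [mul_one] at this
    rw [neg_neg, e, map_smul, LinearMap.smul_apply, C.bil_comm, this, smul_zero]
  have hl : ∀ x y : C.carrier, C.bil x (s * y) = -C.bil (s * x) y := by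
    intro x y
    rw [C.bil_comm, C.bil_conj_left, C.conj_pure s.2, neg_mul, map_neg, C.bil_comm]
  have hss : ∀ x y : C.pure, C.bil x y = 0 → C.bil ((s : C.carrier) * x) (s * y) = 0 := by
    intro x y hxy
    rw [C.bil_mul_left, hxy, mul_zero]
  have hs : ∀ x : C.pure, C.bil s ((s : C.carrier) * x) = 0 := by
    intro x
    have := C.bil_mul_left (s : C.carrier) 1 x
    rwa [mul_one, C.bil_comm 1, C.mem_pure.1 x.2, mul_zero] at this
  have hxs : ∀ x : C.pure, C.bil x ((s : C.carrier) * x) = 0 := by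
    intro x
    have h1 := C.bil_mul_right (x : C.carrier) 1 s
    rwa [one_mul, C.bil_comm 1, C.mem_pure.1 s.2, mul_zero] at h1
  have hwt : C.bil ((s : C.carrier) * C.cross t u) t = 0 := by
    rw [htu, ← neg_neg ((s : C.carrier) * _), ← h.mul_mul, map_neg, LinearMap.neg_apply,
      C.bil_conj_right, C.conj_pure u.2, mul_neg, map_neg, neg_neg, C.mul_anticomm t.2 s.2
        ((C.bil_comm _ _).trans h.st), map_neg, LinearMap.neg_apply, C.bil_mul_left, h.su, mul_zero,
      neg_zero]
  have hwu : C.bil ((s : C.carrier) * C.cross t u) u = 0 := by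
    have h1 := C.bil_mul_right (u : C.carrier) ((s : C.carrier) * t) 1
    rw [one_mul, C.mem_pure.1 (C.mul_mem_pure s.2 h.st), mul_zero] at h1
    rw [htu, ← neg_neg ((s : C.carrier) * _), ← h.mul_mul, map_neg, LinearMap.neg_apply, h1,
      neg_zero]
  have hc : ∀ {x y : C.carrier}, C.bil x y = 0 → C.bil y x = 0 := fun h =>
    (C.bil_comm _ _).trans h
  have hn : ∀ {x y : C.carrier}, C.bil (s * x) y = 0 → C.bil x (s * y) = 0 := fun h => by
    rw [hl, h, neg_zero]
  have hut := h.stu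
  have hus := h.bil_mul_left_eq
  have key : ∀ i j, i < j → C.bil (C.oct s t u i) (C.oct s t u j) = 0 := by
    simp only [Fin.forall_fin_succ, Fin.forall_fin_zero, oct]
    simp [hst, hsu, hsw, hsw', htw, huw, h.st, h.su, h.tu, hs, hxs, hss, hc h.tu,
      hc (hxs t), hc (hxs u), hut, hwu, hwt, hn hut, hc (hn hut), hc (hwt), hc (hwu),
      hn hwt, hn hwu, hc (hn hwt), hc (hn hwu), hn hus, hc htw, hc huw]
  intro i j hij
  rcases lt_or_gt_of_ne hij with hlt | hlt
  · exact key i j hlt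
  · exact hc (key j i hlt)

/-- An anisotropic vector orthogonal to a small orthogonal family. -/
lemma exists_ortho (h2 : (2 : F) ≠ 0) {m : ℕ} (y : Fin m → C.carrier)
    (ho : ∀ i j, i ≠ j → C.bil (y i) (y j) = 0) (hn : ∀ i, C.norm (y i) ≠ 0)
    (hm : m < Module.finrank F C.carrier) :
    ∃ x, (∀ i, C.bil x (y i) = 0) ∧ C.norm x ≠ 0 := by
  by_contra! h
  have hb : ∀ x x', (∀ i, C.bil x (y i) = 0) → (∀ i, C.bil x' (y i) = 0) → C.bil x x' = 0 := by
    intro x x' hx hx'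
    rw [C.bil_def, h x hx, h x' hx', h (x + x') fun i => by
      rw [map_add, LinearMap.add_apply, hx, hx', add_zero]]
    simp
  have hproj : ∀ z, ∀ i, C.bil (z - ∑ j, (C.bil z (y j) / C.bil (y j) (y j)) • y j) (y i) = 0 := by
    intro z i
    rw [map_sub, LinearMap.sub_apply, map_sum, LinearMap.sum_apply, Finset.sum_eq_single i]
    · rw [map_smul, LinearMap.smul_apply, smul_eq_mul, div_mul_cancel₀, sub_self]
      exact (C.norm_ne_zero_iff h2).1 (hn i)
    · intro j _ hj
      rw [map_smul, LinearMap.smul_apply, ho j i hj, smul_zero]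
    · simp
  have hspan : ∀ z, z ∈ Submodule.span F (Set.range y) := by
    intro z
    have h0 : z - ∑ j, (C.bil z (y j) / C.bil (y j) (y j)) • y j = 0 := by
      apply C.eq_of_bil
      intro w
      have e1 := hb _ _ (hproj z) (hproj w)
      have e2 := hproj z
      set z' := z - ∑ j, (C.bil z (y j) / C.bil (y j) (y j)) • y j
      rw [map_sub, map_sum, Finset.sum_eq_zero fun i _ => by rw [map_smul, e2, smul_zero],
        sub_zero] at e1
      rw [e1, map_zero, LinearMap.zero_apply]
    rw [sub_eq_zero.1 h0]
    exact Submodule.sum_mem _ fun i _ => Submodule.smul_mem _ _ (Submodule.subset_span ⟨i, rfl⟩)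
  have := finrank_range_le_card (R := F) y
  rw [Set.finrank, Submodule.eq_top_iff'.2 hspan, finrank_top, Fintype.card_fin] at this
  omega

end CompositionAlgebra

namespace CompositionAlgebra

variable {F : Type u} [Field F] (C : CompositionAlgebra F)

/-- An orthogonal basis of a quaternion subalgebra of a composition algebra. -/
structure QuaternionFamily (q : Fin 4 → C.carrier) : Prop where
  zero : q 0 = 1
  mul_mem : ∀ i j, q i * q j ∈ Submodule.span F (Set.range q)
  conj_mem : ∀ i, C.conj (q i) ∈ Submodule.span F (Set.range q)
  assoc : ∀ i j l, q i * (q j * q l) = (q i * q j) * q l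
  ortho : ∀ i j, i ≠ j → C.bil (q i) (q j) = 0
  norm_ne : ∀ i, C.norm (q i) ≠ 0
  average : ∀ i, ∑ j, (C.norm (q j))⁻¹ • (q j * (q i * C.conj (q j))) =
    if i = 0 then (4 : F) • (1 : C.carrier) else 0

variable {C}

/-- The quaternion basis generated by two orthogonal pure elements. -/
lemma quaternionFamily {x y : C.pure} (h : C.bil x y = 0) (hx : C.norm x ≠ 0)
    (hy : C.norm y ≠ 0) :
    C.QuaternionFamily ![1, (x : C.carrier), y, x * y] := by
  have hz := C.mul_mem_pure x.2 h
  have nz : C.norm ((x : C.carrier) * y) ≠ 0 := by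
    rw [C.norm_mul]
    exact mul_ne_zero hx hy
  have sq : ∀ {z : C.carrier}, z ∈ C.pure → z * z = -(C.norm z) • (1 : C.carrier) := by
    intro z hz
    have := C.pure_mul_self_mul hz 1
    rwa [mul_one] at this
  have xx := sq x.2
  have yy := sq y.2
  have zz := sq hz
  have yx := C.mul_anticomm x.2 y.2 h
  have xz : (x : C.carrier) * (x * y) = -(C.norm x) • (y : C.carrier) := C.pure_mul_self_mul x.2 _
  have yz : (y : C.carrier) * (x * y) = C.norm y • (x : C.carrier) := by
    have := C.pure_mul_self_mul y.2 x
    rw [yx, mul_neg, neg_smul, neg_inj] at this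
    exact this
  have oxz : C.bil (x : C.carrier) (x * y) = 0 := by
    rw [C.bil_comm, C.bil_conj_left, C.conj_pure x.2, neg_mul, xx, map_neg, map_smul,
      C.mem_pure.1 y.2, smul_zero, neg_zero]
  have oyz : C.bil (y : C.carrier) (x * y) = 0 := by
    rw [C.bil_comm, C.bil_conj_right, C.conj_pure y.2, mul_neg, yy, map_neg, map_smul,
      C.mem_pure.1 x.2, smul_zero, neg_zero]
  have zx := C.mul_anticomm x.2 hz oxz
  rw [xz] at zx
  have zy := C.mul_anticomm y.2 hz oyz
  rw [yz] at zy
  have h1 : (1 : C.carrier) ∈ Submodule.span F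
      (Set.range ![1, (x : C.carrier), y, x * y]) := Submodule.subset_span ⟨0, rfl⟩
  have hx' : (x : C.carrier) ∈ Submodule.span F
      (Set.range ![1, (x : C.carrier), y, x * y]) := Submodule.subset_span ⟨1, rfl⟩
  have hy' : (y : C.carrier) ∈ Submodule.span F
      (Set.range ![1, (x : C.carrier), y, x * y]) := Submodule.subset_span ⟨2, rfl⟩
  have hz' : (x : C.carrier) * y ∈ Submodule.span F
      (Set.range ![1, (x : C.carrier), y, x * y]) := Submodule.subset_span ⟨3, rfl⟩
  have same : ∀ {z : C.carrier}, z ∈ C.pure → C.norm z ≠ 0 →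
      (C.norm z)⁻¹ • (z * (z * C.conj z)) = z := by
    intro z _ hz
    rw [C.mul_conj, mul_smul_comm, mul_one, smul_smul, inv_mul_cancel₀ hz, one_smul]
  have diff : ∀ {z w : C.carrier}, z ∈ C.pure → w ∈ C.pure → C.bil z w = 0 → C.norm w ≠ 0 →
      (C.norm w)⁻¹ • (w * (z * C.conj w)) = -z := by
    intro z w hz hw hzw hn
    rw [C.conj_pure hw, mul_neg, ← C.mul_anticomm hz hw hzw, C.pure_mul_self_mul hw, smul_smul,
      mul_neg, inv_mul_cancel₀ hn, neg_one_smul]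
  refine ⟨rfl, ?_, ?_, ?_, ?_, ?_, ?_⟩
  · simp only [Fin.forall_fin_succ, Fin.forall_fin_zero]
    generalize Submodule.span F (Set.range ![1, (x : C.carrier), y, x * y]) = W at *
    simp [xx, yy, zz, yx, xz, yz, zx, zy, h1, hx', hy', hz', Submodule.smul_mem]
  · simp only [Fin.forall_fin_succ, Fin.forall_fin_zero]
    generalize Submodule.span F (Set.range ![1, (x : C.carrier), y, x * y]) = W at *
    simp [C.conj_one, C.conj_pure x.2, C.conj_pure y.2, C.conj_pure hz, h1, hx', hy', hz']
  · simp only [Fin.forall_fin_succ, Fin.forall_fin_zero]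
    simp [xx, yy, zz, yx, xz, yz, zx, zy, mul_smul_comm, smul_mul_assoc, smul_smul,
      C.norm_mul, mul_comm]
  · have b1 := C.mem_pure.1 x.2
    have b2 := C.mem_pure.1 y.2
    have b3 := C.mem_pure.1 hz
    have key : ∀ i j, i < j → C.bil (![1, (x : C.carrier), y, x * y] i)
        (![1, (x : C.carrier), y, x * y] j) = 0 := by
      simp only [Fin.forall_fin_succ, Fin.forall_fin_zero]
      simp [C.bil_comm 1, b1, b2, b3, h, oxz, oyz]
    intro i j hij
    rcases lt_or_gt_of_ne hij with hlt | hlt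
    · exact key i j hlt
    · rw [C.bil_comm]
      exact key j i hlt
  · simp only [Fin.forall_fin_succ, Fin.forall_fin_zero]
    simp only [Matrix.cons_val_zero, Matrix.cons_val_succ, C.norm_one]
    exact ⟨one_ne_zero, hx, hy, nz, trivial⟩
  · have ozx := (C.bil_comm _ _).trans oxz
    have ozy := (C.bil_comm _ _).trans oyz
    have hyx := (C.bil_comm _ _).trans h
    simp only [Fin.forall_fin_succ, Fin.forall_fin_zero, Fin.sum_univ_four]
    refine ⟨?_, ?_, ?_, ?_, trivial⟩
    · simp only [Matrix.cons_val, one_mul, C.mul_conj, smul_smul, C.norm_one, C.conj_one]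
      rw [inv_mul_cancel₀ hx, inv_mul_cancel₀ hy, inv_mul_cancel₀ nz, if_pos trivial, inv_one]
      module
    · simp only [Matrix.cons_val, Matrix.cons_val_succ, Matrix.cons_val_zero, C.norm_one, C.conj_one, one_mul, mul_one, inv_one, one_smul]
      rw [same x.2 hx, diff x.2 y.2 h hy, diff x.2 hz oxz nz, if_neg (by decide)]
      abel
    · simp only [Matrix.cons_val, Matrix.cons_val_succ, Matrix.cons_val_zero, C.norm_one, C.conj_one, one_mul, mul_one, inv_one, one_smul]
      rw [same y.2 hy, diff y.2 x.2 hyx hx, diff y.2 hz oyz nz, if_neg (by decide)]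
      abel
    · simp only [Matrix.cons_val, Matrix.cons_val_succ, Matrix.cons_val_zero, C.norm_one, C.conj_one, one_mul, mul_one, inv_one, one_smul]
      rw [same hz nz, diff hz x.2 ozx hx, diff hz y.2 ozy hy, if_neg (by decide)]
      abel

end CompositionAlgebra

namespace CompositionAlgebra

variable {F : Type u} [Field F] {C₁ C₂ : CompositionAlgebra F}

/-- The tensor products of the members of two families. -/
noncomputable def tmFamily (q₁ : Fin 4 → C₁.carrier) (q₂ : Fin 4 → C₂.carrier) (i : Fin 4 × Fin 4) :
    T C₁ C₂ := tm (q₁ i.1) (q₂ i.2)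

/-- The span of the tensor products of the members of two families. -/
noncomputable def tmSpan (q₁ : Fin 4 → C₁.carrier) (q₂ : Fin 4 → C₂.carrier) :
    Submodule F (T C₁ C₂) := Submodule.span F (Set.range (tmFamily q₁ q₂))

/-- The averaging operator over the basis of a biquaternion algebra. -/
noncomputable def tmAverage (q₁ : Fin 4 → C₁.carrier) (q₂ : Fin 4 → C₂.carrier) :
    Module.End F (T C₁ C₂) :=
  ∑ i : Fin 4 × Fin 4, ((C₁.norm (q₁ i.1))⁻¹ * (C₂.norm (q₂ i.2))⁻¹) •
    (LinearMap.mulLeft F (tmFamily q₁ q₂ i) ∘ₗ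
      LinearMap.mulRight F ((T C₁ C₂).invol (tmFamily q₁ q₂ i)))

lemma tmAverage_apply (q₁ : Fin 4 → C₁.carrier) (q₂ : Fin 4 → C₂.carrier) (X : T C₁ C₂) :
    tmAverage q₁ q₂ X = ∑ i : Fin 4 × Fin 4, ((C₁.norm (q₁ i.1))⁻¹ * (C₂.norm (q₂ i.2))⁻¹) •
      (tmFamily q₁ q₂ i * (X * (T C₁ C₂).invol (tmFamily q₁ q₂ i))) := by
  simp [tmAverage, LinearMap.sum_apply]

lemma tmAverage_tm (q₁ : Fin 4 → C₁.carrier) (q₂ : Fin 4 → C₂.carrier) (x : C₁.carrier)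
    (y : C₂.carrier) : tmAverage q₁ q₂ (tm x y) =
      tm (∑ i, (C₁.norm (q₁ i))⁻¹ • (q₁ i * (x * C₁.conj (q₁ i))))
        (∑ i, (C₂.norm (q₂ i))⁻¹ • (q₂ i * (y * C₂.conj (q₂ i)))) := by
  rw [tmAverage_apply, Fintype.sum_prod_type]
  simp only [map_sum, LinearMap.sum_apply, map_smul, LinearMap.smul_apply, tmFamily, invol_tm,
    tm_mul, mul_smul, Finset.smul_sum]
  rw [Finset.sum_comm]
  exact Finset.sum_congr rfl fun _ _ => Finset.sum_congr rfl fun _ _ => smul_comm _ _ _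

lemma tm_mem_tmSpan {q₁ : Fin 4 → C₁.carrier} {q₂ : Fin 4 → C₂.carrier} {x : C₁.carrier}
    {y : C₂.carrier} (hx : x ∈ Submodule.span F (Set.range q₁))
    (hy : y ∈ Submodule.span F (Set.range q₂)) : tm x y ∈ tmSpan q₁ q₂ := by
  induction hx using Submodule.span_induction with
  | zero => rw [map_zero]; exact zero_mem _
  | add x x' _ _ hx hx' => rw [map_add]; exact add_mem hx hx'
  | smul c x _ hx => rw [map_smul]; exact Submodule.smul_mem _ _ hx
  | mem x hx =>
    obtain ⟨i, rfl⟩ := hx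
    induction hy using Submodule.span_induction with
    | zero => rw [map_zero]; exact zero_mem _
    | add x x' _ _ hx hx' => rw [map_add]; exact add_mem hx hx'
    | smul c x _ hx => rw [map_smul]; exact Submodule.smul_mem _ _ hx
    | mem y hy =>
      obtain ⟨j, rfl⟩ := hy
      exact Submodule.subset_span ⟨(i, j), rfl⟩

variable {q₁ : Fin 4 → C₁.carrier} {q₂ : Fin 4 → C₂.carrier}

lemma one_mem_tmSpan (h₁ : C₁.QuaternionFamily q₁) (h₂ : C₂.QuaternionFamily q₂) :
    (1 : T C₁ C₂) ∈ tmSpan q₁ q₂ :=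
  Submodule.subset_span ⟨(0, 0), by rw [tmFamily, h₁.zero, h₂.zero]; rfl⟩

lemma mul_mem_tmSpan (h₁ : C₁.QuaternionFamily q₁) (h₂ : C₂.QuaternionFamily q₂) {X Y : T C₁ C₂}
    (hX : X ∈ tmSpan q₁ q₂) (hY : Y ∈ tmSpan q₁ q₂) : X * Y ∈ tmSpan q₁ q₂ := by
  unfold tmSpan at hX hY
  induction hX using Submodule.span_induction with
  | zero => rw [zero_mul]; exact zero_mem _
  | add x x' _ _ hx hx' => rw [add_mul]; exact add_mem hx hx'
  | smul c x _ hx => rw [smul_mul_assoc]; exact Submodule.smul_mem _ _ hx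
  | mem x hx =>
    obtain ⟨i, rfl⟩ := hx
    induction hY using Submodule.span_induction with
    | zero => rw [mul_zero]; exact zero_mem _
    | add x x' _ _ hx hx' => rw [mul_add]; exact add_mem hx hx'
    | smul c x _ hx => rw [mul_smul_comm]; exact Submodule.smul_mem _ _ hx
    | mem y hy =>
      obtain ⟨j, rfl⟩ := hy
      rw [tmFamily, tmFamily, tm_mul]
      exact tm_mem_tmSpan (h₁.mul_mem _ _) (h₂.mul_mem _ _)

lemma invol_mem_tmSpan (h₁ : C₁.QuaternionFamily q₁) (h₂ : C₂.QuaternionFamily q₂) {X : T C₁ C₂}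
    (hX : X ∈ tmSpan q₁ q₂) : (T C₁ C₂).invol X ∈ tmSpan q₁ q₂ := by
  unfold tmSpan at hX
  induction hX using Submodule.span_induction with
  | zero => rw [map_zero]; exact zero_mem _
  | add x x' _ _ hx hx' => rw [map_add]; exact add_mem hx hx'
  | smul c x _ hx => rw [map_smul]; exact Submodule.smul_mem _ _ hx
  | mem x hx =>
    obtain ⟨i, rfl⟩ := hx
    rw [tmFamily, invol_tm]
    exact tm_mem_tmSpan (h₁.conj_mem _) (h₂.conj_mem _)

lemma mul_assoc_of_mem_tmSpan (h₁ : C₁.QuaternionFamily q₁) (h₂ : C₂.QuaternionFamily q₂)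
    {X Y Z : T C₁ C₂} (hX : X ∈ tmSpan q₁ q₂) (hY : Y ∈ tmSpan q₁ q₂) (hZ : Z ∈ tmSpan q₁ q₂) :
    X * (Y * Z) = (X * Y) * Z := by
  unfold tmSpan at hX hY hZ
  induction hX using Submodule.span_induction with
  | zero => simp
  | add x x' _ _ hx hx' => rw [add_mul, add_mul, add_mul, hx, hx']
  | smul c x _ hx => rw [smul_mul_assoc, smul_mul_assoc, smul_mul_assoc, hx]
  | mem x hx =>
    obtain ⟨i, rfl⟩ := hx
    induction hY using Submodule.span_induction with
    | zero => simp
    | add x x' _ _ hx hx' => rw [add_mul, mul_add, mul_add, add_mul, hx, hx']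
    | smul c x _ hx =>
      rw [smul_mul_assoc, mul_smul_comm, mul_smul_comm, smul_mul_assoc, hx]
    | mem y hy =>
      obtain ⟨j, rfl⟩ := hy
      induction hZ using Submodule.span_induction with
      | zero => simp
      | add x x' _ _ hx hx' => rw [mul_add, mul_add, mul_add, hx, hx']
      | smul c x _ hx => rw [mul_smul_comm, mul_smul_comm, mul_smul_comm, hx]
      | mem z hz =>
        obtain ⟨l, rfl⟩ := hz
        simp only [tmFamily, tm_mul, h₁.assoc, h₂.assoc]

lemma pairing_tmFamily (h₁ : C₁.QuaternionFamily q₁) (h₂ : C₂.QuaternionFamily q₂)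
    (i j : Fin 4 × Fin 4) : pairing (tmFamily q₁ q₂ i) (tmFamily q₁ q₂ j) =
      if i = j then 4 * C₁.norm (q₁ i.1) * C₂.norm (q₂ i.2) else 0 := by
  rw [tmFamily, tmFamily, pairing_tm]
  split_ifs with h
  · rw [h, bil_self, bil_self]
    ring
  · by_cases h' : i.1 = j.1
    · rw [h₂.ortho _ _ fun h'' => h (Prod.ext h' h''), mul_zero]
    · rw [h₁.ortho _ _ h', zero_mul]

lemma linearIndependent_tmFamily (h2 : (2 : F) ≠ 0) (h₁ : C₁.QuaternionFamily q₁)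
    (h₂ : C₂.QuaternionFamily q₂) : LinearIndependent F (tmFamily q₁ q₂) := by
  apply LinearMap.linearIndependent_of_isOrthoᵢ (B := pairing)
  · intro i j hij
    rw [Function.onFun, pairing_tmFamily h₁ h₂, if_neg hij]
  · intro i
    rw [pairing_tmFamily h₁ h₂, if_pos rfl]
    have h4 : (4 : F) ≠ 0 := by
      have := mul_ne_zero h2 h2
      norm_num at this
      exact this
    exact mul_ne_zero (mul_ne_zero h4 (h₁.norm_ne _)) (h₂.norm_ne _)

lemma finrank_tmSpan (h2 : (2 : F) ≠ 0) (h₁ : C₁.QuaternionFamily q₁)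
    (h₂ : C₂.QuaternionFamily q₂) : Module.finrank F (tmSpan q₁ q₂) = 16 :=
  (finrank_span_eq_card (linearIndependent_tmFamily h2 h₁ h₂)).trans (by simp)

lemma exists_pairing_ne (h2 : (2 : F) ≠ 0) (h₁ : C₁.QuaternionFamily q₁)
    (h₂ : C₂.QuaternionFamily q₂) {X : T C₁ C₂} (hX : X ∈ tmSpan q₁ q₂) (h0 : X ≠ 0) :
    ∃ i, pairing X (tmFamily q₁ q₂ i) ≠ 0 := by
  by_contra! h
  obtain ⟨c, rfl⟩ := (Submodule.mem_span_range_iff_exists_fun F).1 hX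
  apply h0
  apply Finset.sum_eq_zero
  intro i _
  have := h i
  simp only [map_sum, LinearMap.sum_apply, map_smul, LinearMap.smul_apply,
    pairing_tmFamily h₁ h₂, smul_eq_mul, mul_ite, mul_zero, Finset.sum_ite_eq', Finset.mem_univ,
    if_true] at this
  have h4 : (4 : F) ≠ 0 := by
    have := mul_ne_zero h2 h2
    norm_num at this
    exact this
  rw [(mul_eq_zero.1 this).resolve_right
    (mul_ne_zero (mul_ne_zero h4 (h₁.norm_ne _)) (h₂.norm_ne _)), zero_smul]

lemma tmAverage_eq (h₁ : C₁.QuaternionFamily q₁) (h₂ : C₂.QuaternionFamily q₂) {X : T C₁ C₂}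
    (hX : X ∈ tmSpan q₁ q₂) : tmAverage q₁ q₂ X = (4 * pairing X 1) • (1 : T C₁ C₂) := by
  have h00 : (1 : T C₁ C₂) = tmFamily q₁ q₂ (0, 0) := by
    rw [tmFamily, h₁.zero, h₂.zero]; rfl
  unfold tmSpan at hX
  induction hX using Submodule.span_induction with
  | zero => simp
  | add x x' _ _ hx hx' => rw [map_add, hx, hx', map_add, LinearMap.add_apply]; module
  | smul c x _ hx => rw [map_smul, hx, map_smul, LinearMap.smul_apply, smul_eq_mul]; module
  | mem x hx =>
    obtain ⟨i, rfl⟩ := hx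
    rw [h00, pairing_tmFamily h₁ h₂, ← h00, tmFamily, tmAverage_tm, h₁.average, h₂.average]
    by_cases h : i = (0, 0)
    · rw [h, if_pos rfl, if_pos rfl, if_pos rfl, h₁.zero, h₂.zero, C₁.norm_one, C₂.norm_one,
        map_smul, map_smul, LinearMap.smul_apply, ← tm_one]
      module
    · rw [if_neg h, mul_zero, zero_smul]
      by_cases h' : i.1 = 0
      · rw [if_neg fun h'' => h (Prod.ext h' h''), map_zero]
      · rw [if_neg h', map_zero, LinearMap.zero_apply]

/-- A biquaternion algebra is central. -/
lemma eq_smul_one_of_commute (h2 : (2 : F) ≠ 0) (h₁ : C₁.QuaternionFamily q₁)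
    (h₂ : C₂.QuaternionFamily q₂) {X : T C₁ C₂} (hX : X ∈ tmSpan q₁ q₂)
    (h : ∀ Y ∈ tmSpan q₁ q₂, X * Y = Y * X) : ∃ c : F, X = c • (1 : T C₁ C₂) := by
  have key : ∀ i, ((C₁.norm (q₁ i.1))⁻¹ * (C₂.norm (q₂ i.2))⁻¹) •
      (tmFamily q₁ q₂ i * (X * (T C₁ C₂).invol (tmFamily q₁ q₂ i))) = X := by
    intro i
    have hi : tmFamily q₁ q₂ i ∈ tmSpan q₁ q₂ := Submodule.subset_span ⟨i, rfl⟩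
    have hi' := invol_mem_tmSpan h₁ h₂ hi
    rw [h _ hi', mul_assoc_of_mem_tmSpan h₁ h₂ hi hi' hX, tmFamily, invol_tm, tm_mul, C₁.mul_conj,
      C₂.mul_conj, map_smul, map_smul, LinearMap.smul_apply, ← tm_one, smul_smul, smul_mul_assoc,
      one_mul, smul_smul]
    have n₁ := h₁.norm_ne i.1
    have n₂ := h₂.norm_ne i.2
    rw [show (C₁.norm (q₁ i.1))⁻¹ * (C₂.norm (q₂ i.2))⁻¹ *
      (C₂.norm (q₂ i.2) * C₁.norm (q₁ i.1)) = 1 by field_simp, one_smul]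
  have h16 : (16 : F) ≠ 0 := by
    have := pow_ne_zero 4 h2
    norm_num at this
    exact this
  have hR := tmAverage_eq h₁ h₂ hX
  rw [tmAverage_apply, Finset.sum_congr rfl fun i _ => key i, Finset.sum_const, Finset.card_univ,
    Fintype.card_prod, Fintype.card_fin, ← Nat.cast_smul_eq_nsmul F] at hR
  refine ⟨16⁻¹ * (4 * pairing X 1), ?_⟩
  rw [mul_smul, ← hR, smul_smul]
  norm_num
  rw [inv_mul_cancel₀ h16, one_smul]

/-- A biquaternion algebra is simple. -/
lemma one_mem_of_ideal (h2 : (2 : F) ≠ 0) (h₁ : C₁.QuaternionFamily q₁)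
    (h₂ : C₂.QuaternionFamily q₂) {I : Submodule F (T C₁ C₂)} (hI : I ≤ tmSpan q₁ q₂)
    (hmul : ∀ X ∈ I, ∀ Y ∈ tmSpan q₁ q₂, Y * X ∈ I ∧ X * Y ∈ I) {X : T C₁ C₂} (hX : X ∈ I)
    (h0 : X ≠ 0) : (1 : T C₁ C₂) ∈ I := by
  obtain ⟨i, hi⟩ := exists_pairing_ne h2 h₁ h₂ (hI hX) h0
  have mem : ∀ i, tmFamily q₁ q₂ i ∈ tmSpan q₁ q₂ := fun i => Submodule.subset_span ⟨i, rfl⟩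
  have mem' := fun i => invol_mem_tmSpan h₁ h₂ (mem i)
  have hY := (hmul X hX _ (mem' i)).2
  have hR := tmAverage_eq h₁ h₂ (hI hY)
  rw [pairing_mul_right, one_mul, AlgebraWithInvolution.invol_invol] at hR
  have hmem : tmAverage q₁ q₂ (X * (T C₁ C₂).invol (tmFamily q₁ q₂ i)) ∈ I := by
    rw [tmAverage_apply]
    exact Submodule.sum_mem _ fun j _ => Submodule.smul_mem _ _
      (hmul _ (hmul _ hY _ (mem' j)).2 _ (mem j)).1
  rw [hR] at hmem
  have h4 : (4 : F) ≠ 0 := by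
    have := mul_ne_zero h2 h2
    norm_num at this
    exact this
  exact (Submodule.smul_mem_iff _ (mul_ne_zero h4 hi)).1 hmem

end CompositionAlgebra

/-- A pair of half-spin maps for a bilinear form. -/
structure HalfSpin {F S M : Type*} [Field F] [AddCommGroup S] [Module F S] [AddCommGroup M]
    [Module F M] (B : LinearMap.BilinForm F S) (m m' : S →ₗ[F] Module.End F M) : Prop where
  rel : ∀ u v x, m u (m' v x) + m v (m' u x) = -B u v • x
  rel' : ∀ u v x, m' u (m v x) + m' v (m u x) = -B u v • x

namespace HalfSpin

variable {F S M S' M' : Type*} [Field F] [AddCommGroup S] [Module F S] [AddCommGroup M]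
  [Module F M] [AddCommGroup S'] [Module F S'] [AddCommGroup M'] [Module F M']
  {B' : LinearMap.BilinForm F S'} {n n' : S' →ₗ[F] Module.End F M'}
  {B : LinearMap.BilinForm F S} {m m' : S →ₗ[F] Module.End F M}

/-- The operators `m(u) m'(v)` as a bilinear map. -/
def even (m m' : S →ₗ[F] Module.End F M) : S →ₗ[F] S →ₗ[F] Module.End F M :=
  LinearMap.mk₂ F (fun u v => m u ∘ₗ m' v) (by intros; ext; simp) (by intros; ext; simp)
    (by intros; ext; simp) (by intros; ext; simp)

lemma even_apply (u v : S) (x : M) : even m m' u v x = m u (m' v x) := rfl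

lemma two_self (h : HalfSpin B m m') (u : S) (x : M) :
    (2 : F) • even m m' u u x = -B u u • x := by
  rw [← h.rel, even_apply, two_smul]

lemma even_self (h2 : (2 : F) ≠ 0) (h : HalfSpin B m m') (u : S) (x : M) :
    even m m' u u x = (-B u u / 2) • x := by
  have := congrArg ((2 : F)⁻¹ • ·) (h.two_self u x)
  simp only [smul_smul, inv_mul_cancel₀ h2, one_smul] at this
  rw [this, div_eq_inv_mul]

/-- All even products are determined by those involving a fixed vector. -/
lemma even_even (h : HalfSpin B m m') (w u v : S) (x : M) :
    even m m' w u (even m m' w v x) =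
      -B u w • even m m' w v x - even m m' w w (even m m' u v x) := by
  simp only [even_apply]
  rw [eq_sub_of_add_eq (h.rel' u w (m' v x)), map_sub, map_smul]

lemma cliffordFamily (h2 : (2 : F) ≠ 0) (h : HalfSpin B m m') {r : ℕ} (e : Fin (r + 1) → S)
    (he : ∀ i j, i ≠ j → B (e i) (e j) = 0) :
    CliffordFamily (fun i : Fin r => -(B (e 0) (e 0) / 2 * (B (e i.succ) (e i.succ) / 2)))
      fun i => even m m' (e 0) (e i.succ) where
  sq i x := by
    rw [h.even_even, he _ _ (Fin.succ_ne_zero i), h.even_self h2, h.even_self h2]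
    module
  anti i j x hij := by
    have hij' : i.succ ≠ j.succ := fun h => hij (Fin.succ_injective _ h)
    rw [h.even_even, h.even_even, he _ _ (Fin.succ_ne_zero i), he _ _ (Fin.succ_ne_zero j),
      h.even_self h2, h.even_self h2]
    have := h.rel (e i.succ) (e j.succ) x
    rw [he _ _ hij', ← even_apply, ← even_apply] at this
    linear_combination (norm := module) (B (e 0) (e 0) / 2) • this

/-- An operator intertwining the even products with a fixed vector intertwines all of them. -/
lemma intertwine (h2 : (2 : F) ≠ 0) (h : HalfSpin B m m') (h' : HalfSpin B' n n') {r : ℕ}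
    (e : Module.Basis (Fin (r + 1)) F S) (e' : Module.Basis (Fin (r + 1)) F S')
    (he : ∀ i j, i ≠ j → B (e i) (e j) = 0) (he' : ∀ i j, i ≠ j → B' (e' i) (e' j) = 0)
    (hB : ∀ i, B' (e' i) (e' i) = B (e i) (e i)) (hn : B (e 0) (e 0) ≠ 0) (α : M' →ₗ[F] M)
    (hα : ∀ (i : Fin r) x,
      α (even n n' (e' 0) (e' i.succ) x) = even m m' (e 0) (e i.succ) (α x))
    (u v : S') (x : M') : α (even n n' u v x) =
      even m m' (e'.equiv e (Equiv.refl _) u) (e'.equiv e (Equiv.refl _) v) (α x) := by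
  have h0 : ∀ j x, α (even n n' (e' 0) (e' j) x) = even m m' (e 0) (e j) (α x) := by
    intro j x
    induction j using Fin.cases with
    | zero => rw [h.even_self h2, h'.even_self h2, hB, map_smul]
    | succ i => exact hα i x
  have hij : ∀ i j x, α (even n n' (e' i) (e' j) x) = even m m' (e i) (e j) (α x) := by
    intro i j x
    induction i using Fin.cases with
    | zero => exact h0 j x
    | succ i =>
      have h₁ := congrArg α (h'.even_even (e' 0) (e' i.succ) (e' j) x)
      have h₂ := h.even_even (e 0) (e i.succ) (e j) (α x)
      rw [h0, h0, h₂, he _ _ (Fin.succ_ne_zero i), he' _ _ (Fin.succ_ne_zero i),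
        h.even_self h2, h'.even_self h2, hB] at h₁
      simp only [neg_zero, zero_smul, zero_sub, map_neg, map_smul, neg_inj] at h₁
      have hc : -B (e 0) (e 0) / 2 ≠ 0 := div_ne_zero (neg_ne_zero.2 hn) h2
      exact (smul_right_injective M hc h₁).symm
  let g := (e'.equiv e (Equiv.refl _)).toLinearMap
  have key : (even n n').compr₂ (LinearMap.llcomp F M' M' M α) =
      ((even m m').compl₁₂ g g).compr₂ ((LinearMap.llcomp F M' M M).flip α) := by
    refine e'.ext fun i => e'.ext fun j => LinearMap.ext fun x => ?_
    simpa [g] using hij i j x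
  simpa [g] using LinearMap.congr_fun (LinearMap.congr_fun₂ key u v) x

/-- Two pairs of half-spin maps for isometric quadratic spaces of dimension 14 on spaces of
dimension 64 are equivalent, up to a change of the isometry. -/
theorem exists_equivalence [FiniteDimensional F M] [FiniteDimensional F M'] (h2 : (2 : F) ≠ 0)
    (h : HalfSpin B m m') (h' : HalfSpin B' n n')
    (e : Module.Basis (Fin 14) F S) (e' : Module.Basis (Fin 14) F S')
    (he : ∀ i j, i ≠ j → B (e i) (e j) = 0) (he' : ∀ i j, i ≠ j → B' (e' i) (e' j) = 0)
    (hB : ∀ i, B' (e' i) (e' i) = B (e i) (e i)) (hn : ∀ i, B (e i) (e i) ≠ 0)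
    (hM : Module.finrank F M = 64) (hM' : Module.finrank F M' = 64) :
    ∃ (g : S' ≃ₗ[F] S) (α : M' ≃ₗ[F] M), (∀ u v, B (g u) (g v) = B' u v) ∧
      ∀ u v x, α (n u (n' v x)) = m (g u) (m' (g v) (α x)) := by
  have hc := h.cliffordFamily h2 e he
  have hc' := h'.cliffordFamily h2 e' he'
  simp only [hB] at hc'
  obtain ⟨α, hα, ε, hε, hl⟩ := CliffordFamily.exists_intertwiner (n := 12) (d := 64) (by decide)
    (by norm_num) h2 hc hc' (fun i => neg_ne_zero.2
      (mul_ne_zero (div_ne_zero (hn _) h2) (div_ne_zero (hn _) h2))) hM hM'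
  have hε2 : ε * ε = 1 := by rcases hε with rfl | rfl <;> ring
  let w : Fin 14 → Fˣ := Function.update 1 (Fin.last 13) ⟨ε, ε, hε2, hε2⟩
  have hw₁ : ∀ i, i ≠ Fin.last 13 → w i = 1 := fun i hi => Function.update_of_ne hi _ _
  have hw : ∀ i, (w i : F) * w i = 1 := by
    intro i
    by_cases hi : i = Fin.last 13
    · subst hi; simp [w, hε2]
    · simp [hw₁ i hi]
  let f := e.unitsSMul w
  have hf : ∀ i, f i = (w i : F) • e i := fun i => Module.Basis.unitsSMul_apply i
  have hff : ∀ i j, B (f i) (f j) = w i * w j * B (e i) (e j) := by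
    intro i j
    simp only [hf, map_smul, LinearMap.smul_apply, smul_eq_mul]
    ring
  have hoff : ∀ i j, i ≠ j → B (f i) (f j) = 0 := fun i j hij => by
    rw [hff, he i j hij, mul_zero]
  have hdiag : ∀ i, B (f i) (f i) = B (e i) (e i) := fun i => by rw [hff, hw, one_mul]
  have hB' : ∀ i, B' (e' i) (e' i) = B (f i) (f i) := fun i => by rw [hB, hdiag]
  refine ⟨e'.equiv f (Equiv.refl _), α, ?_, ?_⟩
  · have key : B.compl₁₂ (e'.equiv f (Equiv.refl _)).toLinearMap
        (e'.equiv f (Equiv.refl _)).toLinearMap = B' := by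
      refine e'.ext fun i => e'.ext fun j => ?_
      rw [LinearMap.compl₁₂_apply, LinearEquiv.coe_coe, Module.Basis.equiv_apply,
        Module.Basis.equiv_apply]
      by_cases hij : i = j
      · subst hij; exact (hB' i).symm
      · rw [he' i j hij]; exact hoff i j hij
    exact fun u v => LinearMap.congr_fun₂ key u v
  · refine h.intertwine h2 h' f e' hoff he' hB' (by rw [hdiag]; exact hn 0) α.toLinearMap ?_
    intro i x
    have h0 : f 0 = e 0 := by rw [hf]; simp [w]
    induction i using Fin.lastCases with
    | last =>
      have : f (Fin.last 12).succ = ε • e (Fin.last 12).succ := by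
        rw [hf]; congr 1
      rw [h0, this, map_smul]
      exact hl x
    | cast i =>
      have : f i.castSucc.succ = e i.castSucc.succ := by
        have : i.castSucc.succ ≠ Fin.last 13 := by
          intro h
          have := congrArg Fin.val h
          simp at this
          omega
        rw [hf, hw₁ _ this]; simp
      rw [h0, this]
      exact hα i x

end HalfSpin

namespace SpinModel

variable {k F S M S' M' : Type*} [Field k] [Field F] [Algebra k F] [AddCommGroup S] [Module F S]
  [AddCommGroup M] [Module F M] [AddCommGroup S'] [Module k S'] [AddCommGroup M'] [Module k M']

lemma fierz_of_dual (D : SpinModel F S M) {ι : Type*} [Fintype ι] {c c' : ι → S}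
    (h : DualFamilies D.B c c') (x y z : M) : (2 : F) • D.V x y z =
      ∑ i, ∑ j, D.pair (D.E (c i) (c j) x) y • D.E (c' j) (c' i) z - (3 * D.pair x y) • z := by
  have h₁ : ∀ u u' : S, ∑ j, D.pair (D.E u (D.b j) x) y • D.E (D.b' j) u' z =
      ∑ j, D.pair (D.E u (c j) x) y • D.E (c' j) u' z := fun u u' =>
    D.dual.sum_eq D.symm h (LinearMap.mk₂ F (fun v v' => D.pair (D.E u v x) y • D.E v' u' z)
      (by intros; simp [E, add_smul]) (by intros; simp [E, smul_smul])
      (by intros; simp [E]) (by intros; simp [E, smul_smul, mul_comm]))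
  have h₂ : ∀ v v' : S, ∑ i, D.pair (D.E (D.b i) v x) y • D.E v' (D.b' i) z =
      ∑ i, D.pair (D.E (c i) v x) y • D.E v' (c' i) z := fun v v' =>
    D.dual.sum_eq D.symm h (LinearMap.mk₂ F (fun u u' => D.pair (D.E u v x) y • D.E v' u' z)
      (by intros; simp [E, add_smul]) (by intros; simp [E, smul_smul])
      (by intros; simp [E]) (by intros; simp [E, smul_smul, mul_comm]))
  have := D.fierz x y z
  simp only [← E.eq_1] at this
  rw [this]
  simp only [h₁]
  rw [Finset.sum_comm]
  simp only [h₂]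
  rw [Finset.sum_comm]

/-- Semilinear maps intertwining the half-spin maps up to a scalar intertwine the operators `V`. -/
theorem V_transport (D' : SpinModel k S' M') (D : SpinModel F S M) (h2 : (2 : F) ≠ 0)
    (γ : S' →ₛₗ[algebraMap k F] S) (hγ : ∀ s, s ∈ Submodule.span F (Set.range γ)) {l : F}
    (hl : l ≠ 0) (hB : ∀ u v, D.B (γ u) (γ v) = l * algebraMap k F (D'.B u v))
    (a : M' →ₛₗ[algebraMap k F] M) (hE : ∀ u v x, D.E (γ u) (γ v) (a x) = l • a (D'.E u v x))
    {y : M'} {w : M} (hw : ∀ x, D.pair (a x) w = algebraMap k F (D'.pair x y)) (x z : M') :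
    D.V (a x) w (a z) = a (D'.V x y z) := by
  have hd : DualFamilies D.B (fun i => γ (D'.b i)) (fun i => l⁻¹ • γ (D'.b' i)) := by
    constructor
    · intro s
      induction hγ s using Submodule.span_induction with
      | mem s hs =>
        obtain ⟨u, rfl⟩ := hs
        conv_rhs => rw [← D'.dual.sum_left u]
        simp [hB, hl, map_sum]
      | zero => simp
      | add s t _ _ hs ht =>
        conv_rhs => rw [← hs, ← ht]
        simp [add_smul, mul_add, Finset.sum_add_distrib]
      | smul r s _ hs =>
        conv_rhs => rw [← hs]
        simp [Finset.smul_sum, smul_smul, mul_left_comm]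
    · intro s
      induction hγ s using Submodule.span_induction with
      | mem s hs =>
        obtain ⟨u, rfl⟩ := hs
        conv_rhs => rw [← D'.dual.sum_right u]
        simp [hB, hl, map_sum, smul_smul, mul_right_comm l]
      | zero => simp
      | add s t _ _ hs ht =>
        conv_rhs => rw [← hs, ← ht]
        simp [add_smul, Finset.sum_add_distrib]
      | smul r s _ hs =>
        conv_rhs => rw [← hs]
        simp [Finset.smul_sum, smul_smul, mul_assoc]
  have h₁ := D.fierz_of_dual hd (a x) w (a z)
  have h₂ := congrArg a (D'.fierz_of_dual D'.dual x y z)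
  have hl' : ∀ u v, D.E (l⁻¹ • γ u) (l⁻¹ • γ v) (a z) = l⁻¹ • a (D'.E u v z) := by
    intro u v
    have : D.E (l⁻¹ • γ u) (l⁻¹ • γ v) (a z) = l⁻¹ • l⁻¹ • D.E (γ u) (γ v) (a z) := by
      simp [E]
    rw [this, hE, inv_smul_smul₀ hl]
  apply smul_right_injective M h2
  simp only [map_smulₛₗ, map_sub, map_sum, map_ofNat, map_mul] at h₂
  change (2 : F) • _ = (2 : F) • _
  rw [h₁, h₂]
  simp only [hE, hl', hw, map_smul, LinearMap.smul_apply, smul_smul, smul_eq_mul]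
  congr 1
  refine Finset.sum_congr rfl fun i _ => Finset.sum_congr rfl fun j _ => ?_
  rw [mul_right_comm, mul_inv_cancel₀ hl, one_mul]

end SpinModel

section ProductAlgebra

open CompositionAlgebra

namespace AlgebraWithInvolution

variable {k : Type u} [CommRing k] (A : AlgebraWithInvolution k) {S : Type u} [CommRing S]
  [Algebra k S]

/-- Pure tensors in a scalar extension. -/
def bc (c : S) (a : A) : A.baseChange S := (c ⊗ₜ a : S ⊗[k] A.carrier)

lemma bc_add (c : S) (a b : A) : A.bc c (a + b) = A.bc c a + A.bc c b :=
  TensorProduct.tmul_add c a b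

lemma bc_smul (c : S) (d : k) (a : A) : A.bc c (d • a) = algebraMap k S d • A.bc c a :=
  (TensorProduct.tmul_smul d c a).trans (algebraMap_smul S d (c ⊗ₜ a : S ⊗[k] A.carrier)).symm

lemma smul_bc (c d : S) (a : A) : c • A.bc d a = A.bc (c * d) a :=
  TensorProduct.smul_tmul' c d a

lemma bc_mul (a b : A) : A.bc (1 : S) (a * b) = A.bc 1 a * A.bc 1 b :=
  ((Algebra.TensorProduct.tmul_mul_tmul (1 : S) 1 a b).trans (by rw [mul_one]; rfl)).symm

lemma bc_invol (c : S) (a : A) : A.bc c (A.invol a) = (A.baseChange S).invol (A.bc c a) := rfl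

lemma bc_ind {p : A.baseChange S → Prop} (h0 : p 0) (hs : ∀ (c : S) a, p (c • A.bc 1 a))
    (ha : ∀ x y, p x → p y → p (x + y)) (x : A.baseChange S) : p x :=
  TensorProduct.induction_on (motive := p) x h0 (fun c a => by
    have := hs c a
    rwa [smul_bc, mul_one] at this) ha

end AlgebraWithInvolution

namespace ProductAlgebraSplitting

variable {k : Type u} [Field k] {A : AlgebraWithInvolution k} {m₁ m₂ : ℕ}
  (P : ProductAlgebraSplitting A m₁ m₂)

/-- The embedding of `A` in its split form. -/
noncomputable def J : A →ₛₗ[algebraMap k P.K] T P.C₁ P.C₂ where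
  toFun a := P.iso.toLinearEquiv (A.bc 1 a)
  map_add' a b := by rw [A.bc_add, map_add]
  map_smul' c a := by rw [A.bc_smul, map_smul]

lemma J_apply (a : A) : P.J a = P.iso.toLinearEquiv (A.bc 1 a) := rfl

lemma J_mul (a b : A) : P.J (a * b) = P.J a * P.J b := by
  rw [J_apply, J_apply, J_apply, ← P.iso.map_mul, A.bc_mul]

lemma J_one : P.J 1 = 1 := P.iso.map_one

lemma J_invol (a : A) : P.J (A.invol a) = (T P.C₁ P.C₂).invol (P.J a) := by
  rw [J_apply, J_apply, A.bc_invol, P.iso.map_invol]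

lemma J_Vop (x y z : A) : P.J (A.Vop x y z) = (T P.C₁ P.C₂).Vop (P.J x) (P.J y) (P.J z) := by
  simp only [AlgebraWithInvolution.Vop, map_add, map_sub, J_mul, J_invol]

lemma J_ind {p : T P.C₁ P.C₂ → Prop} (h0 : p 0) (hJ : ∀ (c : P.K) a, p (c • P.J a))
    (ha : ∀ x y, p x → p y → p (x + y)) (x : T P.C₁ P.C₂) : p x := by
  obtain ⟨y, rfl⟩ := P.iso.toLinearEquiv.surjective x
  induction y using A.bc_ind with
  | h0 => rwa [map_zero]
  | hs c a =>
    rw [map_smul]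
    exact hJ c a
  | ha x y hx hy =>
    rw [map_add]
    exact ha _ _ hx hy

/-- The projection of the split form to `A` induced by a linear form on the splitting field. -/
noncomputable def ret (r : P.K →ₗ[k] k) : T P.C₁ P.C₂ →+ A :=
  ((TensorProduct.lid k A.carrier).toLinearMap.toAddMonoidHom.comp
    (r.rTensor A.carrier).toAddMonoidHom).comp P.iso.toLinearEquiv.symm.toLinearMap.toAddMonoidHom

lemma ret_smul_J (r : P.K →ₗ[k] k) (c : P.K) (a : A) : P.ret r (c • P.J a) = r c • a := by
  have h : P.iso.toLinearEquiv.symm (c • P.J a) = A.bc c a := by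
    rw [map_smul, J_apply, LinearEquiv.symm_apply_apply, A.smul_bc, mul_one]
  have h' : P.ret r (c • P.J a) = TensorProduct.lid k A.carrier
    (r.rTensor A.carrier (P.iso.toLinearEquiv.symm (c • P.J a))) := rfl
  rw [h', h]
  rfl

lemma exists_retraction : ∃ r : P.K →ₗ[k] k, r 1 = 1 := by
  obtain ⟨g, hg⟩ := LinearMap.exists_leftInverse_of_injective (Algebra.linearMap k P.K)
    (LinearMap.ker_eq_bot.2 (algebraMap k P.K).injective)
  exact ⟨g, by simpa using LinearMap.congr_fun hg 1⟩

/-- A chosen linear form mapping `1` to `1`. -/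
noncomputable def r : P.K →ₗ[k] k := P.exists_retraction.choose

lemma r_one : P.r 1 = 1 := P.exists_retraction.choose_spec

lemma ret_J (a : A) : P.ret P.r (P.J a) = a := by
  have := P.ret_smul_J P.r 1 a
  rwa [one_smul, r_one, one_smul] at this

lemma J_injective : Function.Injective P.J := fun a b h => by
  rw [← P.ret_J a, h, P.ret_J]

lemma ret_mul_J (r : P.K →ₗ[k] k) (X : T P.C₁ P.C₂) (a : A) :
    P.ret r (X * P.J a) = P.ret r X * a := by
  induction X using P.J_ind with
  | h0 => simp
  | hJ c b => rw [smul_mul_assoc, ← P.J_mul, ret_smul_J, ret_smul_J, smul_mul_assoc]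
  | ha x y hx hy => rw [add_mul, map_add, map_add, hx, hy, add_mul]

lemma ret_J_mul (r : P.K →ₗ[k] k) (X : T P.C₁ P.C₂) (a : A) :
    P.ret r (P.J a * X) = a * P.ret r X := by
  induction X using P.J_ind with
  | h0 => simp
  | hJ c b => rw [mul_smul_comm, ← P.J_mul, ret_smul_J, ret_smul_J, mul_smul_comm]
  | ha x y hx hy => rw [mul_add, map_add, map_add, hx, hy, mul_add]

lemma ret_invol (r : P.K →ₗ[k] k) (X : T P.C₁ P.C₂) :
    P.ret r ((T P.C₁ P.C₂).invol X) = A.invol (P.ret r X) := by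
  induction X using P.J_ind with
  | h0 => simp
  | hJ c b => rw [map_smul, ← P.J_invol, ret_smul_J, ret_smul_J, map_smul]
  | ha x y hx hy => rw [map_add, map_add, hx, hy, map_add, map_add]

lemma ret_Vop (r : P.K →ₗ[k] k) (x z : A) (Y : T P.C₁ P.C₂) :
    P.ret r ((T P.C₁ P.C₂).Vop (P.J x) Y (P.J z)) = A.Vop x (P.ret r Y) z := by
  simp only [AlgebraWithInvolution.Vop, map_add, map_sub, ret_mul_J, ret_J_mul, ret_invol,
    ← J_invol, ← J_mul]

lemma conjInvertible_of_J {x : A} {Y : T P.C₁ P.C₂}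
    (h : ∀ Z, (T P.C₁ P.C₂).Vop (P.J x) Y Z = Z) : A.ConjInvertible x :=
  ⟨P.ret P.r Y, fun z => by rw [← P.ret_Vop, h, P.ret_J]⟩

lemma Vop_J_eq {x y : A} (h : ∀ z, A.Vop x y z = z) (Z : T P.C₁ P.C₂) :
    (T P.C₁ P.C₂).Vop (P.J x) (P.J y) Z = Z := by
  induction Z using P.J_ind with
  | h0 => rw [← AlgebraWithInvolution.VLin_apply, map_zero]
  | hJ c a => rw [← AlgebraWithInvolution.VLin_apply, map_smul,
      AlgebraWithInvolution.VLin_apply, ← P.J_Vop, h]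
  | ha x y hx hy =>
    rw [← AlgebraWithInvolution.VLin_apply, map_add, AlgebraWithInvolution.VLin_apply,
      AlgebraWithInvolution.VLin_apply, hx, hy]

lemma mem_of_J_mem_span {V : Submodule k A} {a : A}
    (h : P.J a ∈ Submodule.span P.K (P.J '' V)) : a ∈ V := by
  have key : ∀ r : P.K →ₗ[k] k, ∀ X ∈ Submodule.span P.K (P.J '' V), ∀ c : P.K,
      P.ret r (c • X) ∈ V := by
    intro r X hX
    induction hX using Submodule.span_induction with
    | mem X hX =>
      obtain ⟨v, hv, rfl⟩ := hX
      intro c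
      rw [ret_smul_J]
      exact V.smul_mem _ hv
    | zero => simp
    | add x y _ _ hx hy =>
      intro c
      rw [smul_add, map_add]
      exact V.add_mem (hx c) (hy c)
    | smul d x _ hx =>
      intro c
      rw [smul_smul]
      exact hx _
  have := key P.r _ h 1
  rwa [one_smul, P.ret_J] at this

lemma linearIndependent_J {ι : Type*} {v : ι → A} (hv : LinearIndependent k v) :
    LinearIndependent P.K fun i => P.J (v i) := by
  rw [linearIndependent_iff'] at hv ⊢
  intro s g hg i hi
  rw [← Module.forall_dual_apply_eq_zero_iff k]
  intro r
  refine hv s (fun i => r (g i)) ?_ i hi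
  rw [← map_zero (P.ret r), ← hg, map_sum]
  exact Finset.sum_congr rfl fun i _ => (P.ret_smul_J r _ _).symm

lemma finrank_eq (P : ProductAlgebraSplitting A m₁ m₂) : Module.finrank k A.carrier = m₁ * m₂ := by
  rw [← Module.finrank_baseChange (R := P.K)]
  exact P.iso.toLinearEquiv.finrank_eq.trans
    ((Module.finrank_tensorProduct (R := P.K) (S := P.K)).trans (congrArg₂ _ P.finrank₁ P.finrank₂))

end ProductAlgebraSplitting

namespace ProductAlgebraSplitting

variable {k : Type u} [Field k] {A : AlgebraWithInvolution k}
  (P : ProductAlgebraSplitting A 8 8)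

/-- The spin model of the split form. -/
noncomputable def D (h2 : (2 : P.K) ≠ 0) : SpinModel P.K (P.C₁.pure × P.C₂.pure) (T P.C₁ P.C₂) :=
  model h2 P.finrank₁ P.finrank₂

lemma two_ne (h2 : (2 : k) ≠ 0) : (2 : P.K) ≠ 0 := by
  have := (map_ne_zero (algebraMap k P.K)).2 h2
  rwa [map_ofNat] at this

lemma three_ne (h3 : (3 : k) ≠ 0) : (3 : P.K) ≠ 0 := by
  have := (map_ne_zero (algebraMap k P.K)).2 h3
  rwa [map_ofNat] at this

lemma exists_sk (h2 : (2 : P.K) ≠ 0) (X : T P.C₁ P.C₂) :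
    ∃ u, sk P.C₁ P.C₂ u = (2 : P.K)⁻¹ • (X - (T P.C₁ P.C₂).invol X) := by
  obtain ⟨e⟩ := P.C₁.exists_pureBasis h2 P.finrank₁
  obtain ⟨f⟩ := P.C₂.exists_pureBasis h2 P.finrank₂
  refine ⟨(2 : P.K)⁻¹ • skPsi e f X 1, ?_⟩
  rw [map_smul, sk_skPsi e f h2, AlgebraWithInvolution.invol_one, mul_one, one_mul]

lemma half_sub_neg {F M : Type*} [Field F] [AddCommGroup M] [Module F M] (h2 : (2 : F) ≠ 0) (x : M) :
    (2 : F)⁻¹ • (x - -x) = x := by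
  rw [sub_neg_eq_add, ← two_smul F x, smul_smul, inv_mul_cancel₀ h2, one_smul]

/-- The pair of pure elements underlying a skew element. -/
theorem exists_p (h2 : (2 : P.K) ≠ 0) :
    ∃ p : A.skew →ₛₗ[algebraMap k P.K] (P.C₁.pure × P.C₂.pure),
      ∀ s, sk P.C₁ P.C₂ (p s) = P.J s := by
  have h : ∀ s : A.skew, ∃ u, sk P.C₁ P.C₂ u = P.J s := by
    intro s
    obtain ⟨u, hu⟩ := P.exists_sk h2 (P.J s)
    refine ⟨u, ?_⟩
    rw [hu, ← P.J_invol, show A.invol s = -(s : A.carrier) from s.2, map_neg, half_sub_neg h2]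
  choose p hp using h
  have inj : ∀ u v, sk P.C₁ P.C₂ u = sk P.C₁ P.C₂ v → u = v := by
    intro u v huv
    exact sub_eq_zero.1 (sk_inj h2 _ (by rw [map_sub, huv, sub_self]))
  refine ⟨⟨⟨p, fun s t => inj _ _ ?_⟩, fun a s => inj _ _ ?_⟩, hp⟩
  · rw [map_add, hp, hp, hp, ← map_add]
    rfl
  · change sk P.C₁ P.C₂ (p (a • s)) = _
    rw [map_smul, hp, hp, ← map_smulₛₗ]
    rfl

/-- Among the multiples of a scalar by elements of the prime field, at least two avoid the roots of
a quadratic polynomial. -/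
lemma exists_two_nonroots (h2 : (2 : k) ≠ 0) (h3 : (3 : k) ≠ 0) {K : Type*} [Field K] [Algebra k K]
    (x y z : K) (hz : z ≠ 0) : ∃ a b : k, a ≠ b ∧
      x + algebraMap k K a * y + algebraMap k K a ^ 2 * z ≠ 0 ∧
      x + algebraMap k K b * y + algebraMap k K b ^ 2 * z ≠ 0 := by
  have key : ∀ a b c : k, a ≠ b → a ≠ c → b ≠ c →
      ∃ d, (d = a ∨ d = b ∨ d = c) ∧
        x + algebraMap k K d * y + algebraMap k K d ^ 2 * z ≠ 0 := by
    intro a b c hab hac hbc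
    by_contra! h
    have ha := h a (by simp)
    have hb := h b (by simp)
    have hc := h c (by simp)
    have hab' := sub_ne_zero.2 ((algebraMap k K).injective.ne hab)
    have hac' := sub_ne_zero.2 ((algebraMap k K).injective.ne hac)
    have hbc' := sub_ne_zero.2 ((algebraMap k K).injective.ne hbc)
    refine mul_ne_zero (mul_ne_zero (mul_ne_zero hab' hac') hbc') hz ?_
    linear_combination (algebraMap k K b - algebraMap k K c) * ha -
      (algebraMap k K a - algebraMap k K c) * hb + (algebraMap k K a - algebraMap k K b) * hc
  have h10 : (1 : k) ≠ 0 := one_ne_zero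
  have h1 : (-1 : k) ≠ 1 := fun h => h2 (by linear_combination -h)
  have h4 : (2 : k) ≠ 1 := fun h => h10 (by linear_combination h)
  have h5 : (2 : k) ≠ -1 := fun h => h3 (by linear_combination h)
  have h6 : (-1 : k) ≠ 0 := neg_ne_zero.2 h10
  obtain ⟨a, ha, ha'⟩ := key 0 1 (-1) h10.symm h6.symm h1.symm
  rcases ha with rfl | rfl | rfl
  · obtain ⟨b, hb, hb'⟩ := key 2 1 (-1) h4 h5 h1.symm
    exact ⟨0, b, by rcases hb with rfl | rfl | rfl <;> simp [h2.symm], ha', hb'⟩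
  · obtain ⟨b, hb, hb'⟩ := key 2 0 (-1) h2 h5 h6.symm
    exact ⟨1, b, by rcases hb with rfl | rfl | rfl <;> simp [h4.symm, h1.symm], ha', hb'⟩
  · obtain ⟨b, hb, hb'⟩ := key 2 0 1 h2 h4 h10.symm
    exact ⟨-1, b, by rcases hb with rfl | rfl | rfl <;> simp [h5.symm, h1, h6], ha', hb'⟩

/-- The Albert form and its companion map, expressed in the split form. -/
structure SkewData (Φ : AlbertForm A) where
  h2 : (2 : k) ≠ 0
  h3 : (3 : k) ≠ 0
  p : A.skew →ₛₗ[algebraMap k P.K] (P.C₁.pure × P.C₂.pure)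
  sk_p : ∀ s, sk P.C₁ P.C₂ (p s) = P.J s
  c : P.K
  c_ne : c ≠ 0
  δ : k
  c_sq : c * c = algebraMap k P.K δ
  p_nat : ∀ s, p (Φ.natMap s) = c • flip2 P.C₁ P.C₂ (p s)

lemma p_span (h2 : (2 : P.K) ≠ 0) (p : A.skew →ₛₗ[algebraMap k P.K] (P.C₁.pure × P.C₂.pure))
    (hp : ∀ s, sk P.C₁ P.C₂ (p s) = P.J s) (u : P.C₁.pure × P.C₂.pure) :
    u ∈ Submodule.span P.K (Set.range p) := by
  have key : ∀ X : T P.C₁ P.C₂, (2 : P.K)⁻¹ • (X - (T P.C₁ P.C₂).invol X) ∈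
      (Submodule.span P.K (Set.range p)).map (sk P.C₁ P.C₂) := by
    intro X
    induction X using P.J_ind with
    | h0 => simp
    | hJ c a =>
      have hs : A.invol (a - A.invol a) = -(a - A.invol a) := by
        rw [map_sub, A.invol_invol, neg_sub]
      refine ⟨((2 : P.K)⁻¹ * c) • p ⟨a - A.invol a, hs⟩,
        Submodule.smul_mem _ _ (Submodule.subset_span ⟨_, rfl⟩), ?_⟩
      rw [map_smul, hp, map_smul, ← P.J_invol, ← smul_sub, mul_smul, ← map_sub]
    | ha x y hx hy =>
      rw [map_add, add_sub_add_comm, smul_add]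
      exact Submodule.add_mem _ hx hy
  obtain ⟨v, hv, hvu⟩ := key (sk P.C₁ P.C₂ u)
  rw [invol_sk, half_sub_neg h2] at hvu
  have : v = u := sub_eq_zero.1 (sk_inj h2 _ (by rw [map_sub, hvu, sub_self]))
  rwa [← this]

theorem exists_skewData (h2 : (2 : k) ≠ 0) (h3 : (3 : k) ≠ 0) (Φ : AlbertForm A) :
    Nonempty (P.SkewData Φ) := by
  have h2K := P.two_ne h2
  obtain ⟨p, hp⟩ := P.exists_p h2K
  set Bp := albertBil P.C₁ P.C₂ with hBp
  have hBsymm : ∀ u v, Bp u v = Bp v u := (P.D h2K).symm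
  have hsq : ∀ u x, mL P.C₁ P.C₂ u (mL P.C₁ P.C₂ (flip2 P.C₁ P.C₂ u) x) =
      (-(2 : P.K)⁻¹ * Bp u u) • x := by
    intro u x
    have h := mL_rel u u x
    rw [← two_smul P.K] at h
    rw [mul_comm, mul_neg, ← neg_mul, mul_comm, mul_smul, ← h, smul_smul, inv_mul_cancel₀ h2K,
      one_smul]
  have hflip : ∀ u, flip2 P.C₁ P.C₂ (flip2 P.C₁ P.C₂ u) = u := by
    intro u
    simp [flip2_apply]
  have hBf : ∀ u v, Bp (flip2 P.C₁ P.C₂ u) (flip2 P.C₁ P.C₂ v) = Bp u v := by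
    intro u v
    simp [hBp, albertBil_apply, flip2_apply]
  have hnat : ∀ (s : A.skew) X, mL P.C₁ P.C₂ (p s) (mL P.C₁ P.C₂ (p (Φ.natMap s)) X) =
      -(algebraMap k P.K (Φ.Q s)) • X := by
    intro s X
    induction X using P.J_ind with
    | h0 => simp
    | hJ c a =>
      rw [map_smul, map_smul, mL_apply, mL_apply, hp, hp, ← P.J_mul, ← P.J_mul, Φ.mul_natMap,
        map_smulₛₗ, map_neg, smul_comm]
    | ha x y hx hy => rw [map_add, map_add, hx, hy, smul_add]
  have minj : ∀ u v, (∀ X, mL P.C₁ P.C₂ u X = mL P.C₁ P.C₂ v X) → u = v := fun u v h =>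
    (P.D h2K).m_inj (LinearMap.ext h)
  have hγ : ∀ s : A.skew, Bp (p s) (p s) ≠ 0 →
      ∃ γ : P.K, p (Φ.natMap s) = γ • flip2 P.C₁ P.C₂ (p s) := by
    intro s hs
    refine ⟨2 * (Bp (p s) (p s))⁻¹ * algebraMap k P.K (Φ.Q s), minj _ _ fun X => ?_⟩
    have h := congrArg (mL P.C₁ P.C₂ (flip2 P.C₁ P.C₂ (p s))) (hnat s X)
    have h' := hsq (flip2 P.C₁ P.C₂ (p s)) (mL P.C₁ P.C₂ (p (Φ.natMap s)) X)
    rw [hflip, hBf] at h'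
    rw [h', map_smul] at h
    have h'' := congrArg (fun Y => (-2 * (Bp (p s) (p s))⁻¹) • Y) h
    simp only [smul_smul] at h''
    have e : -2 * (Bp (p s) (p s))⁻¹ * (-(2 : P.K)⁻¹ * Bp (p s) (p s)) = 1 := by
      field_simp
    rw [e, one_smul] at h''
    rw [h'', map_smul, LinearMap.smul_apply]
    congr 1
    ring
  have hspan := P.p_span h2K p hp
  obtain ⟨s₀, hs₀⟩ : ∃ s₀ : A.skew, Bp (p s₀) (p s₀) ≠ 0 := by
    by_contra! h
    have h1 : ∀ s t, Bp (p s) (p t) = 0 := by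
      intro s t
      have := h (s + t)
      rw [map_add, map_add, map_add, LinearMap.add_apply, LinearMap.add_apply, h s, h t,
        hBsymm (p t) (p s)] at this
      have h4 : 2 * Bp (p s) (p t) = 0 := by linear_combination this
      exact (mul_eq_zero.1 h4).resolve_left h2K
    have h2' : ∀ u v, Bp u v = 0 := by
      have h5 : ∀ t u, Bp u (p t) = 0 := by
        intro t u
        have : Submodule.span P.K (Set.range p) ≤ LinearMap.ker (Bp.flip (p t)) := by
          rw [Submodule.span_le]
          rintro _ ⟨s, rfl⟩
          exact h1 s t
        exact this (hspan u)
      intro u v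
      have : Submodule.span P.K (Set.range p) ≤ LinearMap.ker (Bp u) := by
        rw [Submodule.span_le]
        rintro _ ⟨s, rfl⟩
        exact h5 s u
      exact this (hspan v)
    exact one_ne_zero (((P.D h2K).dual_one 0).symm.trans (h2' _ _))
  obtain ⟨c, hc⟩ := hγ s₀ hs₀
  have hps₀ : p s₀ ≠ 0 := by
    intro h
    exact hs₀ (by rw [h, map_zero])
  have hall : ∀ t : A.skew, p (Φ.natMap t) = c • flip2 P.C₁ P.C₂ (p t) := by
    intro t
    have hev : ∀ a : k, Bp (p t) (p t) + algebraMap k P.K a * (2 * Bp (p t) (p s₀)) +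
        algebraMap k P.K a ^ 2 * Bp (p s₀) (p s₀) ≠ 0 →
        ∃ γ, p (Φ.natMap t) + (algebraMap k P.K a * c) • flip2 P.C₁ P.C₂ (p s₀) =
          γ • flip2 P.C₁ P.C₂ (p t) + (γ * algebraMap k P.K a) • flip2 P.C₁ P.C₂ (p s₀) := by
      intro a ha
      obtain ⟨γ, h⟩ := hγ (t + a • s₀) (by
        convert ha using 1
        simp only [map_add, map_smulₛₗ, LinearMap.add_apply, LinearMap.smul_apply, smul_eq_mul,
          RingHom.id_apply, hBsymm (p s₀) (p t)]
        ring)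
      refine ⟨γ, ?_⟩
      rw [map_add, map_add, map_smul, map_smulₛₗ, hc, map_add, map_smulₛₗ, map_add, map_smul,
        smul_add, smul_smul, smul_smul] at h
      exact h
    obtain ⟨a, b, hab, ha, hb⟩ := exists_two_nonroots h2 h3 (Bp (p t) (p t))
      (2 * Bp (p t) (p s₀)) _ hs₀
    obtain ⟨γ, hγa⟩ := hev a ha
    obtain ⟨γ', hγb⟩ := hev b hb
    have hab' := sub_ne_zero.2 ((algebraMap k P.K).injective.ne hab)
    by_cases hγγ : γ = γ'
    · subst hγγ
      have h : ((algebraMap k P.K a - algebraMap k P.K b) * (c - γ)) •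
          flip2 P.C₁ P.C₂ (p s₀) = 0 := by
        linear_combination (norm := module) hγa - hγb
      have h0 : flip2 P.C₁ P.C₂ (p s₀) ≠ 0 := fun h => hps₀ (by rw [← hflip (p s₀), h, map_zero])
      have hcγ := ((mul_eq_zero.1 ((smul_eq_zero.1 h).resolve_right h0))).resolve_left hab'
      rw [← sub_eq_zero.1 hcγ] at hγa
      rw [mul_comm] at hγa
      exact add_right_cancel hγa
    · have hne := sub_ne_zero.2 hγγ
      have ht : p t = ((γ - γ')⁻¹ * (algebraMap k P.K a * (c - γ) - algebraMap k P.K b * (c - γ'))) •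
          p s₀ := by
        have h : (γ - γ') • flip2 P.C₁ P.C₂ (p t) =
            (algebraMap k P.K a * (c - γ) - algebraMap k P.K b * (c - γ')) •
              flip2 P.C₁ P.C₂ (p s₀) := by
          linear_combination (norm := module) hγb - hγa
        have h' := congrArg (flip2 P.C₁ P.C₂) h
        rw [map_smul, map_smul, hflip, hflip] at h'
        rw [mul_smul, ← h', smul_smul, inv_mul_cancel₀ hne, one_smul]
      set e := (γ - γ')⁻¹ * (algebraMap k P.K a * (c - γ) - algebraMap k P.K b * (c - γ')) with he
      have hJ : P.J t ∈ Submodule.span P.K (P.J '' (Submodule.span k {(s₀ : A.carrier)})) := by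
        rw [← hp, ht, map_smul, hp]
        exact Submodule.smul_mem _ _ (Submodule.subset_span
          ⟨_, Submodule.mem_span_singleton_self _, rfl⟩)
      obtain ⟨d, hd⟩ := Submodule.mem_span_singleton.1 (P.mem_of_J_mem_span hJ)
      have hd' : t = d • s₀ := Subtype.ext hd.symm
      rw [hd', map_smul, map_smulₛₗ, hc, map_smulₛₗ, map_smul, smul_comm]
  have hc0 : c ≠ 0 := by
    rintro rfl
    have hp0 : ∀ t, p (Φ.natMap t) = 0 := fun t => by rw [hall, zero_smul]
    have hQ : ∀ s, Φ.Q s = 0 := by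
      intro s
      have h := hnat s 1
      rw [hp0, map_zero, LinearMap.zero_apply, map_zero, ← P.J_one, ← map_neg, ← map_smulₛₗ,
        ← map_zero P.J] at h
      have h' := P.J_injective h.symm
      rcases smul_eq_zero.1 h' with h' | h'
      · exact neg_eq_zero.1 h'
      · have h1 : (1 : T P.C₁ P.C₂) = 0 := P.J_one.symm.trans (by rw [h', map_zero])
        refine absurd (minj (p s₀) 0 fun X => ?_) hps₀
        rw [← one_mul X, h1, zero_mul, map_zero, map_zero]
    refine absurd (hQ s₀) ((Φ.nonzero_iff s₀).2 ?_)
    have hfin : FiniteDimensional k A.carrier := Module.finite_of_finrank_pos (by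
      rw [P.finrank_eq]; norm_num)
    let L : A.carrier →ₗ[k] A.carrier := LinearMap.mulLeft k (s₀ : A.carrier)
    have hL : Function.Injective L := by
      rw [← LinearMap.ker_eq_bot, eq_bot_iff]
      intro a ha
      have h : P.J (s₀ * a) = 0 := by
        rw [show (s₀ * a : A.carrier) = 0 from ha, map_zero]
      rw [P.J_mul, ← hp] at h
      have h' := hsq (flip2 P.C₁ P.C₂ (p s₀)) (P.J a)
      rw [hflip, mL_apply (p s₀), h, map_zero, hBf] at h'
      have h'' := (smul_eq_zero.1 h'.symm).resolve_left
        (mul_ne_zero (neg_ne_zero.2 (inv_ne_zero h2K)) hs₀)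
      exact P.J_injective (h''.trans (map_zero P.J).symm)
    exact ⟨hL, LinearMap.injective_iff_surjective.1 hL⟩
  have hcc : c * c = algebraMap k P.K (P.r (c * c)) := by
    have hs₀' : (s₀ : A.carrier) ≠ 0 := by
      intro h
      have : s₀ = 0 := Subtype.ext h
      exact hps₀ (by rw [this, map_zero])
    have h : (c * c) • P.J s₀ = P.J (Φ.natMap (Φ.natMap s₀)) := by
      rw [← hp, ← hp, hall, hall, map_smul (flip2 P.C₁ P.C₂), hflip, smul_smul, map_smul]
    rw [← sub_eq_zero, ← Module.forall_dual_apply_eq_zero_iff k]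
    intro r
    have h1 := congrArg (P.ret r) h
    have h3 := congrArg (P.ret P.r) h
    rw [P.ret_J, ret_smul_J] at h3
    have h5 := P.ret_smul_J r 1 ((Φ.natMap (Φ.natMap s₀) : A.skew) : A.carrier)
    rw [one_smul] at h5
    rw [h5, ret_smul_J, ← h3, smul_smul] at h1
    have h4 := smul_left_injective k hs₀' h1
    rw [map_sub, Algebra.algebraMap_eq_smul_one, map_smul, h4, smul_eq_mul, mul_comm, sub_self]
  exact ⟨⟨h2, h3, p, hp, c, hc0, _, hcc, hall⟩⟩

end ProductAlgebraSplitting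

namespace ProductAlgebraSplitting

variable {k : Type u} [Field k] {A : AlgebraWithInvolution k}
  {P : ProductAlgebraSplitting A 8 8} {Φ : AlbertForm A}

lemma finiteDimensional (P : ProductAlgebraSplitting A 8 8) : FiniteDimensional k A.carrier :=
  Module.finite_of_finrank_pos (by rw [P.finrank_eq]; norm_num)

namespace SkewData

lemma two_ne (G : P.SkewData Φ) : (2 : P.K) ≠ 0 := P.two_ne G.h2

lemma mL_p (G : P.SkewData Φ) (s : A.skew) (X) : mL P.C₁ P.C₂ (G.p s) X = P.J s * X := by
  rw [mL_apply, G.sk_p]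

lemma flip_flip (u : P.C₁.pure × P.C₂.pure) : flip2 P.C₁ P.C₂ (flip2 P.C₁ P.C₂ u) = u := by
  simp [flip2_apply]

lemma p_injective (G : P.SkewData Φ) : Function.Injective G.p := fun s t h => by
  have := congrArg (sk P.C₁ P.C₂) h
  rw [G.sk_p, G.sk_p] at this
  exact Subtype.ext (P.J_injective this)

lemma T_one_ne : (1 : T P.C₁ P.C₂) ≠ 0 := by
  intro h
  have : (Module.finrank P.K (T P.C₁ P.C₂)) = 0 :=
    haveI : FiniteDimensional P.K (T P.C₁ P.C₂) :=
      inferInstanceAs (FiniteDimensional P.K (P.C₁.carrier ⊗[P.K] P.C₂.carrier))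
    Module.finrank_zero_iff.2 ⟨fun X Y => by rw [← one_mul X, ← one_mul Y, h, zero_mul, zero_mul]⟩
  have h' : Module.finrank P.K (T P.C₁ P.C₂) = 64 :=
    (Module.finrank_tensorProduct (R := P.K) (S := P.K) (M := P.C₁.carrier) (M' := P.C₂.carrier)).trans
      (by rw [P.finrank₁, P.finrank₂])
  omega

/-- The polarised identity for the companion map. -/
lemma polar_mul (Φ : AlbertForm A) (s t : A.skew) (a : A) :
    (s : A.carrier) * ((Φ.natMap t : A.carrier) * a) +
      (t : A.carrier) * ((Φ.natMap s : A.carrier) * a) = -QuadraticMap.polar Φ.Q s t • a := by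
  have h := Φ.mul_natMap (s + t) a
  rw [map_add] at h
  simp only [Submodule.coe_add, add_mul, mul_add, Φ.mul_natMap] at h
  rw [QuadraticMap.polar]
  linear_combination (norm := module) h

lemma mL_nat (G : P.SkewData Φ) (s : A.skew) (X) :
    P.J (Φ.natMap s : A.skew) * X = G.c • mL P.C₁ P.C₂ (flip2 P.C₁ P.C₂ (G.p s)) X := by
  rw [← G.mL_p, G.p_nat, map_smul, LinearMap.smul_apply]

lemma map_polar (G : P.SkewData Φ) (s t : A.skew) :
    algebraMap k P.K (QuadraticMap.polar Φ.Q s t) =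
      G.c * albertBil P.C₁ P.C₂ (G.p s) (G.p t) := by
  have h := congrArg P.J (polar_mul Φ s t 1)
  rw [map_add, P.J_mul, P.J_mul, P.J_mul, P.J_mul, G.mL_nat, G.mL_nat, ← G.mL_p, ← G.mL_p,
    map_smul, map_smul, ← smul_add, mL_rel, map_smulₛₗ, P.J_one, smul_smul] at h
  have h' := smul_left_injective P.K T_one_ne h
  rw [map_neg] at h'
  linear_combination h'

lemma two_mul_map (G : P.SkewData Φ) (s : A.skew) :
    2 * algebraMap k P.K (Φ.Q s) = G.c * albertBil P.C₁ P.C₂ (G.p s) (G.p s) := by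
  rw [← G.map_polar, QuadraticMap.polar_self, nsmul_eq_mul, map_mul, Nat.cast_ofNat, map_ofNat]

lemma nat_nat (G : P.SkewData Φ) (s : A.skew) : Φ.natMap (Φ.natMap s) = G.δ • s := by
  apply G.p_injective
  rw [G.p_nat, G.p_nat, map_smul, flip_flip, smul_smul, G.c_sq, map_smulₛₗ]

lemma δ_ne (G : P.SkewData Φ) : G.δ ≠ 0 := by
  intro h
  have := G.c_sq
  rw [h, map_zero] at this
  exact G.c_ne (mul_self_eq_zero.1 this)

lemma polar_nat (G : P.SkewData Φ) (s t : A.skew) : QuadraticMap.polar Φ.Q (Φ.natMap s) (Φ.natMap t) =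
    G.δ * QuadraticMap.polar Φ.Q s t := by
  apply (algebraMap k P.K).injective
  rw [map_mul, ← G.c_sq, G.map_polar, G.map_polar, G.p_nat, G.p_nat]
  simp [albertBil_apply, flip2_apply]
  ring

lemma polar_nat_left (G : P.SkewData Φ) (s t : A.skew) : QuadraticMap.polar Φ.Q (Φ.natMap s) t =
    QuadraticMap.polar Φ.Q s (Φ.natMap t) := by
  apply (algebraMap k P.K).injective
  rw [G.map_polar, G.map_polar, G.p_nat, G.p_nat]
  simp [albertBil_apply, flip2_apply]

lemma Q_nat (G : P.SkewData Φ) (s : A.skew) : Φ.Q (Φ.natMap s) = G.δ * Φ.Q s := by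
  have h := G.polar_nat s s
  rw [QuadraticMap.polar_self, QuadraticMap.polar_self] at h
  apply mul_left_cancel₀ G.h2
  simp only [nsmul_eq_mul, Nat.cast_ofNat] at h
  linear_combination h

/-- The companion identity with the roles of the two factors exchanged. -/
lemma natMap_mul (G : P.SkewData Φ) (s : A.skew) (a : A) :
    (Φ.natMap s : A.carrier) * ((s : A.carrier) * a) = -(Φ.Q s) • a := by
  have h := Φ.mul_natMap (Φ.natMap s) a
  rw [G.nat_nat, G.Q_nat, Submodule.coe_smul, smul_mul_assoc, mul_smul_comm, ← mul_neg,
    mul_smul] at h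
  exact smul_right_injective _ G.δ_ne h

lemma polar_mul' (G : P.SkewData Φ) (s t : A.skew) (a : A) :
    (Φ.natMap s : A.carrier) * ((t : A.carrier) * a) +
      (Φ.natMap t : A.carrier) * ((s : A.carrier) * a) = -QuadraticMap.polar Φ.Q s t • a := by
  have h := G.natMap_mul (s + t) a
  rw [map_add] at h
  simp only [Submodule.coe_add, add_mul, mul_add, G.natMap_mul] at h
  rw [QuadraticMap.polar]
  linear_combination (norm := module) h

/-- A nonzero element that is not conjugate-invertible forces the Albert form to be isotropic. -/
theorem exists_isotropic (G : P.SkewData Φ) {x : A} (hx : x ≠ 0) (hi : ¬ A.ConjInvertible x) :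
    ∃ s : A.skew, s ≠ 0 ∧ Φ.Q s = 0 := by
  by_contra! hQ
  have hfin := P.finiteDimensional
  have hfinT : FiniteDimensional P.K (T P.C₁ P.C₂) :=
    inferInstanceAs (FiniteDimensional P.K (P.C₁.carrier ⊗[P.K] P.C₂.carrier))
  have h1 : P.J x ∈ Submodule.span P.K {z | ∃ u v, z = (P.D G.two_ne).E u v (P.J x) -
      (P.D G.two_ne).E v u (P.J x)} := by
    by_contra h
    obtain ⟨y, hy⟩ := (P.D G.two_ne).exists_inv G.two_ne h
    exact hi (P.conjInvertible_of_J hy)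
  set V : Submodule k A.carrier := Submodule.span k
    {z | ∃ s t : A.skew, z = (s : A.carrier) * ((Φ.natMap t : A.carrier) * x) -
      (t : A.carrier) * ((Φ.natMap s : A.carrier) * x)} with hV
  have h2 : P.J x ∈ Submodule.span P.K (P.J '' V) := by
    refine Submodule.span_le.2 ?_ h1
    rintro _ ⟨u, v, rfl⟩
    have hE : ∀ s t : A.skew, mL P.C₁ P.C₂ (G.p s) (mL P.C₁ P.C₂ (flip2 P.C₁ P.C₂ (G.p t)) (P.J x)) =
        G.c⁻¹ • P.J ((s : A.carrier) * ((Φ.natMap t : A.carrier) * x)) := by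
      intro s t
      rw [P.J_mul, P.J_mul, G.mL_nat, mul_smul_comm, G.mL_p, smul_smul, inv_mul_cancel₀ G.c_ne,
        one_smul]
    have hs := P.p_span G.two_ne G.p G.sk_p
    induction hs u using Submodule.span_induction with
    | zero => simp [SpinModel.E]
    | add u u' _ _ hu hu' =>
      simp only [SpinModel.E, map_add, LinearMap.add_apply, SetLike.mem_coe] at hu hu' ⊢
      rw [add_sub_add_comm]
      exact add_mem hu hu'
    | smul c u _ hu =>
      simp only [SpinModel.E, map_smul, LinearMap.smul_apply, SetLike.mem_coe] at hu ⊢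
      rw [← smul_sub]
      exact Submodule.smul_mem _ _ hu
    | mem u hu =>
      obtain ⟨s, rfl⟩ := hu
      induction hs v using Submodule.span_induction with
      | zero => simp [SpinModel.E]
      | add u u' _ _ hu hu' =>
        simp only [SpinModel.E, map_add, LinearMap.add_apply, SetLike.mem_coe] at hu hu' ⊢
        rw [add_sub_add_comm]
        exact add_mem hu hu'
      | smul c u _ hu =>
        simp only [SpinModel.E, map_smul, LinearMap.smul_apply, SetLike.mem_coe] at hu ⊢
        rw [← smul_sub]
        exact Submodule.smul_mem _ _ hu
      | mem u hu =>
        obtain ⟨t, rfl⟩ := hu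
        change mL P.C₁ P.C₂ (G.p s) (mL P.C₁ P.C₂ (flip2 P.C₁ P.C₂ (G.p t)) (P.J x)) -
          mL P.C₁ P.C₂ (G.p t) (mL P.C₁ P.C₂ (flip2 P.C₁ P.C₂ (G.p s)) (P.J x)) ∈ _
        rw [hE, hE, ← smul_sub, ← map_sub]
        exact Submodule.smul_mem _ _ (Submodule.subset_span
          ⟨_, Submodule.subset_span ⟨s, t, rfl⟩, rfl⟩)
  have hxV := P.mem_of_J_mem_span h2
  let lm : A.skew →ₗ[k] A.carrier →ₗ[k] A.carrier := (LinearMap.mul k A.carrier).comp A.skew.subtype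
  let κ : A.skew →ₗ[k] Module.End k (A.carrier × A.carrier) :=
    LinearMap.mk₂ k (fun s z => (lm s z.2, -lm (Φ.natMap s) z.1))
      (fun s t z => by simp [add_comm]) (fun c s z => by simp)
      (fun s y z => by simp [add_comm]) (fun c s z => by simp)
  have hκ : ∀ s z, κ s z = ((s : A.carrier) * z.2, -((Φ.natMap s : A.carrier) * z.1)) :=
    fun s z => rfl
  have key := eq_zero_of_mem_span_commutators G.h2 (QuadraticMap.polarBilin Φ.Q)
    (fun u v => QuadraticMap.polar_comm _ _ _)
    (fun u hu => by
      by_contra hne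
      rw [QuadraticMap.polarBilin_apply_apply, QuadraticMap.polar_self] at hu
      simp only [nsmul_eq_mul, Nat.cast_ofNat] at hu
      exact hQ u hne ((mul_eq_zero.1 hu).resolve_left G.h2))
    κ (fun u v => by
      refine LinearMap.ext fun z => ?_
      have e1 := polar_mul Φ u v z.1
      have e2 := G.polar_mul' u v z.2
      rw [QuadraticMap.polarBilin_apply_apply]
      refine Prod.ext ?_ ?_
      · change (u : A.carrier) * -((Φ.natMap v : A.carrier) * z.1) +
          (v : A.carrier) * -((Φ.natMap u : A.carrier) * z.1) = QuadraticMap.polar Φ.Q u v • z.1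
        rw [mul_neg, mul_neg, ← neg_add, e1, neg_smul, neg_neg]
      · change -((Φ.natMap u : A.carrier) * ((v : A.carrier) * z.2)) +
          -((Φ.natMap v : A.carrier) * ((u : A.carrier) * z.2)) = QuadraticMap.polar Φ.Q u v • z.2
        rw [← neg_add, e2, neg_smul, neg_neg]) (x, 0) (by
      have : V ≤ (Submodule.span k {z | ∃ s t, z = κ s (κ t (x, 0)) - κ t (κ s (x, 0))}).comap
          (LinearMap.inl k A.carrier A.carrier) := by
        rw [hV, Submodule.span_le]
        rintro _ ⟨s, t, rfl⟩
        refine Submodule.subset_span ⟨t, s, ?_⟩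
        rw [hκ, hκ, hκ, hκ]
        refine Prod.ext ?_ ?_
        · simp only [LinearMap.inl_apply, Prod.fst_sub, mul_neg]
          abel
        · simp
      exact this hxV)
  exact hx (congrArg Prod.fst key)

/-- An isotropic skew element is not conjugate-invertible. -/
theorem not_conjInvertible (G : P.SkewData Φ) {s : A.skew} (hs : s ≠ 0) (h : Φ.Q s = 0) :
    ¬ A.ConjInvertible (s : A.carrier) := by
  rintro ⟨y, hy⟩
  have h0 : (P.D G.two_ne).B (G.p s) (G.p s) = 0 := by
    have := G.two_mul_map s
    rw [h, map_zero, mul_zero] at this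
    exact (mul_eq_zero.1 this.symm).resolve_left G.c_ne
  refine (P.D G.two_ne).not_inv_of_isotropic G.two_ne
    (fun h' => hs (G.p_injective (h'.trans (map_zero _).symm))) h0 (1 : T P.C₁ P.C₂) ⟨P.J y, ?_⟩
  have e : (P.D G.two_ne).m (G.p s) (1 : T P.C₁ P.C₂) = P.J s := by
    change mL P.C₁ P.C₂ (G.p s) 1 = _
    rw [G.mL_p, mul_one]
  rw [e]
  exact P.Vop_J_eq hy

end SkewData

end ProductAlgebraSplitting

/-- In an associative ring with involution, `V_{b,y} = id` forces `b ȳ = 1`. -/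
theorem mul_eq_one_of_Vop_eq {R : Type*} [Ring R] (h2 : ∀ x : R, 2 * x = 0 → x = 0)
    (h3 : ∀ x : R, 3 * x = 0 → x = 0) (σ : R →+ R) (σ_one : σ 1 = 1)
    (σ_mul : ∀ x y, σ (x * y) = σ y * σ x) (σ_σ : ∀ x, σ (σ x) = x) {b y : R}
    (h : ∀ z, b * σ y * z + z * σ y * b - z * σ b * y = z) : b * σ y = 1 := by
  obtain ⟨u, hu⟩ : ∃ u, u = 1 - b * σ y := ⟨_, rfl⟩
  obtain ⟨q, hq⟩ : ∃ q, q = σ y * b := ⟨_, rfl⟩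
  have hp : b * σ y = 1 - u := by rw [hu]; abel
  have hσq : σ q = q - u := by
    have h1 := h 1
    rw [mul_one, one_mul, one_mul, ← hq, hp] at h1
    rw [hq, σ_mul, σ_σ]
    linear_combination (norm := noncomm_ring) hq - h1
  have hσq' : σ b * y = q - u := by rw [← hσq, hq, σ_mul, σ_σ]
  have hcen : ∀ z, u * z = z * u := by
    intro z
    have h1 := h z
    rw [hp, mul_assoc z, mul_assoc z, hσq', ← hq] at h1
    linear_combination (norm := noncomm_ring) -h1
  have hσu : σ u = -u := by
    have h1 := congrArg σ hσq
    rw [σ_σ, map_sub, hσq] at h1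
    linear_combination (norm := noncomm_ring) h1
  have hqq : q * q = (1 - u) * q := by
    rw [hq, ← hp]
    have h1 := hcen (σ y)
    have h2 : σ y * (b * σ y) = b * σ y * σ y := by
      rw [hp]
      linear_combination (norm := noncomm_ring) h1
    linear_combination (norm := noncomm_ring) h2 * b
  have h4 : 4 * (u * q) = u * (1 + 2 * u) := by
    have h1 := congrArg σ hqq
    rw [σ_mul, σ_mul, map_sub, σ_one, hσu, hσq] at h1
    linear_combination (norm := noncomm_ring) hqq - h1 + 2 * hcen q
  have h5 : u * (2 * u - 1) * (1 + 2 * u) = 0 := by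
    apply h3
    have h1 := congrArg (fun z => 16 * (u * z)) hqq
    have e1 : 16 * (u * (q * q)) = u * (1 + 2 * u) * (1 + 2 * u) := by
      linear_combination (norm := noncomm_ring) 4 * h4 * q + (1 + 2 * u) * h4
    have e2 : 16 * (u * ((1 - u) * q)) = 4 * (1 - u) * (u * (1 + 2 * u)) := by
      linear_combination (norm := noncomm_ring) 4 * (1 - u) * h4
    rw [e1, e2] at h1
    linear_combination (norm := noncomm_ring) h1
  obtain ⟨g, hg⟩ : ∃ g, g = u * (2 * u - 1) := ⟨_, rfl⟩
  have hgc : ∀ z, g * z = z * g := by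
    intro z
    rw [hg]
    linear_combination (norm := noncomm_ring) 2 * u * hcen z + 2 * hcen z * u - hcen z
  have hgq : g * q = 0 := by
    apply h2
    apply h2
    rw [← hg] at h5
    linear_combination (norm := (rw [hg]; noncomm_ring)) (2 * u - 1) * h4 + h5
  have hgb : g * b = 0 := by
    apply h3
    have e1 : b * q = (1 - u) * b := by rw [hq, ← hp, mul_assoc]
    have e2 : g * ((1 - u) * b) = 0 := by
      rw [← e1, ← mul_assoc, hgc, mul_assoc, hgq, mul_zero]
    rw [← hg] at h5
    linear_combination (norm := noncomm_ring) 2 * e2 + h5 * b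
  have hg0 : g = 0 := by
    have e1 : g * (1 - u) = 0 := by rw [← hp, ← mul_assoc, hgb, zero_mul]
    apply h3
    rw [← hg] at h5
    linear_combination (norm := noncomm_ring) 2 * e1 + h5
  rw [hg0] at hg
  have hu0 : u = 0 := by
    have h1 := congrArg σ hg
    rw [σ_mul, map_zero, map_sub, σ_one, two_mul, map_add, hσu] at h1
    apply h2
    linear_combination (norm := noncomm_ring) hg - h1
  rw [hp, hu0, sub_zero]

namespace ProductAlgebraSplitting

variable {k : Type u} [Field k] {A : AlgebraWithInvolution k}

/-- Conjugate-invertible elements of associative subalgebras are invertible. -/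
theorem exists_inverse (P : ProductAlgebraSplitting A 8 8) (h2 : (2 : k) ≠ 0) (h3 : (3 : k) ≠ 0)
    (B : Submodule k A.carrier) (h1 : (1 : A.carrier) ∈ B)
    (hm : ∀ a ∈ B, ∀ b ∈ B, a * b ∈ B) (hi : ∀ a ∈ B, A.invol a ∈ B)
    (ha : ∀ a ∈ B, ∀ b ∈ B, ∀ c ∈ B, a * (b * c) = (a * b) * c) {b : A} (hb : b ∈ B)
    (hinv : A.ConjInvertible b) : ∃ c ∈ B, b * c = 1 ∧ c * b = 1 := by
  have hfin := P.finiteDimensional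
  obtain ⟨y, hy⟩ := hinv
  have hU : ∀ w, A.Vop b w b = 0 → w = 0 := by
    intro w hw
    have e : (P.D (P.two_ne h2)).V (P.J b) (P.J w) (P.J b) = 0 := by
      change (T P.C₁ P.C₂).Vop _ _ _ = 0
      rw [← P.J_Vop, hw, map_zero]
    have := (P.D (P.two_ne h2)).U_injective (P.two_ne h2) (P.three_ne h3) (x := P.J b) (y := P.J y)
      (P.Vop_J_eq hy) e
    exact P.J_injective (this.trans (map_zero P.J).symm)
  have hyB : y ∈ B := by
    have hVB : ∀ w ∈ B, A.Vop b w b ∈ B := by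
      intro w hw
      exact sub_mem (add_mem (hm _ (hm _ hb _ (hi _ hw)) _ hb) (hm _ (hm _ hb _ (hi _ hw)) _ hb))
        (hm _ (hm _ hb _ (hi _ hb)) _ hw)
    let U : B →ₗ[k] B :=
      { toFun := fun w => ⟨A.Vop b w b, hVB w w.2⟩
        map_add' := fun v w => Subtype.ext (by
          simp only [AlgebraWithInvolution.Vop, Submodule.coe_add, map_add, mul_add, add_mul]
          abel)
        map_smul' := fun c w => Subtype.ext (by
          simp only [AlgebraWithInvolution.Vop, Submodule.coe_smul, map_smul, mul_smul_comm,
            smul_mul_assoc, RingHom.id_apply]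
          module) }
    have hUi : Function.Injective U := by
      rw [← LinearMap.ker_eq_bot, eq_bot_iff]
      intro w hw
      exact Subtype.ext (hU w (congrArg Subtype.val hw))
    obtain ⟨w, hw⟩ := LinearMap.injective_iff_surjective.1 hUi ⟨b, hb⟩
    have hw' : A.Vop b w b = b := congrArg Subtype.val hw
    have : y - w = 0 := hU _ (by
      have e : A.Vop b (y - w) b = A.Vop b y b - A.Vop b w b := by
        simp only [AlgebraWithInvolution.Vop, map_sub, mul_sub, sub_mul]
        abel
      rw [e, hw', hy, sub_self])
    rw [sub_eq_zero.1 this]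
    exact w.2
  let : Mul B := ⟨fun x y => ⟨x * y, hm _ x.2 _ y.2⟩⟩
  let : One B := ⟨⟨1, h1⟩⟩
  let : Ring B :=
    { (inferInstance : AddCommGroup B) with
      mul := (· * ·)
      one := 1
      mul_assoc := fun x y z => Subtype.ext (ha _ x.2 _ y.2 _ z.2).symm
      one_mul := fun x => Subtype.ext (one_mul (x : A.carrier))
      mul_one := fun x => Subtype.ext (mul_one (x : A.carrier))
      left_distrib := fun x y z => Subtype.ext (mul_add (x : A.carrier) y z)
      right_distrib := fun x y z => Subtype.ext (add_mul (x : A.carrier) y z)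
      zero_mul := fun x => Subtype.ext (zero_mul (x : A.carrier))
      mul_zero := fun x => Subtype.ext (mul_zero (x : A.carrier)) }
  let : Algebra k B := Algebra.ofModule
    (fun c x y => Subtype.ext (smul_mul_assoc c (x : A.carrier) (y : A.carrier)))
    (fun c x y => Subtype.ext (mul_smul_comm c (x : A.carrier) (y : A.carrier)))
  have hreg : ∀ (c : k), c ≠ 0 → ∀ x : B, algebraMap k B c * x = 0 → x = 0 := by
    intro c hc x hx
    rw [← Algebra.smul_def] at hx
    exact (smul_eq_zero.1 hx).resolve_left hc
  let σ : B →+ B := ⟨⟨fun x => ⟨A.invol x, hi _ x.2⟩, Subtype.ext (map_zero A.invol)⟩,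
    fun x y => Subtype.ext (map_add A.invol _ _)⟩
  have key := mul_eq_one_of_Vop_eq (R := B)
    (fun x hx => hreg 2 h2 x (by rwa [map_ofNat])) (fun x hx => hreg 3 h3 x (by rwa [map_ofNat]))
    σ (Subtype.ext A.invol_one) (fun x y => Subtype.ext (A.invol_mul _ _))
    (fun x => Subtype.ext (A.invol_invol _)) (b := ⟨b, hb⟩) (y := ⟨y, hyB⟩)
    (fun z => Subtype.ext (hy z))
  have key' : σ ⟨y, hyB⟩ * (⟨b, hb⟩ : B) = 1 := by
    let L : B →ₗ[k] B := LinearMap.mulLeft k ⟨b, hb⟩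
    have hL : Function.Surjective L := fun z => ⟨σ ⟨y, hyB⟩ * z, by
      change (⟨b, hb⟩ : B) * _ = _
      rw [← mul_assoc, key, one_mul]⟩
    apply LinearMap.injective_iff_surjective.2 hL
    change (⟨b, hb⟩ : B) * (_ * _) = _ * 1
    rw [← mul_assoc, key, one_mul, mul_one]
  exact ⟨_, (σ ⟨y, hyB⟩).2, congrArg Subtype.val key, congrArg Subtype.val key'⟩

end ProductAlgebraSplitting

namespace CompositionAlgebra

variable {k : Type u} [Field k]

lemma exists_pure_of_isometry (C : CompositionAlgebra k) {w : Fin 8 → k} (hw : w 0 = 1)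
    (e : QuadraticMap.IsometryEquiv C.norm (QuadraticMap.weightedSumSquares k w)) :
    ∃ z : C.pure, C.norm z = w 1 := by
  set x := e.symm (Pi.single 0 1) with hx
  set y := e.symm (Pi.single 1 1) with hy
  have hn : ∀ i : Fin 8, QuadraticMap.weightedSumSquares k w (Pi.single i 1) = w i := by
    intro i
    rw [QuadraticMap.weightedSumSquares_apply, Finset.sum_eq_single i]
    · simp
    · intro j _ hj
      simp [Pi.single_eq_of_ne hj]
    · simp
  have hnx : C.norm x = 1 := by rw [hx, e.symm.map_app, hn, hw]
  have hny : C.norm y = w 1 := by rw [hy, e.symm.map_app, hn]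
  have hxy : C.bil x y = 0 := by
    rw [C.bil_def, hnx, hny, hx, hy, ← map_add, e.symm.map_app,
      QuadraticMap.weightedSumSquares_apply]
    simp [Fin.sum_univ_eight, hw]
  refine ⟨⟨C.conj x * y, ?_⟩, ?_⟩
  · rw [mem_pure, C.bil_conj_left, C.conj_conj, mul_one, C.bil_comm, hxy]
  · rw [C.norm_mul, C.norm_conj, hnx, hny, one_mul]

/-- A tensor product of octonion algebras whose norms have a common slot is not a structurable
division algebra. -/
theorem not_division_of_pure {C₁ C₂ : CompositionAlgebra k} (h2 : (2 : k) ≠ 0)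
    (h8₁ : Module.finrank k C₁.carrier = 8) (h8₂ : Module.finrank k C₂.carrier = 8)
    {z₁ : C₁.pure} {z₂ : C₂.pure} (h : C₁.norm z₁ = C₂.norm z₂) (h0 : C₁.norm z₁ ≠ 0) :
    ¬ (T C₁ C₂).IsStructurableDivisionAlgebra := by
  intro hdiv
  have hz : ((z₁, z₂) : C₁.pure × C₂.pure) ≠ 0 := by
    intro hz
    have : z₁ = 0 := congrArg Prod.fst hz
    exact h0 (by rw [this]; simp)
  have hb : (model h2 h8₁ h8₂).B (z₁, z₂) (z₁, z₂) = 0 := by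
    change albertBil C₁ C₂ _ _ = 0
    rw [albertBil_apply, C₁.bil_self, C₂.bil_self, h, sub_self]
  refine (model h2 h8₁ h8₂).not_inv_of_isotropic h2 hz hb (1 : T C₁ C₂) ?_
  have e : (model h2 h8₁ h8₂).m (z₁, z₂) (1 : T C₁ C₂) = sk C₁ C₂ (z₁, z₂) := by
    change mL C₁ C₂ _ _ = _
    rw [mL_apply, mul_one]
  rw [e]
  exact hdiv _ fun h' => hz (sk_inj h2 _ h')

end CompositionAlgebra

lemma AlgebraWithInvolution.Isotopy.isStructurableDivisionAlgebra {k : Type u} [Field k]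
    {A B : AlgebraWithInvolution k} (f : A.Isotopy B) (h : A.IsStructurableDivisionAlgebra) :
    B.IsStructurableDivisionAlgebra := by
  intro x hx
  obtain ⟨y, hy⟩ := h (f.toLinearEquiv.symm x) (by simpa using hx)
  refine ⟨f.hat y, fun z => ?_⟩
  have := f.map_Vop (f.toLinearEquiv.symm x) y (f.toLinearEquiv.symm z)
  rw [hy] at this
  simpa using this.symm

/-- Two quadratic forms that do not vanish identically have a common nonzero over a base field of
characteristic not two or three. -/
lemma QuadraticMap.exists_common_ne_zero {k K S M M' : Type*} [Field k] [Field K] [Algebra k K]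
    [AddCommGroup S] [Module k S] [AddCommGroup M] [Module K M] [AddCommGroup M'] [Module K M']
    (h2 : (2 : k) ≠ 0) (h3 : (3 : k) ≠ 0) (q : QuadraticForm K M) (q' : QuadraticForm K M')
    (p : S →ₛₗ[algebraMap k K] M) (p' : S →ₛₗ[algebraMap k K] M')
    (h : ∃ a, q (p a) ≠ 0) (h' : ∃ a, q' (p' a) ≠ 0) :
    ∃ a, q (p a) ≠ 0 ∧ q' (p' a) ≠ 0 := by
  obtain ⟨a, ha⟩ := h
  obtain ⟨b, hb⟩ := h'
  by_contra! hc
  have hab := hc a ha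
  have hba : q (p b) = 0 := by
    by_contra h
    exact hb (hc b h)
  have e : ∀ m : k, q (p (a + m • b)) = q (p a) + algebraMap k K m * QuadraticMap.polar q (p a) (p b) := by
    intro m
    rw [map_add, map_smulₛₗ, QuadraticMap.map_add q, QuadraticMap.map_smul, hba,
      QuadraticMap.polar_smul_right, smul_zero, add_zero, smul_eq_mul]
  have e' : ∀ m : k, q' (p' (a + m • b)) = algebraMap k K m * QuadraticMap.polar q' (p' a) (p' b) +
      algebraMap k K m * algebraMap k K m * q' (p' b) := by
    intro m
    rw [map_add, map_smulₛₗ, QuadraticMap.map_add q', QuadraticMap.map_smul, hab,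
      QuadraticMap.polar_smul_right, smul_eq_mul, smul_eq_mul, zero_add, add_comm]
  set x := q (p a)
  set y := QuadraticMap.polar q (p a) (p b)
  set x' := QuadraticMap.polar q' (p' a) (p' b)
  set y' := q' (p' b)
  have key : ∀ m : k, m ≠ 0 → x + algebraMap k K m * y = 0 ∨ x' + algebraMap k K m * y' = 0 := by
    intro m hm
    by_contra! h
    have := hc (a + m • b) (by rw [e]; exact h.1)
    rw [e'] at this
    have hm' : algebraMap k K m ≠ 0 := (map_ne_zero _).2 hm
    exact h.2 (mul_left_cancel₀ hm' (by linear_combination this))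
  have i1 : ∀ m n : k, m ≠ n → x + algebraMap k K m * y = 0 → x + algebraMap k K n * y = 0 →
      False := by
    intro m n hmn hm hn
    have hd : algebraMap k K m - algebraMap k K n ≠ 0 :=
      sub_ne_zero.2 ((algebraMap k K).injective.ne hmn)
    have hy : y = 0 := mul_left_cancel₀ hd (by linear_combination hm - hn)
    exact ha (by rw [hy] at hm; simpa using hm)
  have i2 : ∀ m n : k, m ≠ n → x' + algebraMap k K m * y' = 0 → x' + algebraMap k K n * y' = 0 →
      False := by
    intro m n hmn hm hn
    have hd : algebraMap k K m - algebraMap k K n ≠ 0 :=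
      sub_ne_zero.2 ((algebraMap k K).injective.ne hmn)
    exact hb (mul_left_cancel₀ hd (by linear_combination hm - hn))
  have h10 : (1 : k) ≠ 0 := one_ne_zero
  have h1 : (1 : k) ≠ -1 := fun h => h2 (by linear_combination h)
  have h4 : (1 : k) ≠ 2 := fun h => h10 (by linear_combination -h)
  have h5 : (-1 : k) ≠ 2 := fun h => h3 (by linear_combination -h)
  rcases key 1 h10 with a1 | a1 <;> rcases key (-1) (neg_ne_zero.2 h10) with a2 | a2 <;>
    rcases key 2 h2 with a3 | a3
  · exact i1 _ _ h1 a1 a2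
  · exact i1 _ _ h1 a1 a2
  · exact i1 _ _ h4 a1 a3
  · exact i2 _ _ h5 a2 a3
  · exact i1 _ _ h5 a2 a3
  · exact i2 _ _ h4 a1 a3
  · exact i2 _ _ h1 a1 a2
  · exact i2 _ _ h1 a1 a2

/-- A quadratic form vanishing on a set that is closed under addition and spans vanishes. -/
lemma QuadraticMap.eq_zero_of_span {k K S M : Type*} [Field k] [Field K] [Algebra k K]
    [AddCommGroup S] [Module k S] [AddCommGroup M] [Module K M] (q : QuadraticForm K M)
    (p : S →ₛₗ[algebraMap k K] M) (hp : ∀ u, u ∈ Submodule.span K (Set.range p))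
    (h : ∀ a, q (p a) = 0) (u : M) : q u = 0 := by
  have hpol : ∀ a u, QuadraticMap.polar q (p a) u = 0 := by
    intro a u
    induction hp u using Submodule.span_induction with
    | mem x hx =>
      obtain ⟨b, rfl⟩ := hx
      rw [QuadraticMap.polar, ← map_add, h, h, h]
      simp
    | zero => exact QuadraticMap.polar_zero_right _ _
    | add x y _ _ hx hy => rw [QuadraticMap.polar_add_right, hx, hy, add_zero]
    | smul c x _ hx => rw [QuadraticMap.polar_smul_right, hx, smul_zero]
  have hpol' : ∀ x y, QuadraticMap.polar q x y = 0 := by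
    intro x y
    induction hp x using Submodule.span_induction with
    | mem x hx =>
      obtain ⟨b, rfl⟩ := hx
      exact hpol b y
    | zero => exact QuadraticMap.polar_zero_left _ _
    | add x x' _ _ hx hx' => rw [QuadraticMap.polar_add_left, hx, hx', add_zero]
    | smul c x _ hx => rw [QuadraticMap.polar_smul_left, hx, smul_zero]
  induction hp u using Submodule.span_induction with
  | mem x hx =>
    obtain ⟨b, rfl⟩ := hx
    exact h b
  | zero => exact QuadraticMap.map_zero _
  | add x y _ _ hx hy => rw [QuadraticMap.map_add q, hx, hy, hpol', add_zero, add_zero]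
  | smul c x _ hx => rw [QuadraticMap.map_smul, hx, smul_zero]

namespace ProductAlgebraSplitting

variable {k : Type u} [Field k] {A : AlgebraWithInvolution k}
  {P : ProductAlgebraSplitting A 8 8} {Φ : AlbertForm A}

namespace SkewData

lemma exists_skew (G : P.SkewData Φ) {a : A} {u : P.C₁.pure × P.C₂.pure}
    (h : P.J a = sk P.C₁ P.C₂ u) : ∃ s : A.skew, (s : A.carrier) = a ∧ G.p s = u := by
  refine ⟨⟨a, P.J_injective ?_⟩, rfl, ?_⟩
  · rw [P.J_invol, h, invol_sk, map_neg, h]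
  · refine sub_eq_zero.1 (sk_inj G.two_ne _ ?_)
    rw [map_sub, G.sk_p]
    exact sub_eq_zero.2 h

lemma exists_cross (G : P.SkewData Φ) (s t : A.skew) : ∃ r : A.skew,
    (r : A.carrier) = (2 : k)⁻¹ • ((s : A.carrier) * t - t * s) ∧
    G.p r = (P.C₁.cross (G.p s).1 (G.p t).1, P.C₂.cross (G.p s).2 (G.p t).2) := by
  apply G.exists_skew
  rw [map_smulₛₗ, map_sub, P.J_mul, P.J_mul, ← G.sk_p, ← G.sk_p, sk_apply, sk_apply, sk_apply]
  simp only [add_mul, mul_add, tm_mul, one_mul, mul_one, coe_cross, map_smul, map_sub,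
    LinearMap.sub_apply, LinearMap.smul_apply, map_inv₀, map_ofNat]
  module

lemma exists_assoc (G : P.SkewData Φ) (s t v : A.skew) : ∃ r : A.skew,
    G.p r = (P.C₁.assoc (G.p s).1 (G.p t).1 (G.p v).1, P.C₂.assoc (G.p s).2 (G.p t).2 (G.p v).2) := by
  obtain ⟨r, -, h⟩ := G.exists_skew (a := ((s : A.carrier) * t) * v - s * (t * v))
    (u := (P.C₁.assoc (G.p s).1 (G.p t).1 (G.p v).1, P.C₂.assoc (G.p s).2 (G.p t).2 (G.p v).2)) (by
      rw [map_sub, P.J_mul, P.J_mul, P.J_mul, P.J_mul, ← G.sk_p, ← G.sk_p, ← G.sk_p, sk_apply,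
        sk_apply, sk_apply, sk_apply]
      simp only [add_mul, mul_add, tm_mul, one_mul, mul_one, coe_assoc, map_sub,
        LinearMap.sub_apply]
      abel)
  exact ⟨r, h⟩

lemma map_Q (G : P.SkewData Φ) (s : A.skew) : algebraMap k P.K (Φ.Q s) =
    G.c * (P.C₁.norm (G.p s).1 - P.C₂.norm (G.p s).2) := by
  have h := G.two_mul_map s
  rw [albertBil_apply, bil_self, bil_self] at h
  exact mul_left_cancel₀ G.two_ne (by linear_combination h)

lemma map_polar_nat (G : P.SkewData Φ) (s t : A.skew) :
    algebraMap k P.K (QuadraticMap.polar Φ.Q s (Φ.natMap t)) =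
      algebraMap k P.K G.δ * (P.C₁.bil (G.p s).1 (G.p t).1 + P.C₂.bil (G.p s).2 (G.p t).2) := by
  rw [G.map_polar, G.p_nat, ← G.c_sq]
  simp [albertBil_apply, flip2_apply]
  ring

lemma eq_zero_of_polar (G : P.SkewData Φ) {s : A.skew}
    (h : ∀ t, QuadraticMap.polar Φ.Q s t = 0) : s = 0 := by
  apply G.p_injective
  rw [map_zero]
  apply (P.D G.two_ne).eq_of_B
  intro u
  change albertBil P.C₁ P.C₂ _ u = albertBil P.C₁ P.C₂ 0 u
  rw [map_zero, LinearMap.zero_apply]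
  induction P.p_span G.two_ne G.p G.sk_p u using Submodule.span_induction with
  | mem x hx =>
    obtain ⟨t, rfl⟩ := hx
    have := G.map_polar s t
    rw [h, map_zero] at this
    exact (mul_eq_zero.1 this.symm).resolve_left G.c_ne
  | zero => exact map_zero _
  | add x y _ _ hx hy => rw [map_add, hx, hy, add_zero]
  | smul c x _ hx => rw [map_smul, hx, smul_zero]

lemma span_fst (G : P.SkewData Φ) (x : P.C₁.pure) :
    x ∈ Submodule.span P.K (Set.range ((LinearMap.fst P.K P.C₁.pure P.C₂.pure).comp G.p)) := by
  have := P.p_span G.two_ne G.p G.sk_p (x, 0)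
  have h := Submodule.mem_map_of_mem (f := LinearMap.fst P.K P.C₁.pure P.C₂.pure) this
  rwa [Submodule.map_span, ← Set.range_comp] at h

lemma span_snd (G : P.SkewData Φ) (x : P.C₂.pure) :
    x ∈ Submodule.span P.K (Set.range ((LinearMap.snd P.K P.C₁.pure P.C₂.pure).comp G.p)) := by
  have := P.p_span G.two_ne G.p G.sk_p (0, x)
  have h := Submodule.mem_map_of_mem (f := LinearMap.snd P.K P.C₁.pure P.C₂.pure) this
  rwa [Submodule.map_span, ← Set.range_comp] at h

/-- A common nonzero of two quadratic functions of the components. -/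
lemma exists_components (G : P.SkewData Φ) (f : P.C₁.pure →ₗ[P.K] P.C₁.pure)
    (g : P.C₂.pure →ₗ[P.K] P.C₂.pure) (hf : ∃ x, P.C₁.norm (f x) ≠ 0)
    (hg : ∃ x, P.C₂.norm (g x) ≠ 0) :
    ∃ a : A.skew, P.C₁.norm (f (G.p a).1) ≠ 0 ∧ P.C₂.norm (g (G.p a).2) ≠ 0 := by
  apply QuadraticMap.exists_common_ne_zero G.h2 G.h3
    (P.C₁.norm.comp (P.C₁.pure.subtype ∘ₗ f)) (P.C₂.norm.comp (P.C₂.pure.subtype ∘ₗ g))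
    ((LinearMap.fst P.K P.C₁.pure P.C₂.pure).comp G.p)
    ((LinearMap.snd P.K P.C₁.pure P.C₂.pure).comp G.p)
  · by_contra! h
    obtain ⟨x, hx⟩ := hf
    exact hx (QuadraticMap.eq_zero_of_span _ _ G.span_fst h x)
  · by_contra! h
    obtain ⟨x, hx⟩ := hg
    exact hx (QuadraticMap.eq_zero_of_span _ _ G.span_snd h x)

end SkewData

end ProductAlgebraSplitting

namespace ProductAlgebraSplitting

variable {k : Type u} [Field k] {A : AlgebraWithInvolution k}
  {P : ProductAlgebraSplitting A 8 8} {Φ : AlbertForm A}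

namespace SkewData

lemma exists_pure_norm_ne {F : Type u} [Field F] (C : CompositionAlgebra F) (h2 : (2 : F) ≠ 0)
    (h8 : Module.finrank F C.carrier = 8) : ∃ x : C.pure, C.norm x ≠ 0 := by
  obtain ⟨x, hx, hn⟩ := C.exists_ortho h2 ![1] (by simp [Fin.forall_fin_one]) (by simp [C.norm_one])
    (by rw [h8]; norm_num)
  exact ⟨⟨x, C.mem_pure.2 (hx 0)⟩, hn⟩

/-- An isotropic vector whose components have nonzero norm. -/
lemma exists_isotropic_components (G : P.SkewData Φ) {s : A.skew} (hs : s ≠ 0) (h0 : Φ.Q s = 0) :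
    ∃ v : A.skew, Φ.Q v = 0 ∧ QuadraticMap.polar Φ.Q v (Φ.natMap v) ≠ 0 := by
  by_contra! hc
  have hδ := G.δ_ne
  have h2 := G.h2
  have hself : ∀ x, QuadraticMap.polar Φ.Q x x = 2 * Φ.Q x := fun x => by
    rw [QuadraticMap.polar_self, nsmul_eq_mul, Nat.cast_ofNat]
  have hsθ := hc s h0
  by_cases hA : ∃ t, QuadraticMap.polar Φ.Q s t = 0 ∧ QuadraticMap.polar Φ.Q (Φ.natMap s) t ≠ 0
  · obtain ⟨t, ht, hne⟩ := hA
    set β := QuadraticMap.polar Φ.Q (Φ.natMap s) t with hβ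
    have c1 : QuadraticMap.polar Φ.Q t (Φ.natMap s) = β := QuadraticMap.polar_comm _ _ _
    have c2 : QuadraticMap.polar Φ.Q s (Φ.natMap t) = β := (G.polar_nat_left s t).symm
    have c3 : QuadraticMap.polar Φ.Q t s = 0 := (QuadraticMap.polar_comm _ _ _).trans ht
    have c4 : QuadraticMap.polar Φ.Q (Φ.natMap s) s = 0 := (QuadraticMap.polar_comm _ _ _).trans hsθ
    have c5 : QuadraticMap.polar Φ.Q (Φ.natMap s) (Φ.natMap t) = 0 := by
      rw [G.polar_nat, ht, mul_zero]
    have c6 : QuadraticMap.polar Φ.Q (Φ.natMap s) (Φ.natMap s) = 0 := by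
      rw [G.polar_nat, hself, h0]; ring
    set τ := QuadraticMap.polar Φ.Q t (Φ.natMap t) with hτ
    have hQ := hc (t + ((1 - τ) / (2 * β)) • s + (-(Φ.Q t) / β) • Φ.natMap s) (by
      simp only [QuadraticMap.map_add Φ.Q, QuadraticMap.map_smul, G.Q_nat, h0,
        QuadraticMap.polar_add_left, QuadraticMap.polar_smul_left, QuadraticMap.polar_smul_right,
        smul_eq_mul, c1, c3, hsθ]
      field_simp
      ring)
    simp only [map_add, map_smul, G.nat_nat, QuadraticMap.polar_add_left, QuadraticMap.polar_add_right,
      QuadraticMap.polar_smul_left, QuadraticMap.polar_smul_right, smul_eq_mul, c1, c2, c3, c4, c5, c6,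
      hsθ, ← hτ, hself, h0] at hQ
    field_simp at hQ
    exact mul_ne_zero (mul_ne_zero h2 h2) (mul_ne_zero hne hne) (by linear_combination hQ)
  · push Not at hA
    obtain ⟨t₀, ht₀⟩ : ∃ t, QuadraticMap.polar Φ.Q s t ≠ 0 := by
      by_contra! h
      exact hs (G.eq_zero_of_polar h)
    obtain ⟨t, ht⟩ : ∃ t, QuadraticMap.polar Φ.Q s t = 1 :=
      ⟨(QuadraticMap.polar Φ.Q s t₀)⁻¹ • t₀, by
        rw [QuadraticMap.polar_smul_right, smul_eq_mul, inv_mul_cancel₀ ht₀]⟩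
    set κ := QuadraticMap.polar Φ.Q (Φ.natMap s) t with hκ
    have hθ : Φ.natMap s = κ • s := by
      refine sub_eq_zero.1 (G.eq_zero_of_polar fun x => ?_)
      have h1 := hA (x - QuadraticMap.polar Φ.Q s x • t) (by
        rw [QuadraticMap.polar_sub_right, QuadraticMap.polar_smul_right, ht, smul_eq_mul, mul_one,
          sub_self])
      rw [QuadraticMap.polar_sub_right, QuadraticMap.polar_smul_right, smul_eq_mul] at h1
      rw [QuadraticMap.polar_sub_left, QuadraticMap.polar_smul_left, smul_eq_mul]
      linear_combination h1
    have hκδ : κ * κ = G.δ := by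
      have h := G.nat_nat s
      rw [hθ, map_smul, hθ, smul_smul] at h
      exact smul_left_injective k hs h
    have hκ0 : κ ≠ 0 := fun h => hδ (by rw [← hκδ, h, zero_mul])
    obtain ⟨w, hw, hwQ⟩ : ∃ w, Φ.natMap w = -(κ • w) ∧ Φ.Q w ≠ 0 := by
      by_contra! h
      have hx : ∀ x, Φ.Q (κ • x - Φ.natMap x) = 0 := fun x => h _ (by
        rw [map_sub, map_smul, G.nat_nat, ← hκδ]; module)
      have hθ' : ∀ x, Φ.natMap x = κ • x := by
        intro x
        refine (sub_eq_zero.1 (G.eq_zero_of_polar fun y => ?_)).symm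
        have h1 : QuadraticMap.polar Φ.Q (κ • x - Φ.natMap x) (κ • y - Φ.natMap y) = 0 := by
          have h := hx (x + y)
          rw [map_add Φ.natMap] at h
          rw [QuadraticMap.polar, hx, hx, sub_zero, sub_zero, ← h]
          congr 1
          module
        simp only [QuadraticMap.polar_sub_left, QuadraticMap.polar_sub_right,
          QuadraticMap.polar_smul_left, QuadraticMap.polar_smul_right, smul_eq_mul,
          ← G.polar_nat_left x y, G.polar_nat] at h1
        rw [QuadraticMap.polar_sub_left, QuadraticMap.polar_smul_left, smul_eq_mul]
        apply mul_left_cancel₀ (mul_ne_zero h2 hκ0)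
        linear_combination h1 + QuadraticMap.polar Φ.Q x y * hκδ
      have hp : ∀ u, G.c • flip2 P.C₁ P.C₂ u = algebraMap k P.K κ • u := by
        intro u
        induction P.p_span G.two_ne G.p G.sk_p u using Submodule.span_induction with
        | mem x hx =>
          obtain ⟨t, rfl⟩ := hx
          rw [← G.p_nat, hθ', map_smulₛₗ]
        | zero => simp
        | add x y _ _ hx hy => rw [map_add, smul_add, smul_add, hx, hy]
        | smul c x _ hx => rw [map_smul, smul_comm, hx, smul_comm]
      obtain ⟨x, hx⟩ := exists_pure_norm_ne P.C₁ G.two_ne P.finrank₁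
      obtain ⟨y, hy⟩ := exists_pure_norm_ne P.C₂ G.two_ne P.finrank₂
      have hx0 : x ≠ 0 := fun h => hx (by rw [h]; simp)
      have hy0 : y ≠ 0 := fun h => hy (by rw [h]; simp)
      have h1 := congrArg Prod.fst (hp (x, y))
      have h3 := congrArg Prod.snd (hp (x, y))
      simp only [flip2_apply, Prod.smul_mk] at h1 h3
      rw [smul_neg, ← neg_smul] at h3
      have e1 := smul_left_injective P.K hx0 h1
      have e2 := smul_left_injective P.K hy0 h3
      exact G.c_ne (mul_left_cancel₀ G.two_ne (by linear_combination e1 - e2))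
    set t' := (2 : k)⁻¹ • (t + κ⁻¹ • Φ.natMap t) with ht'
    have b1 : QuadraticMap.polar Φ.Q s t' = 1 := by
      rw [ht', QuadraticMap.polar_smul_right, QuadraticMap.polar_add_right,
        QuadraticMap.polar_smul_right, ht, ← G.polar_nat_left, ← hκ]
      simp only [smul_eq_mul]
      field_simp
      norm_num
    have hθt : Φ.natMap t' = κ • t' := by
      rw [ht', map_smul, map_add, map_smul, G.nat_nat, ← hκδ, smul_comm κ, smul_smul κ⁻¹,
        inv_mul_cancel_left₀ hκ0, smul_add κ, smul_smul κ, mul_inv_cancel₀ hκ0, one_smul, add_comm]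
    have hort : ∀ x, Φ.natMap x = κ • x → QuadraticMap.polar Φ.Q w x = 0 := by
      intro x hx
      have h := G.polar_nat_left w x
      rw [hw, hx, QuadraticMap.polar_neg_left, QuadraticMap.polar_smul_left,
        QuadraticMap.polar_smul_right, smul_eq_mul] at h
      exact mul_left_cancel₀ (mul_ne_zero h2 hκ0) (by linear_combination -h)
    have b2 : QuadraticMap.polar Φ.Q t' s = 1 := (QuadraticMap.polar_comm _ _ _).trans b1
    have b3 := hort t' hθt
    have b4 := hort s hθ
    have b5 : QuadraticMap.polar Φ.Q t' w = 0 := (QuadraticMap.polar_comm _ _ _).trans b3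
    have b6 : QuadraticMap.polar Φ.Q s w = 0 := (QuadraticMap.polar_comm _ _ _).trans b4
    have hQ := hc (w + t' + (-(Φ.Q w) - Φ.Q t') • s) (by
      simp only [QuadraticMap.map_add Φ.Q, QuadraticMap.map_smul, h0,
        QuadraticMap.polar_add_left, QuadraticMap.polar_smul_right, smul_eq_mul, b2, b3, b4]
      ring)
    simp only [map_add, map_smul, hw, hθt, hθ, QuadraticMap.polar_add_left,
      QuadraticMap.polar_add_right, QuadraticMap.polar_neg_right, QuadraticMap.polar_smul_left,
      QuadraticMap.polar_smul_right, smul_eq_mul, b1, b2, b3, b4, b5, b6, hself, h0] at hQ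
    exact hwQ (mul_left_cancel₀ (mul_ne_zero (mul_ne_zero h2 h2) hκ0) (by linear_combination -hQ))

/-- Scaling the components makes a vector with anisotropic components anisotropic. -/
lemma exists_scale (G : P.SkewData Φ) {s : A.skew} (h₁ : P.C₁.norm (G.p s).1 ≠ 0) :
    ∃ (t : A.skew) (l₁ l₂ : P.K) (l : k), l ≠ 0 ∧
      l₁ * l₂ = algebraMap k P.K l ∧ G.p t = (l₁ • (G.p s).1, l₂ • (G.p s).2) ∧ Φ.Q t ≠ 0 := by
  by_cases hQ : Φ.Q s = 0
  · obtain ⟨x, hx0, hx⟩ : ∃ x : k, x ≠ 0 ∧ x * x - G.δ ≠ 0 := by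
      by_cases h : G.δ = 1
      · refine ⟨2, G.h2, ?_⟩
        rw [h]
        convert G.h3 using 1
        norm_num
      · exact ⟨1, one_ne_zero, fun h' => h (by linear_combination -h')⟩
    have hn : P.C₁.norm (G.p s).1 = P.C₂.norm (G.p s).2 := by
      have := G.map_Q s
      rw [hQ, map_zero] at this
      exact sub_eq_zero.1 ((mul_eq_zero.1 this.symm).resolve_left G.c_ne)
    have hp : G.p (x • s + Φ.natMap s) = ((algebraMap k P.K x + G.c) • (G.p s).1,
        (algebraMap k P.K x - G.c) • (G.p s).2) := by
      rw [map_add, map_smulₛₗ, G.p_nat, flip2_apply]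
      refine Prod.ext ?_ ?_
      · simp [add_smul]
      · simp [sub_eq_add_neg, add_smul]
    refine ⟨x • s + Φ.natMap s, algebraMap k P.K x + G.c, algebraMap k P.K x - G.c, _, hx, ?_, hp, ?_⟩
    · rw [map_sub, map_mul, ← G.c_sq]; ring
    · intro h
      have := G.map_Q (x • s + Φ.natMap s)
      rw [h, map_zero, hp] at this
      simp only [Submodule.coe_smul, QuadraticMap.map_smul, ← hn, smul_eq_mul] at this
      have h4 : (4 : P.K) ≠ 0 := by
        have := mul_ne_zero G.two_ne G.two_ne
        norm_num at this
        exact this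
      refine mul_ne_zero (mul_ne_zero (mul_ne_zero h4 (mul_ne_zero G.c_ne G.c_ne))
        ((map_ne_zero (algebraMap k P.K)).2 hx0)) h₁ ?_
      linear_combination -this
  · exact ⟨s, 1, 1, 1, one_ne_zero, by simp, by simp, hQ⟩

end SkewData

end ProductAlgebraSplitting

namespace CompositionAlgebra

variable {F : Type u} [Field F] {C : CompositionAlgebra F}

lemma OrthoTriple.smul {s t u : C.pure} (h : C.OrthoTriple s t u) (c : F) :
    C.OrthoTriple s t (c • u) where
  st := h.st
  su := by rw [Submodule.coe_smul, map_smul, h.su, smul_zero]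
  tu := by rw [Submodule.coe_smul, map_smul, h.tu, smul_zero]
  stu := by rw [Submodule.coe_smul, map_smul, h.stu, smul_zero]

lemma norm_cross (h2 : (2 : F) ≠ 0) {x y : C.pure} (h : C.bil x y = 0) :
    C.norm (C.cross x y) = C.norm x * C.norm y := by
  rw [C.cross_eq h2 h, C.norm_mul]

lemma exists_cross_norm_ne (h2 : (2 : F) ≠ 0) (h8 : Module.finrank F C.carrier = 8) {s : C.pure}
    (hs : C.norm s ≠ 0) : ∃ x, C.norm (C.cross s x) ≠ 0 := by
  have h1 : C.bil 1 s = 0 := (C.bil_comm _ _).trans (C.mem_pure.1 s.2)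
  obtain ⟨x, hx, hn⟩ := C.exists_ortho h2 ![1, (s : C.carrier)]
    (by simp [Fin.forall_fin_two, h1, C.mem_pure.1 s.2]) (by simp [Fin.forall_fin_two, C.norm_one, hs])
    (by rw [h8]; norm_num)
  refine ⟨⟨x, C.mem_pure.2 (hx 0)⟩, ?_⟩
  rw [norm_cross h2 ((C.bil_comm _ _).trans (hx 1))]
  exact mul_ne_zero hs hn

lemma exists_assoc_norm_ne (h2 : (2 : F) ≠ 0) (h8 : Module.finrank F C.carrier = 8) {s t : C.pure}
    (hs : C.norm s ≠ 0) (ht : C.norm t ≠ 0) (hst : C.bil s t = 0) :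
    ∃ x, C.norm (C.assoc s t x) ≠ 0 := by
  have hc : ∀ {x y : C.carrier}, C.bil x y = 0 → C.bil y x = 0 := fun h => (C.bil_comm _ _).trans h
  have h1 := C.mem_pure.1 s.2
  have h3 := C.mem_pure.1 t.2
  have h4 := C.mem_pure.1 (C.mul_mem_pure s.2 hst)
  have h5 : C.bil s ((s : C.carrier) * t) = 0 := by
    rw [← C.cross_eq h2 hst]
    exact C.bil_cross s t
  have h6 : C.bil t ((s : C.carrier) * t) = 0 := by
    have := C.bil_mul_right (t : C.carrier) 1 s
    rwa [one_mul, hc h1, mul_zero] at this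
  obtain ⟨x, hx, hn⟩ := C.exists_ortho h2 ![1, (s : C.carrier), (t : C.carrier), (s : C.carrier) * t]
    (by
      simp only [Fin.forall_fin_succ, Fin.forall_fin_zero]
      simp [h1, h3, h4, h5, h6, hc h1, hc h3, hc h4, hc h5, hc h6, hst, hc hst])
    (by
      simp only [Fin.forall_fin_succ, Fin.forall_fin_zero]
      simp [C.norm_one, hs, ht, C.norm_mul])
    (by rw [h8]; norm_num)
  have ho : C.OrthoTriple s t ⟨x, C.mem_pure.2 (hx 0)⟩ := ⟨hst, hc (hx 1), hc (hx 2), hc (hx 3)⟩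
  refine ⟨_, ho.norm_assoc.trans_ne ?_⟩
  have h44 : (4 : F) ≠ 0 := by
    have := mul_ne_zero h2 h2
    norm_num at this
    exact this
  exact mul_ne_zero h44 (mul_ne_zero (mul_ne_zero hs ht) hn)

end CompositionAlgebra

namespace ProductAlgebraSplitting

variable {k : Type u} [Field k] {A : AlgebraWithInvolution k}
  {P : ProductAlgebraSplitting A 8 8} {Φ : AlbertForm A}

namespace SkewData

/-- Skew elements generating the algebra whose components form triples adapted to repeated
doubling, the first of them being isotropic. -/
structure Frame (G : P.SkewData Φ) where
  s : A.skew
  t : A.skew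
  u : A.skew
  w : A.skew
  ν : k
  ν_ne : ν ≠ 0
  norm_s₁ : P.C₁.norm (G.p s).1 = algebraMap k P.K ν
  norm_s₂ : P.C₂.norm (G.p s).2 = algebraMap k P.K ν
  ortho₁ : P.C₁.OrthoTriple (G.p s).1 (G.p t).1 (G.p u).1
  ortho₂ : P.C₂.OrthoTriple (G.p s).2 (G.p t).2 (G.p u).2
  l₁ : P.K
  l₂ : P.K
  l : k
  l_ne : l ≠ 0
  l_mul : l₁ * l₂ = algebraMap k P.K l
  p_w : G.p w = (l₁ • P.C₁.cross (G.p t).1 (G.p u).1, l₂ • P.C₂.cross (G.p t).2 (G.p u).2)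
  norm_t₁ : P.C₁.norm (G.p t).1 ≠ 0
  norm_t₂ : P.C₂.norm (G.p t).2 ≠ 0
  norm_u₁ : P.C₁.norm (G.p u).1 ≠ 0
  norm_u₂ : P.C₂.norm (G.p u).2 ≠ 0
  Q_t : Φ.Q t ≠ 0
  Q_u : Φ.Q u ≠ 0
  Q_w : Φ.Q w ≠ 0

theorem exists_frame (G : P.SkewData Φ) (hiso : ∃ s : A.skew, s ≠ 0 ∧ Φ.Q s = 0) :
    Nonempty G.Frame := by
  have h2 := G.two_ne
  have hl : ∀ {l₁ l₂ : P.K} {l : k}, l ≠ 0 → l₁ * l₂ = algebraMap k P.K l → l₁ ≠ 0 ∧ l₂ ≠ 0 := by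
    intro l₁ l₂ l hl h
    have : l₁ * l₂ ≠ 0 := by rw [h]; exact (map_ne_zero _).2 hl
    exact ⟨left_ne_zero_of_mul this, right_ne_zero_of_mul this⟩
  obtain ⟨s', hs', h0'⟩ := hiso
  obtain ⟨s, hs, hsθ⟩ := G.exists_isotropic_components hs' h0'
  have hn : P.C₁.norm (G.p s).1 = P.C₂.norm (G.p s).2 := by
    have := G.map_Q s
    rw [hs, map_zero] at this
    exact sub_eq_zero.1 ((mul_eq_zero.1 this.symm).resolve_left G.c_ne)
  have h4 : (4 : k) ≠ 0 := by
    have := mul_ne_zero G.h2 G.h2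
    norm_num at this
    exact this
  obtain ⟨ν, hν⟩ : ∃ ν : k, QuadraticMap.polar Φ.Q s (Φ.natMap s) = 4 * G.δ * ν :=
    ⟨_, (mul_div_cancel₀ _ (mul_ne_zero h4 G.δ_ne)).symm⟩
  have hν0 : ν ≠ 0 := fun h => hsθ (by rw [hν, h, mul_zero])
  have hν₁ : P.C₁.norm (G.p s).1 = algebraMap k P.K ν := by
    have h := G.map_polar_nat s s
    rw [hν, bil_self, bil_self, ← hn, map_mul, map_mul, map_ofNat] at h
    have hd : (4 : P.K) * algebraMap k P.K G.δ ≠ 0 := by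
      rw [← map_ofNat (algebraMap k P.K) 4, ← map_mul]
      exact (map_ne_zero _).2 (mul_ne_zero h4 G.δ_ne)
    exact mul_left_cancel₀ hd (by linear_combination -h)
  have hν₂ := hn.symm.trans hν₁
  have hν0' : algebraMap k P.K ν ≠ 0 := (map_ne_zero _).2 hν0
  have hs₁ : P.C₁.norm (G.p s).1 ≠ 0 := hν₁.trans_ne hν0'
  have hs₂ : P.C₂.norm (G.p s).2 ≠ 0 := hν₂.trans_ne hν0'
  obtain ⟨a, ha₁, ha₂⟩ := G.exists_components (P.C₁.cross (G.p s).1) (P.C₂.cross (G.p s).2)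
    (exists_cross_norm_ne h2 P.finrank₁ hs₁) (exists_cross_norm_ne h2 P.finrank₂ hs₂)
  obtain ⟨r, -, hr⟩ := G.exists_cross s a
  obtain ⟨t, i₁, i₂, i, hi, hi', ht, hQt⟩ := G.exists_scale (s := r) (by rwa [hr])
  rw [hr] at ht
  obtain ⟨hi₁, hi₂⟩ := hl hi hi'
  have ht₁ : P.C₁.norm (G.p t).1 ≠ 0 := by
    rw [ht, Submodule.coe_smul, QuadraticMap.map_smul]
    exact mul_ne_zero (mul_ne_zero hi₁ hi₁) ha₁
  have ht₂ : P.C₂.norm (G.p t).2 ≠ 0 := by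
    rw [ht, Submodule.coe_smul, QuadraticMap.map_smul]
    exact mul_ne_zero (mul_ne_zero hi₂ hi₂) ha₂
  have hst₁ : P.C₁.bil (G.p s).1 (G.p t).1 = 0 := by
    rw [ht, Submodule.coe_smul, map_smul, bil_cross, smul_zero]
  have hst₂ : P.C₂.bil (G.p s).2 (G.p t).2 = 0 := by
    rw [ht, Submodule.coe_smul, map_smul, bil_cross, smul_zero]
  obtain ⟨b, hb₁, hb₂⟩ := G.exists_components (P.C₁.assoc (G.p s).1 (G.p t).1)
    (P.C₂.assoc (G.p s).2 (G.p t).2)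
    (exists_assoc_norm_ne h2 P.finrank₁ hs₁ ht₁ hst₁) (exists_assoc_norm_ne h2 P.finrank₂ hs₂ ht₂ hst₂)
  obtain ⟨q, hq⟩ := G.exists_assoc s t b
  obtain ⟨u, j₁, j₂, j, hj, hj', hu, hQu⟩ := G.exists_scale (s := q) (by rwa [hq])
  rw [hq] at hu
  obtain ⟨hj₁, hj₂⟩ := hl hj hj'
  have hu₁ : P.C₁.norm (G.p u).1 ≠ 0 := by
    rw [hu, Submodule.coe_smul, QuadraticMap.map_smul]
    exact mul_ne_zero (mul_ne_zero hj₁ hj₁) hb₁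
  have hu₂ : P.C₂.norm (G.p u).2 ≠ 0 := by
    rw [hu, Submodule.coe_smul, QuadraticMap.map_smul]
    exact mul_ne_zero (mul_ne_zero hj₂ hj₂) hb₂
  have ho₁ : P.C₁.OrthoTriple (G.p s).1 (G.p t).1 (G.p u).1 := by
    rw [hu]
    exact (orthoTriple_assoc P.C₁ hst₁ _).smul _
  have ho₂ : P.C₂.OrthoTriple (G.p s).2 (G.p t).2 (G.p u).2 := by
    rw [hu]
    exact (orthoTriple_assoc P.C₂ hst₂ _).smul _
  obtain ⟨x, -, hx⟩ := G.exists_cross t u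
  obtain ⟨w, l₁, l₂, l, hl0, hl', hw, hQw⟩ := G.exists_scale (s := x) (by
    rw [hx, norm_cross h2 ho₁.tu]
    exact mul_ne_zero ht₁ hu₁)
  rw [hx] at hw
  exact ⟨⟨s, t, u, w, ν, hν0, hν₁, hν₂, ho₁, ho₂, l₁, l₂, l, hl0, hl', hw, ht₁, ht₂, hu₁, hu₂,
    hQt, hQu, hQw⟩⟩

end SkewData

end ProductAlgebraSplitting

namespace ProductAlgebraSplitting

variable {k : Type u} [Field k] {A : AlgebraWithInvolution k}
  {P : ProductAlgebraSplitting A 8 8} {Φ : AlbertForm A}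

namespace SkewData

/-- The vector obtained by exchanging the component norms. -/
lemma exists_swap (G : P.SkewData Φ) (e : A.skew) : ∃ e' : A.skew,
    G.p e' = (P.C₂.norm (G.p e).2 • (G.p e).1, P.C₁.norm (G.p e).1 • (G.p e).2) := by
  have hT := G.map_polar_nat e e
  have hQ := G.map_Q e
  rw [bil_self, bil_self] at hT
  have h2 := G.two_ne
  have hδ : algebraMap k P.K G.δ ≠ 0 := (map_ne_zero _).2 G.δ_ne
  have hc := G.c_ne
  refine ⟨(QuadraticMap.polar Φ.Q e (Φ.natMap e) / (4 * G.δ)) • e -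
    (Φ.Q e / (2 * G.δ)) • Φ.natMap e, ?_⟩
  have h4 : (4 : P.K) ≠ 0 := by
    have := mul_ne_zero h2 h2
    norm_num at this
    exact this
  rw [map_sub, map_smulₛₗ, map_smulₛₗ, G.p_nat, flip2_apply, map_div₀, map_div₀, map_mul, map_mul,
    map_ofNat, map_ofNat, hT, hQ]
  have e1 : algebraMap k P.K G.δ * (2 * P.C₁.norm (G.p e).1 + 2 * P.C₂.norm (G.p e).2) /
      (4 * algebraMap k P.K G.δ) = (P.C₁.norm (G.p e).1 + P.C₂.norm (G.p e).2) / 2 := by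
    field_simp
    ring
  have e2 : G.c * (P.C₁.norm (G.p e).1 - P.C₂.norm (G.p e).2) / (2 * algebraMap k P.K G.δ) * G.c =
      (P.C₁.norm (G.p e).1 - P.C₂.norm (G.p e).2) / 2 := by
    rw [← G.c_sq]
    field_simp
  rw [e1, smul_smul, e2]
  refine Prod.ext ?_ ?_
  · simp only [Prod.fst_sub, Prod.smul_fst]
    rw [← sub_smul]
    congr 1
    field_simp
    ring
  · simp only [Prod.snd_sub, Prod.smul_snd, smul_neg, sub_neg_eq_add]
    rw [← add_smul]
    congr 1
    field_simp
    ring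

/-- The four vectors in the plane of the components of a given vector and in its translate. -/
lemma exists_block (G : P.SkewData Φ) (F : G.Frame) {e : A.skew}
    (h₁ : P.C₁.bil (G.p F.s).1 (G.p e).1 = 0) (h₂ : P.C₂.bil (G.p F.s).2 (G.p e).2 = 0)
    (hQ : Φ.Q e ≠ 0) : ∃ (e' f f' : A.skew) (N : k),
      algebraMap k P.K N = P.C₁.norm (G.p e).1 * P.C₂.norm (G.p e).2 ∧
      G.p e' = (P.C₂.norm (G.p e).2 • (G.p e).1, P.C₁.norm (G.p e).1 • (G.p e).2) ∧
      G.p f = (P.C₁.cross (G.p F.s).1 (G.p e).1, P.C₂.cross (G.p F.s).2 (G.p e).2) ∧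
      G.p f' = (P.C₂.norm (G.p e).2 • P.C₁.cross (G.p F.s).1 (G.p e).1,
        P.C₁.norm (G.p e).1 • P.C₂.cross (G.p F.s).2 (G.p e).2) ∧
      Φ.Q e' = -N * Φ.Q e ∧ Φ.Q f = F.ν * Φ.Q e ∧ Φ.Q f' = F.ν * (-N * Φ.Q e) ∧
      QuadraticMap.polar Φ.Q e e' = 0 ∧ QuadraticMap.polar Φ.Q f f' = 0 := by
  have inj := (algebraMap k P.K).injective
  obtain ⟨e', he'⟩ := G.exists_swap e
  obtain ⟨f, -, hf⟩ := G.exists_cross F.s e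
  obtain ⟨f', -, hf'⟩ := G.exists_cross F.s e'
  rw [he'] at hf'
  simp only [map_smul] at hf'
  have n1 := P.C₁.norm_cross G.two_ne h₁
  have n2 := P.C₂.norm_cross G.two_ne h₂
  rw [F.norm_s₁] at n1
  rw [F.norm_s₂] at n2
  have q := G.map_Q e
  have q' := G.map_Q e'
  rw [he'] at q'
  simp only [Submodule.coe_smul, QuadraticMap.map_smul, smul_eq_mul] at q'
  have hQK : algebraMap k P.K (Φ.Q e) ≠ 0 := (map_ne_zero _).2 hQ
  have hN : algebraMap k P.K (-(Φ.Q e') / Φ.Q e) = P.C₁.norm (G.p e).1 * P.C₂.norm (G.p e).2 := by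
    rw [map_div₀, map_neg, div_eq_iff hQK, q, q']
    ring
  refine ⟨e', f, f', -(Φ.Q e') / Φ.Q e, hN, he', hf, hf', ?_, ?_, ?_, ?_, ?_⟩
  · field_simp
  · apply inj
    rw [G.map_Q, hf, map_mul, q, n1, n2]
    ring
  · apply inj
    rw [G.map_Q, hf', map_mul, map_mul, map_neg, hN, q]
    simp only [Submodule.coe_smul, QuadraticMap.map_smul, smul_eq_mul, n1, n2]
    ring
  · apply inj
    rw [G.map_polar, he', albertBil_apply, map_zero]
    simp only [Submodule.coe_smul, map_smul, smul_eq_mul, bil_self]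
    ring
  · apply inj
    rw [G.map_polar, hf, hf', albertBil_apply, map_zero]
    simp only [Submodule.coe_smul, map_smul, smul_eq_mul, bil_self, n1, n2]
    ring

lemma polar_eq_zero (G : P.SkewData Φ) (F : G.Frame) {e f : A.skew} {i j : Fin 7} (hij : i ≠ j)
    (he : ∃ a b : P.K, G.p e = (a • P.C₁.oct (G.p F.s).1 (G.p F.t).1 (G.p F.u).1 i,
      b • P.C₂.oct (G.p F.s).2 (G.p F.t).2 (G.p F.u).2 i))
    (hf : ∃ a b : P.K, G.p f = (a • P.C₁.oct (G.p F.s).1 (G.p F.t).1 (G.p F.u).1 j,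
      b • P.C₂.oct (G.p F.s).2 (G.p F.t).2 (G.p F.u).2 j)) :
    QuadraticMap.polar Φ.Q e f = 0 := by
  obtain ⟨a, b, he⟩ := he
  obtain ⟨a', b', hf⟩ := hf
  apply (algebraMap k P.K).injective
  rw [G.map_polar, he, hf, albertBil_apply, map_zero]
  simp only [Submodule.coe_smul, map_smul, LinearMap.smul_apply, smul_eq_mul,
    F.ortho₁.oct_ortho G.two_ne i j hij, F.ortho₂.oct_ortho G.two_ne i j hij, mul_zero, sub_zero]

end SkewData

end ProductAlgebraSplitting

namespace ProductAlgebraSplitting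

variable {k : Type u} [Field k] {A : AlgebraWithInvolution k}
  {P : ProductAlgebraSplitting A 8 8} {Φ : AlbertForm A}

namespace SkewData

lemma p_add_smul (G : P.SkewData Φ) (s : A.skew) (v : k) :
    G.p (s + v • Φ.natMap s) = ((1 + algebraMap k P.K v * G.c) • (G.p s).1,
      (1 - algebraMap k P.K v * G.c) • (G.p s).2) := by
  rw [map_add, map_smulₛₗ, G.p_nat, flip2_apply]
  refine Prod.ext ?_ ?_
  · simp only [Prod.fst_add, Prod.smul_fst]
    module
  · simp only [Prod.snd_add, Prod.smul_snd]
    module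

lemma Frame.Q_add_smul {G : P.SkewData Φ} (F : G.Frame) (v : k) :
    Φ.Q (F.s + v • Φ.natMap F.s) = 4 * v * G.δ * F.ν := by
  apply (algebraMap k P.K).injective
  rw [G.map_Q, G.p_add_smul, map_mul, map_mul, map_mul, map_ofNat, ← G.c_sq]
  simp only [Submodule.coe_smul, QuadraticMap.map_smul, smul_eq_mul, F.norm_s₁, F.norm_s₂]
  ring

lemma Frame.polar_add_smul {G : P.SkewData Φ} (F : G.Frame) (v : k) :
    QuadraticMap.polar Φ.Q (F.s + v • Φ.natMap F.s) (F.s + (-v) • Φ.natMap F.s) = 0 := by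
  apply (algebraMap k P.K).injective
  rw [G.map_polar, G.p_add_smul, G.p_add_smul, albertBil_apply, map_zero]
  simp only [Submodule.coe_smul, map_smul, LinearMap.smul_apply, smul_eq_mul, bil_self, F.norm_s₁,
    F.norm_s₂, map_neg]
  ring

set_option maxHeartbeats 2000000 in
/-- An isotropic Albert form is diagonalised with the entries of `φ₁′ ⊥ ⟨-1⟩φ₂′`, up to a factor. -/
theorem exists_orthogonal_family (G : P.SkewData Φ) (F : G.Frame) :
    ∃ (d a b₁ c₁ b₂ c₂ : kˣ) (e₀ e₁ : Fin 7 → A.skew),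
      (∀ i j, QuadraticMap.polar Φ.Q (Fin.append e₀ e₁ i) (Fin.append e₀ e₁ j) =
        if i = j then 2 * Φ.Q (Fin.append e₀ e₁ i) else 0) ∧
      (∀ i, Φ.Q (e₀ i) = d * (![-(a : k), -(b₁ : k), (a : k) * b₁, -(c₁ : k), (a : k) * c₁,
        (b₁ : k) * c₁, -((a : k) * b₁ * c₁)] : Fin 7 → k) i) ∧
      (∀ i, Φ.Q (e₁ i) = d * (![(a : k), (b₂ : k), -((a : k) * b₂), (c₂ : k), -((a : k) * c₂),
        -((b₂ : k) * c₂), (a : k) * b₂ * c₂] : Fin 7 → k) i) := by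
  have hw₁ : P.C₁.bil (G.p F.s).1 (P.C₁.cross (G.p F.t).1 (G.p F.u).1) = 0 := by
    rw [P.C₁.cross_eq G.two_ne F.ortho₁.tu, F.ortho₁.bil_mul_right_eq]
  have hw₂ : P.C₂.bil (G.p F.s).2 (P.C₂.cross (G.p F.t).2 (G.p F.u).2) = 0 := by
    rw [P.C₂.cross_eq G.two_ne F.ortho₂.tu, F.ortho₂.bil_mul_right_eq]
  obtain ⟨t', ts, ts', Nt, hNt, pt', pts, pts', Qt', Qts, Qts', Bt, Bts⟩ :=
    G.exists_block F F.ortho₁.st F.ortho₂.st F.Q_t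
  obtain ⟨u', us, us', Nu, hNu, pu', pus, pus', Qu', Qus, Qus', Bu, Bus⟩ :=
    G.exists_block F F.ortho₁.su F.ortho₂.su F.Q_u
  obtain ⟨w', ws, ws', Nw, hNw, pw', pws, pws', Qw', Qws, Qws', Bw, Bws⟩ :=
    G.exists_block F (e := F.w) (by rw [F.p_w, Submodule.coe_smul, map_smul, hw₁, smul_zero])
      (by rw [F.p_w, Submodule.coe_smul, map_smul, hw₂, smul_zero]) F.Q_w
  have hNw' : Nw = Nt * Nu * F.l ^ 2 := by
    apply (algebraMap k P.K).injective
    rw [hNw, map_mul, map_mul, map_pow, hNt, hNu, ← F.l_mul, F.p_w]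
    simp only [Submodule.coe_smul, QuadraticMap.map_smul, smul_eq_mul,
      norm_cross G.two_ne F.ortho₁.tu, norm_cross G.two_ne F.ortho₂.tu]
    ring
  have hNt0 : Nt ≠ 0 := fun h => by
    rw [h, map_zero] at hNt
    exact mul_ne_zero F.norm_t₁ F.norm_t₂ hNt.symm
  have hNu0 : Nu ≠ 0 := fun h => by
    rw [h, map_zero] at hNu
    exact mul_ne_zero F.norm_u₁ F.norm_u₂ hNu.symm
  have hl := F.l_ne
  have hν := F.ν_ne
  have hx := F.Q_t
  have hy := F.Q_u
  have hz := F.Q_w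
  have hδ := G.δ_ne
  have h2 := G.h2
  have h4 : (4 : k) ≠ 0 := by
    have := mul_ne_zero h2 h2
    norm_num at this
    exact this
  have hNw0 : Nw ≠ 0 := by
    rw [hNw']
    exact mul_ne_zero (mul_ne_zero hNt0 hNu0) (pow_ne_zero 2 hl)
  generalize hx' : Φ.Q F.t = x at *
  generalize hy' : Φ.Q F.u = y at *
  generalize hz' : Φ.Q F.w = z at *
  set v := x * y * z / (4 * G.δ) with hv
  set m := (Nt * Nu * F.l)⁻¹ with hm
  set e₀ : Fin 7 → A.skew := ![F.s + v • Φ.natMap F.s, (y * z) • F.t, (y * z) • ts, (x * z) • F.u,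
    (x * z) • us, (x * y * z) • F.w, (x * y * z) • ws] with he₀
  set e₁ : Fin 7 → A.skew := ![F.s + (-v) • Φ.natMap F.s, (y * Nu * z * Nw * m) • t',
    (y * Nu * z * Nw * m) • ts', (x * Nt * z * Nw * m) • u', (x * Nt * z * Nw * m) • us',
    (x * Nt * y * Nu * z * Nw * m) • w', (x * Nt * y * Nu * z * Nw * m) • ws'] with he₁
  have oct₀ : ∀ i, ∃ a b : P.K, G.p (e₀ i) = (a • P.C₁.oct (G.p F.s).1 (G.p F.t).1 (G.p F.u).1 i,
      b • P.C₂.oct (G.p F.s).2 (G.p F.t).2 (G.p F.u).2 i) := by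
    simp only [Fin.forall_fin_succ, Fin.forall_fin_zero, he₀]
    refine ⟨⟨_, _, G.p_add_smul F.s v⟩, ⟨_, _, map_smulₛₗ G.p _ _⟩, ⟨_, _, (map_smulₛₗ G.p _ _).trans (by rw [pts]; rfl)⟩,
      ⟨_, _, map_smulₛₗ G.p _ _⟩, ⟨_, _, (map_smulₛₗ G.p _ _).trans (by rw [pus]; rfl)⟩,
      ⟨_, _, (map_smulₛₗ G.p _ _).trans (by
        rw [F.p_w, Prod.smul_mk, smul_smul, smul_smul]; rfl)⟩,
      ⟨_, _, (map_smulₛₗ G.p _ _).trans (by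
        rw [pws, F.p_w, map_smul, map_smul, Prod.smul_mk, smul_smul, smul_smul]; rfl)⟩, trivial⟩
  have oct₁ : ∀ i, ∃ a b : P.K, G.p (e₁ i) = (a • P.C₁.oct (G.p F.s).1 (G.p F.t).1 (G.p F.u).1 i,
      b • P.C₂.oct (G.p F.s).2 (G.p F.t).2 (G.p F.u).2 i) := by
    simp only [Fin.forall_fin_succ, Fin.forall_fin_zero, he₁]
    refine ⟨⟨_, _, G.p_add_smul F.s (-v)⟩,
      ⟨_, _, (map_smulₛₗ G.p _ _).trans (by rw [pt', Prod.smul_mk, smul_smul, smul_smul]; rfl)⟩,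
      ⟨_, _, (map_smulₛₗ G.p _ _).trans (by rw [pts', Prod.smul_mk, smul_smul, smul_smul]; rfl)⟩,
      ⟨_, _, (map_smulₛₗ G.p _ _).trans (by rw [pu', Prod.smul_mk, smul_smul, smul_smul]; rfl)⟩,
      ⟨_, _, (map_smulₛₗ G.p _ _).trans (by rw [pus', Prod.smul_mk, smul_smul, smul_smul]; rfl)⟩,
      ⟨_, _, (map_smulₛₗ G.p _ _).trans (by
        rw [pw', Prod.smul_mk, smul_smul, smul_smul, F.p_w, smul_smul, smul_smul]; rfl)⟩,
      ⟨_, _, (map_smulₛₗ G.p _ _).trans (by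
        rw [pws', Prod.smul_mk, smul_smul, smul_smul, F.p_w, map_smul, map_smul, smul_smul,
          smul_smul]; rfl)⟩, trivial⟩
  have hself : ∀ i, QuadraticMap.polar Φ.Q (e₀ i) (e₁ i) = 0 := by
    simp only [Fin.forall_fin_succ, Fin.forall_fin_zero, he₀, he₁]
    simp [QuadraticMap.polar_smul_left, QuadraticMap.polar_smul_right, Bt, Bts, Bu, Bus, Bw, Bws]
    simpa using F.polar_add_smul v
  have hpol : ∀ i j, QuadraticMap.polar Φ.Q (e₀ i) (e₁ j) = 0 := by
    intro i j
    by_cases hij : i = j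
    · rw [hij, hself]
    · exact G.polar_eq_zero F hij (oct₀ i) (oct₁ j)
  have h2Q : ∀ s, QuadraticMap.polar Φ.Q s s = 2 * Φ.Q s := fun s => by
    rw [QuadraticMap.polar_self, nsmul_eq_mul, Nat.cast_ofNat]
  refine ⟨Units.mk0 (x * y * z) (mul_ne_zero (mul_ne_zero hx hy) hz),
    Units.mk0 (-F.ν) (neg_ne_zero.2 hν), Units.mk0 (-(y * z)) (neg_ne_zero.2 (mul_ne_zero hy hz)),
    Units.mk0 (-(x * z)) (neg_ne_zero.2 (mul_ne_zero hx hz)),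
    Units.mk0 (-(y * Nu * (z * Nw)))
      (neg_ne_zero.2 (mul_ne_zero (mul_ne_zero hy hNu0) (mul_ne_zero hz hNw0))),
    Units.mk0 (-(x * Nt * (z * Nw)))
      (neg_ne_zero.2 (mul_ne_zero (mul_ne_zero hx hNt0) (mul_ne_zero hz hNw0))), e₀, e₁, ?_, ?_, ?_⟩
  · intro i j
    by_cases hij : i = j
    · rw [hij, if_pos rfl, h2Q]
    rw [if_neg hij]
    induction i using Fin.addCases with
    | left i =>
      induction j using Fin.addCases with
      | left j =>
        rw [Fin.append_left, Fin.append_left]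
        exact G.polar_eq_zero F (fun h => hij (by rw [h])) (oct₀ i) (oct₀ j)
      | right j =>
        rw [Fin.append_left, Fin.append_right]
        exact hpol i j
    | right i =>
      induction j using Fin.addCases with
      | left j =>
        rw [Fin.append_left, Fin.append_right, QuadraticMap.polar_comm]
        exact hpol j i
      | right j =>
        rw [Fin.append_right, Fin.append_right]
        exact G.polar_eq_zero F (fun h => hij (by rw [h])) (oct₁ i) (oct₁ j)
  · simp only [Fin.forall_fin_succ, Fin.forall_fin_zero, he₀]
    simp [QuadraticMap.map_smul, Qts, Qus, Qws, hx', hy', hz']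
    refine ⟨?_, ?_, ?_, ?_, ?_, ?_, ?_⟩
    · have := F.Q_add_smul v
      simp only [hv] at this ⊢
      rw [this]
      field_simp
    all_goals ring
  · simp only [Fin.forall_fin_succ, Fin.forall_fin_zero, he₁]
    simp [QuadraticMap.map_smul, Qt', Qts', Qu', Qus', Qw', Qws']
    have hmm : m * (Nt * Nu * F.l) = 1 := inv_mul_cancel₀ (mul_ne_zero (mul_ne_zero hNt0 hNu0) hl)
    refine ⟨?_, ?_, ?_, ?_, ?_, ?_, ?_⟩
    · have := F.Q_add_smul (-v)
      simp only [hv, neg_smul] at this ⊢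
      rw [this]
      field_simp
    all_goals
      simp only [hm, hNw']
      field_simp
end SkewData

end ProductAlgebraSplitting

namespace ProductAlgebraSplitting

variable {k : Type u} [Field k] {A : AlgebraWithInvolution k}
  {P : ProductAlgebraSplitting A 8 8} {Φ : AlbertForm A}

namespace SkewData

lemma linearIndependent_p (G : P.SkewData Φ) {ι : Type*} {v : ι → A.skew}
    (hv : LinearIndependent k v) : LinearIndependent P.K fun i => G.p (v i) := by
  have h := P.linearIndependent_J (hv.map' A.skew.subtype (Submodule.ker_subtype _))
  apply LinearIndependent.of_comp (sk P.C₁ P.C₂)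
  convert h using 1
  funext i
  exact G.sk_p (v i)

lemma finrank_skew_le (G : P.SkewData Φ) : Module.finrank k A.skew ≤ 14 := by
  have := P.finiteDimensional
  have h := (G.linearIndependent_p (Module.finBasis k A.skew).linearIndependent).fintype_card_le_finrank
  have h₁ := P.C₁.finrank_pure G.two_ne
  have h₂ := P.C₂.finrank_pure G.two_ne
  rw [P.finrank₁] at h₁
  rw [P.finrank₂] at h₂
  rw [Module.finrank_prod, Fintype.card_fin] at h
  omega

end SkewData

/-- The diagonal entries of `φ₁′ ⊥ ⟨-1⟩φ₂′`. -/
def albertWeights (a b₁ c₁ b₂ c₂ : k) : Fin 14 → k :=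
  ![-a, -b₁, a * b₁, -c₁, a * c₁, b₁ * c₁, -(a * b₁ * c₁),
    a, b₂, -(a * b₂), c₂, -(a * c₂), -(b₂ * c₂), a * b₂ * c₂]

lemma albertWeights_ne (a b₁ c₁ b₂ c₂ : kˣ) (i : Fin 14) :
    albertWeights (a : k) b₁ c₁ b₂ c₂ i ≠ 0 := by
  revert i
  simp [Fin.forall_fin_succ, albertWeights]

namespace SkewData

/-- An isotropic Albert form is similar to `φ₁′ ⊥ ⟨-1⟩φ₂′`, on an explicit basis. -/
theorem exists_orthogonal_basis (G : P.SkewData Φ) (F : G.Frame) :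
    ∃ (d a b₁ c₁ b₂ c₂ : kˣ) (e : Module.Basis (Fin 14) k A.skew),
      (∀ i j, i ≠ j → QuadraticMap.polar Φ.Q (e i) (e j) = 0) ∧
      ∀ i, Φ.Q (e i) = d * albertWeights (a : k) b₁ c₁ b₂ c₂ i := by
  obtain ⟨d, a, b₁, c₁, b₂, c₂, e₀, e₁, hp, h₀, h₁⟩ := G.exists_orthogonal_family F
  have hQ : ∀ i : Fin (7 + 7), Φ.Q (Fin.append e₀ e₁ i) =
      d * albertWeights (a : k) b₁ c₁ b₂ c₂ i := by
    intro i
    induction i using Fin.addCases with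
    | left i =>
      rw [Fin.append_left, h₀]
      congr 1
      fin_cases i <;> rfl
    | right i =>
      rw [Fin.append_right, h₁]
      congr 1
      fin_cases i <;> rfl
  have hli : LinearIndependent k (Fin.append e₀ e₁) := by
    apply LinearMap.linearIndependent_of_isOrthoᵢ (B := QuadraticMap.polarBilin Φ.Q)
    · intro i j hij
      rw [Function.onFun, QuadraticMap.polarBilin_apply_apply, hp, if_neg hij]
    · intro i
      rw [QuadraticMap.polarBilin_apply_apply, hp, if_pos rfl, hQ]
      exact mul_ne_zero G.h2 (mul_ne_zero d.ne_zero (albertWeights_ne a b₁ c₁ b₂ c₂ i))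
  have := P.finiteDimensional
  have hc := hli.fintype_card_le_finrank
  rw [Fintype.card_fin] at hc
  have hf : Fintype.card (Fin (7 + 7)) = Module.finrank k A.skew := by
    rw [Fintype.card_fin]
    exact le_antisymm hc G.finrank_skew_le
  refine ⟨d, a, b₁, c₁, b₂, c₂, basisOfLinearIndependentOfCardEqFinrank hli hf, ?_, ?_⟩
  · intro i j hij
    rw [coe_basisOfLinearIndependentOfCardEqFinrank, hp, if_neg hij]
  · intro i
    rw [coe_basisOfLinearIndependentOfCardEqFinrank, hQ]

end SkewData

lemma smul_weightedSumSquares {n : ℕ} (d : k) (w : Fin n → k) :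
    d • QuadraticMap.weightedSumSquares k w =
      QuadraticMap.weightedSumSquares k fun i => d * w i := by
  ext x
  simp only [_root_.smul_apply, QuadraticMap.weightedSumSquares_apply, smul_eq_mul,
    Finset.mul_sum, mul_assoc]

lemma nonempty_isometryEquiv_of_basis {S : Type*} [AddCommGroup S] [Module k S] {n : ℕ}
    (h2 : (2 : k) ≠ 0) (Q : QuadraticForm k S) (e : Module.Basis (Fin n) k S) {w : Fin n → k}
    (ho : ∀ i j, i ≠ j → QuadraticMap.polar Q (e i) (e j) = 0) (hQ : ∀ i, Q (e i) = w i) :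
    Nonempty (Q.IsometryEquiv (QuadraticMap.weightedSumSquares k w)) := by
  have : Invertible (2 : k) := invertibleOfNonzero h2
  have h := QuadraticMap.basisRepr_eq_of_iIsOrtho Q e (by
    intro i j hij
    rw [Function.onFun, QuadraticMap.associated_apply]
    have := ho i j hij
    rw [QuadraticMap.polar] at this
    rw [this, smul_zero])
  simp only [hQ] at h
  rw [← h]
  exact ⟨Q.isometryEquivBasisRepr e⟩

namespace SkewData

theorem exists_isometryEquiv (G : P.SkewData Φ) (F : G.Frame) : ∃ d a b₁ c₁ b₂ c₂ : kˣ,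
    Nonempty (QuadraticMap.IsometryEquiv Φ.Q
      ((d : k) • QuadraticMap.weightedSumSquares k (albertWeights (a : k) b₁ c₁ b₂ c₂))) := by
  obtain ⟨d, a, b₁, c₁, b₂, c₂, e, ho, hQ⟩ := G.exists_orthogonal_basis F
  refine ⟨d, a, b₁, c₁, b₂, c₂, ?_⟩
  rw [smul_weightedSumSquares]
  exact nonempty_isometryEquiv_of_basis G.h2 Φ.Q e ho hQ

end SkewData

/-- The slot common to both Pfister forms makes the form isotropic. -/
lemma exists_isotropic_of_isometryEquiv {S : Type*} [AddCommGroup S] [Module k S]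
    (Q : QuadraticForm k S) {d a b₁ c₁ b₂ c₂ : k} (f : QuadraticMap.IsometryEquiv Q
      (d • QuadraticMap.weightedSumSquares k (albertWeights a b₁ c₁ b₂ c₂))) :
    ∃ s, s ≠ 0 ∧ Q s = 0 := by
  refine ⟨f.symm (Pi.single 0 1 + Pi.single 7 1), ?_, ?_⟩
  · intro h
    have := congrArg f h
    rw [map_zero, QuadraticMap.IsometryEquiv.apply_symm_apply] at this
    have := congrFun this 0
    simp at this
  · rw [QuadraticMap.IsometryEquiv.map_app, smul_weightedSumSquares,
      QuadraticMap.weightedSumSquares_apply, Finset.sum_eq_add (0 : Fin 14) 7 (by decide)]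
    · simp [albertWeights]
    · intro i _ hi
      simp [hi.1, hi.2]
    all_goals simp

end ProductAlgebraSplitting

namespace ProductAlgebraSplitting

variable {k : Type u} [Field k] {A : AlgebraWithInvolution k}
  {P : ProductAlgebraSplitting A 8 8} {Φ : AlbertForm A}

lemma finrank_span_J (P : ProductAlgebraSplitting A 8 8) (B : Submodule k A.carrier) :
    Module.finrank P.K (Submodule.span P.K (P.J '' B)) = Module.finrank k B := by
  have := P.finiteDimensional
  have hb := Module.finBasis k B
  have h := P.linearIndependent_J (hb.linearIndependent.map' B.subtype (Submodule.ker_subtype _))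
  have e : Submodule.span P.K (P.J '' B) =
      Submodule.span P.K (Set.range fun i => P.J (B.subtype (hb i))) := by
    apply le_antisymm
    · rw [Submodule.span_le]
      rintro _ ⟨a, ha, rfl⟩
      have := hb.sum_repr ⟨a, ha⟩
      have := congrArg B.subtype this
      rw [map_sum] at this
      rw [← show _ = a from this, map_sum]
      refine Submodule.sum_mem _ fun i _ => ?_
      rw [map_smul, map_smulₛₗ]
      exact Submodule.smul_mem _ _ (Submodule.subset_span ⟨i, rfl⟩)
    · rw [Submodule.span_le]
      rintro _ ⟨i, rfl⟩
      exact Submodule.subset_span ⟨_, (hb i).2, rfl⟩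
  rw [e]
  exact (finrank_span_eq_card h).trans (by simp)

lemma mul_mem_span_J (P : ProductAlgebraSplitting A 8 8) {B : Submodule k A.carrier}
    {I J : Submodule k A.carrier} (h : ∀ a ∈ I, ∀ b ∈ J, a * b ∈ B) {X Y : T P.C₁ P.C₂}
    (hX : X ∈ Submodule.span P.K (P.J '' I)) (hY : Y ∈ Submodule.span P.K (P.J '' J)) :
    X * Y ∈ Submodule.span P.K (P.J '' B) := by
  induction hX using Submodule.span_induction with
  | zero => rw [zero_mul]; exact zero_mem _
  | add x x' _ _ hx hx' => rw [add_mul]; exact add_mem hx hx'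
  | smul c x _ hx => rw [smul_mul_assoc]; exact Submodule.smul_mem _ _ hx
  | mem x hx =>
    obtain ⟨a, ha, rfl⟩ := hx
    induction hY using Submodule.span_induction with
    | zero => rw [mul_zero]; exact zero_mem _
    | add x x' _ _ hx hx' => rw [mul_add]; exact add_mem hx hx'
    | smul c x _ hx => rw [mul_smul_comm]; exact Submodule.smul_mem _ _ hx
    | mem y hy =>
      obtain ⟨b, hb, rfl⟩ := hy
      rw [← P.J_mul]
      exact Submodule.subset_span ⟨_, h a ha b hb, rfl⟩

namespace SkewData

/-- The components of a skew element lie in the span of any subspace containing it and its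
image under the `♮`-map. -/
lemma tm_mem_span (G : P.SkewData Φ) {B : Submodule k A.carrier} {s : A.skew}
    (hs : (s : A.carrier) ∈ B) (hs' : (Φ.natMap s : A.carrier) ∈ B) :
    tm ((G.p s).1 : P.C₁.carrier) (1 : P.C₂.carrier) ∈ Submodule.span P.K (P.J '' B) ∧
      tm (1 : P.C₁.carrier) ((G.p s).2 : P.C₂.carrier) ∈ Submodule.span P.K (P.J '' B) := by
  have h := G.sk_p s
  have h' := G.sk_p (Φ.natMap s)
  rw [G.p_nat, map_smul, flip2_apply] at h'
  rw [sk_apply] at h h'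
  have m : P.J s ∈ Submodule.span P.K (P.J '' B) := Submodule.subset_span ⟨_, hs, rfl⟩
  have mN : P.J (Φ.natMap s) ∈ Submodule.span P.K (P.J '' B) := Submodule.subset_span ⟨_, hs', rfl⟩
  have hc := G.c_ne
  have h2 := G.two_ne
  have e : (G.c)⁻¹ • P.J (Φ.natMap s) = tm ((G.p s).1 : P.C₁.carrier) (1 : P.C₂.carrier) -
      tm (1 : P.C₁.carrier) ((G.p s).2 : P.C₂.carrier) := by
    rw [← h', smul_smul, inv_mul_cancel₀ hc, one_smul, Submodule.coe_neg, map_neg, sub_eq_add_neg]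
  constructor
  · rw [show tm ((G.p s).1 : P.C₁.carrier) (1 : P.C₂.carrier) =
      (2 : P.K)⁻¹ • (P.J s + (G.c)⁻¹ • P.J (Φ.natMap s)) by rw [e, ← h, eq_inv_smul_iff₀ h2]; module]
    exact Submodule.smul_mem _ _ (add_mem m (Submodule.smul_mem _ _ mN))
  · rw [show tm (1 : P.C₁.carrier) ((G.p s).2 : P.C₂.carrier) =
      (2 : P.K)⁻¹ • (P.J s - (G.c)⁻¹ • P.J (Φ.natMap s)) by rw [e, ← h, eq_inv_smul_iff₀ h2]; module]
    exact Submodule.smul_mem _ _ (sub_mem m (Submodule.smul_mem _ _ mN))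

/-- An algebra with isotropic Albert form contains a biquaternion algebra with zero divisors. -/
theorem exists_biquaternion (G : P.SkewData Φ) (F : G.Frame) :
    ∃ B : Submodule k A.carrier, (1 : A.carrier) ∈ B ∧
      (∀ a ∈ B, ∀ b ∈ B, a * b ∈ B) ∧
      (∀ a ∈ B, A.invol a ∈ B) ∧
      (∀ a ∈ B, ∀ b ∈ B, ∀ c ∈ B, a * (b * c) = (a * b) * c) ∧
      Module.finrank k B = 16 ∧
      (∀ b ∈ B, (∀ x ∈ B, b * x = x * b) → ∃ c : k, b = c • (1 : A.carrier)) ∧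
      (∀ I : Submodule k A.carrier, I ≤ B →
        (∀ a ∈ I, ∀ x ∈ B, x * a ∈ I ∧ a * x ∈ I) → I = ⊥ ∨ I = B) ∧
      (∃ b ∈ B, b ≠ 0 ∧ ¬ ∃ c ∈ B, b * c = 1 ∧ c * b = 1) := by
  have h2 := G.two_ne
  have hν : algebraMap k P.K F.ν ≠ 0 := (map_ne_zero _).2 F.ν_ne
  obtain ⟨q₁, eq₁⟩ : ∃ q, q = ![1, ((G.p F.s).1 : P.C₁.carrier), (G.p F.t).1,
    (G.p F.s).1 * (G.p F.t).1] := ⟨_, rfl⟩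
  obtain ⟨q₂, eq₂⟩ : ∃ q, q = ![1, ((G.p F.s).2 : P.C₂.carrier), (G.p F.t).2,
    (G.p F.s).2 * (G.p F.t).2] := ⟨_, rfl⟩
  have h₁ : P.C₁.QuaternionFamily q₁ := by
    rw [eq₁]
    exact quaternionFamily F.ortho₁.st (by rw [F.norm_s₁]; exact hν) F.norm_t₁
  have h₂ : P.C₂.QuaternionFamily q₂ := by
    rw [eq₂]
    exact quaternionFamily F.ortho₂.st (by rw [F.norm_s₂]; exact hν) F.norm_t₂
  let B : Submodule k A.carrier := Submodule.comap P.J (tmSpan q₁ q₂)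
  have mem : ∀ a, a ∈ B ↔ P.J a ∈ tmSpan q₁ q₂ := fun _ => Iff.rfl
  have one : (1 : A.carrier) ∈ B := by
    rw [mem, P.J_one]
    exact one_mem_tmSpan h₁ h₂
  have mul : ∀ a ∈ B, ∀ b ∈ B, a * b ∈ B := by
    intro a ha b hb
    rw [mem] at ha hb ⊢
    rw [P.J_mul]
    exact mul_mem_tmSpan h₁ h₂ ha hb
  have range₁ : ∀ i, q₁ i ∈ Submodule.span P.K (Set.range q₁) := fun i =>
    Submodule.subset_span ⟨i, rfl⟩
  have range₂ : ∀ i, q₂ i ∈ Submodule.span P.K (Set.range q₂) := fun i =>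
    Submodule.subset_span ⟨i, rfl⟩
  have one₁ : (1 : P.C₁.carrier) ∈ Submodule.span P.K (Set.range q₁) := h₁.zero ▸ range₁ 0
  have one₂ : (1 : P.C₂.carrier) ∈ Submodule.span P.K (Set.range q₂) := h₂.zero ▸ range₂ 0
  have skew : ∀ s : A.skew, ((G.p s).1 : P.C₁.carrier) ∈ Submodule.span P.K (Set.range q₁) →
      ((G.p s).2 : P.C₂.carrier) ∈ Submodule.span P.K (Set.range q₂) → (s : A.carrier) ∈ B := by
    intro s hs₁ hs₂
    rw [mem, ← G.sk_p, sk_apply]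
    exact add_mem (tm_mem_tmSpan hs₁ one₂) (tm_mem_tmSpan one₁ hs₂)
  have skew' : ∀ s : A.skew, ((G.p s).1 : P.C₁.carrier) ∈ Submodule.span P.K (Set.range q₁) →
      ((G.p s).2 : P.C₂.carrier) ∈ Submodule.span P.K (Set.range q₂) →
      (Φ.natMap s : A.carrier) ∈ B := by
    intro s hs₁ hs₂
    apply skew <;> rw [G.p_nat, flip2_apply]
    · exact Submodule.smul_mem _ _ hs₁
    · exact Submodule.smul_mem _ _ (neg_mem hs₂)
  have s₁ : ((G.p F.s).1 : P.C₁.carrier) ∈ Submodule.span P.K (Set.range q₁) := by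
    have := range₁ 1
    rwa [eq₁] at this ⊢
  have s₂ : ((G.p F.s).2 : P.C₂.carrier) ∈ Submodule.span P.K (Set.range q₂) := by
    have := range₂ 1
    rwa [eq₂] at this ⊢
  have t₁ : ((G.p F.t).1 : P.C₁.carrier) ∈ Submodule.span P.K (Set.range q₁) := by
    have := range₁ 2
    rwa [eq₁] at this ⊢
  have t₂ : ((G.p F.t).2 : P.C₂.carrier) ∈ Submodule.span P.K (Set.range q₂) := by
    have := range₂ 2
    rwa [eq₂] at this ⊢
  have hs := skew F.s s₁ s₂
  have hs' := skew' F.s s₁ s₂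
  have ht := skew F.t t₁ t₂
  have ht' := skew' F.t t₁ t₂
  have le : Submodule.span P.K (P.J '' B) ≤ tmSpan q₁ q₂ := by
    rw [Submodule.span_le]
    rintro _ ⟨a, ha, rfl⟩
    exact ha
  have hspan : Submodule.span P.K (P.J '' B) = tmSpan q₁ q₂ := by
    apply le_antisymm le
    have one' : (tm (1 : P.C₁.carrier) (1 : P.C₂.carrier)) ∈ Submodule.span P.K (P.J '' B) := by
      rw [← tm_one, ← P.J_one]
      exact Submodule.subset_span ⟨1, one, rfl⟩
    have left : ∀ i, tm (q₁ i) (1 : P.C₂.carrier) ∈ Submodule.span P.K (P.J '' B) := by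
      rw [eq₁]
      simp only [Fin.forall_fin_succ, Fin.forall_fin_zero]
      refine ⟨one', (G.tm_mem_span hs hs').1, (G.tm_mem_span ht ht').1, ?_, trivial⟩
      have := P.mul_mem_span_J mul (G.tm_mem_span hs hs').1 (G.tm_mem_span ht ht').1
      rwa [tm_mul, mul_one] at this
    have right : ∀ i, tm (1 : P.C₁.carrier) (q₂ i) ∈ Submodule.span P.K (P.J '' B) := by
      rw [eq₂]
      simp only [Fin.forall_fin_succ, Fin.forall_fin_zero]
      refine ⟨one', (G.tm_mem_span hs hs').2, (G.tm_mem_span ht ht').2, ?_, trivial⟩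
      have := P.mul_mem_span_J mul (G.tm_mem_span hs hs').2 (G.tm_mem_span ht ht').2
      rwa [tm_mul, mul_one] at this
    rw [tmSpan, Submodule.span_le]
    rintro _ ⟨i, rfl⟩
    have := P.mul_mem_span_J mul (left i.1) (right i.2)
    rwa [tm_mul, mul_one, one_mul] at this
  refine ⟨B, one, mul, ?_, ?_, ?_, ?_, ?_, F.s, hs, ?_, ?_⟩
  · intro a ha
    rw [mem] at ha ⊢
    rw [P.J_invol]
    exact invol_mem_tmSpan h₁ h₂ ha
  · intro a ha b hb c hc
    apply P.J_injective
    simp only [P.J_mul]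
    exact mul_assoc_of_mem_tmSpan h₁ h₂ ha hb hc
  · rw [← P.finrank_span_J, hspan, finrank_tmSpan h2 h₁ h₂]
  · intro b hb hcomm
    have hc : ∀ Y ∈ tmSpan q₁ q₂, P.J b * Y = Y * P.J b := by
      intro Y hY
      rw [← hspan] at hY
      induction hY using Submodule.span_induction with
      | zero => simp
      | add x x' _ _ hx hx' => rw [mul_add, add_mul, hx, hx']
      | smul c x _ hx => rw [mul_smul_comm, smul_mul_assoc, hx]
      | mem y hy =>
        obtain ⟨x, hx, rfl⟩ := hy
        rw [← P.J_mul, hcomm x hx, P.J_mul]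
    obtain ⟨c, hc⟩ := eq_smul_one_of_commute h2 h₁ h₂ hb hc
    have : b ∈ Submodule.span k {(1 : A.carrier)} := by
      apply P.mem_of_J_mem_span
      rw [hc, ← P.J_one]
      exact Submodule.smul_mem _ _ (Submodule.subset_span
        ⟨1, Submodule.mem_span_singleton_self _, rfl⟩)
    obtain ⟨d, hd⟩ := Submodule.mem_span_singleton.1 this
    exact ⟨d, hd.symm⟩
  · intro I hIB hI
    rw [or_iff_not_imp_left]
    intro hbot
    obtain ⟨a, ha, ha0⟩ := Submodule.exists_mem_ne_zero_of_ne_bot hbot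
    have h1 : (1 : A.carrier) ∈ I := by
      apply P.mem_of_J_mem_span
      rw [P.J_one]
      refine one_mem_of_ideal h2 h₁ h₂ (X := P.J a) ?_ ?_ (Submodule.subset_span ⟨a, ha, rfl⟩) ?_
      · rw [← hspan]
        exact Submodule.span_mono (Set.image_mono hIB)
      · intro X hX Y hY
        rw [← hspan] at hY
        exact ⟨P.mul_mem_span_J (fun x hx a ha => (hI a ha x hx).1) hY hX,
          P.mul_mem_span_J (fun a ha x hx => (hI a ha x hx).2) hX hY⟩
      · intro h
        exact ha0 (P.J_injective (h.trans (map_zero _).symm))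
    apply le_antisymm hIB
    intro b hb
    have := (hI 1 h1 b hb).1
    rwa [mul_one] at this
  · intro h
    have : G.p F.s = 0 := by
      rw [show F.s = 0 from Subtype.ext h, map_zero]
    have h' := F.norm_s₁
    rw [this] at h'
    exact hν (h'.symm.trans (QuadraticMap.map_zero _))
  · rintro ⟨c, hc, hsc, hcs⟩
    have hQ : Φ.Q F.s = 0 := by
      apply (algebraMap k P.K).injective
      rw [G.map_Q, F.norm_s₁, F.norm_s₂, sub_self, mul_zero, map_zero]
    have h0 : (F.s : A.carrier) * ((Φ.natMap F.s : A.carrier) * 1) = 0 := by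
      rw [Φ.mul_natMap, hQ, neg_zero, zero_smul]
    rw [mul_one] at h0
    have hz : (Φ.natMap F.s : A.carrier) = 0 := by
      have : c * ((F.s : A.carrier) * (Φ.natMap F.s : A.carrier)) =
          (c * (F.s : A.carrier)) * (Φ.natMap F.s : A.carrier) := by
        apply P.J_injective
        simp only [P.J_mul]
        exact mul_assoc_of_mem_tmSpan h₁ h₂ hc hs hs'
      rw [h0, mul_zero, hcs, one_mul] at this
      exact this.symm
    have h' := G.nat_nat F.s
    rw [show Φ.natMap F.s = 0 from Subtype.ext hz, map_zero] at h'
    have hs0 := (smul_eq_zero.1 h'.symm).resolve_left G.δ_ne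
    have h'' := F.norm_s₁
    rw [hs0, map_zero] at h''
    exact hν (h''.symm.trans (QuadraticMap.map_zero _))

end SkewData

end ProductAlgebraSplitting

namespace AlgebraWithInvolution

variable {k : Type u} [Field k] {A B : AlgebraWithInvolution k}

lemma Vop_add_middle (A : AlgebraWithInvolution k) (x y y' z : A) :
    A.Vop x (y + y') z = A.Vop x y z + A.Vop x y' z := by
  simp only [Vop, map_add, mul_add, add_mul]
  abel

lemma Vop_smul_middle (A : AlgebraWithInvolution k) (r : k) (x y z : A) :
    A.Vop x (r • y) z = r • A.Vop x y z := by
  simp only [Vop, map_smul, mul_smul_comm, smul_mul_assoc, smul_add, smul_sub]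

lemma eq_zero_of_Vop (h3 : (3 : k) ≠ 0) {y : A} (h : ∀ x z, A.Vop x y z = 0) : y = 0 := by
  have h1 := h 1 1
  simp only [Vop, one_mul, mul_one, A.invol_one] at h1
  have h2 := congrArg A.invol h1
  simp only [map_sub, map_add, A.invol_invol, map_zero] at h2
  have : (3 : k) • y = 0 := by linear_combination (norm := module) h1 + (2 : k) • h2
  exact (smul_eq_zero.1 this).resolve_left h3

lemma eq_of_Vop (h3 : (3 : k) ≠ 0) {y y' : A} (h : ∀ x z, A.Vop x y z = A.Vop x y' z) :
    y = y' := by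
  rw [← sub_eq_zero]
  apply eq_zero_of_Vop h3
  intro x z
  have : y - y' = y + (-1 : k) • y' := by module
  rw [this, Vop_add_middle, Vop_smul_middle, h]
  module

/-- A linear bijection intertwining the operators `V` up to a change of the second argument is
an isotopy; we record the inverse isotopy. -/
lemma isIsotopic_of_exists_hat (h3 : (3 : k) ≠ 0) [FiniteDimensional k A.carrier]
    (α : A.carrier ≃ₗ[k] B.carrier)
    (h : ∀ y : A, ∃ w : B, ∀ x z, B.Vop (α x) w (α z) = α (A.Vop x y z)) : B.IsIsotopic A := by
  choose β hβ using h
  have hext : ∀ {w w' : B}, (∀ x z, B.Vop (α x) w (α z) = B.Vop (α x) w' (α z)) → w = w' := by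
    intro w w' hw
    refine eq_of_Vop h3 fun x z => ?_
    have := hw (α.symm x) (α.symm z)
    rwa [α.apply_symm_apply, α.apply_symm_apply] at this
  let g : A.carrier →ₗ[k] B.carrier :=
    { toFun := β
      map_add' := fun y y' => hext fun x z => by
        rw [Vop_add_middle, hβ, hβ, hβ, Vop_add_middle, map_add]
      map_smul' := fun r y => hext fun x z => by
        rw [RingHom.id_apply, Vop_smul_middle, hβ, hβ, Vop_smul_middle, map_smul] }
  have hg : Function.Injective g := by
    intro y y' hyy
    refine eq_of_Vop h3 fun x z => α.injective ?_
    rw [← hβ, ← hβ]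
    exact congrArg (fun w => B.Vop (α x) w (α z)) hyy
  have hbij : Function.Bijective g := by
    refine ⟨hg, ?_⟩
    have := (LinearMap.injective_iff_surjective (f := α.symm.toLinearMap ∘ₗ g)).1
      (α.symm.injective.comp hg)
    intro b
    obtain ⟨a, ha⟩ := this (α.symm b)
    exact ⟨a, α.symm.injective ha⟩
  refine ⟨α.symm, (LinearEquiv.ofBijective g hbij).symm, fun x y z => ?_⟩
  apply α.injective
  rw [← hβ, α.apply_symm_apply, α.apply_symm_apply, α.apply_symm_apply]
  congr 1
  exact ((LinearEquiv.ofBijective g hbij).apply_symm_apply y).symm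

end AlgebraWithInvolution

namespace CompositionAlgebra

variable {k : Type u} [Field k] (C : CompositionAlgebra k)

/-- The pure vectors of a diagonalisation of the norm starting with the unit. -/
lemma exists_pure_ortho {w : Fin 8 → k}
    (f : QuadraticMap.IsometryEquiv C.norm (QuadraticMap.weightedSumSquares k w))
    (hf : f 1 = Pi.single 0 1) : ∃ v : Fin 7 → C.pure,
      ∀ i j, C.bil (v i) (v j) = if i = j then 2 * w i.succ else 0 := by
  have key : ∀ i j, C.bil (f.symm (Pi.single i 1)) (f.symm (Pi.single j 1)) =
      if i = j then 2 * w i else 0 := by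
    intro i j
    have hn : ∀ x, C.norm (f.symm x) = QuadraticMap.weightedSumSquares k w x := fun x => by
      rw [← f.map_app, QuadraticMap.IsometryEquiv.apply_symm_apply]
    have hp : ∀ x, QuadraticMap.weightedSumSquares k w x = ∑ i, w i * (x i * x i) := fun x => by
      simp [QuadraticMap.weightedSumSquares_apply]
    rw [bil_def, ← map_add, hn, hn, hn, hp, hp, hp, ← Finset.sum_sub_distrib,
      ← Finset.sum_sub_distrib]
    by_cases hij : i = j
    · subst hij
      rw [if_pos rfl, Finset.sum_eq_single i]
      · simp; ring
      · intro l _ hl; simp [hl]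
      · simp
    · rw [if_neg hij]
      refine Finset.sum_eq_zero fun l _ => ?_
      by_cases hl : l = i
      · subst hl; simp [hij]
      · simp [hl]
  have h1 : f.symm (Pi.single 0 1) = 1 := by
    rw [← hf, QuadraticMap.IsometryEquiv.symm_apply_apply]
  refine ⟨fun i => ⟨f.symm (Pi.single i.succ 1), C.mem_pure.2 ?_⟩, fun i j => ?_⟩
  · rw [← h1, key, if_neg (Fin.succ_ne_zero i)]
  · simp only [key, Fin.succ_inj]

/-- A diagonalisation of the Albert form of a tensor product. -/
lemma exists_albertBasis (h2 : (2 : k) ≠ 0) {C₁ C₂ : CompositionAlgebra k}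
    (h₁ : Module.finrank k C₁.carrier = 8) (h₂ : Module.finrank k C₂.carrier = 8)
    {w₁ w₂ : Fin 7 → k} (hw₁ : ∀ i, w₁ i ≠ 0) (hw₂ : ∀ i, w₂ i ≠ 0)
    {v₁ : Fin 7 → C₁.pure} {v₂ : Fin 7 → C₂.pure}
    (hv₁ : ∀ i j, C₁.bil (v₁ i) (v₁ j) = if i = j then 2 * w₁ i else 0)
    (hv₂ : ∀ i j, C₂.bil (v₂ i) (v₂ j) = if i = j then 2 * w₂ i else 0) :
    ∃ e : Module.Basis (Fin (7 + 7)) k (C₁.pure × C₂.pure), ∀ i j,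
      albertBil C₁ C₂ (e i) (e j) = if i = j then 2 * Fin.append w₁ (-w₂) i else 0 := by
  let e : Fin (7 + 7) → C₁.pure × C₂.pure := Fin.append (fun i => (v₁ i, 0)) (fun i => (0, v₂ i))
  have he : ∀ i j, albertBil C₁ C₂ (e i) (e j) =
      if i = j then 2 * Fin.append w₁ (-w₂) i else 0 := by
    intro i j
    rw [albertBil_apply]
    induction i using Fin.addCases with
    | left i =>
      induction j using Fin.addCases with
      | left j =>
        simp only [e, Fin.append_left, hv₁, (Fin.castAdd_injective 7 7).eq_iff]
        simp
      | right j =>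
        have : (Fin.castAdd 7 i) ≠ Fin.natAdd 7 j := by
          simp only [ne_eq, Fin.ext_iff, Fin.val_castAdd, Fin.val_natAdd]; omega
        rw [if_neg this]
        simp only [e, Fin.append_left, Fin.append_right]
        simp
    | right i =>
      induction j using Fin.addCases with
      | left j =>
        have : (Fin.natAdd 7 i) ≠ Fin.castAdd 7 j := by
          simp only [ne_eq, Fin.ext_iff, Fin.val_castAdd, Fin.val_natAdd]; omega
        rw [if_neg this]
        simp only [e, Fin.append_left, Fin.append_right]
        simp
      | right j =>
        simp only [e, Fin.append_right, hv₂, Fin.natAdd_inj, Pi.neg_apply]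
        split_ifs <;> simp
  have hne : ∀ i, Fin.append w₁ (-w₂) i ≠ 0 := by
    intro i
    induction i using Fin.addCases with
    | left i => rw [Fin.append_left]; exact hw₁ i
    | right i => rw [Fin.append_right]; exact neg_ne_zero.2 (hw₂ i)
  have hli : LinearIndependent k e := by
    apply LinearMap.linearIndependent_of_isOrthoᵢ (B := albertBil C₁ C₂)
    · intro i j hij
      exact (he i j).trans (if_neg hij)
    · intro i
      rw [he, if_pos rfl]
      exact mul_ne_zero h2 (hne i)
  have hf : Fintype.card (Fin (7 + 7)) = Module.finrank k (C₁.pure × C₂.pure) := by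
    have h₁' := C₁.finrank_pure h2
    have h₂' := C₂.finrank_pure h2
    rw [Module.finrank_prod, Fintype.card_fin]
    omega
  refine ⟨basisOfLinearIndependentOfCardEqFinrank hli hf, fun i j => ?_⟩
  rw [coe_basisOfLinearIndependentOfCardEqFinrank, he]

end CompositionAlgebra

namespace ProductAlgebraSplitting

variable {k : Type u} [Field k] {A : AlgebraWithInvolution k}
  {P : ProductAlgebraSplitting A 8 8} {Φ : AlbertForm A}

namespace SkewData

lemma halfSpin (G : P.SkewData Φ) : HalfSpin (QuadraticMap.polarBilin Φ.Q)
    (LinearMap.mul k A.carrier ∘ₗ A.skew.subtype)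
    (LinearMap.mul k A.carrier ∘ₗ A.skew.subtype ∘ₗ Φ.natMap) :=
  ⟨fun s t a => polar_mul Φ s t a, fun s t a => G.polar_mul' s t a⟩

lemma E_p (G : P.SkewData Φ) (s t : A.skew) (a : A) :
    (P.D G.two_ne).E (G.p s) (G.p t) (P.J a) =
      G.c⁻¹ • P.J ((s : A.carrier) * ((Φ.natMap t : A.carrier) * a)) := by
  rw [P.J_mul, P.J_mul, G.mL_nat, mul_smul_comm, inv_smul_smul₀ G.c_ne, ← G.mL_p]
  rfl

lemma B_p (G : P.SkewData Φ) (s t : A.skew) : (P.D G.two_ne).B (G.p s) (G.p t) =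
    G.c⁻¹ * algebraMap k P.K (QuadraticMap.polar Φ.Q s t) := by
  rw [G.map_polar, inv_mul_cancel_left₀ G.c_ne]
  rfl

/-- The transpose of a linear bijection onto the algebra for the pairing over the splitting
field. -/
lemma exists_pairing_eq (G : P.SkewData Φ) {M : Type*} [AddCommGroup M] [Module k M]
    (α : M ≃ₗ[k] A.carrier) (f : M →ₗ[k] k) : ∃ w : T P.C₁ P.C₂,
      ∀ x, (P.D G.two_ne).pair (P.J (α x)) w = algebraMap k P.K (f x) := by
  have := P.finiteDimensional
  have : FiniteDimensional P.K (T P.C₁ P.C₂) :=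
    inferInstanceAs (FiniteDimensional P.K (P.C₁.carrier ⊗[P.K] P.C₂.carrier))
  let b := Module.finBasisOfFinrankEq k A.carrier P.finrank_eq
  have hcard : Fintype.card (Fin (8 * 8)) = Module.finrank P.K (T P.C₁ P.C₂) := by
    rw [Fintype.card_fin, ← P.finrank_eq, ← Module.finrank_baseChange (R := P.K)]
    exact P.iso.toLinearEquiv.finrank_eq
  let e := basisOfLinearIndependentOfCardEqFinrank (P.linearIndependent_J b.linearIndependent) hcard
  have he : ∀ i, e i = P.J (b i) := fun i => by
    rw [coe_basisOfLinearIndependentOfCardEqFinrank]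
  have hnd : ((P.D G.two_ne).pair).Nondegenerate := by
    refine ⟨fun x hx => (P.D G.two_ne).pair_nondeg x hx, fun y hy => ?_⟩
    exact (P.D G.two_ne).pair_nondeg y fun x => ((P.D G.two_ne).pair_symm _ _).trans (hy x)
  let φ := e.constr P.K fun i => algebraMap k P.K (f (α.symm (b i)))
  refine ⟨((P.D G.two_ne).pair.toDual hnd).symm φ, fun x => ?_⟩
  rw [(P.D G.two_ne).pair_symm, ← LinearMap.BilinForm.toDual_def hnd,
    LinearEquiv.apply_symm_apply]
  obtain ⟨a, rfl⟩ := α.symm.surjective x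
  rw [α.apply_symm_apply]
  conv_lhs => rw [← b.sum_repr a]
  conv_rhs => rw [← b.sum_repr a]
  simp only [map_sum, map_smulₛₗ, smul_eq_mul, map_mul, ← he]
  refine Finset.sum_congr rfl fun i _ => ?_
  congr 1
  exact e.constr_basis P.K _ i

/-- A similarity onto the Albert form of a decomposable algebra yields an isotopy. -/
theorem isIsotopic (G : P.SkewData Φ) {C₁ C₂ : CompositionAlgebra k}
    (h₁ : Module.finrank k C₁.carrier = 8) (h₂ : Module.finrank k C₂.carrier = 8) {d : k}
    (hd : d ≠ 0) (e : Module.Basis (Fin 14) k A.skew)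
    (e' : Module.Basis (Fin 14) k (C₁.pure × C₂.pure)) {w : Fin 14 → k} (hw : ∀ i, w i ≠ 0)
    (he : ∀ i j, i ≠ j → QuadraticMap.polar Φ.Q (e i) (e j) = 0)
    (he' : ∀ i j, albertBil C₁ C₂ (e' i) (e' j) = if i = j then 2 * w i else 0)
    (hQ : ∀ i, Φ.Q (e i) = d * w i) : A.IsIsotopic (T C₁ C₂) := by
  have := P.finiteDimensional
  have : FiniteDimensional k (T C₁ C₂) :=
    inferInstanceAs (FiniteDimensional k (C₁.carrier ⊗[k] C₂.carrier))
  let D' := model G.h2 h₁ h₂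
  have h' : HalfSpin (d • D'.B) (d • D'.m) D'.m' := by
    constructor
    · intro u v x
      simp only [LinearMap.smul_apply, ← smul_add, D'.rel]
      simp only [smul_eq_mul]
      module
    · intro u v x
      simp only [LinearMap.smul_apply, map_smul, ← smul_add, D'.rel']
      simp only [smul_eq_mul]
      module
  have hQe : ∀ i, QuadraticMap.polarBilin Φ.Q (e i) (e i) = d * (2 * w i) := by
    intro i
    rw [QuadraticMap.polarBilin_apply_apply, QuadraticMap.polar_self, hQ, nsmul_eq_mul]
    push_cast
    ring
  obtain ⟨g, α, hg, hα⟩ := G.halfSpin.exists_equivalence G.h2 h' e e' he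
    (fun i j hij => by
      rw [LinearMap.smul_apply, LinearMap.smul_apply]
      rw [show D'.B (e' i) (e' j) = 0 from (he' i j).trans (if_neg hij), smul_zero])
    (fun i => by
      rw [LinearMap.smul_apply, LinearMap.smul_apply, hQe]
      rw [show D'.B (e' i) (e' i) = 2 * w i from (he' i i).trans (if_pos rfl), smul_eq_mul])
    (fun i => by rw [hQe]; exact mul_ne_zero hd (mul_ne_zero G.h2 (hw i)))
    P.finrank_eq
    ((Module.finrank_tensorProduct (R := k) (S := k)).trans (congrArg₂ _ h₁ h₂))
  refine AlgebraWithInvolution.isIsotopic_of_exists_hat (A := T C₁ C₂) G.h3 α fun y => ?_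
  obtain ⟨W, hW⟩ := G.exists_pairing_eq α (D'.pair.flip y)
  refine ⟨P.ret P.r W, fun x z => ?_⟩
  rw [← P.ret_Vop]
  refine (congrArg (P.ret P.r) ?_).trans (P.ret_J _)
  let l : P.K := G.c⁻¹ * algebraMap k P.K d
  have hl : l ≠ 0 := mul_ne_zero (inv_ne_zero G.c_ne)
    ((map_ne_zero (algebraMap k P.K)).2 hd)
  let γ : C₁.pure × C₂.pure →ₛₗ[algebraMap k P.K] P.C₁.pure × P.C₂.pure :=
    G.p.comp g.toLinearMap
  let a : T C₁ C₂ →ₛₗ[algebraMap k P.K] T P.C₁ P.C₂ := P.J.comp α.toLinearMap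
  refine D'.V_transport (P.D G.two_ne) G.two_ne γ ?_ hl ?_ a ?_ hW x z
  · intro s
    have hr : Set.range γ = Set.range G.p := g.surjective.range_comp G.p
    rw [hr]
    exact P.p_span G.two_ne G.p G.sk_p s
  · intro u v
    have := hg u v
    rw [QuadraticMap.polarBilin_apply_apply] at this
    change (P.D G.two_ne).B (G.p (g u)) (G.p (g v)) = _
    rw [G.B_p, this, LinearMap.smul_apply, LinearMap.smul_apply, smul_eq_mul, map_mul, mul_assoc]
  · intro u v x
    have := hα u v x
    change (P.D G.two_ne).E (G.p (g u)) (G.p (g v)) (P.J (α x)) = l • P.J (α (D'.E u v x))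
    rw [G.E_p]
    rw [LinearMap.smul_apply, LinearMap.smul_apply, map_smul] at this
    have h := congrArg P.J this
    rw [map_smulₛₗ] at h
    rw [mul_smul]
    exact congrArg (G.c⁻¹ • ·) h.symm

/-- An isotropic Albert form forces the algebra to be isotopic to a tensor product of two
octonion algebras whose norms have a common slot. -/
theorem exists_isotopic (G : P.SkewData Φ) (F : G.Frame) : ∃ C₁ C₂ : CompositionAlgebra k,
    Module.finrank k C₁.carrier = 8 ∧ Module.finrank k C₂.carrier = 8 ∧
    (∃ a b₁ c₁ b₂ c₂ : kˣ,
      Nonempty (QuadraticMap.IsometryEquiv C₁.norm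
        (QuadraticMap.weightedSumSquares k
          ![1, -(a : k), -(b₁ : k), (a : k) * b₁, -(c₁ : k), (a : k) * c₁,
            (b₁ : k) * c₁, -((a : k) * b₁ * c₁)])) ∧
      Nonempty (QuadraticMap.IsometryEquiv C₂.norm
        (QuadraticMap.weightedSumSquares k
          ![1, -(a : k), -(b₂ : k), (a : k) * b₂, -(c₂ : k), (a : k) * c₂,
            (b₂ : k) * c₂, -((a : k) * b₂ * c₂)]))) ∧
    A.IsIsotopic (C₁.toAWI.tensor C₂.toAWI) := by
  obtain ⟨d, a, b₁, c₁, b₂, c₂, e, ho, hQ⟩ := G.exists_orthogonal_basis F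
  have hC₁ := Cayley.finrank_alg G.h2 a.ne_zero b₁.ne_zero c₁.ne_zero
  have hC₂ := Cayley.finrank_alg G.h2 a.ne_zero b₂.ne_zero c₂.ne_zero
  obtain ⟨v₁, hv₁⟩ := exists_pure_ortho _ (Cayley.isometry G.h2 a.ne_zero b₁.ne_zero c₁.ne_zero)
    (by ext i; fin_cases i <;> rfl)
  obtain ⟨v₂, hv₂⟩ := exists_pure_ortho _ (Cayley.isometry G.h2 a.ne_zero b₂.ne_zero c₂.ne_zero)
    (by ext i; fin_cases i <;> rfl)
  have hne : ∀ b c : kˣ, ∀ i : Fin 7, (![1, -(a : k), -(b : k), (a : k) * b, -(c : k),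
      (a : k) * c, (b : k) * c, -((a : k) * b * c)] : Fin 8 → k) i.succ ≠ 0 := by
    intro b c i
    revert i
    simp [Fin.forall_fin_succ]
  obtain ⟨e', he'⟩ := exists_albertBasis G.h2 hC₁ hC₂ (hne b₁ c₁) (hne b₂ c₂) hv₁ hv₂
  refine ⟨_, _, hC₁, hC₂, ⟨a, b₁, c₁, b₂, c₂, ⟨Cayley.isometry G.h2 _ _ _⟩,
    ⟨Cayley.isometry G.h2 _ _ _⟩⟩, ?_⟩
  refine G.isIsotopic hC₁ hC₂ d.ne_zero e e' (w := albertWeights (a : k) b₁ c₁ b₂ c₂)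
    (albertWeights_ne a b₁ c₁ b₂ c₂) ho (fun i j => ?_) hQ
  refine (he' i j).trans ?_
  congr 2
  clear hQ ho
  induction i using Fin.addCases (m := 7) (n := 7) with
  | left i => rw [Fin.append_left]; fin_cases i <;> rfl
  | right i =>
    rw [Fin.append_right]
    fin_cases i <;> simp [albertWeights]

end SkewData

end ProductAlgebraSplitting

end ProductAlgebra

/-- For a bi-octonion algebra `(A,−)` over a field `k` of characteristic
not 2 or 3, the following are equivalent: (1) `(A,−)` is not a structurable division algebra;
(2) the Albert form is isotropic; (3) there is a nonzero non-conjugate-invertible skew element;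
(4) `(A,−)` has an involution-stable biquaternion (i.e. 16-dimensional associative central
simple) subalgebra that is not a division algebra; (5) `(A,−)` has an involution-stable
associative subalgebra that is not a division algebra; (6) the Albert form is similar to
`φ₁′ ⊥ ⟨−1⟩φ₂′` for 3-Pfister forms `φ₁,φ₂` with a common slot; (7) `(A,−)` is isotopic to a
decomposable bi-octonion algebra `C₁ ⊗ C₂` whose octonion factors have norms with a common
slot. -/
theorem bioctonion_division_tfae
    {k : Type u} [Field k] (hk2 : (2 : k) ≠ 0) (hk3 : (3 : k) ≠ 0)
    (A : AlgebraWithInvolution k) (hA : IsProductAlgebra A 8 8)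
    (Φ : AlbertForm A) :
    List.TFAE
      [ -- (1)
        ¬ A.IsStructurableDivisionAlgebra,
        -- (2) the Albert form is isotropic
        (∃ s : A.skew, s ≠ 0 ∧ Φ.Q s = 0),
        -- (3) a nonzero skew element that is not conjugate-invertible
        (∃ s : A.skew, (s : A.carrier) ≠ 0 ∧ ¬ A.ConjInvertible (s : A.carrier)),
        -- (4) a non-division biquaternion subalgebra stabilised by the involution
        (∃ B : Submodule k A.carrier, (1 : A.carrier) ∈ B ∧
          (∀ a ∈ B, ∀ b ∈ B, a * b ∈ B) ∧
          (∀ a ∈ B, A.invol a ∈ B) ∧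
          (∀ a ∈ B, ∀ b ∈ B, ∀ c ∈ B, a * (b * c) = (a * b) * c) ∧
          Module.finrank k B = 16 ∧
          (∀ b ∈ B, (∀ x ∈ B, b * x = x * b) → ∃ c : k, b = c • (1 : A.carrier)) ∧
          (∀ I : Submodule k A.carrier, I ≤ B →
            (∀ a ∈ I, ∀ x ∈ B, x * a ∈ I ∧ a * x ∈ I) → I = ⊥ ∨ I = B) ∧
          (∃ b ∈ B, b ≠ 0 ∧ ¬ ∃ c ∈ B, b * c = 1 ∧ c * b = 1)),
        -- (5) a non-division associative subalgebra stabilised by the involution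
        (∃ B : Submodule k A.carrier, (1 : A.carrier) ∈ B ∧
          (∀ a ∈ B, ∀ b ∈ B, a * b ∈ B) ∧
          (∀ a ∈ B, A.invol a ∈ B) ∧
          (∀ a ∈ B, ∀ b ∈ B, ∀ c ∈ B, a * (b * c) = (a * b) * c) ∧
          (∃ b ∈ B, b ≠ 0 ∧ ¬ ∃ c ∈ B, b * c = 1 ∧ c * b = 1)),
        -- (6) the Albert form is similar to `φ₁′ ⊥ ⟨−1⟩φ₂′`, common slot `a`
        (∃ d a b₁ c₁ b₂ c₂ : kˣ,
          Nonempty (QuadraticMap.IsometryEquiv Φ.Q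
            ((d : k) • QuadraticMap.weightedSumSquares k
              ![-(a : k), -(b₁ : k), (a : k) * b₁, -(c₁ : k), (a : k) * c₁, (b₁ : k) * c₁,
                -((a : k) * b₁ * c₁),
                (a : k), (b₂ : k), -((a : k) * b₂), (c₂ : k), -((a : k) * c₂),
                -((b₂ : k) * c₂), (a : k) * b₂ * c₂]))),
        -- (7) isotopic to a decomposable algebra whose factors have norms with a common slot
        (∃ C₁ C₂ : CompositionAlgebra k,
          Module.finrank k C₁.carrier = 8 ∧ Module.finrank k C₂.carrier = 8 ∧
          (∃ a b₁ c₁ b₂ c₂ : kˣ,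
            Nonempty (QuadraticMap.IsometryEquiv C₁.norm
              (QuadraticMap.weightedSumSquares k
                ![1, -(a : k), -(b₁ : k), (a : k) * b₁, -(c₁ : k), (a : k) * c₁,
                  (b₁ : k) * c₁, -((a : k) * b₁ * c₁)])) ∧
            Nonempty (QuadraticMap.IsometryEquiv C₂.norm
              (QuadraticMap.weightedSumSquares k
                ![1, -(a : k), -(b₂ : k), (a : k) * b₂, -(c₂ : k), (a : k) * c₂,
                  (b₂ : k) * c₂, -((a : k) * b₂ * c₂)]))) ∧
          A.IsIsotopic (C₁.toAWI.tensor C₂.toAWI)) ] := by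
  obtain ⟨P⟩ := hA
  obtain ⟨G⟩ := P.exists_skewData hk2 hk3 Φ
  tfae_have 1 → 2 := by
    intro h
    simp only [AlgebraWithInvolution.IsStructurableDivisionAlgebra, not_forall] at h
    obtain ⟨x, hx, hi⟩ := h
    exact G.exists_isotropic hx hi
  tfae_have 2 → 3 := fun ⟨s, hs, h⟩ =>
    ⟨s, fun h0 => hs (Subtype.ext h0), G.not_conjInvertible hs h⟩
  tfae_have 3 → 1 := fun ⟨s, hs, h⟩ hdiv => h (hdiv _ hs)
  tfae_have 2 → 4 := by
    intro h
    obtain ⟨F⟩ := G.exists_frame h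
    exact G.exists_biquaternion F
  tfae_have 4 → 5 := fun ⟨B, h1, hm, hi, ha, _, _, _, hb⟩ => ⟨B, h1, hm, hi, ha, hb⟩
  tfae_have 5 → 1 := by
    rintro ⟨B, h1, hm, hi, ha, b, hb, hb0, hn⟩ hdiv
    exact hn (P.exists_inverse hk2 hk3 B h1 hm hi ha hb (hdiv b hb0))
  tfae_have 2 → 6 := by
    intro h
    obtain ⟨F⟩ := G.exists_frame h
    exact G.exists_isometryEquiv F
  tfae_have 6 → 2 := by
    rintro ⟨d, a, b₁, c₁, b₂, c₂, ⟨f⟩⟩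
    exact ProductAlgebraSplitting.exists_isotropic_of_isometryEquiv Φ.Q f
  tfae_have 2 → 7 := by
    intro h
    obtain ⟨F⟩ := G.exists_frame h
    exact G.exists_isotopic F
  tfae_have 7 → 1 := by
    rintro ⟨C₁, C₂, h₁, h₂, ⟨a, b₁, c₁, b₂, c₂, ⟨f₁⟩, ⟨f₂⟩⟩, ⟨g⟩⟩ hdiv
    obtain ⟨z₁, hz₁⟩ := C₁.exists_pure_of_isometry rfl f₁
    obtain ⟨z₂, hz₂⟩ := C₂.exists_pure_of_isometry rfl f₂
    refine CompositionAlgebra.not_division_of_pure hk2 h₁ h₂ (hz₁.trans hz₂.symm) ?_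
      (g.isStructurableDivisionAlgebra hdiv)
    rw [hz₁]
    exact neg_ne_zero.2 a.ne_zero
  tfae_finish
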